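/- Primes in arithmetic progressions after removing few characters: For every natural number J ≥ 1 and every ε > 0 there is a constant C = C(J,ε) > 0 such that for all natural numbers q ≥ 1 and all real x ≥ max(q^{10}, C), setting Q = q·log x, there exists a set 𝒳 of non-principal Dirichlet characters mod q with at most J elements satisfying both: (i) for every non-principal Dirichlet character ψ mod q with ψ ∉ 𝒳, | ∑_{n ≤ x} Λ(n)·ψ(n) | ≤ C · x · (log Q/log x)^{1 − 1/√(J+1) − ε}; and (ii) for every a with gcd(a,q) = 1, | ∑_{n ≤ x, n ≡ a (mod q)} Λ(n) − (1/φ(q))·∑_{χ ∈ 𝒳} conj(χ(a))·∑_{n ≤ x} Λ(n)·χ(n) − x/φ(q) | ≤ C · (x/φ(q)) · (log Q/log x)^{1 − 1/√(J+1) − ε}. -/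

import Mathlib

namespace SieveAP

/-- The elementary symmetric sum of degree `k` of the numbers `x i`, `i ∈ S`. -/
noncomputable def esym {ι : Type*} (x : ι → ℝ) (k : ℕ) (S : Finset ι) : ℝ :=
  ∑ A ∈ S.powersetCard k, ∏ i ∈ A, x i

/-- The inclusion-exclusion sum for `∏ (1 - x i)` truncated at degree `k`. -/
noncomputable def inclExcl {ι : Type*} (x : ι → ℝ) (k : ℕ) (S : Finset ι) : ℝ :=
  ∑ j ∈ Finset.range (k + 1), (-1) ^ j * esym x j S

section Bonferroni

variable {ι : Type*} (x : ι → ℝ)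

lemma esym_zero (S : Finset ι) : esym x 0 S = 1 := by simp [esym]

lemma esym_nonneg {S : Finset ι} (hx : ∀ i ∈ S, 0 ≤ x i) (k : ℕ) : 0 ≤ esym x k S :=
  Finset.sum_nonneg fun _ hA => Finset.prod_nonneg fun i hi =>
    hx i ((Finset.mem_powersetCard.1 hA).1 hi)

lemma esym_succ_insert [DecidableEq ι] {S : Finset ι} {p : ι} (hp : p ∉ S) (k : ℕ) :
    esym x (k + 1) (insert p S) = esym x (k + 1) S + x p * esym x k S := by
  unfold esym
  rw [Finset.powersetCard_succ_insert hp, Finset.sum_union, Finset.sum_image, Finset.mul_sum]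
  · congr 1
    refine Finset.sum_congr rfl fun A hA => ?_
    rw [Finset.prod_insert]
    exact fun h => hp ((Finset.mem_powersetCard.1 hA).1 h)
  · intro A hA A' hA' h
    have hA1 : p ∉ A := fun h => hp ((Finset.mem_powersetCard.1 hA).1 h)
    have hA2 : p ∉ A' := fun h => hp ((Finset.mem_powersetCard.1 hA').1 h)
    have := congrArg (fun s => s.erase p) h
    simpa [Finset.erase_insert hA1, Finset.erase_insert hA2] using this
  · rw [Finset.disjoint_left]
    intro A hA hA'
    obtain ⟨A', -, rfl⟩ := Finset.mem_image.1 hA'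
    exact hp ((Finset.mem_powersetCard.1 hA).1 (Finset.mem_insert_self _ _))

lemma inclExcl_succ (S : Finset ι) (k : ℕ) :
    inclExcl x (k + 1) S = inclExcl x k S + (-1) ^ (k + 1) * esym x (k + 1) S := by
  unfold inclExcl
  rw [Finset.sum_range_succ]

lemma inclExcl_succ_insert [DecidableEq ι] {S : Finset ι} {p : ι} (hp : p ∉ S) (k : ℕ) :
    inclExcl x (k + 1) (insert p S) = inclExcl x (k + 1) S - x p * inclExcl x k S := by
  induction k with
  | zero => simp [inclExcl, Finset.sum_range_succ, esym_zero, esym_succ_insert x hp]; ring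
  | succ k ih =>
    rw [inclExcl_succ, ih, esym_succ_insert x hp, inclExcl_succ x S (k + 1), inclExcl_succ x S k]
    ring

lemma inclExcl_error_nonneg [DecidableEq ι] (S : Finset ι) :
    ∀ k, (∀ i ∈ S, 0 ≤ x i ∧ x i ≤ 1) →
      0 ≤ (-1 : ℝ) ^ k * (inclExcl x k S - ∏ i ∈ S, (1 - x i)) := by
  induction S using Finset.induction_on with
  | empty =>
    intro k _
    have : inclExcl x k ∅ = 1 := by
      induction k with
      | zero => simp [inclExcl, esym_zero]
      | succ k ih => rw [inclExcl_succ, ih, esym, Finset.powersetCard_eq_empty.2 (by simp)]; simp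
    simp [this]
  | insert p S hp ih =>
    intro k hx
    have hS : ∀ i ∈ S, 0 ≤ x i ∧ x i ≤ 1 := fun i hi => hx i (Finset.mem_insert_of_mem hi)
    have hxp := hx p (Finset.mem_insert_self _ _)
    rw [Finset.prod_insert hp]
    cases k with
    | zero =>
      have h := ih 0 hS
      simp only [inclExcl, zero_add, Finset.range_one, Finset.sum_singleton, pow_zero, esym_zero,
        one_mul] at h ⊢
      have h0 : 0 ≤ ∏ i ∈ S, (1 - x i) :=
        Finset.prod_nonneg fun i hi => by linarith [(hS i hi).2]
      nlinarith
    | succ k =>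
      have h1 := ih (k + 1) hS
      have h2 := mul_nonneg hxp.1 (ih k hS)
      rw [inclExcl_succ_insert x hp]
      have : (-1 : ℝ) ^ (k + 1) * (inclExcl x (k + 1) S - x p * inclExcl x k S
          - (1 - x p) * ∏ i ∈ S, (1 - x i))
          = (-1) ^ (k + 1) * (inclExcl x (k + 1) S - ∏ i ∈ S, (1 - x i))
            + x p * ((-1) ^ k * (inclExcl x k S - ∏ i ∈ S, (1 - x i))) := by ring
      rw [this]
      exact add_nonneg h1 h2

lemma prod_le_inclExcl_even {S : Finset ι} (hx : ∀ i ∈ S, 0 ≤ x i ∧ x i ≤ 1) (k : ℕ) :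
    ∏ i ∈ S, (1 - x i) ≤ inclExcl x (2 * k) S := by
  classical
  have := inclExcl_error_nonneg x S (2 * k) hx
  rw [pow_mul] at this
  simp at this
  exact this

lemma inclExcl_even_le {S : Finset ι} (hx : ∀ i ∈ S, 0 ≤ x i ∧ x i ≤ 1) (k : ℕ) :
    inclExcl x (2 * k) S ≤ ∏ i ∈ S, (1 - x i) + esym x (2 * k + 1) S := by
  classical
  have := inclExcl_error_nonneg x S (2 * k + 1) hx
  rw [inclExcl_succ, pow_succ, pow_mul] at this
  simp at this
  linarith

lemma esym_le_exp {S : Finset ι} (hx : ∀ i ∈ S, 0 ≤ x i) {z : ℝ} (hz : 0 < z) (m : ℕ) :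
    esym x m S ≤ Real.exp (z * ∑ i ∈ S, x i) / z ^ m := by
  classical
  rw [le_div_iff₀ (by positivity), mul_comm]
  calc z ^ m * esym x m S = ∑ A ∈ S.powersetCard m, ∏ i ∈ A, (z * x i) := by
        rw [esym, Finset.mul_sum]
        refine Finset.sum_congr rfl fun A hA => ?_
        rw [Finset.prod_mul_distrib, Finset.prod_const, (Finset.mem_powersetCard.1 hA).2]
    _ ≤ ∑ A ∈ S.powerset, ∏ i ∈ A, (z * x i) := by
        refine Finset.sum_le_sum_of_subset_of_nonneg ?_ ?_
        · intro A hA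
          exact Finset.mem_powerset.2 (Finset.mem_powersetCard.1 hA).1
        · intro A hA _
          exact Finset.prod_nonneg fun i hi =>
            mul_nonneg hz.le (hx i (Finset.mem_powerset.1 hA hi))
    _ = ∏ i ∈ S, (1 + z * x i) := (Finset.prod_one_add _).symm
    _ ≤ ∏ i ∈ S, Real.exp (z * x i) := by
        refine Finset.prod_le_prod (fun i hi => ?_) fun i _ => ?_
        · have := mul_nonneg hz.le (hx i hi); linarith
        · rw [add_comm]; exact Real.add_one_le_exp _
    _ = Real.exp (z * ∑ i ∈ S, x i) := by rw [← Real.exp_sum, Finset.mul_sum]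

end Bonferroni

/-- `θ n = ∑ a i` over those `i` with `d i ∣ n`, where every `d i` is composed of primes
satisfying `P`; the density `∑ a i / d i` is `m` and `∑ |a i| ≤ A`. -/
def SieveWt (P : ℕ → Prop) (θ : ℕ → ℝ) (m A : ℝ) : Prop :=
  ∃ (ι : Type) (_ : Fintype ι) (a : ι → ℝ) (d : ι → ℕ), (∀ i, d i ≠ 0) ∧
    (∀ i p, p.Prime → p ∣ d i → P p) ∧ (∀ n, θ n = ∑ i, if d i ∣ n then a i else 0) ∧
    m = ∑ i, a i / d i ∧ ∑ i, |a i| ≤ A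

namespace SieveWt

variable {P P' : ℕ → Prop} {θ θ' : ℕ → ℝ} {m m' A A' : ℝ}

lemma one (P : ℕ → Prop) : SieveWt P (fun _ => 1) 1 1 := by
  refine ⟨Unit, inferInstance, fun _ => 1, fun _ => 1, by simp, ?_, by simp, by simp, by simp⟩
  intro _ p hp h
  exact absurd (Nat.dvd_one.1 h) hp.one_lt.ne'

lemma mono (h : SieveWt P θ m A) (hP : ∀ p, P p → P' p) (hA : A ≤ A') : SieveWt P' θ m A' := by
  obtain ⟨ι, _, a, d, h0, h1, h2, h3, h4⟩ := h
  exact ⟨ι, inferInstance, a, d, h0, fun i p hp hd => hP p (h1 i p hp hd), h2, h3, h4.trans hA⟩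

lemma add (h : SieveWt P θ m A) (h' : SieveWt P θ' m' A') :
    SieveWt P (fun n => θ n + θ' n) (m + m') (A + A') := by
  obtain ⟨ι, _, a, d, h0, h1, h2, h3, h4⟩ := h
  obtain ⟨κ, _, a', d', h0', h1', h2', h3', h4'⟩ := h'
  refine ⟨ι ⊕ κ, inferInstance, Sum.elim a a', Sum.elim d d', ?_, ?_, ?_, ?_, ?_⟩
  · rintro (i | i) <;> simp [h0, h0']
  · rintro (i | i) p hp hd
    · exact h1 i p hp hd
    · exact h1' i p hp hd
  · intro n
    simp only [h2, h2']
    rw [Fintype.sum_sum_type]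
    rfl
  · simp [h3, h3']
  · simpa using add_le_add h4 h4'

lemma const_mul (h : SieveWt P θ m A) (c : ℝ) :
    SieveWt P (fun n => c * θ n) (c * m) (|c| * A) := by
  obtain ⟨ι, _, a, d, h0, h1, h2, h3, h4⟩ := h
  refine ⟨ι, inferInstance, fun i => c * a i, d, h0, h1, ?_, ?_, ?_⟩
  · intro n; simp [h2, Finset.mul_sum]
  · simp [h3, Finset.mul_sum, mul_div_assoc]
  · simp only [abs_mul, ← Finset.mul_sum]
    exact mul_le_mul_of_nonneg_left h4 (abs_nonneg c)

lemma mul (h : SieveWt P θ m A) (h' : SieveWt P' θ' m' A') (hPP : ∀ p, P p → ¬ P' p) :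
    SieveWt (fun p => P p ∨ P' p) (fun n => θ n * θ' n) (m * m') (A * A') := by
  obtain ⟨ι, _, a, d, h0, h1, h2, h3, h4⟩ := h
  obtain ⟨κ, _, a', d', h0', h1', h2', h3', h4'⟩ := h'
  have hc : ∀ i j, Nat.Coprime (d i) (d' j) := fun i j =>
    Nat.Coprime.symm (Nat.coprime_of_dvd fun p hp hd hd' => hPP p (h1 i p hp hd') (h1' j p hp hd))
  refine ⟨ι × κ, inferInstance, fun i => a i.1 * a' i.2, fun i => d i.1 * d' i.2, ?_, ?_, ?_, ?_,
    ?_⟩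
  · rintro ⟨i, j⟩; simp [h0, h0']
  · rintro ⟨i, j⟩ p hp hd
    rcases hp.dvd_mul.1 hd with hd | hd
    · exact Or.inl (h1 i p hp hd)
    · exact Or.inr (h1' j p hp hd)
  · intro n
    simp only [h2, h2']
    rw [Finset.sum_mul_sum, Fintype.sum_prod_type]
    refine Finset.sum_congr rfl fun i _ => Finset.sum_congr rfl fun j _ => ?_
    have : d i * d' j ∣ n ↔ d i ∣ n ∧ d' j ∣ n :=
      ⟨fun h => ⟨dvd_of_mul_right_dvd h, dvd_of_mul_left_dvd h⟩,
        fun h => (hc i j).mul_dvd_of_dvd_of_dvd h.1 h.2⟩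
    by_cases hi : d i ∣ n <;> by_cases hj : d' j ∣ n <;> simp [this, hi, hj]
  · rw [h3, h3', Finset.sum_mul_sum, Fintype.sum_prod_type]
    refine Finset.sum_congr rfl fun i _ => Finset.sum_congr rfl fun j _ => ?_
    push_cast
    rw [div_mul_div_comm]
  · rw [Fintype.sum_prod_type]
    simp only [abs_mul, ← Finset.mul_sum, ← Finset.sum_mul]
    exact mul_le_mul h4 h4' (Finset.sum_nonneg fun _ _ => abs_nonneg _)
      ((Finset.sum_nonneg fun _ _ => abs_nonneg _).trans h4)

/-- The indicator function of the multiples of `p`. -/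
noncomputable def dvdInd (n p : ℕ) : ℝ := if p ∣ n then 1 else 0

lemma prod_dvdInd {B : Finset ℕ} (hB : ∀ p ∈ B, p.Prime) (n : ℕ) :
    ∏ p ∈ B, dvdInd n p = if ∏ p ∈ B, p ∣ n then 1 else 0 := by
  have h : (∏ p ∈ B, p ∣ n) ↔ ∀ p ∈ B, p ∣ n :=
    ⟨fun h p hp => (Finset.dvd_prod_of_mem _ hp).trans h,
      fun h => Finset.prod_primes_dvd n (fun p hp => (hB p hp).prime) h⟩
  by_cases hd : ∀ p ∈ B, p ∣ n
  · rw [if_pos (h.2 hd)]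
    exact Finset.prod_eq_one fun p hp => by simp [dvdInd, hd p hp]
  · rw [if_neg (fun h' => hd (h.1 h'))]
    push Not at hd
    obtain ⟨p, hp, hpn⟩ := hd
    exact Finset.prod_eq_zero hp (by simp [dvdInd, hpn])

lemma esym_block {B : Finset ℕ} (hB : ∀ p ∈ B, p.Prime) (k : ℕ) :
    SieveWt (· ∈ B) (fun n => esym (dvdInd n) k B) (esym (fun p : ℕ => (1 : ℝ) / p) k B)
      ((B.card : ℝ) ^ k) := by
  refine ⟨{A // A ∈ B.powersetCard k}, inferInstance, fun _ => 1, fun A => ∏ p ∈ A.1, p,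
    ?_, ?_, ?_, ?_, ?_⟩
  · rintro ⟨A, hA⟩
    exact Finset.prod_ne_zero_iff.2 fun p hp => (hB p ((Finset.mem_powersetCard.1 hA).1 hp)).ne_zero
  · rintro ⟨A, hA⟩ p hp hd
    obtain ⟨r, hr, hpr⟩ := (hp.prime.dvd_finsetProd_iff _).1 hd
    have hrB := (Finset.mem_powersetCard.1 hA).1 hr
    rwa [(Nat.prime_dvd_prime_iff_eq hp (hB r hrB)).1 hpr]
  · intro n
    simp only [esym]
    rw [← Finset.sum_coe_sort]
    refine Finset.sum_congr rfl fun A _ => ?_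
    rw [prod_dvdInd]
    exact fun p hp => hB p ((Finset.mem_powersetCard.1 A.2).1 hp)
  · rw [esym, ← Finset.sum_coe_sort]
    refine Finset.sum_congr rfl fun A _ => ?_
    simp
  · simp only [abs_one, Finset.sum_const, nsmul_eq_mul, mul_one, Finset.card_univ,
      Fintype.card_coe, Finset.card_powersetCard]
    exact_mod_cast Nat.choose_le_pow _ _

lemma inclExcl_block {B : Finset ℕ} (hB : ∀ p ∈ B, p.Prime) (k : ℕ) :
    SieveWt (· ∈ B) (fun n => inclExcl (dvdInd n) k B)
      (inclExcl (fun p : ℕ => (1 : ℝ) / p) k B) (((B.card : ℝ) + 1) ^ k) := by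
  induction k with
  | zero =>
    have h0 := one (· ∈ B)
    simpa [inclExcl, esym_zero] using h0
  | succ k ih =>
    have h := ih.add ((esym_block hB (k + 1)).const_mul ((-1) ^ (k + 1)))
    simp only [inclExcl_succ]
    refine h.mono (fun _ h => h) ?_
    rw [abs_pow, abs_neg, abs_one, one_pow, one_mul, pow_succ (_ + 1), pow_succ, mul_add, mul_one,
      add_comm]
    gcongr
    linarith

end SieveWt

open Finset

section Mertens

lemma sum_log_div_prime_le {N : ℕ} (hN : 1 ≤ N) :
    ∑ p ∈ N.primesLE, Real.log p / p ≤ Real.log N + Real.log 4 := by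
  have hN0 : (0 : ℝ) < N := by exact_mod_cast hN
  have h1 : ∑ n ∈ Ioc 0 N, Real.log n
      = ∑ n ∈ Ioc 0 N, ArithmeticFunction.vonMangoldt n * ((N / n : ℕ) : ℝ) := by
    rw [← ArithmeticFunction.sum_Ioc_mul_zeta_eq_sum, ArithmeticFunction.vonMangoldt_mul_zeta]
    rfl
  have h2 : ∑ n ∈ Ioc 0 N, Real.log n ≤ N * Real.log N := by
    have : ∀ n ∈ Ioc 0 N, Real.log n ≤ Real.log N := fun n hn => by
      rw [mem_Ioc] at hn
      exact Real.log_le_log (by exact_mod_cast hn.1) (by exact_mod_cast hn.2)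
    simpa using Finset.sum_le_card_nsmul _ _ _ this
  have h3 : ∑ p ∈ N.primesLE, Real.log p * ((N / p : ℕ) : ℝ)
      ≤ ∑ n ∈ Ioc 0 N, ArithmeticFunction.vonMangoldt n * ((N / n : ℕ) : ℝ) := by
    have hsub : N.primesLE ⊆ Ioc 0 N := fun p hp => by
      rw [Nat.mem_primesLE] at hp
      exact mem_Ioc.2 ⟨hp.2.pos, hp.1⟩
    refine le_trans (le_of_eq ?_) (Finset.sum_le_sum_of_subset_of_nonneg hsub fun n _ _ =>
      mul_nonneg ArithmeticFunction.vonMangoldt_nonneg (Nat.cast_nonneg _))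
    refine Finset.sum_congr rfl fun p hp => ?_
    rw [ArithmeticFunction.vonMangoldt_apply_prime (Nat.mem_primesLE.1 hp).2]
  have h4 : N * ∑ p ∈ N.primesLE, Real.log p / p
      ≤ ∑ p ∈ N.primesLE, Real.log p * ((N / p : ℕ) : ℝ) + ∑ p ∈ N.primesLE, Real.log p := by
    rw [Finset.mul_sum, ← Finset.sum_add_distrib]
    refine Finset.sum_le_sum fun p hp => ?_
    have hp' := (Nat.mem_primesLE.1 hp).2
    have hlt : (N : ℝ) / p ≤ (N / p : ℕ) + 1 := by
      have := Nat.lt_floor_add_one ((N : ℝ) / p)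
      rw [Nat.floor_div_eq_div] at this
      exact this.le
    have hlog : 0 ≤ Real.log p := Real.log_natCast_nonneg p
    calc (N : ℝ) * (Real.log p / p) = Real.log p * (N / p) := by ring
      _ ≤ Real.log p * ((N / p : ℕ) + 1) := by gcongr
      _ = _ := by ring
  have h5 : ∑ p ∈ N.primesLE, Real.log p ≤ Real.log 4 * N := by
    rw [← Chebyshev.theta_eq_sum_primesLE_log]
    exact Chebyshev.theta_le_log4_mul_x hN0.le
  refine le_of_mul_le_mul_left ?_ hN0
  linarith

/-- The reciprocals of the primes in `(√y, y]` have bounded sum. -/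
lemma sum_inv_prime_le {y : ℕ} (hy : 2 ≤ y) {B : Finset ℕ}
    (hB : ∀ p ∈ B, p.Prime ∧ p ≤ y ∧ y.sqrt < p) : ∑ p ∈ B, (1 : ℝ) / p ≤ 8 := by
  have hlog2 := Real.log_two_gt_d9
  have hlogy : Real.log 2 ≤ Real.log y := Real.log_le_log (by norm_num) (by exact_mod_cast hy)
  have h1 : Real.log y / 2 * ∑ p ∈ B, (1 : ℝ) / p ≤ ∑ p ∈ y.primesLE, Real.log p / p := by
    rw [Finset.mul_sum]
    refine (Finset.sum_le_sum (g := fun p : ℕ => Real.log p / p) fun p hp => ?_).trans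
      (Finset.sum_le_sum_of_subset_of_nonneg (fun p hp => ?_) fun p _ _ => by positivity)
    · obtain ⟨hp1, hp2, hp3⟩ := hB p hp
      have : (y : ℝ) ≤ (p : ℝ) ^ 2 := by
        have := Nat.sqrt_lt'.1 hp3
        exact_mod_cast this.le
      have h2 : Real.log y ≤ 2 * Real.log p := by
        have h3 := Real.log_le_log (by positivity) this
        rwa [Real.log_pow, Nat.cast_ofNat] at h3
      rw [mul_one_div]
      gcongr
      linarith
    · exact Nat.mem_primesLE.2 ⟨(hB p hp).2.1, (hB p hp).1⟩
  have h2 := sum_log_div_prime_le (show 1 ≤ y by omega)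
  have h4 : Real.log 4 = 2 * Real.log 2 := by
    rw [show (4 : ℝ) = 2 ^ 2 by norm_num, Real.log_pow]; norm_num
  by_contra hcon
  push Not at hcon
  nlinarith

end Mertens

/-- The density of integers without prime factors `p ≤ y`, `p ∤ q`. -/
noncomputable def vdens (q y : ℕ) : ℝ := ∏ p ∈ y.primesLE.filter (fun p => ¬ p ∣ q), (1 - 1 / (p : ℝ))

open scoped Classical in
/-- The indicator function of integers without prime factors `p ≤ y`, `p ∤ q`. -/
noncomputable def sift (q y n : ℕ) : ℝ :=
  if ∀ p, p.Prime → p ≤ y → ¬ p ∣ q → ¬ p ∣ n then 1 else 0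

lemma prime_factor_pos {p : ℕ} (hp : p.Prime) : 0 < 1 - 1 / (p : ℝ) := by
  have : (1 : ℝ) < p := by exact_mod_cast hp.one_lt
  rw [sub_pos, div_lt_one (by linarith)]
  exact this

lemma vdens_pos (q y : ℕ) : 0 < vdens q y :=
  Finset.prod_pos fun _ hp => prime_factor_pos (Nat.mem_primesLE.1 (mem_filter.1 hp).1).2

lemma prime_factor_le_one (p : ℕ) : 1 - 1 / (p : ℝ) ≤ 1 := by
  have : (0 : ℝ) ≤ 1 / p := by positivity
  linarith

lemma vdens_le_inv_log {y : ℕ} (hy : 2 ≤ y) : vdens 1 y ≤ 1 / Real.log y := by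
  have hy' : (1 : ℝ) < y := by exact_mod_cast hy
  have hlog : 0 < Real.log y := Real.log_pos hy'
  rw [le_one_div (vdens_pos _ _) hlog]
  let f : ℕ →* ℝ :=
    { toFun := fun n => ((n : ℝ))⁻¹
      map_one' := by simp
      map_mul' := fun a b => by push_cast; rw [mul_inv] }
  have hf : ∀ {p : ℕ}, p.Prime → ‖f p‖ < 1 := fun {p} hp => by
    have : (1 : ℝ) < p := by exact_mod_cast hp.one_lt
    simp only [f, MonoidHom.coe_mk, OneHom.coe_mk, norm_inv, RCLike.norm_natCast]
    exact inv_lt_one_of_one_lt₀ this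
  obtain ⟨hs, hsum⟩ :=
    EulerProduct.summable_and_hasSum_smoothNumbers_prod_primesBelow_geometric hf (y + 1)
  have hV : 1 / vdens 1 y = ∏ p ∈ (y + 1).primesBelow, (1 - f p)⁻¹ := by
    rw [vdens, one_div, ← Finset.prod_inv_distrib]
    refine Finset.prod_congr ?_ fun p _ => by simp [f]
    ext p
    rw [mem_filter]
    refine ⟨fun h => h.1, fun h => ⟨h, ?_⟩⟩
    rw [Nat.dvd_one]
    exact (Nat.prime_of_mem_primesBelow h).one_lt.ne'
  have hsub := sum_le_hasSum (f := fun m : (y + 1).smoothNumbers => f m)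
    ((Icc 1 y).subtype (· ∈ (y + 1).smoothNumbers)) (fun i _ => by simp [f]) hsum
  rw [hV]
  refine le_trans ?_ hsub
  have h1 : ∑ x ∈ (Icc 1 y).subtype (· ∈ (y + 1).smoothNumbers), f x = ∑ n ∈ Icc 1 y, (n : ℝ)⁻¹ := by
    rw [Finset.sum_subtype_eq_sum_filter, Finset.filter_true_of_mem]
    · simp [f]
    · intro n hn
      rw [mem_Icc] at hn
      exact Nat.mem_smoothNumbers_of_lt (by omega) (by omega)
  rw [h1]
  have h2 := log_add_one_le_harmonic y
  rw [harmonic_eq_sum_Icc] at h2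
  push_cast at h2
  refine le_trans ?_ h2
  gcongr
  linarith

lemma one_sub_ge_exp {x : ℝ} (h0 : 0 ≤ x) (h1 : x ≤ 1 / 2) : Real.exp (-(2 * x)) ≤ 1 - x := by
  have h := Real.one_sub_le_exp_neg (-(2 * x))
  rw [neg_neg] at h
  rw [Real.exp_neg, inv_le_comm₀ (Real.exp_pos _) (by linarith)]
  refine le_trans ?_ (Real.add_one_le_exp (2 * x))
  rw [inv_le_iff_one_le_mul₀ (by linarith)]
  nlinarith

/-- The primes in `(√y, y]` not dividing `q`. -/
def topBlock (q y : ℕ) : Finset ℕ := (y.primesLE.filter (fun p => ¬ p ∣ q)).filter (y.sqrt < ·)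

lemma mem_topBlock {q y p : ℕ} : p ∈ topBlock q y ↔ p.Prime ∧ p ≤ y ∧ ¬ p ∣ q ∧ y.sqrt < p := by
  rw [topBlock, mem_filter, mem_filter, Nat.mem_primesLE]
  tauto

lemma vdens_eq_mul_topBlock (q y : ℕ) :
    vdens q y = vdens q y.sqrt * ∏ p ∈ topBlock q y, (1 - 1 / (p : ℝ)) := by
  rw [vdens, ← Finset.prod_filter_not_mul_prod_filter _ (y.sqrt < ·)]
  congr 1
  refine Finset.prod_congr ?_ fun _ _ => rfl
  ext p
  simp only [mem_filter, Nat.mem_primesLE, not_lt]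
  have := Nat.sqrt_le_self y
  constructor
  · rintro ⟨⟨⟨h1, h2⟩, h3⟩, h4⟩; exact ⟨⟨h4, h2⟩, h3⟩
  · rintro ⟨⟨h1, h2⟩, h3⟩; exact ⟨⟨⟨h1.trans this, h2⟩, h3⟩, h1⟩

lemma sift_eq_mul_topBlock (q y n : ℕ) :
    sift q y n = sift q y.sqrt n * ∏ p ∈ topBlock q y, (1 - SieveWt.dvdInd n p) := by
  have hsq := Nat.sqrt_le_self y
  by_cases h : ∃ p ∈ topBlock q y, p ∣ n
  · obtain ⟨p, hp, hpn⟩ := h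
    rw [Finset.prod_eq_zero hp (by simp [SieveWt.dvdInd, hpn]), mul_zero, sift, if_neg]
    rw [mem_topBlock] at hp
    exact fun h => h p hp.1 hp.2.1 hp.2.2.1 hpn
  · push Not at h
    rw [Finset.prod_eq_one (fun p hp => by simp [SieveWt.dvdInd, h p hp]), mul_one, sift, sift]
    classical
    refine if_congr ?_ rfl rfl
    refine ⟨fun h' p hp h1 h2 => h' p hp (h1.trans hsq) h2, fun h' p hp h1 h2 => ?_⟩
    by_cases hps : p ≤ y.sqrt
    · exact h' p hp hps h2
    · exact h p (mem_topBlock.2 ⟨hp, h1, h2, not_le.1 hps⟩)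

lemma sift_nonneg (q y n : ℕ) : 0 ≤ sift q y n := by
  unfold sift; split_ifs <;> norm_num

lemma sift_le_one (q y n : ℕ) : sift q y n ≤ 1 := by
  unfold sift; split_ifs <;> norm_num

lemma exp_32_le : 4 * Real.exp 32 ≤ 2 ^ 50 := by
  have h := Real.exp_one_lt_d9
  have : Real.exp 32 = Real.exp 1 ^ 32 := by rw [← Real.exp_nat_mul]; norm_num
  rw [this]
  calc 4 * Real.exp 1 ^ 32 ≤ 4 * 2.7182818286 ^ 32 := by gcongr
    _ ≤ 2 ^ 50 := by norm_num

lemma esym_topBlock_le (q : ℕ) {y : ℕ} (hy : 2 ≤ y) (s : ℕ) :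
    esym (fun p : ℕ => (1 : ℝ) / p) (2 * (s + 25) + 1) (topBlock q y)
      ≤ (∏ p ∈ topBlock q y, (1 - 1 / (p : ℝ))) / 2 ^ (s + 3) := by
  set B := topBlock q y
  have hS : ∑ p ∈ B, (1 : ℝ) / p ≤ 8 := sum_inv_prime_le hy fun p hp => by
    rw [mem_topBlock] at hp; exact ⟨hp.1, hp.2.1, hp.2.2.2⟩
  have h1 := esym_le_exp (fun p : ℕ => (1 : ℝ) / p) (S := B) (fun p _ => by positivity)
    (show (0 : ℝ) < 2 by norm_num) (2 * (s + 25) + 1)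
  have h2 : Real.exp (-16) ≤ ∏ p ∈ B, (1 - 1 / (p : ℝ)) := by
    calc Real.exp (-16) ≤ Real.exp (∑ p ∈ B, -(2 * (1 / (p : ℝ)))) := by
          rw [Finset.sum_neg_distrib, ← Finset.mul_sum]
          gcongr; linarith
      _ = ∏ p ∈ B, Real.exp (-(2 * (1 / (p : ℝ)))) := Real.exp_sum _ _
      _ ≤ _ := by
          refine Finset.prod_le_prod (fun _ _ => (Real.exp_pos _).le) fun p hp => ?_
          refine one_sub_ge_exp (by positivity) ?_
          have : (2 : ℝ) ≤ p := by exact_mod_cast (mem_topBlock.1 hp).1.two_le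
          exact one_div_le_one_div_of_le (by norm_num) this
  refine h1.trans ?_
  have h3 : Real.exp (2 * ∑ p ∈ B, (1 : ℝ) / p) ≤ Real.exp 32 * Real.exp (-16) := by
    rw [← Real.exp_add]; gcongr; linarith
  rw [div_le_div_iff₀ (by positivity) (by positivity)]
  have h5 : (2 : ℝ) ^ (2 * (s + 25) + 1) = 2 ^ 50 / 4 * 2 ^ (s + 3) * 2 ^ s := by
    rw [show 2 * (s + 25) + 1 = 48 + (s + 3) + s by ring, pow_add, pow_add]; norm_num
  have h6 : (1 : ℝ) ≤ 2 ^ s := one_le_pow₀ (by norm_num)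
  have h7 := exp_32_le
  rw [h5]
  have hP := (Real.exp_pos (-16)).le.trans h2
  calc Real.exp (2 * ∑ p ∈ B, (1 : ℝ) / p) * 2 ^ (s + 3)
      ≤ (2 ^ 50 / 4) * (∏ p ∈ B, (1 - 1 / (p : ℝ))) * 2 ^ (s + 3) := by
        gcongr
        refine h3.trans ?_
        gcongr
        linarith
    _ = (2 ^ 50 / 4) * (∏ p ∈ B, (1 - 1 / (p : ℝ))) * 2 ^ (s + 3) * 1 := by ring
    _ ≤ (2 ^ 50 / 4) * (∏ p ∈ B, (1 - 1 / (p : ℝ))) * 2 ^ (s + 3) * 2 ^ s :=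
        mul_le_mul_of_nonneg_left h6 (mul_nonneg (mul_nonneg (by norm_num) hP) (by positivity))
    _ = _ := by ring

lemma level_bound {y s : ℕ} (hy : 2 ≤ y) :
    2 * ((y.sqrt : ℝ) ^ (208 * (s + 1 + 3)) * ((y : ℝ) + 1) ^ (2 * (s + 25) + 1))
      ≤ (y : ℝ) ^ (208 * (s + 3)) := by
  have hy' : (2 : ℝ) ≤ y := by exact_mod_cast hy
  have h1 : (y.sqrt : ℝ) ^ 2 ≤ y := by exact_mod_cast Nat.sqrt_le' y
  calc 2 * ((y.sqrt : ℝ) ^ (208 * (s + 1 + 3)) * ((y : ℝ) + 1) ^ (2 * (s + 25) + 1))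
      = 2 * (((y.sqrt : ℝ) ^ 2) ^ (104 * (s + 4)) * ((y : ℝ) + 1) ^ (2 * (s + 25) + 1)) := by
        rw [← pow_mul]; ring_nf
    _ ≤ y * ((y : ℝ) ^ (104 * (s + 4)) * ((y : ℝ) ^ 2) ^ (2 * (s + 25) + 1)) := by
        gcongr; nlinarith
    _ = (y : ℝ) ^ (1 + 104 * (s + 4) + 2 * (2 * (s + 25) + 1)) := by
        rw [← pow_mul, ← pow_add, add_assoc, pow_add _ 1, pow_one]
    _ ≤ _ := pow_le_pow_right₀ (by linarith) (by omega)

lemma abs_mul_sub_mul_le {m V M W ρ ε : ℝ} (hV : 0 ≤ V) (hW : 0 ≤ W) (hm : |m - V| ≤ V * ε)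
    (hM : W ≤ M) (hM' : M ≤ W + W * ρ) :
    |m * M - V * W| ≤ V * W * (ε + ρ + ε * ρ) := by
  have h1 : m * M - V * W = (m - V) * M + V * (M - W) := by ring
  rw [h1]
  refine (abs_add_le _ _).trans ?_
  rw [abs_mul, abs_mul, abs_of_nonneg hV, abs_of_nonneg (hW.trans hM), abs_of_nonneg (sub_nonneg.2 hM)]
  have hVε : 0 ≤ V * ε := (abs_nonneg _).trans hm
  calc |m - V| * M + V * (M - W) ≤ V * ε * (W + W * ρ) + V * (W * ρ) := by
        gcongr
        · exact hW.trans hM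
        · linarith
    _ = _ := by ring

theorem fundamental_lemma (q : ℕ) : ∀ (y : ℕ), 1 ≤ y → ∀ s : ℕ, ∃ (U L : ℕ → ℝ) (mU mL : ℝ),
    SieveWt (fun p => p ≤ y ∧ ¬ p ∣ q) U mU ((y : ℝ) ^ (208 * (s + 3))) ∧
    SieveWt (fun p => p ≤ y ∧ ¬ p ∣ q) L mL ((y : ℝ) ^ (208 * (s + 3))) ∧
    (∀ n, L n ≤ sift q y n) ∧ (∀ n, sift q y n ≤ U n) ∧
    |mU - vdens q y| ≤ vdens q y * (1 / 2 ^ s) ∧ |mL - vdens q y| ≤ vdens q y * (1 / 2 ^ s) := by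
  intro y
  induction y using Nat.strong_induction_on with
  | _ y ih =>
  intro hy s
  rcases hy.eq_or_lt with rfl | hy2
  · have h1 : ∀ n, sift q 1 n = 1 := fun n => by
      unfold sift
      exact if_pos fun p hp h => absurd hp.one_lt (not_lt.2 h)
    have h2 : vdens q 1 = 1 := by
      refine Finset.prod_eq_one fun p hp => ?_
      have := Nat.mem_primesLE.1 (mem_filter.1 hp).1
      exact absurd this.2.one_lt (not_lt.2 this.1)
    have h3 := SieveWt.one (fun p => p ≤ 1 ∧ ¬ p ∣ q)
    refine ⟨fun _ => 1, fun _ => 1, 1, 1, by simpa using h3, by simpa using h3, ?_, ?_, ?_, ?_⟩ <;>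
      simp [h1, h2]
  · obtain ⟨U, L, mU, mL, hU, hL, hL1, hU1, hmU, hmL⟩ :=
      ih y.sqrt (Nat.sqrt_lt_self hy2) (Nat.sqrt_pos.2 hy) (s + 1)
    have hBp : ∀ p ∈ topBlock q y, p.Prime := fun p hp => (mem_topBlock.1 hp).1
    set B := topBlock q y with hB
    set W := ∏ p ∈ B, (1 - 1 / (p : ℝ)) with hW
    set x : ℕ → ℝ := fun p => (1 : ℝ) / p with hx
    have hx01 : ∀ p ∈ B, 0 ≤ x p ∧ x p ≤ 1 := fun p hp =>
      ⟨by positivity, by have := prime_factor_pos (hBp p hp); simp only [hx]; linarith⟩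
    have hd01 : ∀ n, ∀ p ∈ B, 0 ≤ SieveWt.dvdInd n p ∧ SieveWt.dvdInd n p ≤ 1 := fun n p _ => by
      unfold SieveWt.dvdInd; split_ifs <;> norm_num
    set e := esym x (2 * (s + 25) + 1) B
    have he0 : 0 ≤ e := esym_nonneg x (fun p hp => (hx01 p hp).1) _
    have he : e ≤ W / 2 ^ (s + 3) := esym_topBlock_le q hy2 s
    have hW0 : 0 < W := Finset.prod_pos fun p hp => prime_factor_pos (hBp p hp)
    have hT0 : W ≤ inclExcl x (2 * (s + 25)) B := prod_le_inclExcl_even x hx01 _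
    have hT1 : inclExcl x (2 * (s + 25)) B ≤ W + e := inclExcl_even_le x hx01 _
    have hV0 := vdens_pos q y.sqrt
    have hcard : (B.card : ℝ) ≤ y := by
      have : B ⊆ Icc 1 y := fun p hp => mem_Icc.2 ⟨(hBp p hp).pos, (mem_topBlock.1 hp).2.1⟩
      have := Finset.card_le_card this
      rw [Nat.card_Icc] at this
      exact_mod_cast this
    have hdisj : ∀ p, (p ≤ y.sqrt ∧ ¬ p ∣ q) → ¬ p ∈ B := fun p hp hp' =>
      absurd (mem_topBlock.1 hp').2.2.2 (not_lt.2 hp.1)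
    have hP : ∀ p, ((p ≤ y.sqrt ∧ ¬ p ∣ q) ∨ p ∈ B) → p ≤ y ∧ ¬ p ∣ q := by
      rintro p (hp | hp)
      · exact ⟨hp.1.trans (Nat.sqrt_le_self y), hp.2⟩
      · have := mem_topBlock.1 hp; exact ⟨this.2.1, this.2.2.1⟩
    have hUT := hU.mul (SieveWt.inclExcl_block hBp (2 * (s + 25))) hdisj
    have hLT := hL.mul (SieveWt.inclExcl_block hBp (2 * (s + 25))) hdisj
    have hUe := hU.mul (SieveWt.esym_block hBp (2 * (s + 25) + 1)) hdisj
    have hA1 : (y.sqrt : ℝ) ^ (208 * (s + 1 + 3)) * ((B.card : ℝ) + 1) ^ (2 * (s + 25))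
        ≤ (y.sqrt : ℝ) ^ (208 * (s + 1 + 3)) * ((y : ℝ) + 1) ^ (2 * (s + 25) + 1) := by
      refine mul_le_mul_of_nonneg_left ?_ (by positivity)
      calc ((B.card : ℝ) + 1) ^ (2 * (s + 25)) ≤ ((y : ℝ) + 1) ^ (2 * (s + 25)) := by gcongr
        _ ≤ _ := pow_le_pow_right₀ (by linarith [Nat.cast_nonneg (α := ℝ) y]) (by omega)
    have hA2 : (y.sqrt : ℝ) ^ (208 * (s + 1 + 3)) * (B.card : ℝ) ^ (2 * (s + 25) + 1)
        ≤ (y.sqrt : ℝ) ^ (208 * (s + 1 + 3)) * ((y : ℝ) + 1) ^ (2 * (s + 25) + 1) := by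
      gcongr; linarith
    have hA := level_bound (s := s) hy2
    have hA0 : 0 ≤ (y.sqrt : ℝ) ^ (208 * (s + 1 + 3)) * ((y : ℝ) + 1) ^ (2 * (s + 25) + 1) := by
      positivity
    have hLU := hLT.add (hUe.const_mul (-1))
    refine ⟨_, _, _, _, hUT.mono hP (by linarith), hLU.mono hP ?_, ?_, ?_, ?_, ?_⟩
    · rw [abs_neg, abs_one, one_mul]; linarith
    · intro n
      have h1 := prod_le_inclExcl_even (SieveWt.dvdInd n) (hd01 n) (s + 25)
      have h2 := inclExcl_even_le (SieveWt.dvdInd n) (hd01 n) (s + 25)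
      have h3 : 0 ≤ ∏ p ∈ B, (1 - SieveWt.dvdInd n p) :=
        Finset.prod_nonneg fun p hp => by linarith [(hd01 n p hp).2]
      have h4 := esym_nonneg (SieveWt.dvdInd n) (fun p hp => (hd01 n p hp).1) (2 * (s + 25) + 1)
      have h5 := sift_nonneg q y.sqrt n
      rw [sift_eq_mul_topBlock]
      have h6 := mul_le_mul_of_nonneg_right (hL1 n) (h3.trans h1)
      have h7 := mul_le_mul_of_nonneg_right (hU1 n) h4
      have h8 := mul_le_mul_of_nonneg_left h2 h5
      rw [mul_add (sift q y.sqrt n)] at h8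
      linarith
    · intro n
      have h1 := prod_le_inclExcl_even (SieveWt.dvdInd n) (hd01 n) (s + 25)
      have h3 : 0 ≤ ∏ p ∈ B, (1 - SieveWt.dvdInd n p) :=
        Finset.prod_nonneg fun p hp => by linarith [(hd01 n p hp).2]
      rw [sift_eq_mul_topBlock]
      exact mul_le_mul (hU1 n) h1 h3 ((sift_nonneg _ _ _).trans (hU1 n))
    all_goals
      rw [vdens_eq_mul_topBlock q y]
      have hw : (1 : ℝ) / 2 ^ (s + 1) = 1 / 2 ^ s * (1 / 2) := by rw [pow_succ]; field_simp
      have hw3 : W / 2 ^ (s + 3) = W * (1 / 2 ^ s * (1 / 8)) := by rw [pow_add]; field_simp; norm_num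
      have hs1 : (1 : ℝ) / 2 ^ s ≤ 1 := by
        rw [div_le_one (by positivity)]; exact one_le_pow₀ (by norm_num)
      have hs0 : (0 : ℝ) < 1 / 2 ^ s := by positivity
      rw [hw3] at he
      rw [hw] at hmU hmL
      set w := (1 : ℝ) / 2 ^ s
      have hVW := mul_pos hV0 hW0
    · refine (abs_mul_sub_mul_le (ρ := w * (1 / 8)) hV0.le hW0.le hmU hT0 (hT1.trans (by linarith))).trans ?_
      refine mul_le_mul_of_nonneg_left ?_ hVW.le
      nlinarith
    · have h1 := abs_mul_sub_mul_le (ρ := w * (1 / 8)) hV0.le hW0.le hmL hT0 (hT1.trans (by linarith))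
      have h2 : |mU * e| ≤ vdens q y.sqrt * W * ((1 + w * (1 / 2)) * (w * (1 / 8))) := by
        rw [abs_mul, abs_of_nonneg he0]
        have : |mU| ≤ vdens q y.sqrt * (1 + w * (1 / 2)) := by
          have := abs_le.1 hmU
          rw [abs_le]; constructor <;> nlinarith
        calc |mU| * e ≤ vdens q y.sqrt * (1 + w * (1 / 2)) * (W * (w * (1 / 8))) := by gcongr
          _ = _ := by ring
      have h3 : mL * inclExcl x (2 * (s + 25)) B + -1 * (mU * esym x (2 * (s + 25) + 1) B)
          - vdens q y.sqrt * W
          = (mL * inclExcl x (2 * (s + 25)) B - vdens q y.sqrt * W) - mU * e := by ring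
      rw [h3]
      refine (abs_sub _ _).trans ((add_le_add h1 h2).trans ?_)
      rw [← mul_add]
      refine mul_le_mul_of_nonneg_left ?_ hVW.le
      nlinarith

section Counting

open ArithmeticFunction

/-- The integers of `(M, N]` in the residue class `b` modulo `q`. -/
abbrev apIoc (q : ℕ) (b : ZMod q) (M N : ℕ) : Finset ℕ :=
  (Ioc M N).filter (fun n : ℕ => (n : ZMod q) = b)

lemma abs_card_modEq_sub_le {r : ℕ} (hr : 0 < r) (v : ℕ) {M N : ℕ} (hMN : M ≤ N) :
    |(#{n ∈ Ioc M N | n ≡ v [MOD r]} : ℝ) - ((N : ℝ) - M) / r| ≤ 1 := by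
  have h := Nat.Ioc_filter_modEq_card (r := r) M N hr v
  have hr' : (0 : ℚ) < r := by exact_mod_cast hr
  have hle : ((M : ℚ) - v) / r ≤ ((N : ℚ) - v) / r := by gcongr
  rw [max_eq_left (sub_nonneg.2 (Int.floor_le_floor hle))] at h
  have h1 := Int.floor_le (((N : ℚ) - v) / r)
  have h2 := Int.lt_floor_add_one (((N : ℚ) - v) / r)
  have h3 := Int.floor_le (((M : ℚ) - v) / r)
  have h4 := Int.lt_floor_add_one (((M : ℚ) - v) / r)
  have h5 : (#{n ∈ Ioc M N | n ≡ v [MOD r]} : ℚ)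
      = (⌊((N : ℚ) - v) / r⌋ : ℚ) - ⌊((M : ℚ) - v) / r⌋ := by exact_mod_cast congrArg (Int.cast : ℤ → ℚ) h
  have h6 : ((N : ℚ) - v) / r - ((M : ℚ) - v) / r = ((N : ℚ) - M) / r := by
    rw [← sub_div]; ring
  have h7 : |(#{n ∈ Ioc M N | n ≡ v [MOD r]} : ℚ) - ((N : ℚ) - M) / r| ≤ 1 := by
    rw [abs_le]; constructor <;> linarith
  have h8 := (Rat.cast_le (K := ℝ)).2 h7
  push_cast at h8
  exact h8

lemma abs_card_dvd_sub_le {q d : ℕ} (hq : 0 < q) (hd : 0 < d) (hqd : Nat.Coprime q d)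
    (b : ZMod q) {M N : ℕ} (hMN : M ≤ N) :
    |(#{n ∈ apIoc q b M N | d ∣ n} : ℝ) - ((N : ℝ) - M) / q / d| ≤ 1 := by
  have : NeZero q := ⟨hq.ne'⟩
  obtain ⟨k, hk1, hk2⟩ := Nat.chineseRemainder hqd b.val 0
  have h := abs_card_modEq_sub_le (Nat.mul_pos hq hd) k hMN
  have heq : ∀ n : ℕ, ((n : ZMod q) = b ∧ d ∣ n) ↔ n ≡ k [MOD (q * d)] := fun n => by
    have hb : b = ((b.val : ℕ) : ZMod q) := (ZMod.natCast_zmod_val b).symm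
    rw [← Nat.modEq_and_modEq_iff_modEq_mul hqd, hb, ZMod.natCast_eq_natCast_iff,
      ← Nat.modEq_zero_iff_dvd]
    exact ⟨fun h => ⟨h.1.trans hk1.symm, h.2.trans hk2.symm⟩,
      fun h => ⟨h.1.trans hk1, h.2.trans hk2⟩⟩
  rw [Finset.filter_filter]
  simp only [heq]
  rwa [div_div, ← Nat.cast_mul]

variable {P : ℕ → Prop} {θ : ℕ → ℝ} {m A : ℝ}

lemma SieveWt.abs_sum_sub_le (h : SieveWt P θ m A) {q : ℕ} (hq : 0 < q) (hP : ∀ p, P p → ¬ p ∣ q)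
    (b : ZMod q) {M N : ℕ} (hMN : M ≤ N) :
    |∑ n ∈ apIoc q b M N, θ n - ((N : ℝ) - M) * (m / q)| ≤ A := by
  obtain ⟨ι, _, a, d, h0, h1, h2, h3, h4⟩ := h
  have e1 : ∑ n ∈ apIoc q b M N, θ n
      = ∑ i, a i * (#{n ∈ apIoc q b M N | d i ∣ n} : ℝ) := by
    simp only [h2]
    rw [Finset.sum_comm]
    refine Finset.sum_congr rfl fun i _ => ?_
    rw [← Finset.sum_filter, Finset.sum_const, nsmul_eq_mul, mul_comm]
  have e2 : ((N : ℝ) - M) * (m / q) = ∑ i, a i * (((N : ℝ) - M) / q / d i) := by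
    rw [h3, Finset.sum_div, Finset.mul_sum]
    refine Finset.sum_congr rfl fun i _ => ?_
    ring
  rw [e1, e2, ← Finset.sum_sub_distrib]
  refine (Finset.abs_sum_le_sum_abs _ _).trans (le_trans ?_ h4)
  refine Finset.sum_le_sum fun i _ => ?_
  rw [← mul_sub, abs_mul]
  refine mul_le_of_le_one_right (abs_nonneg _) ?_
  refine abs_card_dvd_sub_le hq (Nat.pos_of_ne_zero (h0 i)) ?_ b hMN
  exact Nat.Coprime.symm (Nat.coprime_of_dvd fun p hp hd hd' => hP p (h1 i p hp hd) hd')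

lemma sift_one_eq_of_isUnit {q : ℕ} {n : ℕ} (hn : IsUnit (n : ZMod q)) (y : ℕ) :
    sift 1 y n = sift q y n := by
  rw [ZMod.isUnit_iff_coprime] at hn
  classical
  unfold sift
  refine if_congr ?_ rfl rfl
  refine ⟨fun h p hp h1 _ => h p hp h1 (by rw [Nat.dvd_one]; exact hp.one_lt.ne'),
    fun h p hp h1 _ h3 => ?_⟩
  refine h p hp h1 (fun h2 => ?_) h3
  exact Nat.not_coprime_of_dvd_of_dvd hp.one_lt h3 h2 hn

lemma abs_sum_sift_sub_le {q : ℕ} (hq : 0 < q) {b : ZMod q} (hb : IsUnit b) {y : ℕ} (hy : 1 ≤ y)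
    (s : ℕ) {M N : ℕ} (hMN : M ≤ N) :
    |∑ n ∈ apIoc q b M N, sift 1 y n - ((N : ℝ) - M) * (vdens q y / q)|
      ≤ ((N : ℝ) - M) * (vdens q y / q) / 2 ^ s + (y : ℝ) ^ (208 * (s + 3)) := by
  obtain ⟨U, L, mU, mL, hU, hL, hL1, hU1, hmU, hmL⟩ := fundamental_lemma q y hy s
  have e : ∑ n ∈ apIoc q b M N, sift 1 y n
      = ∑ n ∈ apIoc q b M N, sift q y n :=
    Finset.sum_congr rfl fun n hn => sift_one_eq_of_isUnit ((mem_filter.1 hn).2 ▸ hb) y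
  have h1 := abs_le.1 (hU.abs_sum_sub_le hq (fun p hp => hp.2) b hMN)
  have h2 := abs_le.1 (hL.abs_sum_sub_le hq (fun p hp => hp.2) b hMN)
  have h3 : ∑ n ∈ apIoc q b M N, sift q y n
      ≤ ∑ n ∈ apIoc q b M N, U n := Finset.sum_le_sum fun n _ => hU1 n
  have h4 : ∑ n ∈ apIoc q b M N, L n
      ≤ ∑ n ∈ apIoc q b M N, sift q y n := Finset.sum_le_sum fun n _ => hL1 n
  have hq' : (0 : ℝ) < q := by exact_mod_cast hq
  have hMN' : (0 : ℝ) ≤ (N : ℝ) - M := sub_nonneg.2 (by exact_mod_cast hMN)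
  have hX : 0 ≤ ((N : ℝ) - M) / q := by positivity
  have h5 : ((N : ℝ) - M) * (mU / q) ≤ ((N : ℝ) - M) * (vdens q y / q)
      + ((N : ℝ) - M) * (vdens q y / q) / 2 ^ s := by
    have := mul_le_mul_of_nonneg_left (abs_le.1 hmU).2 hX
    calc ((N : ℝ) - M) * (mU / q) = ((N : ℝ) - M) / q * (mU - vdens q y)
          + ((N : ℝ) - M) * (vdens q y / q) := by ring
      _ ≤ ((N : ℝ) - M) / q * (vdens q y * (1 / 2 ^ s)) + ((N : ℝ) - M) * (vdens q y / q) := by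
          gcongr
      _ = _ := by ring
  have h6 : ((N : ℝ) - M) * (vdens q y / q) - ((N : ℝ) - M) * (vdens q y / q) / 2 ^ s
      ≤ ((N : ℝ) - M) * (mL / q) := by
    have := mul_le_mul_of_nonneg_left (abs_le.1 hmL).1 hX
    calc ((N : ℝ) - M) * (vdens q y / q) - ((N : ℝ) - M) * (vdens q y / q) / 2 ^ s
        = ((N : ℝ) - M) / q * (-(vdens q y * (1 / 2 ^ s))) + ((N : ℝ) - M) * (vdens q y / q) := by
          ring
      _ ≤ ((N : ℝ) - M) / q * (mL - vdens q y) + ((N : ℝ) - M) * (vdens q y / q) := by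
          gcongr
      _ = _ := by ring
  rw [e, abs_le]
  constructor <;> linarith

lemma vdens_div_le {q : ℕ} (hq : 0 < q) (y : ℕ) :
    vdens q y / q ≤ vdens 1 y / q.totient := by
  have hq' : (0 : ℝ) < q := by exact_mod_cast hq
  have hφ : (0 : ℝ) < q.totient := by exact_mod_cast Nat.totient_pos.2 hq
  have h1 : (q.totient : ℝ) = q * ∏ p ∈ q.primeFactors, (1 - 1 / (p : ℝ)) := by
    have := congrArg (Rat.cast : ℚ → ℝ) (Nat.totient_eq_mul_prod_factors q)
    push_cast at this
    simpa using this
  have h2 : vdens 1 y = vdens q y * ∏ p ∈ y.primesLE.filter (fun p => p ∣ q), (1 - 1 / (p : ℝ)) := by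
    have : vdens 1 y = ∏ p ∈ y.primesLE, (1 - 1 / (p : ℝ)) := by
      rw [vdens, Finset.filter_true_of_mem]
      intro p hp
      rw [Nat.dvd_one]
      exact (Nat.mem_primesLE.1 hp).2.one_lt.ne'
    rw [this, vdens, mul_comm, Finset.prod_filter_mul_prod_filter_not]
  have h3 : ∏ p ∈ q.primeFactors, (1 - 1 / (p : ℝ))
      ≤ ∏ p ∈ y.primesLE.filter (fun p => p ∣ q), (1 - 1 / (p : ℝ)) := by
    have hsub : y.primesLE.filter (fun p => p ∣ q) ⊆ q.primeFactors := fun p hp => by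
      rw [mem_filter, Nat.mem_primesLE] at hp
      exact Nat.mem_primeFactors.2 ⟨hp.1.2, hp.2, hq.ne'⟩
    refine Finset.prod_le_prod_of_subset_of_le_one hsub ?_ ?_
    · exact fun p hp => (prime_factor_pos (Nat.prime_of_mem_primeFactors hp)).le
    · exact fun p _ _ => prime_factor_le_one p
  rw [div_le_div_iff₀ hq' hφ, h1, h2]
  have hV := vdens_pos q y
  calc vdens q y * (q * ∏ p ∈ q.primeFactors, (1 - 1 / (p : ℝ)))
      ≤ vdens q y * (q * ∏ p ∈ y.primesLE.filter (fun p => p ∣ q), (1 - 1 / (p : ℝ))) := by gcongr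
    _ = _ := by ring

lemma vdens_div_le_log {q : ℕ} (hq : 0 < q) {y : ℕ} (hy : 2 ≤ y) :
    vdens q y / q ≤ 1 / (q.totient * Real.log y) := by
  refine (vdens_div_le hq y).trans ?_
  rw [mul_comm, ← div_div]
  gcongr
  exact vdens_le_inv_log hy

/-- Integers in a short segment of a progression without prime factors `≤ Y`. -/
lemma sum_sift_le {q : ℕ} (hq : 0 < q) {b : ZMod q} (hb : IsUnit b) {Y : ℕ} (hY : 2 ≤ Y) {M N : ℕ}
    (hMN : M ≤ N) (h : (q : ℝ) * (Y : ℝ) ^ 625 ≤ (N : ℝ) - M) :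
    ∑ n ∈ apIoc q b M N, sift 1 Y n
      ≤ 3 * (((N : ℝ) - M) / (q.totient * Real.log Y)) := by
  have h1 := (abs_le.1 (abs_sum_sift_sub_le hq hb (show 1 ≤ Y by omega) 0 hMN)).2
  have hY' : (2 : ℝ) ≤ Y := by exact_mod_cast hY
  have hlog : 0 < Real.log Y := Real.log_pos (by linarith)
  have hlogY : Real.log Y ≤ Y := (Real.log_le_sub_one_of_pos (by linarith)).trans (by linarith)
  have hφ : (0 : ℝ) < q.totient := by exact_mod_cast Nat.totient_pos.2 hq
  have hφq : (q.totient : ℝ) ≤ q := by exact_mod_cast Nat.totient_le q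
  have hMN' : (0 : ℝ) ≤ (N : ℝ) - M := sub_nonneg.2 (by exact_mod_cast hMN)
  have h2 := mul_le_mul_of_nonneg_left (vdens_div_le_log hq hY) hMN'
  rw [mul_one_div] at h2
  have h3 : (Y : ℝ) ^ (208 * (0 + 3)) ≤ ((N : ℝ) - M) / (q.totient * Real.log Y) := by
    rw [le_div_iff₀ (by positivity)]
    refine le_trans ?_ h
    calc (Y : ℝ) ^ (208 * (0 + 3)) * (q.totient * Real.log Y) ≤ (Y : ℝ) ^ 624 * (q * Y) := by
          norm_num only; gcongr
      _ = _ := by ring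
  rw [pow_zero, div_one] at h1
  linarith

lemma sift_one_eq_one_iff {y n : ℕ} : sift 1 y n = 1 ↔ ∀ p, p.Prime → p ∣ n → y < p := by
  unfold sift
  constructor
  · intro h p hp hpn
    by_contra hc
    rw [if_neg] at h
    · norm_num at h
    · exact fun h' => h' p hp (not_lt.1 hc) (by rw [Nat.dvd_one]; exact hp.one_lt.ne') hpn
  · intro h
    rw [if_pos]
    exact fun p hp h1 _ h3 => absurd (h p hp h3) (not_lt.2 h1)

lemma sift_eq_zero_or_one (q y n : ℕ) : sift q y n = 0 ∨ sift q y n = 1 := by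
  unfold sift; split_ifs <;> simp

/-- Prime powers of small primes contribute little. -/
lemma sum_vonMangoldt_mul_one_sub_sift_le (Y N : ℕ) :
    ∑ n ∈ Ioc 0 N, Λ n * (1 - sift 1 Y n) ≤ Y * Real.log N := by
  classical
  have h1 : ∀ n ∈ Ioc 0 N, Λ n * (1 - sift 1 Y n)
      ≤ ∑ p ∈ Ioc 0 Y with p.Prime, if n ∈ (Icc 1 (Nat.log p N)).image (p ^ ·) then Real.log p else 0 := by
    intro n hn
    have hnn : ∀ p ∈ (Ioc 0 Y).filter Nat.Prime,
        0 ≤ if n ∈ (Icc 1 (Nat.log p N)).image (p ^ ·) then Real.log (p : ℝ) else 0 := fun p _ => by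
      split_ifs
      · exact Real.log_natCast_nonneg p
      · exact le_rfl
    by_cases hz : Λ n * (1 - sift 1 Y n) = 0
    · rw [hz]; exact Finset.sum_nonneg hnn
    · have hΛ : Λ n ≠ 0 := left_ne_zero_of_mul hz
      have hs : sift 1 Y n ≠ 1 := fun h => hz (by rw [h]; ring)
      obtain ⟨p, k, hp, hk, rfl⟩ := (isPrimePow_nat_iff _).1 (vonMangoldt_ne_zero_iff.1 hΛ)
      have hpY : p ≤ Y := by
        by_contra hc
        refine hs (sift_one_eq_one_iff.2 fun r hr hrp => ?_)
        rw [(Nat.prime_dvd_prime_iff_eq hr hp).1 (hr.dvd_of_dvd_pow hrp)]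
        exact not_le.1 hc
      refine le_trans ?_ (Finset.single_le_sum hnn (mem_filter.2 ⟨mem_Ioc.2 ⟨hp.pos, hpY⟩, hp⟩))
      rw [mem_Ioc] at hn
      rw [if_pos (mem_image_of_mem _ (mem_Icc.2 ⟨hk, Nat.le_log_of_pow_le hp.one_lt hn.2⟩)),
        vonMangoldt_apply_pow hk.ne', vonMangoldt_apply_prime hp]
      exact mul_le_of_le_one_right (Real.log_natCast_nonneg p) (by linarith [sift_nonneg 1 Y (p ^ k)])
  refine (Finset.sum_le_sum h1).trans ?_
  rw [Finset.sum_comm]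
  have h2 : ∀ p ∈ (Ioc 0 Y).filter Nat.Prime, (∑ n ∈ Ioc 0 N,
      if n ∈ (Icc 1 (Nat.log p N)).image (p ^ ·) then Real.log (p : ℝ) else 0) ≤ Real.log N := by
    intro p hp
    have hp' := (mem_filter.1 hp).2
    rw [← Finset.sum_filter, Finset.sum_const, nsmul_eq_mul]
    have hsub : (Ioc 0 N).filter (fun n => n ∈ (Icc 1 (Nat.log p N)).image (p ^ ·))
        ⊆ (Icc 1 (Nat.log p N)).image (p ^ ·) := fun n hn => (mem_filter.1 hn).2
    have hc := (Finset.card_le_card hsub).trans Finset.card_image_le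
    rw [Nat.card_Icc, Nat.add_sub_cancel] at hc
    rcases Nat.eq_zero_or_pos N with rfl | hN
    · simp
    calc (_ : ℝ) * Real.log p ≤ (Nat.log p N : ℝ) * Real.log p := by
          gcongr
      _ = Real.log ((p : ℝ) ^ Nat.log p N) := (Real.log_pow _ _).symm
      _ ≤ Real.log N := by
          refine Real.log_le_log (by have := hp'.pos; positivity) ?_
          exact_mod_cast Nat.pow_log_le_self p hN.ne'
  refine (Finset.sum_le_card_nsmul _ _ _ h2).trans ?_
  rw [nsmul_eq_mul]
  refine mul_le_mul_of_nonneg_right ?_ (Real.log_natCast_nonneg N)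
  have := Finset.card_filter_le (Ioc 0 Y) Nat.Prime
  rw [Nat.card_Ioc, Nat.sub_zero] at this
  exact_mod_cast this

lemma exists_nat_root {N k : ℕ} (hN : 0 < N) (hk : 0 < k) :
    ∃ Y : ℕ, (Y : ℝ) ^ k ≤ N ∧ (N : ℝ) ≤ ((Y : ℝ) + 1) ^ k := by
  have hspec := Nat.findGreatest_spec (P := fun Y => Y ^ k ≤ N) (m := 1) (n := N) hN
    (by rw [one_pow]; exact hN)
  refine ⟨Nat.findGreatest (fun Y => Y ^ k ≤ N) N, by exact_mod_cast hspec, ?_⟩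
  by_contra hc
  set Y := Nat.findGreatest (fun Y => Y ^ k ≤ N) N
  have hc' : (Y + 1) ^ k ≤ N := by exact_mod_cast (not_le.1 hc).le
  have hle : Y + 1 ≤ N := (Nat.le_self_pow hk.ne' _).trans hc'
  have := Nat.le_findGreatest (P := fun Y => Y ^ k ≤ N) hle hc'
  omega

/-- A Brun-Titchmarsh bound for the von Mangoldt function. -/
theorem exists_brun_titchmarsh : ∃ C : ℝ, 0 < C ∧ ∀ (q : ℕ), 0 < q → ∀ b : ZMod q, IsUnit b →
    ∀ M N : ℕ, M ≤ N → (q : ℝ) ^ 2 * N ≤ ((N : ℝ) - M) ^ 2 →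
      ∑ n ∈ apIoc q b M N, Λ n ≤ C * (((N : ℝ) - M) / q.totient) := by
  refine ⟨20000, by norm_num, fun q hq b hb M N hMN h => ?_⟩
  have hφ : (0 : ℝ) < q.totient := by exact_mod_cast Nat.totient_pos.2 hq
  have hφq : (q.totient : ℝ) ≤ q := by exact_mod_cast Nat.totient_le q
  have hq' : (1 : ℝ) ≤ q := by exact_mod_cast hq
  have hMN' : (0 : ℝ) ≤ (N : ℝ) - M := sub_nonneg.2 (by exact_mod_cast hMN)
  have hqφ : ((N : ℝ) - M) / q ≤ ((N : ℝ) - M) / q.totient := by gcongr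
  rcases Nat.eq_zero_or_pos N with rfl | hN
  · obtain rfl : M = 0 := by omega
    simp [apIoc]
  have hN' : (1 : ℝ) ≤ N := by exact_mod_cast hN
  obtain ⟨k, hk⟩ : ∃ k : ℕ, k = 2500 := ⟨_, rfl⟩
  obtain ⟨Y, hY1, hY2⟩ := exists_nat_root hN (show 0 < k by omega)
  have hlogN : Real.log N ≤ 2500 * Real.log ((Y : ℝ) + 1) := by
    have := Real.log_le_log (by linarith) hY2
    rwa [Real.log_pow, hk, Nat.cast_ofNat] at this
  have hlogN0 : 0 ≤ Real.log N := Real.log_nonneg hN'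
  by_cases hY : 2 ≤ Y
  · have hY' : (2 : ℝ) ≤ Y := by exact_mod_cast hY
    have hlogY : Real.log ((Y : ℝ) + 1) ≤ 2 * Real.log Y := by
      have : Real.log ((Y : ℝ) + 1) ≤ Real.log ((Y : ℝ) ^ 2) :=
        Real.log_le_log (by linarith) (by nlinarith)
      rwa [Real.log_pow, Nat.cast_ofNat] at this
    have hlY0 : 0 < Real.log Y := Real.log_pos (by linarith)
    have hY3 : Real.log Y ≤ Y := (Real.log_le_sub_one_of_pos (by linarith)).trans (by linarith)
    have hlev : (q : ℝ) * (Y : ℝ) ^ 625 ≤ (N : ℝ) - M := by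
      refine le_of_sq_le_sq ?_ hMN'
      refine le_trans ?_ h
      rw [mul_pow, ← pow_mul]
      gcongr
      exact (pow_le_pow_right₀ (by linarith) (by omega)).trans hY1
    have h1 := sum_sift_le hq hb hY hMN hlev
    have h2 : ∑ n ∈ apIoc q b M N, Λ n * (1 - sift 1 Y n) ≤ Y * Real.log N := by
      refine le_trans ?_ (sum_vonMangoldt_mul_one_sub_sift_le Y N)
      refine Finset.sum_le_sum_of_subset_of_nonneg ?_ fun n _ _ => ?_
      · exact (Finset.filter_subset _ _).trans (Finset.Ioc_subset_Ioc_left (Nat.zero_le _))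
      · exact mul_nonneg vonMangoldt_nonneg (by linarith [sift_le_one 1 Y n])
    have h3 : ∑ n ∈ apIoc q b M N, Λ n * sift 1 Y n
        ≤ Real.log N * ∑ n ∈ apIoc q b M N, sift 1 Y n := by
      rw [Finset.mul_sum]
      refine Finset.sum_le_sum fun n hn => ?_
      rw [mem_filter, mem_Ioc] at hn
      refine mul_le_mul_of_nonneg_right ?_ (sift_nonneg _ _ _)
      exact vonMangoldt_le_log.trans
        (Real.log_le_log (by exact_mod_cast (by omega : 0 < n)) (by exact_mod_cast hn.1.2))
    have h4 : ∑ n ∈ apIoc q b M N, Λ n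
        = ∑ n ∈ apIoc q b M N, Λ n * sift 1 Y n
          + ∑ n ∈ apIoc q b M N, Λ n * (1 - sift 1 Y n) := by
      rw [← Finset.sum_add_distrib]
      exact Finset.sum_congr rfl fun n _ => by ring
    have h5 : Real.log N * ∑ n ∈ apIoc q b M N, sift 1 Y n
        ≤ 15000 * (((N : ℝ) - M) / q.totient) := by
      calc _ ≤ (5000 * Real.log Y) * (3 * (((N : ℝ) - M) / (q.totient * Real.log Y))) := by
            refine mul_le_mul ?_ h1 (Finset.sum_nonneg fun _ _ => sift_nonneg _ _ _) (by positivity)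
            linarith
        _ = _ := by field_simp; ring
    have h6 : (Y : ℝ) * Real.log N ≤ 5000 * (((N : ℝ) - M) / q.totient) := by
      calc (Y : ℝ) * Real.log N ≤ Y * (5000 * Y) := by gcongr; linarith
        _ = 5000 * (Y : ℝ) ^ 2 := by ring
        _ ≤ 5000 * (Y : ℝ) ^ 625 := by
            exact mul_le_mul_of_nonneg_left (pow_le_pow_right₀ (by linarith) (by norm_num))
              (by norm_num)
        _ ≤ 5000 * (((N : ℝ) - M) / q) := by
            gcongr
            rw [le_div_iff₀ (by linarith), mul_comm]
            exact hlev
        _ ≤ _ := by gcongr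
    linarith
  · have hY1 : (Y : ℝ) + 1 ≤ 2 := by
      have : Y + 1 ≤ 2 := by omega
      exact_mod_cast this
    have hlog : Real.log N ≤ 2500 := by
      have h2 : Real.log ((Y : ℝ) + 1) ≤ Real.log 2 := Real.log_le_log (by positivity) hY1
      linarith [Real.log_two_lt_d9]
    have h1 : ∑ n ∈ apIoc q b M N, Λ n
        ≤ (#(apIoc q b M N) : ℝ) * 2500 := by
      rw [← nsmul_eq_mul]
      refine Finset.sum_le_card_nsmul _ _ _ fun n hn => ?_
      rw [mem_filter, mem_Ioc] at hn
      exact (vonMangoldt_le_log.trans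
        (Real.log_le_log (by exact_mod_cast (by omega : 0 < n)) (by exact_mod_cast hn.1.2))).trans hlog
    have h2 := (abs_le.1 (abs_card_dvd_sub_le hq one_pos (Nat.coprime_one_right q) b hMN)).2
    simp only [one_dvd, Finset.filter_true, Nat.cast_one, div_one] at h2
    have h3 : (q : ℝ) ≤ (N : ℝ) - M := by
      refine le_of_sq_le_sq ?_ hMN'
      refine le_trans ?_ h
      nlinarith
    have h4 : 1 ≤ ((N : ℝ) - M) / q := by rwa [le_div_iff₀ (by linarith), one_mul]
    nlinarith

end Counting

section Abel

/-- Summation by parts against a nonnegative antitone weight, with the partial sums of `c`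
dominated by those of `β`. -/
lemma norm_sum_mul_antitone_le {c : ℕ → ℂ} {β φ : ℕ → ℝ} {β₀ : ℝ} {M N : ℕ} (hMN : M ≤ N)
    (hφ : ∀ n, M < n → n < N → φ (n + 1) ≤ φ n) (hφ0 : ∀ n, M < n → n ≤ N → 0 ≤ φ n)
    (hc : ∀ m, M < m → m ≤ N → ‖∑ n ∈ Ioc M m, c n‖ ≤ β₀ + ∑ n ∈ Ioc M m, β n) :
    ‖∑ n ∈ Ioc M N, c n * φ n‖ ≤ β₀ * φ (M + 1) + ∑ n ∈ Ioc M N, β n * φ n ∨ M = N := by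
  rcases hMN.eq_or_lt with h | hlt
  · exact Or.inr h
  left
  have key : ∀ m, M < m → m ≤ N →
      ‖∑ n ∈ Ioc M m, c n * φ n - (∑ n ∈ Ioc M m, c n) * φ m‖
        ≤ β₀ * φ (M + 1) + ∑ n ∈ Ioc M m, β n * φ n - (β₀ + ∑ n ∈ Ioc M m, β n) * φ m := by
    intro m hm
    induction m, hm using Nat.le_induction with
    | base => intro _; simp; ring_nf; simp
    | succ m hm ih =>
      intro hmN
      have hmM : M ≤ m := by omega
      have h1 := ih (by omega)
      rw [Finset.sum_Ioc_succ_top hmM, Finset.sum_Ioc_succ_top hmM, Finset.sum_Ioc_succ_top hmM,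
        Finset.sum_Ioc_succ_top hmM]
      have h2 := hc m (by omega) (by omega)
      have h3 := hφ m (by omega) (by omega)
      have e : ∑ n ∈ Ioc M m, c n * (φ n : ℂ) + c (m + 1) * (φ (m + 1) : ℂ)
          - (∑ n ∈ Ioc M m, c n + c (m + 1)) * (φ (m + 1) : ℂ)
          = (∑ n ∈ Ioc M m, c n * (φ n : ℂ) - (∑ n ∈ Ioc M m, c n) * φ m)
            + (∑ n ∈ Ioc M m, c n) * ((φ m - φ (m + 1) : ℝ) : ℂ) := by push_cast; ring
      rw [e]
      refine (norm_add_le _ _).trans ?_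
      rw [norm_mul, Complex.norm_real, Real.norm_of_nonneg (by linarith)]
      have h4 := mul_le_mul_of_nonneg_right h2 (sub_nonneg.2 h3)
      nlinarith
  have h1 := key N hlt le_rfl
  have h2 := mul_le_mul_of_nonneg_right (hc N hlt le_rfl) (hφ0 N hlt le_rfl)
  have e : ∑ n ∈ Ioc M N, c n * (φ n : ℂ)
      = (∑ n ∈ Ioc M N, c n * (φ n : ℂ) - (∑ n ∈ Ioc M N, c n) * φ N)
        + (∑ n ∈ Ioc M N, c n) * φ N := by ring
  rw [e]
  refine (norm_add_le _ _).trans ?_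
  rw [norm_mul, Complex.norm_real, Real.norm_of_nonneg (hφ0 N hlt le_rfl)]
  linarith

lemma norm_sum_mul_antitone_le' {c : ℕ → ℂ} {β φ : ℕ → ℝ} {β₀ : ℝ} {M N : ℕ} (hMN : M ≤ N)
    (hφ : ∀ n, M < n → n < N → φ (n + 1) ≤ φ n) (hφ0 : ∀ n, M < n → 0 ≤ φ n)
    (hc : ∀ m, M < m → m ≤ N → ‖∑ n ∈ Ioc M m, c n‖ ≤ β₀ + ∑ n ∈ Ioc M m, β n) (hβ₀ : 0 ≤ β₀) :
    ‖∑ n ∈ Ioc M N, c n * φ n‖ ≤ β₀ * φ (M + 1) + ∑ n ∈ Ioc M N, β n * φ n := by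
  rcases norm_sum_mul_antitone_le hMN hφ (fun n h _ => hφ0 n h) hc with h | rfl
  · exact h
  · simpa using mul_nonneg hβ₀ (hφ0 (M + 1) (by omega))

lemma sum_mul_antitone_le {c β φ : ℕ → ℝ} {β₀ : ℝ} {M N : ℕ} (hMN : M ≤ N) (hc0 : ∀ n, 0 ≤ c n)
    (hφ : ∀ n, M < n → n < N → φ (n + 1) ≤ φ n) (hφ0 : ∀ n, M < n → 0 ≤ φ n)
    (hc : ∀ m, M < m → m ≤ N → ∑ n ∈ Ioc M m, c n ≤ β₀ + ∑ n ∈ Ioc M m, β n) (hβ₀ : 0 ≤ β₀) :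
    ∑ n ∈ Ioc M N, c n * φ n ≤ β₀ * φ (M + 1) + ∑ n ∈ Ioc M N, β n * φ n := by
  refine le_trans ?_ (norm_sum_mul_antitone_le' (c := fun n => (c n : ℂ)) hMN hφ hφ0 ?_ hβ₀)
  · rw [show ∑ n ∈ Ioc M N, (c n : ℂ) * (φ n : ℂ) = ((∑ n ∈ Ioc M N, c n * φ n : ℝ) : ℂ) by
      push_cast; rfl, Complex.norm_real]
    exact Real.le_norm_self _
  · intro m h1 h2
    rw [← Complex.ofReal_sum, Complex.norm_real,
      Real.norm_of_nonneg (Finset.sum_nonneg fun n _ => hc0 n)]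
    exact hc m h1 h2

end Abel

section Sums

lemma sum_inv_le (N : ℕ) : ∑ n ∈ Ioc 0 N, (1 : ℝ) / n ≤ 1 + Real.log N := by
  have h := harmonic_le_one_add_log N
  have e : ((harmonic N : ℚ) : ℝ) = ∑ n ∈ Ioc 0 N, (1 : ℝ) / n := by
    rw [harmonic_eq_sum_Icc]
    push_cast
    refine Finset.sum_congr (by ext; simp; omega) fun n _ => by rw [one_div]
  rwa [e] at h

lemma rpow_neg_one_sub_le {η : ℝ} (hη : 0 < η) {n : ℕ} (hn : 2 ≤ n) :
    (n : ℝ) ^ (-1 - η) ≤ ((n - 1 : ℝ) ^ (-η) - (n : ℝ) ^ (-η)) / η := by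
  have hn' : (2 : ℝ) ≤ n := by exact_mod_cast hn
  rw [le_div_iff₀ hη]
  have hder : ∀ x ∈ Set.Icc ((n : ℝ) - 1) n, HasDerivWithinAt (fun v : ℝ => -(v ^ (-η)))
      (η * x ^ (-1 - η)) (Set.Icc ((n : ℝ) - 1) n) x := by
    intro x hx
    have hx0 : x ≠ 0 := by linarith [hx.1]
    have := (Real.hasDerivAt_rpow_const (p := -η) (Or.inl hx0)).neg.hasDerivWithinAt
      (s := Set.Icc ((n : ℝ) - 1) n)
    refine this.congr_deriv ?_
    rw [show -η - 1 = -1 - η by ring]; ring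
  obtain ⟨ξ, hξ, h⟩ := exists_hasDerivAt_eq_slope (fun v : ℝ => -(v ^ (-η)))
    (fun x => η * x ^ (-1 - η)) (show (n : ℝ) - 1 < n by linarith)
    (fun x hx => (hder x hx).continuousWithinAt)
    (fun x hx => (hder x ⟨hx.1.le, hx.2.le⟩).hasDerivAt (Icc_mem_nhds hx.1 hx.2))
  have h1 : (n : ℝ) ^ (-1 - η) ≤ ξ ^ (-1 - η) :=
    Real.rpow_le_rpow_of_nonpos (by linarith [hξ.1]) hξ.2.le (by linarith)
  rw [show (n : ℝ) - (n - 1) = 1 by ring, div_one] at h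
  nlinarith

lemma sum_rpow_neg_le {η : ℝ} (hη : 0 < η) (N : ℕ) :
    ∑ n ∈ Ioc 0 N, (n : ℝ) ^ (-1 - η) ≤ 1 + 1 / η := by
  have key : ∀ N : ℕ, 1 ≤ N → ∑ n ∈ Ioc 0 N, (n : ℝ) ^ (-1 - η)
      ≤ 1 + 1 / η - (N : ℝ) ^ (-η) / η := by
    intro N hN
    induction N, hN using Nat.le_induction with
    | base => simp
    | succ N hN ih =>
      rw [Finset.sum_Ioc_succ_top (Nat.zero_le _)]
      have := rpow_neg_one_sub_le hη (show 2 ≤ N + 1 by omega)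
      rw [show ((N + 1 : ℕ) : ℝ) - 1 = N by push_cast; ring, sub_div] at this
      linarith
  rcases Nat.eq_zero_or_pos N with rfl | hN
  · simp; positivity
  · have : 0 ≤ (N : ℝ) ^ (-η) / η := by positivity
    linarith [key N hN]

lemma log_pow_le {η : ℝ} (hη : 0 < η) (k : ℕ) {v : ℝ} (hv : 1 ≤ v) :
    Real.log v ^ k ≤ k.factorial / η ^ k * v ^ η := by
  have h := Real.pow_div_factorial_le_exp (x := η * Real.log v)
    (mul_nonneg hη.le (Real.log_nonneg hv)) k
  rw [mul_comm, ← Real.rpow_def_of_pos (by linarith), div_le_iff₀ (by positivity), mul_pow] at h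
  rw [div_mul_eq_mul_div, le_div_iff₀ (by positivity)]
  linarith

lemma sum_log_pow_rpow_le {η : ℝ} (hη : 0 < η) (hη1 : η ≤ 1) (k N : ℕ) :
    ∑ n ∈ Ioc 0 N, Real.log n ^ k * (n : ℝ) ^ (-1 - η)
      ≤ 3 * 2 ^ k * k.factorial / η ^ (k + 1) := by
  have h1 : ∀ n ∈ Ioc 0 N, Real.log n ^ k * (n : ℝ) ^ (-1 - η)
      ≤ k.factorial / (η / 2) ^ k * (n : ℝ) ^ (-1 - η / 2) := fun n hn => by
    have hn1 : (1 : ℝ) ≤ n := by exact_mod_cast (mem_Ioc.1 hn).1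
    have := mul_le_mul_of_nonneg_right (log_pow_le (half_pos hη) k hn1)
      (Real.rpow_nonneg (by linarith : (0 : ℝ) ≤ n) (-1 - η))
    rw [mul_assoc, ← Real.rpow_add (by linarith)] at this
    rwa [show η / 2 + (-1 - η) = -1 - η / 2 by ring] at this
  refine (Finset.sum_le_sum h1).trans ?_
  rw [← Finset.mul_sum]
  calc _ ≤ k.factorial / (η / 2) ^ k * (1 + 1 / (η / 2)) := by
        gcongr; exact sum_rpow_neg_le (half_pos hη) N
    _ ≤ k.factorial / (η / 2) ^ k * (3 / η) := by
        gcongr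
        rw [one_div_div, le_div_iff₀ hη, add_mul, div_mul_cancel₀ _ hη.ne']; linarith
    _ = _ := by rw [div_pow]; field_simp; ring

/-- The weight `log^k n · n^{-1-δ}`. -/
noncomputable def logWt (k : ℕ) (δ : ℝ) (n : ℕ) : ℝ := Real.log n ^ k * (n : ℝ) ^ (-1 - δ)

lemma logWt_nonneg (k : ℕ) (δ : ℝ) (n : ℕ) : 0 ≤ logWt k δ n :=
  mul_nonneg (pow_nonneg (Real.log_natCast_nonneg n) _) (Real.rpow_nonneg (Nat.cast_nonneg n) _)

lemma logWt_succ_le {k : ℕ} (hk : k ≤ 3) {δ : ℝ} (hδ : 0 ≤ δ) {n : ℕ} (hn : 27 ≤ n) :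
    logWt k δ (n + 1) ≤ logWt k δ n := by
  have hn' : (27 : ℝ) ≤ n := by exact_mod_cast hn
  have hkR : (k : ℝ) ≤ 3 := by exact_mod_cast hk
  have he : Real.exp (1 / 3 : ℝ)⁻¹ ≤ n := by
    rw [inv_div, div_one, show (3 : ℝ) = ((3 : ℕ) : ℝ) * 1 by norm_num, Real.exp_nat_mul]
    have := Real.exp_one_lt_d9
    have h3 : Real.exp 1 ≤ 3 := by linarith
    have h4 := pow_le_pow_left₀ (Real.exp_pos 1).le h3 3
    norm_num at h4 ⊢
    linarith
  have h1 := Real.log_div_self_rpow_antitoneOn (show (0 : ℝ) < 1 / 3 by norm_num) he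
    (show Real.exp (1 / 3 : ℝ)⁻¹ ≤ (n : ℝ) + 1 by linarith) (by linarith)
  have e : ∀ v : ℝ, 1 ≤ v → Real.log v ^ k * v ^ (-1 - δ)
      = (Real.log v / v ^ (1 / 3 : ℝ)) ^ k * v ^ (-(1 + δ - k / 3)) := fun v hv => by
    rw [div_pow, ← Real.rpow_mul_natCast (by linarith), div_mul_eq_mul_div, mul_div_assoc,
      ← Real.rpow_sub (by linarith)]
    congr 2; ring
  unfold logWt
  rw [Nat.cast_add_one, e _ (by linarith), e _ (by linarith)]
  refine mul_le_mul ?_ ?_ (by positivity) ?_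
  · refine pow_le_pow_left₀ (div_nonneg (Real.log_nonneg (by linarith)) (by positivity)) h1 k
  · exact Real.rpow_le_rpow_of_nonpos (by linarith) (by linarith) (by linarith)
  · exact pow_nonneg (div_nonneg (Real.log_nonneg (by linarith)) (by positivity)) _

end Sums

section RoughSums

lemma sum_filter_dvd {E : Type*} [AddCommMonoid E] (f : ℕ → E) {d : ℕ} (hd : 0 < d) (N : ℕ) :
    ∑ n ∈ (Ioc 0 N).filter (d ∣ ·), f n = ∑ m ∈ Ioc 0 (N / d), f (d * m) := by
  refine Finset.sum_nbij' (fun n => n / d) (fun m => d * m) ?_ ?_ ?_ ?_ ?_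
  · intro n hn
    obtain ⟨h1, k, rfl⟩ := mem_filter.1 hn
    rw [mem_Ioc] at h1 ⊢
    rw [Nat.mul_div_cancel_left _ hd]
    exact ⟨Nat.pos_of_mul_pos_left h1.1, (Nat.le_div_iff_mul_le hd).2 (by rw [mul_comm]; exact h1.2)⟩
  · intro m hm
    rw [mem_Ioc] at hm
    rw [mem_filter, mem_Ioc]
    refine ⟨⟨Nat.mul_pos hd hm.1, ?_⟩, dvd_mul_right _ _⟩
    rw [mul_comm]; exact (Nat.le_div_iff_mul_le hd).1 hm.2
  · intro n hn
    exact Nat.mul_div_cancel' (mem_filter.1 hn).2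
  · intro m _
    exact Nat.mul_div_cancel_left _ hd
  · intro n hn
    rw [Nat.mul_div_cancel' (mem_filter.1 hn).2]

lemma SieveWt.norm_sum_mul_sub_le {S : ℕ → Prop} {θ : ℕ → ℝ} {m A : ℝ} (h : SieveWt S θ m A)
    {f : ℕ → ℂ} (hf : ∀ m n, f (m * n) = f m * f n) {N : ℕ} {P : ℂ} {K : ℝ}
    (hK : ∀ d, 0 < d → ‖f d * ∑ m ∈ Ioc 0 (N / d), f m - P / d‖ ≤ K) :
    ‖∑ n ∈ Ioc 0 N, (θ n : ℂ) * f n - m * P‖ ≤ A * K := by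
  obtain ⟨ι, _, a, d, h0, h1, h2, h3, h4⟩ := h
  have hK0 : 0 ≤ K := (norm_nonneg _).trans (hK 1 one_pos)
  have e : ∑ n ∈ Ioc 0 N, (θ n : ℂ) * f n - m * P
      = ∑ i, (a i : ℂ) * (f (d i) * ∑ m ∈ Ioc 0 (N / d i), f m - P / d i) := by
    rw [h3]
    push_cast
    simp only [h2, mul_sub, Finset.sum_sub_distrib, Finset.sum_mul, Complex.ofReal_sum]
    congr 1
    · rw [Finset.sum_comm]
      refine Finset.sum_congr rfl fun i _ => ?_
      have := sum_filter_dvd f (Nat.pos_of_ne_zero (h0 i)) N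
      simp only [hf, ← Finset.mul_sum] at this
      rw [← this, Finset.mul_sum, Finset.sum_filter]
      refine Finset.sum_congr rfl fun n _ => ?_
      split_ifs <;> simp
    · exact Finset.sum_congr rfl fun i _ => by ring
  rw [e]
  refine (norm_sum_le _ _).trans (le_trans (Finset.sum_le_sum fun i _ => ?_)
    ((Finset.sum_mul _ _ K).symm.le.trans (mul_le_mul_of_nonneg_right h4 hK0)))
  rw [norm_mul, Complex.norm_real, Real.norm_eq_abs]
  exact mul_le_mul_of_nonneg_left (hK _ (Nat.pos_of_ne_zero (h0 i))) (abs_nonneg _)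

lemma apIoc_one (b : ZMod 1) (M N : ℕ) : apIoc 1 b M N = Ioc M N :=
  Finset.filter_true_of_mem fun _ _ => Subsingleton.elim _ _

lemma norm_sum_sift_mul_sub_le {y : ℕ} (hy : 1 ≤ y) (s : ℕ) {f : ℕ → ℂ}
    (hf : ∀ m n, f (m * n) = f m * f n) (hf1 : ∀ n, ‖f n‖ ≤ 1) {N : ℕ} {P : ℂ} {K : ℝ}
    (hP : ‖P‖ ≤ N) (hK : ∀ d, 0 < d → ‖f d * ∑ m ∈ Ioc 0 (N / d), f m - P / d‖ ≤ K) :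
    ‖∑ n ∈ Ioc 0 N, (sift 1 y n : ℂ) * f n - vdens 1 y * P‖
      ≤ 3 * (N * vdens 1 y / 2 ^ s) + (y : ℝ) ^ (208 * (s + 3)) * (K + 2) := by
  obtain ⟨U, L, mU, mL, hU, hL, hL1, hU1, hmU, hmL⟩ := fundamental_lemma 1 y hy s
  have h1 := hU.norm_sum_mul_sub_le hf hK
  have hp1 : ∀ p, (p ≤ y ∧ ¬ p ∣ 1) → ¬ p ∣ 1 := fun p hp => hp.2
  have h2 := hU.abs_sum_sub_le one_pos hp1 0 (Nat.zero_le N)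
  have h3 := hL.abs_sum_sub_le one_pos hp1 0 (Nat.zero_le N)
  simp only [apIoc_one, Nat.cast_zero, sub_zero, Nat.cast_one, div_one] at h2 h3
  have hV := (vdens_pos 1 y).le
  have hN : (0 : ℝ) ≤ N := Nat.cast_nonneg N
  set A := (y : ℝ) ^ (208 * (s + 3)) with hA
  have e : ∑ n ∈ Ioc 0 N, (sift 1 y n : ℂ) * f n - vdens 1 y * P
      = (∑ n ∈ Ioc 0 N, (U n : ℂ) * f n - mU * P) - ∑ n ∈ Ioc 0 N, ((U n - sift 1 y n : ℝ) : ℂ) * f n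
        + ((mU - vdens 1 y : ℝ) : ℂ) * P := by
    simp only [Complex.ofReal_sub, sub_mul, Finset.sum_sub_distrib]
    ring
  have h4 : ‖∑ n ∈ Ioc 0 N, ((U n - sift 1 y n : ℝ) : ℂ) * f n‖
      ≤ ∑ n ∈ Ioc 0 N, U n - ∑ n ∈ Ioc 0 N, L n := by
    rw [← Finset.sum_sub_distrib]
    refine (norm_sum_le _ _).trans (Finset.sum_le_sum fun n _ => ?_)
    rw [norm_mul, Complex.norm_real, Real.norm_of_nonneg (sub_nonneg.2 (hU1 n))]
    have := mul_le_mul_of_nonneg_left (hf1 n) (sub_nonneg.2 (hU1 n))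
    linarith [hL1 n]
  have h5 : ‖((mU - vdens 1 y : ℝ) : ℂ) * P‖ ≤ N * vdens 1 y / 2 ^ s := by
    rw [norm_mul, Complex.norm_real, Real.norm_eq_abs]
    calc _ ≤ vdens 1 y * (1 / 2 ^ s) * N := by gcongr
      _ = _ := by ring
  have h6 := (abs_le.1 h2).2
  have h7 := (abs_le.1 h3).1
  have h8 : (N : ℝ) * mU - N * mL ≤ 2 * (N * vdens 1 y / 2 ^ s) := by
    have h9 := (abs_le.1 hmU).2
    have h10 := (abs_le.1 hmL).1
    calc (N : ℝ) * mU - N * mL = N * (mU - mL) := by ring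
      _ ≤ N * (2 * (vdens 1 y * (1 / 2 ^ s))) := by gcongr; linarith
      _ = _ := by ring
  rw [e]
  have := norm_add_le ((∑ n ∈ Ioc 0 N, (U n : ℂ) * f n - mU * P)
    - ∑ n ∈ Ioc 0 N, ((U n - sift 1 y n : ℝ) : ℂ) * f n) (((mU - vdens 1 y : ℝ) : ℂ) * P)
  have := norm_sub_le (∑ n ∈ Ioc 0 N, (U n : ℂ) * f n - mU * P)
    (∑ n ∈ Ioc 0 N, ((U n - sift 1 y n : ℝ) : ℂ) * f n)
  linarith

/-- The sum of a bounded completely multiplicative function over rough integers. -/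
lemma norm_sum_rough_sub_le {b Z : ℕ} (hb : 1 ≤ b) (hZ : 2 ≤ Z) {f : ℕ → ℂ}
    (hf : ∀ m n, f (m * n) = f m * f n) (hf1 : ∀ n, ‖f n‖ ≤ 1) {N : ℕ} {P : ℂ} {K : ℝ}
    (hP : ‖P‖ ≤ N) (hK : ∀ d, 0 < d → ‖f d * ∑ m ∈ Ioc 0 (N / d), f m - P / d‖ ≤ K)
    (hN : (Z : ℝ) ^ (4 * (832 * b)) ≤ N) (hKN : K ≤ (N : ℝ) ^ (1 / 4 : ℝ)) :
    ‖∑ n ∈ Ioc 0 N, (sift 1 (Z ^ b) n : ℂ) * f n - vdens 1 (Z ^ b) * P‖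
      ≤ 51 * ((N : ℝ) ^ (1 - 1 / (2 * (832 * b) * Real.log Z)) / Real.log Z) := by
  have hZ' : (2 : ℝ) ≤ Z := by exact_mod_cast hZ
  have hb' : (1 : ℝ) ≤ b := by exact_mod_cast hb
  set l := Real.log Z with hl
  have hl2 : 1 / 2 ≤ l := by
    have := Real.log_le_log (by norm_num) hZ'
    linarith [Real.log_two_gt_d9]
  have hlZ : l ≤ Z := (Real.log_le_sub_one_of_pos (by linarith)).trans (by linarith)
  obtain ⟨κ, hκ⟩ : ∃ κ : ℕ, κ = 832 * b := ⟨_, rfl⟩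
  have hκ' : (κ : ℝ) = 832 * b := by rw [hκ]; push_cast; rfl
  rw [← hκ] at hN
  rw [← hκ']
  have hκ1 : (832 : ℝ) ≤ κ := by rw [hκ']; linarith
  have hN1 : (2 : ℝ) ≤ N := by
    refine le_trans ?_ hN
    refine hZ'.trans (le_self_pow₀ (by linarith) (by omega))
  have hNZ : 4 * κ * l ≤ Real.log N := by
    have := Real.log_le_log (by positivity) hN
    rw [Real.log_pow] at this
    push_cast at this; linarith
  set R := Real.log N / (κ * l) with hR
  have hκl : 0 < κ * l := by positivity
  have hR4 : 4 ≤ R := by rw [hR, le_div_iff₀ hκl]; linarith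
  obtain ⟨s, hs⟩ : ∃ s : ℕ, s + 3 = ⌊R⌋₊ := by
    have : 4 ≤ ⌊R⌋₊ := Nat.le_floor (by exact_mod_cast hR4)
    exact ⟨⌊R⌋₊ - 3, by omega⟩
  have hs1 : ((s + 3 : ℕ) : ℝ) ≤ R := hs ▸ Nat.floor_le (by linarith)
  have hs2 : R ≤ s + 4 := by
    have := (Nat.lt_floor_add_one R).le
    rw [← hs] at this; push_cast at this; linarith
  have h1 := norm_sum_sift_mul_sub_le (y := Z ^ b) (Nat.one_le_pow _ _ (by omega)) s hf hf1 hP hK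
  refine h1.trans ?_
  have hA : (((Z ^ b : ℕ) : ℝ)) ^ (208 * (s + 3)) ≤ (N : ℝ) ^ (1 / 4 : ℝ) := by
    rw [← Real.log_le_log_iff (by positivity) (by positivity), Real.log_rpow (by linarith),
      Nat.cast_pow, ← pow_mul, Real.log_pow]
    have : Real.log N = R * (κ * l) := by rw [hR, div_mul_cancel₀ _ hκl.ne']
    rw [this]
    push_cast at hs1 ⊢
    have h2 : 208 * b * l * ((s : ℝ) + 3) ≤ 208 * b * l * R := by gcongr
    rw [hκ']; linarith
  have hη : 0 ≤ 1 / (2 * κ * l) ∧ 1 / (2 * κ * l) ≤ 1 / 8 := by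
    refine ⟨by positivity, ?_⟩
    gcongr
    nlinarith
  have hlN : l ≤ (N : ℝ) ^ (1 / 8 : ℝ) := by
    rw [← Real.log_le_log_iff (by linarith) (by positivity), Real.log_rpow (by linarith)]
    have : Real.log l ≤ l := (Real.log_le_sub_one_of_pos (by linarith)).trans (by linarith)
    nlinarith
  have hq1 : (1 : ℝ) ≤ (N : ℝ) ^ (1 / 4 : ℝ) := Real.one_le_rpow (by linarith) (by norm_num)
  have h3 : (N : ℝ) ^ (1 / 2 : ℝ) ≤ (N : ℝ) ^ (1 - 1 / (2 * κ * l)) / l := by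
    rw [le_div_iff₀ (by linarith)]
    calc (N : ℝ) ^ (1 / 2 : ℝ) * l ≤ (N : ℝ) ^ (1 / 2 : ℝ) * (N : ℝ) ^ (1 / 8 : ℝ) := by gcongr
      _ = (N : ℝ) ^ (5 / 8 : ℝ) := by rw [← Real.rpow_add (by linarith)]; norm_num
      _ ≤ _ := Real.rpow_le_rpow_of_exponent_le (by linarith) (by linarith)
  have h4 : (((Z ^ b : ℕ) : ℝ)) ^ (208 * (s + 3)) * (K + 2) ≤ 3 * (N : ℝ) ^ (1 / 2 : ℝ) := by
    have e : (N : ℝ) ^ (1 / 2 : ℝ) = (N : ℝ) ^ (1 / 4 : ℝ) * (N : ℝ) ^ (1 / 4 : ℝ) := by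
      rw [← Real.rpow_add (by linarith)]; norm_num
    have hK0 : 0 ≤ K := (norm_nonneg _).trans (hK 1 one_pos)
    calc _ ≤ (N : ℝ) ^ (1 / 4 : ℝ) * (3 * (N : ℝ) ^ (1 / 4 : ℝ)) := by gcongr; linarith
      _ = _ := by rw [e]; ring
  have hV : vdens 1 (Z ^ b) ≤ 1 / l := by
    refine (vdens_le_inv_log (hZ.trans (Nat.le_self_pow (by omega) _))).trans ?_
    rw [Nat.cast_pow, Real.log_pow]
    gcongr
    nlinarith
  have h5 : 1 / (2 : ℝ) ^ s ≤ 16 * (N : ℝ) ^ (-(1 / (2 * κ * l))) := by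
    have h6 : Real.exp (1 / 2) ≤ 2 := by
      rw [← Real.le_log_iff_exp_le (by norm_num)]
      linarith [Real.log_two_gt_d9]
    have h7 : (N : ℝ) ^ (1 / (2 * κ * l)) ≤ 2 ^ (s + 4) := by
      rw [Real.rpow_def_of_pos (by linarith), show Real.log N * (1 / (2 * κ * l)) = R * (1 / 2) by
        rw [hR]; field_simp]
      calc Real.exp (R * (1 / 2)) ≤ Real.exp (((s + 4 : ℕ) : ℝ) * (1 / 2)) := by
            gcongr; push_cast; exact hs2
        _ = Real.exp (1 / 2) ^ (s + 4) := Real.exp_nat_mul _ _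
        _ ≤ _ := by gcongr
    rw [Real.rpow_neg (by linarith), ← div_eq_mul_inv, div_le_div_iff₀ (by positivity) (by positivity),
      one_mul]
    calc _ ≤ _ := h7
      _ = _ := by ring
  have h8 : N * vdens 1 (Z ^ b) / 2 ^ s ≤ 16 * ((N : ℝ) ^ (1 - 1 / (2 * κ * l)) / l) := by
    calc N * vdens 1 (Z ^ b) / 2 ^ s = N * (vdens 1 (Z ^ b) * (1 / 2 ^ s)) := by ring
      _ ≤ N * (1 / l * (16 * (N : ℝ) ^ (-(1 / (2 * κ * l))))) := by gcongr
      _ = 16 * ((N : ℝ) ^ (1 : ℝ) * (N : ℝ) ^ (-(1 / (2 * κ * l))) / l) := by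
          rw [Real.rpow_one]; ring
      _ = _ := by rw [← Real.rpow_add (by linarith)]; rfl
  linarith

end RoughSums

section Twist

/-- The twist `n^{-it}`. -/
noncomputable def tw (t : ℝ) (n : ℕ) : ℂ := (n : ℂ) ^ (-((t : ℂ) * Complex.I))

lemma tw_mul (t : ℝ) (m n : ℕ) : tw t (m * n) = tw t m * tw t n := by
  unfold tw
  rw [Nat.cast_mul, Complex.natCast_mul_natCast_cpow]

lemma norm_tw {t : ℝ} {n : ℕ} (hn : 0 < n) : ‖tw t n‖ = 1 := by
  unfold tw
  rw [Complex.norm_natCast_cpow_of_pos hn]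
  simp

lemma norm_tw_le (t : ℝ) (n : ℕ) : ‖tw t n‖ ≤ 1 := by
  rcases Nat.eq_zero_or_pos n with rfl | hn
  · unfold tw
    rcases eq_or_ne (-((t : ℂ) * Complex.I)) 0 with h | h
    · rw [h]; simp
    · rw [Nat.cast_zero, Complex.zero_cpow h]; simp
  · exact (norm_tw hn).le

lemma norm_cpow_sub_cpow_le (t : ℝ) {u v : ℝ} (hu : 0 < u) (hv : 0 < v) :
    ‖(u : ℂ) ^ (-((t : ℂ) * Complex.I)) - (v : ℂ) ^ (-((t : ℂ) * Complex.I))‖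
      ≤ |t| * |Real.log u - Real.log v| := by
  have e : ∀ w : ℝ, 0 < w → (w : ℂ) ^ (-((t : ℂ) * Complex.I))
      = Complex.exp (Complex.I * ((-(t * Real.log w) : ℝ) : ℂ)) := fun w hw => by
    rw [Complex.cpow_def_of_ne_zero (by exact_mod_cast hw.ne'), ← Complex.ofReal_log hw.le]
    congr 1; push_cast; ring
  have e2 : Complex.exp (Complex.I * ((-(t * Real.log u) : ℝ) : ℂ))
      = Complex.exp (Complex.I * ((-(t * Real.log v) : ℝ) : ℂ))
        * Complex.exp (Complex.I * ((-(t * (Real.log u - Real.log v)) : ℝ) : ℂ)) := by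
    rw [← Complex.exp_add]; congr 1; push_cast; ring
  rw [e u hu, e v hv, e2, ← mul_sub_one, norm_mul, mul_comm Complex.I, Complex.norm_exp_ofReal_mul_I,
    one_mul]
  refine (Real.norm_exp_I_mul_ofReal_sub_one_le).trans ?_
  rw [Real.norm_eq_abs, abs_neg, abs_mul]

lemma log_succ_sub_log_le {n : ℕ} (hn : 0 < n) : Real.log (n + 1 : ℝ) - Real.log n ≤ 1 / n := by
  have hn' : (0 : ℝ) < n := by exact_mod_cast hn
  rw [← Real.log_div (by linarith) hn'.ne']
  refine (Real.log_le_sub_one_of_pos (by positivity)).trans ?_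
  rw [add_div, div_self hn'.ne']; linarith

lemma norm_tw_sub_succ_le (t : ℝ) {n : ℕ} (hn : 0 < n) :
    ‖tw t n - tw t (n + 1)‖ ≤ |t| * (1 / n) := by
  have hn' : (0 : ℝ) < n := by exact_mod_cast hn
  have h := norm_cpow_sub_cpow_le t hn' (show (0 : ℝ) < n + 1 by linarith)
  have h2 := Real.log_le_log hn' (show (n : ℝ) ≤ n + 1 by linarith)
  rw [abs_sub_comm (Real.log n), abs_of_nonneg (sub_nonneg.2 h2)] at h
  unfold tw
  push_cast at h ⊢
  exact h.trans (mul_le_mul_of_nonneg_left (log_succ_sub_log_le hn) (abs_nonneg t))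

lemma norm_sum_mul_le_of_bounded {c w : ℕ → ℂ} {B : ℝ} (hc : ∀ m, ‖∑ n ∈ Ioc 0 m, c n‖ ≤ B) (M : ℕ) :
    ‖∑ n ∈ Ioc 0 M, c n * w n‖ ≤ B * (‖w (M + 1)‖ + ∑ n ∈ Ioc 0 M, ‖w n - w (n + 1)‖) := by
  have key : ∑ n ∈ Ioc 0 M, c n * w n = (∑ n ∈ Ioc 0 M, c n) * w (M + 1)
      + ∑ m ∈ Ioc 0 M, (∑ n ∈ Ioc 0 m, c n) * (w m - w (m + 1)) := by
    induction M with
    | zero => simp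
    | succ M ih =>
      rw [Finset.sum_Ioc_succ_top (Nat.zero_le _), ih, Finset.sum_Ioc_succ_top (Nat.zero_le _),
        Finset.sum_Ioc_succ_top (Nat.zero_le _), Finset.sum_Ioc_succ_top (Nat.zero_le M) c]
      ring
  rw [key, mul_add, Finset.mul_sum]
  refine (norm_add_le _ _).trans (add_le_add ?_ ((norm_sum_le _ _).trans
    (Finset.sum_le_sum fun m _ => ?_)))
  · rw [norm_mul]; gcongr; exact hc _
  · rw [norm_mul]; gcongr; exact hc _

lemma norm_sum_char_le {q : ℕ} (hq : 0 < q) {χ : DirichletCharacter ℂ q} (hχ : χ ≠ 1) (M : ℕ) :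
    ‖∑ n ∈ Ioc 0 M, χ (n : ZMod q)‖ ≤ q := by
  have : NeZero q := ⟨hq.ne'⟩
  have e : ∑ n ∈ Ioc 0 M, χ (n : ZMod q) = ∑ b : ZMod q, (#(apIoc q b 0 M) : ℂ) * χ b := by
    rw [← Finset.sum_fiberwise_of_maps_to (s := Ioc 0 M) (t := Finset.univ)
      (g := fun n : ℕ => (n : ZMod q)) (fun _ _ => Finset.mem_univ _)]
    refine Finset.sum_congr rfl fun b _ => ?_
    rw [Finset.sum_congr rfl (g := fun _ => χ b) fun n hn => by rw [(mem_filter.1 hn).2],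
      Finset.sum_const, nsmul_eq_mul]
  have h0 : ∑ b : ZMod q, ((M : ℂ) / q) * χ b = 0 := by
    rw [← Finset.mul_sum, MulChar.sum_eq_zero_of_ne_one hχ, mul_zero]
  rw [e, ← sub_zero (∑ b : ZMod q, _), ← h0, ← Finset.sum_sub_distrib]
  refine (norm_sum_le _ _).trans ((Finset.sum_le_card_nsmul _ _ 1 fun b _ => ?_).trans ?_)
  · rw [← sub_mul, norm_mul]
    refine mul_le_one₀ ?_ (norm_nonneg _) (DirichletCharacter.norm_le_one χ b)
    have := abs_card_dvd_sub_le hq one_pos (Nat.coprime_one_right q) b (Nat.zero_le M)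
    simp only [one_dvd, Finset.filter_true, Nat.cast_one, div_one, Nat.cast_zero, sub_zero] at this
    rw [show ((#(apIoc q b 0 M) : ℂ) - (M : ℂ) / q) = (((#(apIoc q b 0 M) : ℝ) - (M : ℝ) / q : ℝ) : ℂ) by
      push_cast; rfl, Complex.norm_real]
    exact this
  · simp [ZMod.card]

lemma norm_sum_char_tw_le {q : ℕ} (hq : 0 < q) {χ : DirichletCharacter ℂ q} (hχ : χ ≠ 1) (t : ℝ)
    (M : ℕ) : ‖∑ n ∈ Ioc 0 M, χ (n : ZMod q) * tw t n‖ ≤ q * (1 + |t| * (1 + Real.log M)) := by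
  refine (norm_sum_mul_le_of_bounded (norm_sum_char_le hq hχ) M).trans ?_
  gcongr
  · exact norm_tw_le _ _
  · calc _ ≤ ∑ n ∈ Ioc 0 M, |t| * ((1 : ℝ) / n) :=
          Finset.sum_le_sum fun n hn => norm_tw_sub_succ_le t (mem_Ioc.1 hn).1
      _ ≤ _ := by rw [← Finset.mul_sum]; gcongr; exact sum_inv_le M

/-- The antiderivative `v^{1-it}/(1-it)`. -/
noncomputable def twInt (t v : ℝ) : ℂ := (v : ℂ) ^ (1 - (t : ℂ) * Complex.I) / (1 - (t : ℂ) * Complex.I)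

lemma one_le_norm_one_sub (t : ℝ) : 1 ≤ ‖(1 : ℂ) - (t : ℂ) * Complex.I‖ := by
  have := Complex.abs_re_le_norm ((1 : ℂ) - (t : ℂ) * Complex.I)
  simpa using this

lemma one_sub_ne_zero' (t : ℝ) : (1 : ℂ) - (t : ℂ) * Complex.I ≠ 0 := by
  rw [← norm_pos_iff]; linarith [one_le_norm_one_sub t]

lemma norm_twInt_le (t : ℝ) {v : ℝ} (hv : 0 ≤ v) : ‖twInt t v‖ ≤ v := by
  unfold twInt
  rw [norm_div]
  have h : ‖(v : ℂ) ^ (1 - (t : ℂ) * Complex.I)‖ = v := by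
    rcases hv.eq_or_lt with rfl | hv
    · rw [Complex.ofReal_zero, Complex.zero_cpow (one_sub_ne_zero' t), norm_zero]
    · rw [Complex.norm_cpow_eq_rpow_re_of_pos hv]; simp
  rw [h]
  exact div_le_self hv (one_le_norm_one_sub t)

lemma hasDerivAt_twInt (t : ℝ) {v : ℝ} (hv : 0 < v) :
    HasDerivAt (twInt t) ((v : ℂ) ^ (-((t : ℂ) * Complex.I))) v := by
  unfold twInt
  have h := hasDerivAt_ofReal_cpow_const' (r := -((t : ℂ) * Complex.I)) hv.ne' (fun h => by
    have := congrArg Complex.re h; simp at this)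
  rw [show -((t : ℂ) * Complex.I) + 1 = 1 - (t : ℂ) * Complex.I by ring] at h
  exact h

lemma norm_twInt_sub_le (t : ℝ) {u v : ℝ} (hu : 0 < u) (huv : u ≤ v) :
    ‖twInt t v - twInt t u‖ ≤ v - u := by
  have := norm_image_sub_le_of_norm_deriv_le_segment' (f := twInt t) (a := u) (b := v) (C := 1)
    (fun x hx => (hasDerivAt_twInt t (hu.trans_le hx.1)).hasDerivWithinAt)
    (fun x hx => by
      rw [Complex.norm_cpow_eq_rpow_re_of_pos (hu.trans_le hx.1)]; simp) v ⟨huv, le_rfl⟩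
  linarith

lemma norm_twInt_succ_sub_le (t : ℝ) {n : ℕ} (hn : 0 < n) :
    ‖tw t (n + 1) - (twInt t (n + 1 : ℕ) - twInt t n)‖ ≤ |t| * (1 / n) := by
  have hn' : (0 : ℝ) < n := by exact_mod_cast hn
  set w := tw t (n + 1) with hw
  have h := norm_image_sub_le_of_norm_deriv_le_segment' (f := fun v => twInt t v - v * w)
    (a := n) (b := (n + 1 : ℕ)) (C := |t| * (1 / n))
    (f' := fun v => (v : ℂ) ^ (-((t : ℂ) * Complex.I)) - w)
    (fun x hx => by
      have h1 := hasDerivAt_twInt t (hn'.trans_le hx.1)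
      have h2 : HasDerivAt (fun v : ℝ => (v : ℂ) * w) w x := by
        simpa using (Complex.ofRealCLM.hasDerivAt (x := x)).mul_const w
      exact (h1.sub h2).hasDerivWithinAt)
    (fun x hx => by
      have hx0 := hn'.trans_le hx.1
      have hx1 : x < (n : ℝ) + 1 := by have := hx.2; push_cast at this; exact this
      have h1 := norm_cpow_sub_cpow_le t hx0 (show (0 : ℝ) < n + 1 by linarith)
      rw [hw, tw]
      push_cast at h1 ⊢
      refine h1.trans (mul_le_mul_of_nonneg_left ?_ (abs_nonneg t))
      have h2 := Real.log_le_log hx0 hx1.le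
      have h3 := Real.log_le_log hn' hx.1
      rw [abs_sub_comm, abs_of_nonneg (by linarith)]
      linarith [log_succ_sub_log_le hn]) _ ⟨by push_cast; linarith, le_rfl⟩
  rw [show ((n + 1 : ℕ) : ℝ) - n = 1 by push_cast; ring, mul_one] at h
  refine le_trans (le_of_eq ?_) h
  rw [← norm_neg]
  congr 1
  push_cast
  ring

lemma norm_sum_tw_sub_le (t : ℝ) (M : ℕ) :
    ‖∑ n ∈ Ioc 0 M, tw t n - twInt t M‖ ≤ 2 + 2 * |t| * (1 + Real.log M) := by
  have key : ∀ M : ℕ, 1 ≤ M → ‖∑ n ∈ Ioc 0 M, tw t n - twInt t M‖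
      ≤ 2 + 2 * |t| * ∑ n ∈ Ioc 0 M, (1 : ℝ) / n := by
    intro M hM
    induction M, hM using Nat.le_induction with
    | base =>
      have h1 : ‖tw t 1‖ ≤ 1 := norm_tw_le t 1
      have h2 := norm_twInt_le t (show (0 : ℝ) ≤ (1 : ℕ) by norm_num)
      rw [show Ioc 0 1 = {1} from rfl, Finset.sum_singleton, Finset.sum_singleton]
      refine (norm_sub_le _ _).trans ?_
      push_cast at h2 ⊢
      have := abs_nonneg t
      linarith
    | succ M hM ih =>
      rw [Finset.sum_Ioc_succ_top (Nat.zero_le _), Finset.sum_Ioc_succ_top (Nat.zero_le _)]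
      have h1 := norm_twInt_succ_sub_le t hM
      have hM' : (0 : ℝ) < M := by exact_mod_cast hM
      have h2 : (1 : ℝ) / M ≤ 2 * (1 / (M + 1 : ℕ)) := by
        have : (1 : ℝ) ≤ M := by exact_mod_cast hM
        rw [mul_one_div, div_le_div_iff₀ hM' (by positivity)]
        push_cast; linarith
      have h3 := mul_le_mul_of_nonneg_left h2 (abs_nonneg t)
      have e : ∑ n ∈ Ioc 0 M, tw t n + tw t (M + 1) - twInt t (M + 1 : ℕ)
          = (∑ n ∈ Ioc 0 M, tw t n - twInt t M)
            + (tw t (M + 1) - (twInt t (M + 1 : ℕ) - twInt t M)) := by ring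
      rw [e]
      refine (norm_add_le _ _).trans ?_
      linarith
  rcases Nat.eq_zero_or_pos M with rfl | hM
  · have := norm_twInt_le t (le_refl (0 : ℝ))
    have h2 := abs_nonneg t
    simp
    linarith
  · refine (key M hM).trans ?_
    gcongr
    exact sum_inv_le M

end Twist

section RoughL

lemma sift_anti {y y' : ℕ} (h : y ≤ y') (n : ℕ) : sift 1 y' n ≤ sift 1 y n := by
  rcases sift_eq_zero_or_one 1 y' n with h0 | h1
  · rw [h0]; exact sift_nonneg _ _ _
  · rw [h1, sift_one_eq_one_iff.2]
    exact fun p hp hpn => h.trans_lt (sift_one_eq_one_iff.1 h1 p hp hpn)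

lemma half_le_log {Z : ℕ} (hZ : 2 ≤ Z) : 1 / 2 ≤ Real.log Z := by
  have := Real.log_le_log (by norm_num) (show (2 : ℝ) ≤ Z by exact_mod_cast hZ)
  linarith [Real.log_two_gt_d9]

lemma eq_one_of_sift {y n : ℕ} (h : sift 1 y n = 1) (hn : n ≤ y) (hn0 : 0 < n) : n = 1 := by
  by_contra hc
  have h1 := sift_one_eq_one_iff.1 h _ (Nat.minFac_prime hc) (Nat.minFac_dvd n)
  have := Nat.minFac_le hn0
  omega

lemma sum_sift_le_one {y N : ℕ} (hN : N ≤ y) : ∑ n ∈ Ioc 0 N, sift 1 y n ≤ 1 := by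
  have : ∑ n ∈ Ioc 0 N, sift 1 y n ≤ ∑ n ∈ Ioc 0 N, if n = 1 then (1 : ℝ) else 0 := by
    refine Finset.sum_le_sum fun n hn => ?_
    rw [mem_Ioc] at hn
    rcases sift_eq_zero_or_one 1 y n with h | h
    · rw [h]; split_ifs <;> norm_num
    · rw [if_pos (eq_one_of_sift h (hn.2.trans hN) hn.1)]; exact sift_le_one _ _ _
  refine this.trans ?_
  rw [Finset.sum_ite_eq']
  split_ifs <;> norm_num

lemma sum_rough_le {b Z : ℕ} (hb : 625 ≤ b) (hZ : 2 ≤ Z) (N : ℕ) :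
    ∑ n ∈ Ioc 0 N, sift 1 (Z ^ b) n ≤ 1 + 3 / Real.log Z * N := by
  have hl := half_le_log hZ
  have h0 : 0 ≤ 3 / Real.log Z * N := by positivity
  rcases le_total N (Z ^ b) with h | h
  · linarith [sum_sift_le_one h]
  · have hpow : Z ^ 625 ≤ N := (Nat.pow_le_pow_right (by omega) hb).trans h
    have h1 := sum_sift_le (q := 1) one_pos (b := 0) (Subsingleton.elim (1 : ZMod 1) 0 ▸ isUnit_one)
      hZ (Nat.zero_le N) (by
        have : (Z : ℝ) ^ 625 ≤ N := by exact_mod_cast hpow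
        simpa using this)
    simp only [apIoc_one, Nat.cast_zero, sub_zero, Nat.totient_one, Nat.cast_one, one_mul] at h1
    have h2 : ∑ n ∈ Ioc 0 N, sift 1 (Z ^ b) n ≤ ∑ n ∈ Ioc 0 N, sift 1 Z n :=
      Finset.sum_le_sum fun n _ => sift_anti (Nat.le_self_pow (by omega) _) n
    calc _ ≤ _ := h2.trans h1
      _ = 3 / Real.log Z * N := by ring
      _ ≤ _ := by linarith

lemma rpow_neg_succ_le {δ : ℝ} (hδ : 0 ≤ δ) {n : ℕ} (hn : 0 < n) :
    ((n + 1 : ℕ) : ℝ) ^ (-1 - δ) ≤ (n : ℝ) ^ (-1 - δ) :=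
  Real.rpow_le_rpow_of_nonpos (by exact_mod_cast hn) (by push_cast; linarith) (by linarith)

lemma sum_rough_mul_rpow_le {b Z : ℕ} (hb : 625 ≤ b) (hZ : 2 ≤ Z) {δ : ℝ} (hδ : 0 ≤ δ) (N : ℕ) :
    ∑ n ∈ Ioc 0 N, sift 1 (Z ^ b) n * (n : ℝ) ^ (-1 - δ)
      ≤ 1 + 3 / Real.log Z * ∑ n ∈ Ioc 0 N, (n : ℝ) ^ (-1 - δ) := by
  have h := sum_mul_antitone_le (c := sift 1 (Z ^ b)) (β := fun _ => 3 / Real.log Z)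
    (φ := fun n : ℕ => (n : ℝ) ^ (-1 - δ)) (β₀ := 1) (Nat.zero_le N) (fun n => sift_nonneg _ _ n)
    (fun n hn _ => rpow_neg_succ_le hδ hn) (fun n _ => by positivity) (fun m _ _ => by
      simpa [mul_comm] using sum_rough_le hb hZ m) zero_le_one
  rw [Finset.mul_sum]
  simpa using h

lemma sum_rpow_le_log {δ : ℝ} (hδ : 0 ≤ δ) (N : ℕ) :
    ∑ n ∈ Ioc 0 N, (n : ℝ) ^ (-1 - δ) ≤ 1 + Real.log N := by
  refine le_trans (Finset.sum_le_sum fun n hn => ?_) (sum_inv_le N)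
  have hn1 : (1 : ℝ) ≤ n := by exact_mod_cast (mem_Ioc.1 hn).1
  calc (n : ℝ) ^ (-1 - δ) ≤ (n : ℝ) ^ (-1 : ℝ) :=
        Real.rpow_le_rpow_of_exponent_le hn1 (by linarith)
    _ = 1 / n := by rw [Real.rpow_neg_one, one_div]

/-- The initial segment of a weighted sum over rough numbers. -/
lemma sum_rough_logWt_le {b Z : ℕ} (hb : 625 ≤ b) (hZ : 2 ≤ Z) {δ : ℝ} (hδ : 0 ≤ δ) (k B : ℕ)
    {N : ℕ} (hN : N ≤ Z ^ B) :
    ∑ n ∈ Ioc 0 N, sift 1 (Z ^ b) n * logWt k δ n ≤ (7 + 3 * B) * B ^ k * Real.log Z ^ k := by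
  have hl := half_le_log hZ
  set l := Real.log Z with hldef
  have hlog : ∀ n ∈ Ioc 0 N, Real.log n ≤ B * l := fun n hn => by
    rw [hldef, ← Real.log_pow]
    refine Real.log_le_log (by exact_mod_cast (mem_Ioc.1 hn).1) ?_
    exact_mod_cast (mem_Ioc.1 hn).2.trans hN
  have h1 : ∑ n ∈ Ioc 0 N, sift 1 (Z ^ b) n * logWt k δ n
      ≤ (B * l) ^ k * ∑ n ∈ Ioc 0 N, sift 1 (Z ^ b) n * (n : ℝ) ^ (-1 - δ) := by
    rw [Finset.mul_sum]
    refine Finset.sum_le_sum fun n hn => ?_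
    have h2 := pow_le_pow_left₀ (Real.log_natCast_nonneg n) (hlog n hn) k
    have h3 : 0 ≤ sift 1 (Z ^ b) n * (n : ℝ) ^ (-1 - δ) :=
      mul_nonneg (sift_nonneg _ _ _) (by positivity)
    calc _ = Real.log n ^ k * (sift 1 (Z ^ b) n * (n : ℝ) ^ (-1 - δ)) := by unfold logWt; ring
      _ ≤ _ := by gcongr
  have hlogN : Real.log N ≤ B * l := by
    rcases Nat.eq_zero_or_pos N with rfl | hN0
    · simp; positivity
    · exact hlog N (mem_Ioc.2 ⟨hN0, le_rfl⟩)
  have h2 := sum_rough_mul_rpow_le hb hZ hδ N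
  have h3 : 3 / l * ∑ n ∈ Ioc 0 N, (n : ℝ) ^ (-1 - δ) ≤ 6 + 3 * B := by
    calc _ ≤ 3 / l * (1 + B * l) := by gcongr; linarith [sum_rpow_le_log hδ N]
      _ = 3 / l + 3 * B := by field_simp
      _ ≤ 6 + 3 * B := by
        gcongr
        rw [div_le_iff₀ (by linarith)]; linarith
  calc _ ≤ _ := h1
    _ ≤ (B * l) ^ k * (7 + 3 * B) := by gcongr; linarith
    _ = _ := by rw [mul_pow]; ring

lemma logWt_le {k : ℕ} {δ : ℝ} (hδ : 0 ≤ δ) {n : ℕ} (hn : 0 < n) :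
    logWt k δ n ≤ Real.log n ^ k / n := by
  have hn1 : (1 : ℝ) ≤ n := by exact_mod_cast hn
  unfold logWt
  rw [div_eq_mul_inv, ← Real.rpow_neg_one]
  exact mul_le_mul_of_nonneg_left (Real.rpow_le_rpow_of_exponent_le hn1 (by linarith))
    (pow_nonneg (Real.log_natCast_nonneg n) k)

/-- A tail estimate for sequences with a power saving `N^{-1/(2κ log Z)}` in their partial sums. -/
lemma exists_tail_bound (κ : ℕ) (hκ : 1 ≤ κ) : ∃ C : ℝ, 0 < C ∧ ∀ (Z : ℕ), 2 ≤ Z → ∀ (M₀ : ℕ),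
    27 ≤ M₀ → M₀ ≤ Z ^ (4 * κ) → ∀ (a : ℕ → ℂ) (A : ℝ), 0 ≤ A →
    (∀ N, M₀ ≤ N → ‖∑ n ∈ Ioc 0 N, a n‖ ≤ A * ((N : ℝ) ^ (1 - 1 / (2 * κ * Real.log Z)) / Real.log Z)) →
    ∀ k ≤ 3, ∀ δ : ℝ, 0 ≤ δ → ∀ N, M₀ ≤ N →
      ‖∑ n ∈ Ioc M₀ N, a n * logWt k δ n‖ ≤ C * A * Real.log Z ^ k := by
  refine ⟨4 * (8 * κ) ^ 3 + 3 * 2 ^ 3 * 6 * (2 * κ) ^ 4, by positivity, ?_⟩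
  intro Z hZ M₀ hM27 hM₀ a A hA ha k hk δ hδ N hN
  have hl := half_le_log hZ
  have hκ' : (1 : ℝ) ≤ κ := by exact_mod_cast hκ
  set l := Real.log Z with hldef
  set η := 1 / (2 * κ * l) with hη
  have hη0 : 0 < η := by positivity
  have hη1 : η ≤ 1 := by
    rw [hη, div_le_one (by positivity)]; nlinarith
  have hM1 : (1 : ℝ) ≤ M₀ := by exact_mod_cast (by omega : 1 ≤ M₀)
  have hpart : ∀ m : ℕ, 1 ≤ m → (m : ℝ) ^ (1 - η) ≤ ∑ n ∈ Ioc 0 m, (n : ℝ) ^ (-η) := by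
    intro m hm
    have hm' : (0 : ℝ) < m := by exact_mod_cast hm
    calc (m : ℝ) ^ (1 - η) = ∑ n ∈ Ioc 0 m, (m : ℝ) ^ (-η) := by
          rw [Finset.sum_const, Nat.card_Ioc, nsmul_eq_mul, Nat.sub_zero, sub_eq_add_neg,
            Real.rpow_add hm', Real.rpow_one]
      _ ≤ _ := Finset.sum_le_sum fun n hn => by
          have := mem_Ioc.1 hn
          exact Real.rpow_le_rpow_of_nonpos (by exact_mod_cast this.1) (by exact_mod_cast this.2)
            (by linarith)
  have hhead : ∑ n ∈ Ioc 0 M₀, (n : ℝ) ^ (-η) ≤ M₀ := by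
    calc _ ≤ ∑ n ∈ Ioc 0 M₀, (1 : ℝ) := Finset.sum_le_sum fun n hn =>
          Real.rpow_le_one_of_one_le_of_nonpos (by exact_mod_cast (mem_Ioc.1 hn).1) (by linarith)
      _ = M₀ := by simp
  have hM2 : (M₀ : ℝ) ^ (1 - η) ≤ M₀ := (hpart M₀ (by omega)).trans hhead
  have h := norm_sum_mul_antitone_le' (c := a) (β := fun n => A / l * (n : ℝ) ^ (-η))
    (φ := logWt k δ) (β₀ := A / l * (2 * M₀)) hN (fun n hn _ => logWt_succ_le hk hδ (by omega))
    (fun n _ => logWt_nonneg _ _ _) (fun m hm1 hm2 => by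
      have h1 := ha m hm1.le
      have h2 := ha M₀ le_rfl
      have h3 : ∑ n ∈ Ioc M₀ m, a n = ∑ n ∈ Ioc 0 m, a n - ∑ n ∈ Ioc 0 M₀, a n := by
        rw [eq_sub_iff_add_eq, add_comm, Finset.sum_Ioc_consecutive _ (Nat.zero_le _) hm1.le]
      have h4 := Finset.sum_Ioc_consecutive (fun n : ℕ => (n : ℝ) ^ (-η)) (Nat.zero_le M₀) hm1.le
      have h5 := hpart m (by omega)
      rw [h3, ← Finset.mul_sum]
      refine (norm_sub_le _ _).trans ((add_le_add h1 h2).trans ?_)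
      calc A * ((m : ℝ) ^ (1 - η) / l) + A * ((M₀ : ℝ) ^ (1 - η) / l)
          = A / l * ((m : ℝ) ^ (1 - η) + (M₀ : ℝ) ^ (1 - η)) := by ring
        _ ≤ A / l * (2 * M₀ + ∑ n ∈ Ioc M₀ m, (n : ℝ) ^ (-η)) := by
            refine mul_le_mul_of_nonneg_left ?_ (by positivity)
            have h6 := hpart M₀ (by omega)
            linarith
        _ = _ := by ring) (by positivity)
  refine h.trans ?_
  have hlog1 : Real.log (M₀ + 1 : ℕ) ≤ 8 * κ * l := by
    have h1 : M₀ + 1 ≤ Z ^ (8 * κ) := by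
      calc M₀ + 1 ≤ M₀ ^ 2 := by nlinarith
        _ ≤ (Z ^ (4 * κ)) ^ 2 := Nat.pow_le_pow_left hM₀ 2
        _ = _ := by rw [← pow_mul]; congr 1; ring
    have h2 : ((M₀ + 1 : ℕ) : ℝ) ≤ (Z : ℝ) ^ (8 * κ) := by exact_mod_cast h1
    have := Real.log_le_log (by positivity) h2
    rw [Real.log_pow] at this
    push_cast at this ⊢
    exact this
  have hB1 : A / l * (2 * M₀) * logWt k δ (M₀ + 1) ≤ 4 * (8 * κ) ^ 3 * A * l ^ k := by
    have h1 : logWt k δ (M₀ + 1) ≤ (8 * κ * l) ^ k / M₀ := by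
      refine (logWt_le hδ (Nat.succ_pos _)).trans ?_
      have := pow_le_pow_left₀ (Real.log_natCast_nonneg (M₀ + 1)) hlog1 k
      gcongr
      omega
    have hl2 : 1 / l ≤ 2 := by rw [div_le_iff₀ (by linarith)]; linarith
    calc A / l * (2 * M₀) * logWt k δ (M₀ + 1) ≤ A / l * (2 * M₀) * ((8 * κ * l) ^ k / M₀) := by gcongr
      _ = 2 * (1 / l) * (8 * κ) ^ k * A * l ^ k := by rw [mul_pow]; field_simp
      _ ≤ 2 * 2 * (8 * κ) ^ 3 * A * l ^ k := by gcongr; linarith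
      _ = _ := by ring
  have hB2 : ∑ n ∈ Ioc M₀ N, A / l * (n : ℝ) ^ (-η) * logWt k δ n
      ≤ 3 * 2 ^ 3 * 6 * (2 * κ) ^ 4 * A * l ^ k := by
    have h1 : ∑ n ∈ Ioc M₀ N, A / l * (n : ℝ) ^ (-η) * logWt k δ n
        ≤ A / l * ∑ n ∈ Ioc 0 N, Real.log n ^ k * (n : ℝ) ^ (-1 - η) := by
      rw [Finset.mul_sum]
      refine (Finset.sum_le_sum fun n hn => ?_).trans
        (Finset.sum_le_sum_of_subset_of_nonneg (Finset.Ioc_subset_Ioc_left (Nat.zero_le _))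
          fun n _ _ => by have := Real.log_natCast_nonneg n; positivity)
      have hn1 : (1 : ℝ) ≤ n := by exact_mod_cast (show 1 ≤ n by have := (mem_Ioc.1 hn).1; omega)
      rw [mul_assoc]
      refine mul_le_mul_of_nonneg_left ?_ (by positivity)
      unfold logWt
      rw [mul_left_comm, ← Real.rpow_add (by linarith)]
      refine mul_le_mul_of_nonneg_left ?_ (pow_nonneg (Real.log_natCast_nonneg n) k)
      exact Real.rpow_le_rpow_of_exponent_le hn1 (by linarith)
    have hk6 : (k.factorial : ℝ) ≤ 6 := by
      have : k.factorial ≤ Nat.factorial 3 := Nat.factorial_le hk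
      exact_mod_cast this
    calc _ ≤ _ := h1
      _ ≤ A / l * (3 * 2 ^ k * k.factorial / η ^ (k + 1)) := by
          gcongr; exact sum_log_pow_rpow_le hη0 hη1 k N
      _ = 3 * 2 ^ k * k.factorial * (2 * κ) ^ (k + 1) * A * l ^ k := by
          rw [hη, div_pow, one_pow, mul_pow, pow_succ l]; field_simp
      _ ≤ 3 * 2 ^ 3 * 6 * (2 * κ) ^ 4 * A * l ^ k := by
          gcongr
          · norm_num
          · linarith
          · omega
  linarith

end RoughL

section RoughTwists

lemma vdens_le_one (q y : ℕ) : vdens q y ≤ 1 :=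
  Finset.prod_le_one
    (fun _ hp => (prime_factor_pos (Nat.mem_primesLE.1 (mem_filter.1 hp).1).2).le)
    fun p _ => prime_factor_le_one p

lemma twist_error_le {Z κ N : ℕ} (hZ : 2 ≤ Z) (hκ : 36 ≤ κ) (hN : (Z : ℝ) ^ (4 * κ) ≤ N) {t : ℝ}
    (ht : |t| ≤ (Z : ℝ) ^ 12) :
    Z * (3 + 2 * |t| * (1 + Real.log N)) ≤ (N : ℝ) ^ (1 / 4 : ℝ) := by
  have hZ' : (2 : ℝ) ≤ Z := by exact_mod_cast hZ
  have hN144 : (Z : ℝ) ^ 144 ≤ N :=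
    (pow_le_pow_right₀ (by linarith) (by omega)).trans hN
  have hN1 : (1 : ℝ) ≤ N := (one_le_pow₀ (by linarith)).trans hN144
  set u := (N : ℝ) ^ (1 / 8 : ℝ) with hu
  have hu1 : 1 ≤ u := Real.one_le_rpow hN1 (by norm_num)
  have hlog : Real.log N ≤ 8 * u := by
    have := Real.log_le_rpow_div (by linarith : (0 : ℝ) ≤ N) (show (0 : ℝ) < 1 / 8 by norm_num)
    rw [← hu] at this; linarith
  have hu2 : (N : ℝ) ^ (1 / 4 : ℝ) = u * u := by
    rw [hu, ← Real.rpow_add (by linarith)]; norm_num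
  have hZu : (Z : ℝ) ^ 18 ≤ u := by
    have := Real.rpow_le_rpow (by positivity) hN144 (show (0 : ℝ) ≤ 1 / 8 by norm_num)
    rw [← hu, ← Real.rpow_natCast, ← Real.rpow_mul (by linarith)] at this
    norm_num at this
    exact_mod_cast this
  have hZ12 : (1 : ℝ) ≤ (Z : ℝ) ^ 12 := one_le_pow₀ (by linarith)
  have h5 : (21 : ℝ) ≤ (Z : ℝ) ^ 5 := by
    have := pow_le_pow_left₀ (by norm_num) hZ' 5
    linarith
  rw [hu2]
  calc Z * (3 + 2 * |t| * (1 + Real.log N))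
      ≤ Z * (3 * ((Z : ℝ) ^ 12 * u) + 2 * (Z : ℝ) ^ 12 * (u + 8 * u)) := by
        gcongr
        nlinarith
    _ = 21 * ((Z : ℝ) ^ 13 * u) := by ring
    _ ≤ (Z : ℝ) ^ 5 * ((Z : ℝ) ^ 13 * u) := by gcongr
    _ = (Z : ℝ) ^ 18 * u := by ring
    _ ≤ u * u := by gcongr

lemma log_div_le_log (d N : ℕ) : Real.log (N / d : ℕ) ≤ Real.log N := by
  rcases Nat.eq_zero_or_pos (N / d) with h | h
  · rw [h]; simpa using Real.log_natCast_nonneg N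
  · exact Real.log_le_log (by exact_mod_cast h) (by exact_mod_cast Nat.div_le_self N d)

/-- Weighted sums of a nonprincipal character over rough integers, twisted by `n^{-it}`. -/
lemma exists_rough_char_bound (b : ℕ) (hb : 625 ≤ b) : ∃ C : ℝ, 0 < C ∧ ∀ Z : ℕ, 2 ≤ Z →
    ∀ q : ℕ, 0 < q → q ≤ Z → ∀ χ : DirichletCharacter ℂ q, χ ≠ 1 → ∀ t : ℝ, |t| ≤ (Z : ℝ) ^ 12 →
    ∀ k ≤ 3, ∀ δ : ℝ, 0 ≤ δ → ∀ N : ℕ,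
      ‖∑ n ∈ Ioc 0 N, (sift 1 (Z ^ b) n : ℂ) * (χ (n : ZMod q) * tw t n) * logWt k δ n‖
        ≤ C * Real.log Z ^ k := by
  obtain ⟨κ, hκ⟩ : ∃ κ : ℕ, κ = 832 * b := ⟨_, rfl⟩
  have hκ' : (κ : ℝ) = 832 * b := by rw [hκ]; push_cast; rfl
  obtain ⟨C, hC, htail⟩ := exists_tail_bound κ (by omega)
  refine ⟨(7 + 3 * (4 * κ : ℕ)) * (1 + (4 * κ : ℕ) ^ 3) + C * 51, by positivity, ?_⟩
  intro Z hZ q hq hqZ χ hχ t ht k hk δ hδ N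
  have hl := half_le_log hZ
  set a : ℕ → ℂ := fun n => (sift 1 (Z ^ b) n : ℂ) * (χ (n : ZMod q) * tw t n) with ha
  have hcoef : ∀ n, ‖a n‖ ≤ sift 1 (Z ^ b) n := fun n => by
    rw [ha, norm_mul, Complex.norm_real, Real.norm_eq_abs, abs_of_nonneg (sift_nonneg _ _ _), norm_mul]
    have h1 := χ.norm_le_one (n : ZMod q)
    exact mul_le_of_le_one_right (sift_nonneg _ _ _)
      (mul_le_one₀ h1 (norm_nonneg _) (norm_tw_le t n))
  have hhead : ∀ N, N ≤ Z ^ (4 * κ) → ‖∑ n ∈ Ioc 0 N, a n * logWt k δ n‖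
      ≤ (7 + 3 * (4 * κ : ℕ)) * (1 + (4 * κ : ℕ) ^ 3) * Real.log Z ^ k := fun N hN => by
    refine (norm_sum_le _ _).trans ((Finset.sum_le_sum fun n _ => ?_).trans
      ((sum_rough_logWt_le hb hZ hδ k (4 * κ) hN).trans ?_))
    · rw [norm_mul, Complex.norm_real, Real.norm_eq_abs, abs_of_nonneg (logWt_nonneg k δ n)]
      exact mul_le_mul_of_nonneg_right (hcoef n) (logWt_nonneg k δ n)
    · gcongr
      have h1 : (1 : ℝ) ≤ (4 * κ : ℕ) := by exact_mod_cast (by omega : 1 ≤ 4 * κ)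
      have := pow_le_pow_right₀ h1 hk
      linarith
  rcases le_total N (Z ^ (4 * κ)) with hN | hN
  · refine (hhead N hN).trans ?_
    gcongr
    linarith [mul_pos hC (show (0 : ℝ) < 51 by norm_num)]
  · have hN' : ∀ N : ℕ, Z ^ (4 * κ) ≤ N → (Z : ℝ) ^ (4 * κ) ≤ N := fun N h => by exact_mod_cast h
    have h27 : 27 ≤ Z ^ (4 * κ) := by
      calc 27 ≤ 2 ^ 5 := by norm_num
        _ ≤ Z ^ 5 := Nat.pow_le_pow_left hZ 5
        _ ≤ Z ^ (4 * κ) := Nat.pow_le_pow_right (by omega) (by omega)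
    have h1 := htail Z hZ (Z ^ (4 * κ)) h27 le_rfl a 51 (by norm_num) (fun N hN => by
      have h2 := norm_sum_rough_sub_le (b := b) (Z := Z) (f := fun n => χ (n : ZMod q) * tw t n)
        (N := N) (P := 0) (K := Z * (3 + 2 * |t| * (1 + Real.log N))) (by omega) hZ
        (fun m n => by simp only [Nat.cast_mul, map_mul, tw_mul]; ring)
        (fun n => by
          rw [norm_mul]
          exact mul_le_one₀ (χ.norm_le_one _) (norm_nonneg _) (norm_tw_le t n))
        (by simp) (fun d hd => by
          rw [zero_div, sub_zero, norm_mul, norm_mul]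
          have h3 := norm_sum_char_tw_le hq hχ t (N / d)
          have h4 := log_div_le_log d N
          have h5 : (q : ℝ) ≤ Z := by exact_mod_cast hqZ
          have h6 := Real.log_natCast_nonneg N
          have h7 := Real.log_natCast_nonneg (N / d)
          have h8 : ‖χ (d : ZMod q)‖ * ‖tw t d‖ ≤ 1 :=
            mul_le_one₀ (χ.norm_le_one _) (norm_nonneg _) (norm_tw_le t d)
          calc _ ≤ 1 * (q * (1 + |t| * (1 + Real.log (N / d : ℕ)))) := by gcongr
            _ ≤ 1 * (Z * (3 + 2 * |t| * (1 + Real.log N))) := by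
              have h9 : |t| * (1 + Real.log (N / d : ℕ)) ≤ |t| * (1 + Real.log N) := by gcongr
              have h10 : 0 ≤ |t| * (1 + Real.log N) := by positivity
              rw [one_mul, one_mul]
              exact mul_le_mul h5 (by linarith) (by positivity) (by positivity)
            _ = _ := one_mul _)
        (by rw [← hκ]; exact hN' N hN)
        (twist_error_le hZ (κ := κ) (by omega) (hN' N hN) ht)
      rw [mul_zero, sub_zero] at h2
      rw [hκ']
      exact h2) k hk δ hδ N hN
    rw [← Finset.sum_Ioc_consecutive _ (Nat.zero_le _) hN]
    refine (norm_add_le _ _).trans ?_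
    rw [add_mul]
    exact add_le_add (hhead _ le_rfl) h1

lemma tw_mul_twInt (t : ℝ) {d : ℕ} (hd : 0 < d) {v : ℝ} (hv : 0 ≤ v) :
    twInt t v / d = tw t d * twInt t (v / d) := by
  have hd' : (0 : ℝ) < d := by exact_mod_cast hd
  have hdc : (d : ℂ) ≠ 0 := by exact_mod_cast hd.ne'
  have h1 : (v : ℂ) ^ (1 - (t : ℂ) * Complex.I)
      = (d : ℂ) ^ (1 - (t : ℂ) * Complex.I) * ((v / d : ℝ) : ℂ) ^ (1 - (t : ℂ) * Complex.I) := by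
    rw [← Complex.ofReal_natCast, ← Complex.mul_cpow_ofReal_nonneg hd'.le (by positivity)]
    congr 1
    rw [← Complex.ofReal_mul]; congr 1; field_simp
  have h2 : (d : ℂ) ^ (1 - (t : ℂ) * Complex.I) = d * tw t d := by
    unfold tw
    rw [sub_eq_add_neg, Complex.cpow_add _ _ hdc, Complex.cpow_one]
  unfold twInt
  rw [h1, h2]
  field_simp

lemma norm_tw_mul_sum_sub_le (t : ℝ) {d : ℕ} (hd : 0 < d) (N : ℕ) :
    ‖tw t d * ∑ m ∈ Ioc 0 (N / d), tw t m - twInt t N / d‖ ≤ 3 + 2 * |t| * (1 + Real.log N) := by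
  have hd' : (0 : ℝ) < d := by exact_mod_cast hd
  have hlog := Real.log_natCast_nonneg N
  rw [tw_mul_twInt t hd (Nat.cast_nonneg N), ← mul_sub, norm_mul, norm_tw hd, one_mul]
  have h1 := norm_sum_tw_sub_le t (N / d)
  have h2 : ‖twInt t (N / d : ℕ) - twInt t ((N : ℝ) / d)‖ ≤ 1 := by
    have hlt : (N : ℝ) / d < (N / d : ℕ) + 1 := by
      rw [div_lt_iff₀ hd']
      exact_mod_cast (Nat.lt_mul_of_div_lt (Nat.lt_succ_self _) hd)
    have hle : ((N / d : ℕ) : ℝ) ≤ N / d := Nat.cast_div_le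
    rcases Nat.eq_zero_or_pos (N / d) with h0 | h0
    · rw [h0] at hlt ⊢
      have hz : twInt t ((0 : ℕ) : ℝ) = 0 := norm_le_zero_iff.1
        ((norm_twInt_le t (by simp)).trans (by simp))
      rw [hz, zero_sub, norm_neg]
      refine (norm_twInt_le t (by positivity)).trans ?_
      simpa using hlt.le
    · rw [norm_sub_rev]
      refine (norm_twInt_sub_le t (by exact_mod_cast h0) hle).trans (by linarith)
  have h3 := log_div_le_log d N
  have h4 : 2 * |t| * (1 + Real.log (N / d : ℕ)) ≤ 2 * |t| * (1 + Real.log N) := by gcongr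
  calc _ = ‖(∑ m ∈ Ioc 0 (N / d), tw t m - twInt t (N / d : ℕ))
        + (twInt t (N / d : ℕ) - twInt t ((N : ℝ) / d))‖ := by congr 1; ring
    _ ≤ _ := (norm_add_le _ _).trans (by linarith)

/-- The comparison of the rough indicator with its density, twisted by `n^{-it}`. -/
lemma exists_rough_tw_bound (b : ℕ) (hb : 625 ≤ b) : ∃ C : ℝ, 0 < C ∧ ∀ Z : ℕ, 2 ≤ Z →
    ∀ t : ℝ, |t| ≤ (Z : ℝ) ^ 12 → ∀ M₀ : ℕ, M₀ = Z ^ (4 * (832 * b)) → ∀ δ : ℝ, 0 ≤ δ →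
    ∀ N : ℕ, M₀ ≤ N →
      ‖∑ n ∈ Ioc M₀ N, ((sift 1 (Z ^ b) n - vdens 1 (Z ^ b) : ℝ) : ℂ) * tw t n * logWt 0 δ n‖ ≤ C := by
  obtain ⟨κ, hκ⟩ : ∃ κ : ℕ, κ = 832 * b := ⟨_, rfl⟩
  have hκ' : (κ : ℝ) = 832 * b := by rw [hκ]; push_cast; rfl
  obtain ⟨C, hC, htail⟩ := exists_tail_bound κ (by omega)
  refine ⟨C * 55, by positivity, ?_⟩
  intro Z hZ t ht M₀ hM₀ δ hδ N hN
  have hl := half_le_log hZ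
  have hZ' : (2 : ℝ) ≤ Z := by exact_mod_cast hZ
  rw [← hκ] at hM₀
  have h27 : 27 ≤ M₀ := by
    calc 27 ≤ 2 ^ 5 := by norm_num
      _ ≤ Z ^ 5 := Nat.pow_le_pow_left hZ 5
      _ ≤ M₀ := hM₀ ▸ Nat.pow_le_pow_right (by omega) (by omega)
  have h1 := htail Z hZ M₀ h27 hM₀.le
    (fun n => ((sift 1 (Z ^ b) n - vdens 1 (Z ^ b) : ℝ) : ℂ) * tw t n) 55 (by norm_num)
    (fun N hN => by
      have hN' : (Z : ℝ) ^ (4 * κ) ≤ N := by rw [hM₀] at hN; exact_mod_cast hN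
      have hN1 : (1 : ℝ) ≤ N := (one_le_pow₀ (by linarith)).trans hN'
      have herr := twist_error_le hZ (κ := κ) (by omega) hN' ht
      have hlog := Real.log_natCast_nonneg N
      have herr' : 3 + 2 * |t| * (1 + Real.log N) ≤ (N : ℝ) ^ (1 / 4 : ℝ) := by
        refine le_trans ?_ herr
        exact le_mul_of_one_le_left (by positivity) (by linarith)
      have h2 := norm_sum_rough_sub_le (b := b) (Z := Z) (f := tw t) (by omega) hZ
        (tw_mul t) (norm_tw_le t) (norm_twInt_le t (Nat.cast_nonneg N))
        (fun d hd => norm_tw_mul_sum_sub_le t hd N) (by rw [← hκ]; exact hN') herr'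
      have h3 := norm_sum_tw_sub_le t N
      rw [hκ']
      rw [← hκ'] at h2 ⊢
      set η := 1 / (2 * (κ : ℝ) * Real.log Z) with hη
      have hη1 : η ≤ 1 / 2 := by
        have : (36 : ℝ) ≤ κ := by exact_mod_cast (by omega : 36 ≤ κ)
        rw [hη]
        apply one_div_le_one_div_of_le (by norm_num)
        nlinarith
      have hlN : Real.log Z ≤ 4 * (N : ℝ) ^ (1 / 4 : ℝ) := by
        have h4 := Real.log_le_rpow_div (by linarith : (0 : ℝ) ≤ N) (show (0 : ℝ) < 1 / 4 by norm_num)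
        have h5 : Real.log Z ≤ Real.log N := Real.log_le_log (by linarith)
          ((le_self_pow₀ (by linarith) (by omega)).trans hN')
        linarith
      have h6 : (N : ℝ) ^ (1 / 4 : ℝ) ≤ 4 * ((N : ℝ) ^ (1 - η) / Real.log Z) := by
        rw [mul_div_assoc', le_div_iff₀ (by linarith)]
        have h7 : (N : ℝ) ^ (1 / 4 : ℝ) * (N : ℝ) ^ (1 / 4 : ℝ) ≤ (N : ℝ) ^ (1 - η) := by
          rw [← Real.rpow_add (by linarith)]
          exact Real.rpow_le_rpow_of_exponent_le hN1 (by linarith)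
        nlinarith [Real.rpow_nonneg (by linarith : (0 : ℝ) ≤ N) (1 / 4)]
      have hV1 : vdens 1 (Z ^ b) ≤ 1 := vdens_le_one 1 (Z ^ b)
      have hV0 := (vdens_pos 1 (Z ^ b)).le
      have e : ∑ n ∈ Ioc 0 N, ((sift 1 (Z ^ b) n - vdens 1 (Z ^ b) : ℝ) : ℂ) * tw t n
          = (∑ n ∈ Ioc 0 N, (sift 1 (Z ^ b) n : ℂ) * tw t n - vdens 1 (Z ^ b) * twInt t N)
            - vdens 1 (Z ^ b) * (∑ n ∈ Ioc 0 N, tw t n - twInt t N) := by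
        simp only [Complex.ofReal_sub, sub_mul, Finset.sum_sub_distrib, Finset.mul_sum, mul_sub]
        ring
      rw [e]
      refine (norm_sub_le _ _).trans ?_
      have h8 : ‖(vdens 1 (Z ^ b) : ℂ) * (∑ n ∈ Ioc 0 N, tw t n - twInt t N)‖
          ≤ (N : ℝ) ^ (1 / 4 : ℝ) := by
        rw [norm_mul, Complex.norm_real, Real.norm_eq_abs, abs_of_nonneg hV0]
        have := mul_le_mul hV1 h3 (norm_nonneg _) zero_le_one
        linarith
      linarith) 0 (by norm_num) δ hδ N hN
  simpa using h1

end RoughTwists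

section ZetaSums

/-- An antiderivative of `log^k v · v^{-1-w}`. -/
noncomputable def zInt (w : ℂ) : ℕ → ℝ → ℂ
  | 0, v => -(v : ℂ) ^ (-w) / w
  | k + 1, v => -(Real.log v : ℂ) ^ (k + 1) * (v : ℂ) ^ (-w) / w + (k + 1) / w * zInt w k v

lemma hasDerivAt_cpow_neg (w : ℂ) {v : ℝ} (hv : 0 < v) :
    HasDerivAt (fun u : ℝ => (u : ℂ) ^ (-w)) (-w * (v : ℂ) ^ (-1 - w)) v := by
  have h := ((hasDerivAt_id (v : ℂ)).cpow_const (c := -w) (by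
    simpa using Complex.ofReal_mem_slitPlane.2 hv)).comp_ofReal
  simp only [id, mul_one] at h
  rwa [show -w - 1 = -1 - w by ring] at h

lemma hasDerivAt_ofReal_log {v : ℝ} (hv : 0 < v) :
    HasDerivAt (fun u : ℝ => (Real.log u : ℂ)) ((v : ℂ)⁻¹) v := by
  have := (Real.hasDerivAt_log hv.ne').ofReal_comp
  simpa using this

lemma cpow_neg_one_sub (w : ℂ) {v : ℝ} (hv : 0 < v) :
    (v : ℂ) ^ (-1 - w) = (v : ℂ)⁻¹ * (v : ℂ) ^ (-w) := by
  rw [sub_eq_add_neg, Complex.cpow_add _ _ (by exact_mod_cast hv.ne'), Complex.cpow_neg_one]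

lemma hasDerivAt_zInt {w : ℂ} (hw : w ≠ 0) (k : ℕ) {v : ℝ} (hv : 0 < v) :
    HasDerivAt (zInt w k) ((Real.log v : ℂ) ^ k * (v : ℂ) ^ (-1 - w)) v := by
  induction k with
  | zero =>
    have h := ((hasDerivAt_cpow_neg w hv).neg).div_const w
    refine h.congr_deriv ?_
    field_simp
  | succ k ih =>
    have h1 := (((hasDerivAt_ofReal_log hv).pow (k + 1)).neg.mul (hasDerivAt_cpow_neg w hv)).div_const w
    have h := h1.add (ih.const_mul ((k + 1) / w))
    refine h.congr_deriv ?_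
    simp only [Nat.add_sub_cancel, cpow_neg_one_sub w hv, Pi.neg_apply, Pi.pow_apply]
    have hv' : (v : ℂ) ≠ 0 := by exact_mod_cast hv.ne'
    push_cast
    field_simp
    ring

lemma norm_zInt_le {w : ℂ} {ρ : ℝ} (hρ : 0 < ρ) (hρ1 : ρ ≤ 1) (hw : ρ ≤ ‖w‖) (k : ℕ) {v : ℝ}
    (hv : 1 ≤ v) : ‖zInt w k v‖
      ≤ (k + 1).factorial * (1 + Real.log v) ^ k * v ^ (-w.re) / ρ ^ (k + 1) := by
  have hlog := Real.log_nonneg hv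
  have hn : ‖(v : ℂ) ^ (-w)‖ = v ^ (-w.re) := by
    rw [Complex.norm_cpow_eq_rpow_re_of_pos (by linarith), Complex.neg_re]
  have hp : 0 < v ^ (-w.re) := by positivity
  induction k with
  | zero =>
    simp only [zInt, norm_div, norm_neg, hn]
    simp only [zero_add, Nat.factorial_one, Nat.cast_one, pow_zero, one_mul, pow_one]
    gcongr
  | succ k ih =>
    simp only [zInt]
    have h1 : ‖-(Real.log v : ℂ) ^ (k + 1) * (v : ℂ) ^ (-w) / w‖
        ≤ (1 + Real.log v) ^ (k + 1) * v ^ (-w.re) / ρ ^ (k + 2) := by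
      rw [norm_div, norm_mul, norm_neg, norm_pow, hn, Complex.norm_real, Real.norm_eq_abs,
        abs_of_nonneg hlog]
      have : ρ ^ (k + 2) ≤ ‖w‖ := le_trans (pow_le_of_le_one hρ.le hρ1 (by omega)) hw
      gcongr
      linarith
    have h2 : ‖((k : ℂ) + 1) / w * zInt w k v‖
        ≤ (k + 1) / ρ * ((k + 1).factorial * (1 + Real.log v) ^ (k + 1) * v ^ (-w.re) / ρ ^ (k + 1)) := by
      rw [norm_mul, norm_div]
      have h3 : ‖(k : ℂ) + 1‖ = k + 1 := by
        rw [← Nat.cast_succ, Complex.norm_natCast]; push_cast; rfl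
      rw [h3]
      gcongr
      refine ih.trans ?_
      gcongr
      · linarith
      · omega
    refine (norm_add_le _ _).trans ((add_le_add h1 h2).trans ?_)
    have h4 : (1 : ℝ) ≤ (k + 1).factorial := by exact_mod_cast Nat.factorial_pos _
    have h5 : ((k + 1 + 1).factorial : ℝ) = (k + 2) * (k + 1).factorial := by
      rw [Nat.factorial_succ]; push_cast; ring
    rw [h5]
    have e : (1 + Real.log v) ^ (k + 1) * v ^ (-w.re) / ρ ^ (k + 2)
        + (k + 1) / ρ * ((k + 1).factorial * (1 + Real.log v) ^ (k + 1) * v ^ (-w.re) / ρ ^ (k + 1))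
        = (1 + (k + 1) * (k + 1).factorial) * ((1 + Real.log v) ^ (k + 1) * v ^ (-w.re) / ρ ^ (k + 2)) := by
      field_simp
      ring
    rw [e]
    calc _ ≤ ((k + 2) * (k + 1).factorial) * ((1 + Real.log v) ^ (k + 1) * v ^ (-w.re) / ρ ^ (k + 2)) := by
          gcongr; linarith
      _ = _ := by ring

lemma hasDerivAt_log_pow_cpow (w : ℂ) (k : ℕ) {v : ℝ} (hv : 0 < v) :
    HasDerivAt (fun u : ℝ => (Real.log u : ℂ) ^ k * (u : ℂ) ^ (-1 - w))
      (k * (Real.log v : ℂ) ^ (k - 1) * (v : ℂ)⁻¹ * (v : ℂ) ^ (-1 - w)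
        - (1 + w) * (Real.log v : ℂ) ^ k * ((v : ℂ)⁻¹ * (v : ℂ) ^ (-1 - w))) v := by
  have h1 := hasDerivAt_cpow_neg (1 + w) hv
  have h := ((hasDerivAt_ofReal_log hv).pow k).mul h1
  rw [cpow_neg_one_sub (1 + w) hv] at h
  simp only [neg_add'] at h
  refine h.congr_deriv ?_
  simp only [Pi.pow_apply]
  ring

lemma norm_step_le {w : ℂ} (hw : w ≠ 0) (hre : 0 ≤ w.re) (k : ℕ) {n : ℕ} (hn : 1 ≤ n) :
    ‖(Real.log (n + 1 : ℕ) : ℂ) ^ k * ((n + 1 : ℕ) : ℂ) ^ (-1 - w)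
      - (zInt w k (n + 1 : ℕ) - zInt w k n)‖
      ≤ (k + 1 + ‖w‖) * (1 + Real.log (n + 1 : ℕ)) ^ k / (n : ℝ) ^ 2 := by
  have hn' : (1 : ℝ) ≤ n := by exact_mod_cast hn
  set B := (k + 1 + ‖w‖) * (1 + Real.log (n + 1 : ℕ)) ^ k / (n : ℝ) ^ 2 with hB
  set φ : ℝ → ℂ := fun u => (Real.log u : ℂ) ^ k * (u : ℂ) ^ (-1 - w) with hφ
  have hle : (n : ℝ) ≤ (n + 1 : ℕ) := by push_cast; linarith
  have hd : ∀ v : ℝ, n ≤ v → v ≤ (n + 1 : ℕ) → ‖(k * (Real.log v : ℂ) ^ (k - 1) * (v : ℂ)⁻¹ * (v : ℂ) ^ (-1 - w)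
        - (1 + w) * (Real.log v : ℂ) ^ k * ((v : ℂ)⁻¹ * (v : ℂ) ^ (-1 - w)))‖ ≤ B := by
    intro v hv1 hv2
    have hv : 1 ≤ v := hn'.trans hv1
    have hlog := Real.log_nonneg hv
    have hlog2 : Real.log v ≤ Real.log (n + 1 : ℕ) := Real.log_le_log (by linarith) hv2
    set P := (1 + Real.log (n + 1 : ℕ)) ^ k with hP
    have hinv : ‖(v : ℂ)⁻¹ * (v : ℂ) ^ (-1 - w)‖ ≤ 1 / (n : ℝ) ^ 2 := by
      rw [norm_mul, norm_inv, Complex.norm_real, Real.norm_eq_abs, abs_of_pos (by linarith),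
        Complex.norm_cpow_eq_rpow_re_of_pos (by linarith)]
      have h1 : v ^ (-1 - w).re ≤ v⁻¹ := by
        rw [← Real.rpow_neg_one]
        exact Real.rpow_le_rpow_of_exponent_le hv (by simp [hre])
      calc v⁻¹ * v ^ (-1 - w).re ≤ (n : ℝ)⁻¹ * (n : ℝ)⁻¹ := by
            have h2 : v⁻¹ ≤ (n : ℝ)⁻¹ := inv_anti₀ (by linarith) hv1
            have h3 := h1.trans h2
            gcongr
        _ = _ := by rw [one_div, pow_two, mul_inv]
    have e : (k * (Real.log v : ℂ) ^ (k - 1) * (v : ℂ)⁻¹ * (v : ℂ) ^ (-1 - w)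
        - (1 + w) * (Real.log v : ℂ) ^ k * ((v : ℂ)⁻¹ * (v : ℂ) ^ (-1 - w)))
        = (k * (Real.log v : ℂ) ^ (k - 1) - (1 + w) * (Real.log v : ℂ) ^ k)
          * ((v : ℂ)⁻¹ * (v : ℂ) ^ (-1 - w)) := by ring
    rw [e, norm_mul, hB, div_eq_mul_one_div]
    gcongr
    have hpow1 : Real.log v ^ (k - 1) ≤ P := by
      calc Real.log v ^ (k - 1) ≤ (1 + Real.log (n + 1 : ℕ)) ^ (k - 1) := by gcongr; linarith
        _ ≤ P := pow_le_pow_right₀ (by linarith) (by omega)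
    have hpow2 : Real.log v ^ k ≤ P := by rw [hP]; gcongr; linarith
    refine (norm_sub_le _ _).trans ?_
    simp only [norm_mul, norm_pow, Complex.norm_real, Real.norm_eq_abs, abs_of_nonneg hlog,
      Complex.norm_natCast]
    have h1w : ‖1 + w‖ ≤ 1 + ‖w‖ := (norm_add_le _ _).trans (by simp)
    calc _ ≤ k * P + (1 + ‖w‖) * P := by gcongr
      _ = _ := by ring
  have hB0 : 0 ≤ B := (norm_nonneg _).trans (hd n le_rfl hle)
  have hφb : ∀ v : ℝ, n ≤ v → v ≤ (n + 1 : ℕ) → ‖φ v - φ (n + 1 : ℕ)‖ ≤ B := by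
    intro v hv1 hv2
    rw [norm_sub_rev]
    have := norm_image_sub_le_of_norm_deriv_le_segment' (f := φ) (a := v) (b := (n + 1 : ℕ)) (C := B)
      (fun x hx => (hasDerivAt_log_pow_cpow w k
        (show 0 < x by linarith [hx.1])).hasDerivWithinAt)
      (fun x hx => hd x (hv1.trans hx.1) hx.2.le) _ ⟨hv2, le_rfl⟩
    refine this.trans (mul_le_of_le_one_right hB0 ?_)
    push_cast; linarith
  have h := norm_image_sub_le_of_norm_deriv_le_segment' (f := fun v : ℝ => zInt w k v - v * φ (n + 1 : ℕ))
    (a := n) (b := (n + 1 : ℕ)) (C := B)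
    (fun x hx => by
      have hx0 : 0 < x := by linarith [hx.1]
      have h1 := (hasDerivAt_zInt hw k hx0).sub
        (((hasDerivAt_id x).ofReal_comp).mul_const (φ (n + 1 : ℕ)))
      exact h1.hasDerivWithinAt)
    (fun x hx => by
      simp only [Complex.ofReal_one, one_mul]
      exact hφb x hx.1 hx.2.le) _ ⟨hle, le_rfl⟩
  have e : (Real.log (n + 1 : ℕ) : ℂ) ^ k * ((n + 1 : ℕ) : ℂ) ^ (-1 - w)
      - (zInt w k (n + 1 : ℕ) - zInt w k n)
      = -((zInt w k (n + 1 : ℕ) - (((n + 1 : ℕ) : ℝ) : ℂ) * φ (n + 1 : ℕ)) - (zInt w k n - ((n : ℝ) : ℂ) * φ (n + 1 : ℕ))) := by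
    rw [hφ]; push_cast; ring
  rw [e, norm_neg]
  refine h.trans ?_
  push_cast; linarith

lemma one_add_log_pow_le {k : ℕ} (hk : k ≤ 3) {n : ℕ} (hn : 1 ≤ n) :
    (1 + Real.log (n + 1 : ℕ)) ^ k ≤ 512 * (n : ℝ) ^ (1 / 2 : ℝ) := by
  have hn' : (1 : ℝ) ≤ n := by exact_mod_cast hn
  have h1 := log_succ_sub_log_le hn
  have h2 : (1 : ℝ) / n ≤ 1 := by rw [div_le_one (by linarith)]; exact hn'
  have h3 := Real.log_le_rpow_div (by linarith : (0 : ℝ) ≤ n) (show (0 : ℝ) < 1 / 6 by norm_num)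
  set u := (n : ℝ) ^ (1 / 6 : ℝ) with hu
  have hu1 : 1 ≤ u := Real.one_le_rpow hn' (by norm_num)
  have h4 : 1 + Real.log (n + 1 : ℕ) ≤ 8 * u := by push_cast; linarith
  have h5 : 0 ≤ Real.log (n + 1 : ℕ) := Real.log_natCast_nonneg _
  calc (1 + Real.log (n + 1 : ℕ)) ^ k ≤ (1 + Real.log (n + 1 : ℕ)) ^ 3 :=
        pow_le_pow_right₀ (by linarith) hk
    _ ≤ (8 * u) ^ 3 := by gcongr
    _ = 512 * u ^ 3 := by ring
    _ = _ := by rw [hu, ← Real.rpow_natCast, ← Real.rpow_mul (by linarith)]; norm_num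

lemma logWt_mul_tw (k : ℕ) (δ t : ℝ) {n : ℕ} (hn : 0 < n) :
    (logWt k δ n : ℂ) * tw t n = (Real.log n : ℂ) ^ k * (n : ℂ) ^ (-1 - ((δ : ℂ) + t * Complex.I)) := by
  unfold logWt tw
  rw [show (-1 - ((δ : ℂ) + t * Complex.I)) = ((-1 - δ : ℝ) : ℂ) + -(t * Complex.I) by push_cast; ring,
    Complex.cpow_add _ _ (by exact_mod_cast hn.ne'), Complex.ofReal_mul, Complex.ofReal_pow,
    Complex.ofReal_cpow (Nat.cast_nonneg n)]
  push_cast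
  ring

lemma norm_sum_logWt_tw_sub_le {k : ℕ} (hk : k ≤ 3) {δ t : ℝ} (hδ : 0 ≤ δ) (ht : t ≠ 0) {M N : ℕ}
    (hM : 2 ≤ M) (hMN : M ≤ N) :
    ‖∑ n ∈ Ioc M N, (logWt k δ n : ℂ) * tw t n
      - (zInt (δ + t * Complex.I) k N - zInt (δ + t * Complex.I) k M)‖
      ≤ 2048 * (4 + δ + |t|) * (M : ℝ) ^ (-(1 / 2) : ℝ) := by
  set w : ℂ := δ + t * Complex.I with hw
  have hw0 : w ≠ 0 := fun h => ht (by simpa [hw] using congrArg Complex.im h)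
  have hre : w.re = δ := by simp [hw]
  have hnw : ‖w‖ ≤ δ + |t| := by
    refine (norm_add_le _ _).trans ?_
    simp [abs_of_nonneg hδ]
  have hM' : (2 : ℝ) ≤ M := by exact_mod_cast hM
  have hpos : 0 ≤ 512 * (4 + δ + |t|) := by positivity
  have key : ‖∑ n ∈ Ioc M N, (logWt k δ n : ℂ) * tw t n - (zInt w k N - zInt w k M)‖
      ≤ 512 * (4 + δ + |t|) * (2 * (((M : ℝ) - 1) ^ (-(1 / 2) : ℝ) - ((N : ℝ) - 1) ^ (-(1 / 2) : ℝ))) := by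
    induction N, hMN using Nat.le_induction with
    | base => simp
    | succ n hn ih =>
      have hn1 : 1 ≤ n := by omega
      have hn' : (2 : ℝ) ≤ n := by exact_mod_cast (hM.trans hn)
      have h1 := norm_step_le hw0 (by rw [hre]; exact hδ) k hn1
      have h2 := one_add_log_pow_le hk hn1
      have h3 := rpow_neg_one_sub_le (η := 1 / 2) (by norm_num) (n := n) (by omega)
      have h4 : (k + 1 + ‖w‖) * (1 + Real.log (n + 1 : ℕ)) ^ k / (n : ℝ) ^ 2
          ≤ 512 * (4 + δ + |t|) * (n : ℝ) ^ (-1 - 1 / 2 : ℝ) := by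
        have hk' : (k : ℝ) ≤ 3 := by exact_mod_cast hk
        have e : (n : ℝ) ^ (-1 - 1 / 2 : ℝ) = (n : ℝ) ^ (1 / 2 : ℝ) / (n : ℝ) ^ 2 := by
          rw [← Real.rpow_natCast, ← Real.rpow_sub (by linarith)]; norm_num
        have h5 := Real.log_natCast_nonneg (n + 1)
        rw [e]
        calc _ ≤ (4 + δ + |t|) * (512 * (n : ℝ) ^ (1 / 2 : ℝ)) / (n : ℝ) ^ 2 := by
              have h8 : k + 1 + ‖w‖ ≤ 4 + δ + |t| := by linarith
              gcongr
          _ = _ := by ring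
      rw [Finset.sum_Ioc_succ_top hn, logWt_mul_tw k δ t n.succ_pos]
      have e : ∑ n ∈ Ioc M n, (logWt k δ n : ℂ) * tw t n
          + (Real.log (n + 1 : ℕ) : ℂ) ^ k * ((n + 1 : ℕ) : ℂ) ^ (-1 - w) - (zInt w k (n + 1 : ℕ) - zInt w k M)
          = (∑ n ∈ Ioc M n, (logWt k δ n : ℂ) * tw t n - (zInt w k n - zInt w k M))
            + ((Real.log (n + 1 : ℕ) : ℂ) ^ k * ((n + 1 : ℕ) : ℂ) ^ (-1 - w)
              - (zInt w k (n + 1 : ℕ) - zInt w k n)) := by ring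
      rw [e]
      refine (norm_add_le _ _).trans ((add_le_add ih (h1.trans h4)).trans ?_)
      have h6 : (n : ℝ) ^ (-1 - 1 / 2 : ℝ)
          ≤ 2 * (((n : ℝ) - 1) ^ (-(1 / 2) : ℝ) - (n : ℝ) ^ (-(1 / 2) : ℝ)) := by
        refine h3.trans (le_of_eq ?_)
        ring
      have h7 := mul_le_mul_of_nonneg_left h6 hpos
      have e2 : (((n + 1 : ℕ) : ℝ) - 1) = n := by push_cast; ring
      rw [e2]
      linarith
  refine key.trans ?_
  have h1 : ((M : ℝ) - 1) ^ (-(1 / 2) : ℝ) ≤ 2 * (M : ℝ) ^ (-(1 / 2) : ℝ) := by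
    have h2 : ((M : ℝ) - 1) ^ (-(1 / 2) : ℝ) ≤ ((M : ℝ) / 4) ^ (-(1 / 2) : ℝ) :=
      Real.rpow_le_rpow_of_nonpos (by linarith) (by linarith) (by norm_num)
    refine h2.trans (le_of_eq ?_)
    have h4 : (4 : ℝ) ^ (-(1 / 2) : ℝ) = 1 / 2 := by
      rw [show (4 : ℝ) = 2 ^ (2 : ℝ) by norm_num, ← Real.rpow_mul (by norm_num)]
      norm_num [Real.rpow_neg_one]
    rw [Real.div_rpow (by linarith) (by norm_num), h4]
    ring
  have hN1 : 0 ≤ ((N : ℝ) - 1) ^ (-(1 / 2) : ℝ) := by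
    have : (2 : ℝ) ≤ N := by exact_mod_cast hM.trans hMN
    exact Real.rpow_nonneg (by linarith) _
  calc _ ≤ 512 * (4 + δ + |t|) * (2 * (2 * (M : ℝ) ^ (-(1 / 2) : ℝ))) := by gcongr; linarith
    _ = _ := by ring

end ZetaSums

section RoughSeries

/-- The character `χ` restricted to integers without prime factors `≤ y`. -/
noncomputable def rchar (y : ℕ) {q : ℕ} (χ : DirichletCharacter ℂ q) :
    DirichletCharacter ℂ (q * primorial y) :=
  DirichletCharacter.changeLevel (Nat.dvd_mul_right q (primorial y)) χ

lemma sift_eq_one_iff_coprime (y n : ℕ) : sift 1 y n = 1 ↔ Nat.Coprime n (primorial y) := by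
  rw [sift_one_eq_one_iff]
  constructor
  · intro h
    refine Nat.Coprime.symm (Nat.coprime_of_dvd fun p hp h1 h2 => ?_)
    exact absurd (h p hp h2) (not_lt.2 ((hp.dvd_primorial_iff).1 h1))
  · intro h p hp hpn
    by_contra hc
    exact Nat.not_coprime_of_dvd_of_dvd hp.one_lt hpn (hp.dvd_primorial_iff.2 (not_lt.1 hc)) h

lemma rchar_apply (y : ℕ) {q : ℕ} (χ : DirichletCharacter ℂ q) (n : ℕ) :
    rchar y χ (n : ZMod (q * primorial y)) = (sift 1 y n : ℂ) * χ (n : ZMod q) := by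
  by_cases h : Nat.Coprime n (q * primorial y)
  · have h2 := (sift_eq_one_iff_coprime y n).2 (Nat.Coprime.coprime_mul_left_right h)
    have h3 : (ZMod.unitOfCoprime n h : ZMod (q * primorial y)) = n := rfl
    rw [h2, ← h3, rchar, DirichletCharacter.changeLevel_eq_cast_of_dvd, h3,
      ZMod.cast_natCast (Nat.dvd_mul_right q _)]
    simp
  · rw [MulChar.map_nonunit _ (by rwa [ZMod.isUnit_iff_coprime])]
    rcases sift_eq_zero_or_one 1 y n with h1 | h1
    · simp [h1]
    · rw [sift_eq_one_iff_coprime] at h1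
      have h2 : ¬ Nat.Coprime n q := fun h2 => h (Nat.Coprime.mul_right h2 h1)
      rw [MulChar.map_nonunit χ (by rwa [ZMod.isUnit_iff_coprime]), mul_zero]

lemma rchar_one_apply {y q : ℕ} (hq : 0 < q) (hqy : q ≤ y) (n : ℕ) :
    rchar y (1 : DirichletCharacter ℂ q) (n : ZMod (q * primorial y)) = (sift 1 y n : ℂ) := by
  rw [rchar_apply]
  rcases sift_eq_zero_or_one 1 y n with h1 | h1
  · simp [h1]
  · have : Nat.Coprime n q := by
      refine Nat.coprime_of_dvd fun p hp hpn hpq => ?_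
      have := sift_one_eq_one_iff.1 h1 p hp hpn
      have := Nat.le_of_dvd hq hpq
      omega
    rw [MulChar.one_apply (by rwa [ZMod.isUnit_iff_coprime]), mul_one]

lemma rchar_mul (y : ℕ) {q : ℕ} (χ ψ : DirichletCharacter ℂ q) :
    rchar y (χ * ψ) = rchar y χ * rchar y ψ := map_mul _ _ _

lemma rchar_one (y q : ℕ) : rchar y (1 : DirichletCharacter ℂ q) = 1 := map_one _

/-- The coefficients `log^k n · f(n)`. -/
noncomputable def logk (k : ℕ) (f : ℕ → ℂ) : ℕ → ℂ := fun n => (Real.log n : ℂ) ^ k * f n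

lemma logk_zero (f : ℕ → ℂ) : logk 0 f = f := by
  funext n; simp [logk]

lemma logMul_logk (k : ℕ) (f : ℕ → ℂ) : LSeries.logMul (logk k f) = logk (k + 1) f := by
  funext n
  rw [LSeries.logMul, logk, logk, ← Complex.natCast_log]
  ring

lemma abscissa_logk (k : ℕ) (f : ℕ → ℂ) :
    LSeries.abscissaOfAbsConv (logk k f) = LSeries.abscissaOfAbsConv f := by
  induction k with
  | zero => rw [logk_zero]
  | succ k ih => rw [← logMul_logk, LSeries.abscissaOfAbsConv_logMul, ih]

lemma hasDerivAt_LSeries_logk {f : ℕ → ℂ} (hf : LSeries.abscissaOfAbsConv f ≤ 1) (k : ℕ) {s : ℂ}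
    (hs : 1 < s.re) : HasDerivAt (LSeries (logk k f)) (-LSeries (logk (k + 1) f) s) s := by
  rw [← logMul_logk]
  refine LSeries_hasDerivAt ?_
  rw [abscissa_logk]
  exact hf.trans_lt (by exact_mod_cast hs)

lemma summable_logk {f : ℕ → ℂ} (hf : LSeries.abscissaOfAbsConv f ≤ 1) (k : ℕ) {s : ℂ}
    (hs : 1 < s.re) : LSeriesSummable (logk k f) s := by
  refine LSeriesSummable_of_abscissaOfAbsConv_lt_re ?_
  rw [abscissa_logk]
  exact hf.trans_lt (by exact_mod_cast hs)

/-- The point `1 + δ + it`. -/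
noncomputable def pt (δ t : ℝ) : ℂ := 1 + δ + t * Complex.I

lemma pt_re (δ t : ℝ) : (pt δ t).re = 1 + δ := by simp [pt]

lemma one_lt_pt_re {δ : ℝ} (hδ : 0 < δ) (t : ℝ) : 1 < (pt δ t).re := by rw [pt_re]; linarith

lemma term_logk (f : ℕ → ℂ) (k : ℕ) (δ t : ℝ) {n : ℕ} (hn : 0 < n) :
    LSeries.term (logk k f) (pt δ t) n = f n * tw t n * logWt k δ n := by
  rw [LSeries.term_of_ne_zero hn.ne', mul_assoc, mul_comm (tw t n), logWt_mul_tw k δ t hn, logk,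
    div_eq_mul_inv, ← Complex.cpow_neg, pt]
  rw [show (-1 - ((δ : ℂ) + t * Complex.I)) = -(1 + δ + t * Complex.I) by ring]
  ring

lemma tendsto_sum_term {f : ℕ → ℂ} {s : ℂ} (hf : LSeriesSummable f s) :
    Filter.Tendsto (fun N => ∑ n ∈ Ioc 0 N, LSeries.term f s n) Filter.atTop (nhds (LSeries f s)) := by
  have h := (hf.hasSum.tendsto_sum_nat).comp (Filter.tendsto_add_atTop_nat 1)
  refine h.congr fun N => ?_
  simp only [Function.comp]
  rw [Finset.range_eq_Ico, Finset.sum_eq_sum_Ico_succ_bot (Nat.succ_pos N), LSeries.term_zero, zero_add]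
  rfl

lemma norm_LSeries_logk_le {f : ℕ → ℂ} (hf : LSeries.abscissaOfAbsConv f ≤ 1) (k : ℕ) {δ : ℝ}
    (hδ : 0 < δ) (t : ℝ) {B : ℝ} {N₀ : ℕ}
    (h : ∀ N, N₀ ≤ N → ‖∑ n ∈ Ioc 0 N, f n * tw t n * logWt k δ n‖ ≤ B) :
    ‖LSeries (logk k f) (pt δ t)‖ ≤ B := by
  refine le_of_tendsto (tendsto_sum_term (summable_logk hf k (one_lt_pt_re hδ t))).norm ?_
  filter_upwards [Filter.eventually_ge_atTop N₀] with N hN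
  refine le_trans (le_of_eq ?_) (h N hN)
  congr 1
  exact Finset.sum_congr rfl fun n hn => term_logk f k δ t (mem_Ioc.1 hn).1

/-- The coefficients of a Dirichlet character. -/
noncomputable def chSeq {q : ℕ} (χ : DirichletCharacter ℂ q) : ℕ → ℂ := fun n => χ (n : ZMod q)

lemma abscissa_chSeq {q : ℕ} (χ : DirichletCharacter ℂ q) :
    LSeries.abscissaOfAbsConv (chSeq χ) ≤ 1 :=
  LSeries.abscissaOfAbsConv_le_of_le_const ⟨1, fun n _ => χ.norm_le_one n⟩

/-- Bounds for derivatives of rough L-series of nonprincipal characters. -/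
lemma exists_LSeries_bound (b : ℕ) (hb : 625 ≤ b) : ∃ C : ℝ, 1 ≤ C ∧ ∀ Z : ℕ, 2 ≤ Z →
    ∀ q : ℕ, 0 < q → q ≤ Z → ∀ χ : DirichletCharacter ℂ q, χ ≠ 1 → ∀ t : ℝ, |t| ≤ (Z : ℝ) ^ 12 →
    ∀ k ≤ 3, ∀ δ : ℝ, 0 < δ →
      ‖LSeries (logk k (chSeq (rchar (Z ^ b) χ))) (pt δ t)‖ ≤ C * Real.log Z ^ k := by
  obtain ⟨C, hC, h⟩ := exists_rough_char_bound b hb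
  refine ⟨C + 1, by linarith, ?_⟩
  intro Z hZ q hq hqZ χ hχ t ht k hk δ hδ
  have hl := half_le_log hZ
  refine (norm_LSeries_logk_le (N₀ := 0) (abscissa_chSeq _) k hδ t fun N _ => ?_).trans
    (mul_le_mul_of_nonneg_right (by linarith : C ≤ C + 1) (by positivity))
  refine le_trans (le_of_eq ?_) (h Z hZ q hq hqZ χ hχ t ht k hk δ hδ.le N)
  congr 1
  refine Finset.sum_congr rfl fun n _ => ?_
  rw [chSeq, rchar_apply]; ring

/-- The rough principal L-series is bounded away from the pole. -/
lemma exists_principal_LSeries_bound (b : ℕ) (hb : 625 ≤ b) (c : ℝ) (hc : 0 < c) (hc1 : c ≤ 1 / 2) :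
    ∃ C : ℝ, 1 ≤ C ∧ ∀ Z : ℕ, 2 ≤ Z → ∀ q : ℕ, 0 < q → q ≤ Z → ∀ t : ℝ, c / Real.log Z ≤ |t| →
    |t| ≤ (Z : ℝ) ^ 12 → ∀ δ : ℝ, 0 < δ → δ ≤ 1 →
      ‖LSeries (chSeq (rchar (Z ^ b) (1 : DirichletCharacter ℂ q))) (pt δ t)‖ ≤ C := by
  obtain ⟨C, hC, h⟩ := exists_rough_tw_bound b hb
  refine ⟨(7 + 3 * ((4 * (832 * b) : ℕ) : ℝ)) + C + (2 / c + 2 * (2048 * 6)), ?_, ?_⟩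
  · have : (0 : ℝ) ≤ 3 * ((4 * (832 * b) : ℕ) : ℝ) := by positivity
    have : 0 < 2 / c := by positivity
    linarith
  intro Z hZ q hq hqZ t htc ht δ hδ hδ1
  have hl := half_le_log hZ
  have hZ' : (2 : ℝ) ≤ Z := by exact_mod_cast hZ
  rw [← logk_zero (chSeq _)]
  obtain ⟨M₀, hM₀⟩ : ∃ M₀, M₀ = Z ^ (4 * (832 * b)) := ⟨_, rfl⟩
  have hqb : q ≤ Z ^ b := hqZ.trans (Nat.le_self_pow (by omega) _)
  refine norm_LSeries_logk_le (N₀ := M₀) (abscissa_chSeq _) 0 hδ t fun N hN => ?_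
  simp only [chSeq, rchar_one_apply hq hqb]
  have hρ : 0 < c / Real.log Z := by positivity
  have ht0 : t ≠ 0 := fun h0 => by rw [h0, abs_zero] at htc; linarith
  have hM24 : Z ^ 24 ≤ M₀ := hM₀ ▸ Nat.pow_le_pow_right (by omega) (by omega)
  have hM2 : 2 ≤ M₀ := hZ.trans ((Nat.le_self_pow (by omega) _).trans hM24)
  rw [← Finset.sum_Ioc_consecutive _ (Nat.zero_le _) hN]
  have h1 : ‖∑ n ∈ Ioc 0 M₀, (sift 1 (Z ^ b) n : ℂ) * tw t n * logWt 0 δ n‖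
      ≤ 7 + 3 * ((4 * (832 * b) : ℕ) : ℝ) := by
    have h2 := sum_rough_logWt_le hb hZ hδ.le 0 (4 * (832 * b)) (N := M₀) hM₀.le
    simp only [pow_zero, mul_one] at h2
    refine (norm_sum_le _ _).trans ((Finset.sum_le_sum fun n _ => ?_).trans h2)
    rw [norm_mul, norm_mul, Complex.norm_real, Complex.norm_real, Real.norm_eq_abs,
      Real.norm_eq_abs, abs_of_nonneg (logWt_nonneg 0 δ n), abs_of_nonneg (sift_nonneg _ _ _)]
    have := norm_tw_le t n
    exact mul_le_mul_of_nonneg_right (mul_le_of_le_one_right (sift_nonneg _ _ _) this)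
      (logWt_nonneg _ _ _)
  have h2 := h Z hZ t ht M₀ hM₀ δ hδ.le N hN
  set V := vdens 1 (Z ^ b) with hV
  have hV0 : 0 < V := vdens_pos _ _
  have hVl : V ≤ 1 / Real.log Z := by
    refine (vdens_le_inv_log (hZ.trans (Nat.le_self_pow (by omega) _))).trans ?_
    refine one_div_le_one_div_of_le (by linarith) ?_
    exact Real.log_le_log (by linarith) (by exact_mod_cast Nat.le_self_pow (by omega : b ≠ 0) Z)
  have hV2 : V ≤ 2 := hVl.trans (by rw [div_le_iff₀ (by linarith)]; linarith)
  have hz : ∀ n : ℕ, 1 ≤ n → ‖zInt (δ + t * Complex.I) 0 n‖ ≤ Real.log Z / c := by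
    intro n hn
    have hn' : (1 : ℝ) ≤ n := by exact_mod_cast hn
    have h3 := norm_zInt_le (w := δ + t * Complex.I) hρ
      (by rw [div_le_one (by linarith)]; linarith) (htc.trans (by
        simpa using Complex.abs_im_le_norm ((δ : ℂ) + t * Complex.I))) 0 hn'
    refine h3.trans ?_
    simp only [zero_add, Nat.factorial_one, Nat.cast_one, pow_zero, one_mul, pow_one]
    rw [div_div_eq_mul_div]
    gcongr
    refine mul_le_of_le_one_left (by linarith) (Real.rpow_le_one_of_one_le_of_nonpos hn' ?_)
    simp [hδ.le]
  have h3 : ‖∑ n ∈ Ioc M₀ N, (logWt 0 δ n : ℂ) * tw t n‖ ≤ 2 * (Real.log Z / c) + 2048 * 6 := by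
    have h4 := norm_sum_logWt_tw_sub_le (k := 0) (by norm_num) hδ.le ht0 hM2 hN
    have h5 := hz N (by omega)
    have h6 := hz M₀ (by omega)
    have h7 : 2048 * (4 + δ + |t|) * (M₀ : ℝ) ^ (-(1 / 2) : ℝ) ≤ 2048 * 6 := by
      have h8 : (M₀ : ℝ) ^ (-(1 / 2) : ℝ) ≤ ((Z : ℝ) ^ 12)⁻¹ := by
        have h9 : (Z : ℝ) ^ 24 ≤ M₀ := by exact_mod_cast hM24
        calc (M₀ : ℝ) ^ (-(1 / 2) : ℝ) ≤ ((Z : ℝ) ^ 24) ^ (-(1 / 2) : ℝ) :=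
              Real.rpow_le_rpow_of_nonpos (by positivity) h9 (by norm_num)
          _ = _ := by
            rw [← Real.rpow_natCast, ← Real.rpow_mul (by linarith), ← Real.rpow_natCast,
              ← Real.rpow_neg (by linarith)]
            norm_num
      have h12 : (1 : ℝ) ≤ (Z : ℝ) ^ 12 := one_le_pow₀ (by linarith)
      calc _ ≤ 2048 * (6 * (Z : ℝ) ^ 12) * ((Z : ℝ) ^ 12)⁻¹ := by gcongr; linarith
        _ = _ := by field_simp
    have h8 := norm_sub_norm_le (∑ n ∈ Ioc M₀ N, (logWt 0 δ n : ℂ) * tw t n)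
      (zInt (δ + t * Complex.I) 0 N - zInt (δ + t * Complex.I) 0 M₀)
    have h9 := norm_sub_le (zInt (δ + t * Complex.I) 0 N) (zInt (δ + t * Complex.I) 0 M₀)
    linarith
  have e : ∑ n ∈ Ioc M₀ N, (sift 1 (Z ^ b) n : ℂ) * tw t n * logWt 0 δ n
      = ∑ n ∈ Ioc M₀ N, ((sift 1 (Z ^ b) n - V : ℝ) : ℂ) * tw t n * logWt 0 δ n
        + V * ∑ n ∈ Ioc M₀ N, (logWt 0 δ n : ℂ) * tw t n := by
    rw [Finset.mul_sum, ← Finset.sum_add_distrib]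
    refine Finset.sum_congr rfl fun n _ => ?_
    push_cast; ring
  have h4 : ‖(V : ℂ) * ∑ n ∈ Ioc M₀ N, (logWt 0 δ n : ℂ) * tw t n‖ ≤ 2 / c + 2 * (2048 * 6) := by
    rw [norm_mul, Complex.norm_real, Real.norm_eq_abs, abs_of_pos hV0]
    calc _ ≤ V * (2 * (Real.log Z / c) + 2048 * 6) := by gcongr
      _ = V * (2 * (Real.log Z / c)) + V * (2048 * 6) := by ring
      _ ≤ 1 / Real.log Z * (2 * (Real.log Z / c)) + 2 * (2048 * 6) := by gcongr
      _ = _ := by field_simp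
  rw [e]
  have h5 := norm_add_le (∑ n ∈ Ioc 0 M₀, (sift 1 (Z ^ b) n : ℂ) * tw t n * logWt 0 δ n)
    (∑ n ∈ Ioc M₀ N, ((sift 1 (Z ^ b) n - V : ℝ) : ℂ) * tw t n * logWt 0 δ n
        + V * ∑ n ∈ Ioc M₀ N, (logWt 0 δ n : ℂ) * tw t n)
  have h6 := norm_add_le (∑ n ∈ Ioc M₀ N, ((sift 1 (Z ^ b) n - V : ℝ) : ℂ) * tw t n * logWt 0 δ n)
    (V * ∑ n ∈ Ioc M₀ N, (logWt 0 δ n : ℂ) * tw t n)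
  linarith

lemma principal_LSeries_le {b Z q : ℕ} (hb : 625 ≤ b) (hZ : 2 ≤ Z) (hq : 0 < q) (hqZ : q ≤ Z)
    {δ : ℝ} (hδ : 0 < δ) (t : ℝ) :
    ‖LSeries (chSeq (rchar (Z ^ b) (1 : DirichletCharacter ℂ q))) (pt δ t)‖
      ≤ 1 + 3 / Real.log Z * (1 + 1 / δ) := by
  have hl := half_le_log hZ
  have hqb : q ≤ Z ^ b := hqZ.trans (Nat.le_self_pow (by omega) _)
  rw [← logk_zero (chSeq _)]
  refine norm_LSeries_logk_le (N₀ := 0) (abscissa_chSeq _) 0 hδ t fun N _ => ?_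
  simp only [chSeq, rchar_one_apply hq hqb]
  refine (norm_sum_le _ _).trans ((Finset.sum_le_sum fun n _ => ?_).trans
    ((sum_rough_mul_rpow_le hb hZ hδ.le N).trans ?_))
  · rw [norm_mul, norm_mul, Complex.norm_real, Complex.norm_real, Real.norm_eq_abs,
      Real.norm_eq_abs, abs_of_nonneg (logWt_nonneg 0 δ n), abs_of_nonneg (sift_nonneg _ _ _), logWt,
      pow_zero, one_mul]
    have := norm_tw_le t n
    exact mul_le_mul_of_nonneg_right (mul_le_of_le_one_right (sift_nonneg _ _ _) this)
      (by positivity)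
  · gcongr
    exact sum_rpow_neg_le hδ N

end RoughSeries

section LowerBound

lemma re_neg_log_pair_nonneg {a : ℝ} (ha : 0 ≤ a) (ha1 : a < 1) {x y : ℝ} (hx : x ^ 2 = 1)
    (hy : y ^ 2 = 1) :
    0 ≤ (-Complex.log (1 - a)).re + (-Complex.log (1 - x * a)).re + (-Complex.log (1 - y * a)).re
      + (-Complex.log (1 - (x * y) * a)).re := by
  have key : ∀ z : ℝ, (-Complex.log (1 - z * a)).re = -Real.log (1 - z * a) := by
    intro z
    rw [Complex.neg_re, Complex.log_re, show (1 - z * a : ℂ) = ((1 - z * a : ℝ) : ℂ) by push_cast; ring,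
      Complex.norm_real, Real.norm_eq_abs, Real.log_abs]
  have h1 := key 1
  have h2 := key (x * y)
  push_cast at h1 h2
  rw [one_mul, one_mul] at h1
  rw [h1, key x, key y, h2]
  have p1 : Real.log (1 - a) ≤ 0 := Real.log_nonpos (by linarith) (by linarith)
  have p2 : Real.log (1 - a) + Real.log (1 + a) ≤ 0 := by
    rw [← Real.log_mul (by linarith) (by linarith)]
    exact Real.log_nonpos (by nlinarith) (by nlinarith)
  have hx' : x = 1 ∨ x = -1 := by simpa using hx
  have hy' : y = 1 ∨ y = -1 := by simpa using hy
  rcases hx' with rfl | rfl <;> rcases hy' with rfl | rfl <;> norm_num <;> linarith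

/-- Two quadratic characters: the product of the four L-series is at least one. -/
lemma norm_LSeries_four_ge_one {N : ℕ} {χ ψ : DirichletCharacter ℂ N} (hχ : χ ^ 2 = 1)
    (hψ : ψ ^ 2 = 1) {σ : ℝ} (hσ : 0 < σ) :
    1 ≤ ‖LSeries (chSeq (1 : DirichletCharacter ℂ N)) (pt σ 0) * LSeries (chSeq χ) (pt σ 0) *
      LSeries (chSeq ψ) (pt σ 0) * LSeries (chSeq (χ * ψ)) (pt σ 0)‖ := by
  have hs := one_lt_pt_re hσ 0
  have H := fun φ : DirichletCharacter ℂ N => φ.summable_neg_log_one_sub_mul_prime_cpow hs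
  have E := fun φ : DirichletCharacter ℂ N =>
    show _ = LSeries (chSeq φ) (pt σ 0) from φ.LSeries_eulerProduct_exp_log hs
  have R := fun φ : DirichletCharacter ℂ N => (Complex.hasSum_re (H φ).hasSum).summable
  have real : ∀ φ : DirichletCharacter ℂ N, φ ^ 2 = 1 → ∀ n : ℕ, IsUnit (n : ZMod N) →
      ∃ x : ℝ, x ^ 2 = 1 ∧ φ n = x := by
    intro φ hφ n hn
    have : φ n ^ 2 = 1 := by
      rw [← MulChar.pow_apply' φ two_ne_zero, hφ, MulChar.one_apply hn]
    rcases (by simpa using this : φ n = 1 ∨ φ n = -1) with h | h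
    · exact ⟨1, by norm_num, by simp [h]⟩
    · exact ⟨-1, by norm_num, by simp [h]⟩
  rw [← E 1, ← E χ, ← E ψ, ← E (χ * ψ), ← Complex.exp_add, ← Complex.exp_add, ← Complex.exp_add,
    Complex.norm_exp, Real.one_le_exp_iff, Complex.add_re, Complex.add_re, Complex.add_re,
    Complex.re_tsum (H _), Complex.re_tsum (H _), Complex.re_tsum (H _), Complex.re_tsum (H _),
    ← (R 1).tsum_add (R χ), ← ((R 1).add (R χ)).tsum_add (R ψ),
    ← (((R 1).add (R χ)).add (R ψ)).tsum_add (R (χ * ψ))]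
  refine tsum_nonneg fun p => ?_
  by_cases hp : IsUnit ((p : ℕ) : ZMod N)
  · obtain ⟨x, hx, hx'⟩ := real χ hχ p hp
    obtain ⟨y, hy, hy'⟩ := real ψ hψ p hp
    have hp2 : (1 : ℝ) < (p : ℕ) := by exact_mod_cast p.prop.one_lt
    have e : ((p : ℕ) : ℂ) ^ (-pt σ 0) = (((p : ℕ) : ℝ) ^ (-(1 + σ)) : ℝ) := by
      rw [Complex.ofReal_cpow (by linarith)]
      simp [pt]
    have h1 : ((p : ℕ) : ℝ) ^ (-(1 + σ)) < 1 := Real.rpow_lt_one_of_one_lt_of_neg hp2 (by linarith)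
    have := re_neg_log_pair_nonneg (by positivity) h1 hx hy
    rw [MulChar.mul_apply, MulChar.one_apply hp, hx', hy', e, one_mul]
    exact this
  · simp [MulChar.map_nonunit _ hp]

/-- Lipschitz bound for `LSeries` along a segment. -/
lemma norm_LSeries_sub_le {f : ℕ → ℂ} (hf : LSeries.abscissaOfAbsConv f ≤ 1) {s s' : ℂ} {B : ℝ}
    (hs : 1 < s.re) (hs' : 1 < s'.re)
    (hB : ∀ z ∈ segment ℝ s s', ‖LSeries (logk 1 f) z‖ ≤ B) :
    ‖LSeries f s' - LSeries f s‖ ≤ B * ‖s' - s‖ := by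
  have hre : ∀ z ∈ segment ℝ s s', 1 < z.re := by
    intro z hz
    exact (convex_halfSpace_re_gt (r := 1)).segment_subset hs hs' hz
  refine Convex.norm_image_sub_le_of_norm_hasDerivWithin_le (𝕜 := ℂ) (s := segment ℝ s s')
    (f' := fun z => -LSeries (logk 1 f) z) (fun z hz => ?_) (fun z hz => ?_)
    (convex_segment s s') (left_mem_segment ℝ s s') (right_mem_segment ℝ s s')
  · have := hasDerivAt_LSeries_logk hf 0 (hre z hz)
    rw [logk_zero] at this
    exact this.hasDerivWithinAt
  · rw [norm_neg]; exact hB z hz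

lemma segment_pt {δ t δ' t' : ℝ} {z : ℂ} (hz : z ∈ segment ℝ (pt δ t) (pt δ' t')) :
    ∃ δ'' t'', z = pt δ'' t'' ∧ min δ δ' ≤ δ'' ∧ |t''| ≤ max |t| |t'| := by
  obtain ⟨a, b, ha, hb, hab, rfl⟩ := hz
  refine ⟨a * δ + b * δ', a * t + b * t', ?_, ?_, ?_⟩
  · have : (a : ℂ) + b = 1 := by exact_mod_cast hab
    simp only [pt, Complex.real_smul]
    push_cast
    linear_combination this
  · have h1 := mul_le_mul_of_nonneg_left (min_le_left δ δ') ha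
    have h2 := mul_le_mul_of_nonneg_left (min_le_right δ δ') hb
    have h3 : a * min δ δ' + b * min δ δ' = min δ δ' := by rw [← add_mul, hab, one_mul]
    linarith
  · have h1 := mul_le_mul_of_nonneg_left (le_max_left |t| |t'|) ha
    have h2 := mul_le_mul_of_nonneg_left (le_max_right |t| |t'|) hb
    have h3 : a * max |t| |t'| + b * max |t| |t'| = max |t| |t'| := by rw [← add_mul, hab, one_mul]
    have h4 := abs_add_le (a * t) (b * t')
    rw [abs_mul, abs_mul, abs_of_nonneg ha, abs_of_nonneg hb] at h4
    linarith

lemma norm_pt_sub_le (δ t δ' t' : ℝ) : ‖pt δ' t' - pt δ t‖ ≤ |δ' - δ| + |t' - t| := by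
  have e : pt δ' t' - pt δ t = ((δ' - δ : ℝ) : ℂ) + ((t' - t : ℝ) : ℂ) * Complex.I := by
    simp only [pt]; push_cast; ring
  rw [e]
  refine (norm_add_le _ _).trans ?_
  rw [norm_mul, Complex.norm_I, mul_one, Complex.norm_real, Complex.norm_real, Real.norm_eq_abs,
    Real.norm_eq_abs]

/-- The `3-4-1` argument followed by a mean value estimate. -/
lemma lower_of_three_four_one {b Z q : ℕ} (hb : 625 ≤ b) (hZ : 2 ≤ Z) (hq : 0 < q) (hqZ : q ≤ Z)
    {C Δ : ℝ} (hC : 1 ≤ C) (hΔ : Δ = 1 / (16000 * C ^ 5)) (χ : DirichletCharacter ℂ q) {t : ℝ}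
    (h1 : ∀ δ : ℝ, 0 < δ → ‖LSeries (logk 1 (chSeq (rchar (Z ^ b) χ))) (pt δ t)‖ ≤ C * Real.log Z)
    (h2 : ‖LSeries (chSeq (rchar (Z ^ b) (χ ^ 2))) (pt (Δ / Real.log Z) (2 * t))‖ ≤ C)
    {δ : ℝ} (hδ : 0 < δ) (hδΔ : δ * Real.log Z ≤ Δ) :
    C * Δ ≤ ‖LSeries (chSeq (rchar (Z ^ b) χ)) (pt δ t)‖ := by
  have hl := half_le_log hZ
  have hΔ0 : 0 < Δ := by rw [hΔ]; positivity
  have hΔ1 : Δ ≤ 1 := by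
    rw [hΔ, div_le_one (by positivity)]
    have : 1 ≤ C ^ 5 := one_le_pow₀ hC
    linarith
  set σ := Δ / Real.log Z with hσ
  have hσ0 : 0 < σ := by positivity
  have hP := principal_LSeries_le hb hZ hq hqZ hσ0 0
  have hP2 : 1 + 3 / Real.log Z * (1 + 1 / σ) ≤ 10 / Δ := by
    have e : 1 + 3 / Real.log Z * (1 + 1 / σ) = 1 + 3 / Real.log Z + 3 / Δ := by
      rw [hσ]; field_simp; ring
    have h3 : 3 / Real.log Z ≤ 6 := by rw [div_le_iff₀ (by linarith)]; linarith
    have h4 : 7 ≤ 7 / Δ := by rw [le_div_iff₀ hΔ0]; linarith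
    have h5 : 10 / Δ = 7 / Δ + 3 / Δ := by ring
    linarith
  have h341 := (rchar (Z ^ b) χ).norm_LSeries_product_ge_one hσ0 t
  have e0 : (1 + (σ : ℂ)) = pt σ 0 := by simp [pt]
  have e1 : (1 + (σ : ℂ) + Complex.I * t) = pt σ t := by simp [pt, mul_comm]
  have e2 : (1 + (σ : ℂ) + 2 * Complex.I * t) = pt σ (2 * t) := by simp [pt]; ring
  rw [e1, e2, e0, norm_mul, norm_mul, norm_pow, norm_pow, ← rchar_one (Z ^ b) q] at h341
  have e3 : rchar (Z ^ b) χ ^ 2 = rchar (Z ^ b) (χ ^ 2) := by rw [pow_two, pow_two, rchar_mul]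
  rw [e3] at h341
  set P := ‖LSeries (chSeq (rchar (Z ^ b) (1 : DirichletCharacter ℂ q))) (pt σ 0)‖ with hPdef
  set L := ‖LSeries (chSeq (rchar (Z ^ b) χ)) (pt σ t)‖ with hLdef
  have hL : 2 * (C * Δ) ≤ L := by
    by_contra hc
    push Not at hc
    have h3 : P ^ 3 * L ^ 4 * C < 1 := by
      calc P ^ 3 * L ^ 4 * C ≤ (10 / Δ) ^ 3 * L ^ 4 * C := by
            gcongr; exact hP.trans hP2
        _ < (10 / Δ) ^ 3 * (2 * (C * Δ)) ^ 4 * C := by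
            have := pow_lt_pow_left₀ hc (norm_nonneg _) (four_ne_zero)
            gcongr
        _ = 1 := by
            have : Δ * (16000 * C ^ 5) = 1 := by rw [hΔ]; field_simp
            field_simp
            linear_combination this
    have h4 : P ^ 3 * L ^ 4 * ‖LSeries (chSeq (rchar (Z ^ b) (χ ^ 2))) (pt σ (2 * t))‖
        ≤ P ^ 3 * L ^ 4 * C := by gcongr
    exact absurd (le_trans h341 h4) (not_le.2 h3)
  have hδσ : δ ≤ σ := by rw [hσ, le_div_iff₀ (by linarith)]; exact hδΔ
  have hd : ‖LSeries (chSeq (rchar (Z ^ b) χ)) (pt σ t) - LSeries (chSeq (rchar (Z ^ b) χ)) (pt δ t)‖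
      ≤ C * Real.log Z * ‖pt σ t - pt δ t‖ := by
    refine norm_LSeries_sub_le (abscissa_chSeq _) (one_lt_pt_re hδ t) (one_lt_pt_re hσ0 t) ?_
    intro z hz
    obtain ⟨a, b', ha, hb', hab, rfl⟩ := hz
    have e : a • pt δ t + b' • pt σ t = pt (a * δ + b' * σ) t := by
      have : (a : ℂ) + b' = 1 := by exact_mod_cast hab
      simp only [pt, Complex.real_smul]
      push_cast
      linear_combination (1 + t * Complex.I) * this
    rw [e]
    refine h1 _ ?_
    have h3 := mul_le_mul_of_nonneg_left hδσ hb'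
    have h4 : a * δ + b' * δ = δ := by rw [← add_mul, hab, one_mul]
    linarith
  have hd2 : ‖pt σ t - pt δ t‖ ≤ σ := by
    refine (norm_pt_sub_le _ _ _ _).trans ?_
    rw [sub_self, abs_zero, add_zero, abs_of_nonneg (by linarith)]
    linarith
  have hd3 : C * Real.log Z * ‖pt σ t - pt δ t‖ ≤ C * Δ := by
    calc C * Real.log Z * ‖pt σ t - pt δ t‖ ≤ C * Real.log Z * σ := by gcongr
      _ = C * Δ := by rw [hσ]; field_simp
  have := norm_sub_norm_le (LSeries (chSeq (rchar (Z ^ b) χ)) (pt σ t))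
    (LSeries (chSeq (rchar (Z ^ b) χ)) (pt δ t))
  linarith

/-- Lower bounds for rough L-series, outside at most one exceptional character. -/
lemma exists_LSeries_lower_bound (b : ℕ) (hb : 625 ≤ b) : ∃ C η : ℝ, 1 ≤ C ∧ 0 < η ∧ η ≤ 1 / 4 ∧
    ∀ Z : ℕ, 2 ≤ Z → ∀ q : ℕ, 0 < q → q ≤ Z → ∃ 𝒳 : Finset (DirichletCharacter ℂ q), #𝒳 ≤ 1 ∧
      (∀ χ ∈ 𝒳, χ ≠ 1) ∧ ∀ χ : DirichletCharacter ℂ q, χ ≠ 1 → χ ∉ 𝒳 → ∀ t : ℝ,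
      |t| ≤ (Z : ℝ) ^ 10 → ∀ δ : ℝ, 0 < δ → δ * Real.log Z ≤ η →
        1 ≤ C * ‖LSeries (chSeq (rchar (Z ^ b) χ)) (pt δ t)‖ := by
  obtain ⟨C₁, hC₁, hU⟩ := exists_LSeries_bound b hb
  obtain ⟨Δ, hΔ⟩ : ∃ Δ, Δ = 1 / (16000 * C₁ ^ 5) := ⟨_, rfl⟩
  have hΔ0 : 0 < Δ := by rw [hΔ]; positivity
  have hΔle : ∀ C : ℝ, 1 ≤ C → 1 / (16000 * C ^ 5) ≤ 1 / 16000 := by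
    intro C hC
    have : 1 ≤ C ^ 5 := one_le_pow₀ hC
    exact one_div_le_one_div_of_le (by norm_num) (by linarith)
  have hΔ1 : Δ ≤ 1 / 16000 := hΔ ▸ hΔle C₁ hC₁
  obtain ⟨C₂, hC₂, hP⟩ := exists_principal_LSeries_bound b hb (2 * Δ) (by linarith) (by linarith)
  obtain ⟨C₃, hC₃⟩ : ∃ C₃, C₃ = max C₁ C₂ := ⟨_, rfl⟩
  have hC₃1 : 1 ≤ C₃ := hC₃ ▸ le_max_of_le_left hC₁
  have h13 : C₁ ≤ C₃ := hC₃ ▸ le_max_left _ _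
  have h23 : C₂ ≤ C₃ := hC₃ ▸ le_max_right _ _
  obtain ⟨Δ₃, hΔ₃⟩ : ∃ Δ, Δ = 1 / (16000 * C₃ ^ 5) := ⟨_, rfl⟩
  have hΔ₃0 : 0 < Δ₃ := by rw [hΔ₃]; positivity
  have hΔ₃Δ : Δ₃ ≤ Δ := by
    rw [hΔ, hΔ₃]
    exact one_div_le_one_div_of_le (by positivity) (by gcongr)
  have hlow : Δ₃ ≤ C₁ * Δ ∧ Δ₃ ≤ C₃ * Δ₃ := by constructor <;> nlinarith
  refine ⟨1 / Δ₃, Δ₃, ?_, hΔ₃0, by linarith, ?_⟩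
  · rw [le_div_iff₀ hΔ₃0]; linarith
  intro Z hZ q hq hqZ
  have hl := half_le_log hZ
  have hZ' : (2 : ℝ) ≤ Z := by exact_mod_cast hZ
  set σ := Δ / Real.log Z with hσ
  have hσ0 : 0 < σ := by positivity
  let bad : DirichletCharacter ℂ q → Prop := fun χ => χ ≠ 1 ∧ χ ^ 2 = 1 ∧
    ‖LSeries (chSeq (rchar (Z ^ b) χ)) (pt σ 0)‖ < 4 * (C₁ * Δ)
  have hbad : ∀ χ ψ, bad χ → bad ψ → χ = ψ := by
    rintro χ ψ ⟨hχ1, hχ2, hχ3⟩ ⟨hψ1, hψ2, hψ3⟩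
    by_contra hne
    have hne' : χ * ψ ≠ 1 := fun h => hne (by
      calc χ = χ * ψ ^ 2 := by rw [hψ2, mul_one]
        _ = (χ * ψ) * ψ := by rw [pow_two, mul_assoc]
        _ = ψ := by rw [h, one_mul])
    have r2 : ∀ χ : DirichletCharacter ℂ q, χ ^ 2 = 1 → rchar (Z ^ b) χ ^ 2 = 1 := by
      intro χ h
      rw [pow_two, ← rchar_mul, ← pow_two, h, rchar_one]
    have h4 := norm_LSeries_four_ge_one (r2 χ hχ2) (r2 ψ hψ2) hσ0
    rw [norm_mul, norm_mul, norm_mul, ← rchar_one (Z ^ b) q, ← rchar_mul] at h4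
    have hPr := principal_LSeries_le hb hZ hq hqZ hσ0 0
    have hP2 : 1 + 3 / Real.log Z * (1 + 1 / σ) ≤ 10 / Δ := by
      have e : 1 + 3 / Real.log Z * (1 + 1 / σ) = 1 + 3 / Real.log Z + 3 / Δ := by
        rw [hσ]; field_simp; ring
      have h3 : 3 / Real.log Z ≤ 6 := by rw [div_le_iff₀ (by linarith)]; linarith
      have h4 : 7 ≤ 7 / Δ := by rw [le_div_iff₀ hΔ0]; linarith
      have h5 : 10 / Δ = 7 / Δ + 3 / Δ := by ring
      linarith
    have hU0 := hU Z hZ q hq hqZ _ hne' 0 (by rw [abs_zero]; positivity) 0 (by norm_num) σ hσ0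
    rw [logk_zero, pow_zero, mul_one] at hU0
    have h5 : ‖LSeries (chSeq (rchar (Z ^ b) (1 : DirichletCharacter ℂ q))) (pt σ 0)‖ *
        ‖LSeries (chSeq (rchar (Z ^ b) χ)) (pt σ 0)‖ * ‖LSeries (chSeq (rchar (Z ^ b) ψ)) (pt σ 0)‖ *
        ‖LSeries (chSeq (rchar (Z ^ b) (χ * ψ))) (pt σ 0)‖
        ≤ 10 / Δ * (4 * (C₁ * Δ)) * (4 * (C₁ * Δ)) * C₁ := by
      gcongr
      exact hPr.trans hP2
    have h6 : 10 / Δ * (4 * (C₁ * Δ)) * (4 * (C₁ * Δ)) * C₁ < 1 := by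
      have e : 10 / Δ * (4 * (C₁ * Δ)) * (4 * (C₁ * Δ)) * C₁ = 160 * C₁ ^ 3 * Δ := by
        field_simp; ring
      have h7 : C₁ ^ 3 ≤ C₁ ^ 5 := pow_le_pow_right₀ hC₁ (by norm_num)
      have h8 : Δ * (16000 * C₁ ^ 5) = 1 := by rw [hΔ]; field_simp
      rw [e]
      nlinarith
    linarith
  have hX : ∃ 𝒳 : Finset (DirichletCharacter ℂ q), #𝒳 ≤ 1 ∧ ∀ χ, χ ∈ 𝒳 ↔ bad χ := by
    by_cases h : ∃ χ, bad χ
    · obtain ⟨χ, hχ⟩ := h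
      refine ⟨{χ}, by simp, fun ψ => ?_⟩
      rw [mem_singleton]
      exact ⟨fun h => h ▸ hχ, fun h => hbad ψ χ h hχ⟩
    · exact ⟨∅, by simp, fun χ => by simpa using fun hc => h ⟨χ, hc⟩⟩
  obtain ⟨𝒳, hX1, hX2⟩ := hX
  refine ⟨𝒳, hX1, fun χ hχ => ((hX2 χ).1 hχ).1, ?_⟩
  intro χ hχ1 hχX t ht δ hδ hδη
  suffices h : Δ₃ ≤ ‖LSeries (chSeq (rchar (Z ^ b) χ)) (pt δ t)‖ by
    rw [one_div, ← div_eq_inv_mul, le_div_iff₀ hΔ₃0]; linarith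
  have hZ10 : (Z : ℝ) ^ 12 = (Z : ℝ) ^ 10 * (Z : ℝ) ^ 2 := by ring
  have hZ2 : (4 : ℝ) ≤ (Z : ℝ) ^ 2 := by nlinarith
  have hZp : (1 : ℝ) ≤ (Z : ℝ) ^ 10 := one_le_pow₀ (by linarith)
  have h2t : |2 * t| ≤ (Z : ℝ) ^ 12 := by
    rw [abs_mul, abs_of_pos (by norm_num : (0 : ℝ) < 2), hZ10]; nlinarith
  have ht12 : |t| ≤ (Z : ℝ) ^ 12 := by rw [hZ10]; nlinarith
  have hder : ∀ t : ℝ, |t| ≤ (Z : ℝ) ^ 12 → ∀ δ : ℝ, 0 < δ →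
      ‖LSeries (logk 1 (chSeq (rchar (Z ^ b) χ))) (pt δ t)‖ ≤ C₁ * Real.log Z := by
    intro t ht δ hδ
    have := hU Z hZ q hq hqZ χ hχ1 t ht 1 (by norm_num) δ hδ
    rwa [pow_one] at this
  by_cases h2 : χ ^ 2 = 1
  · by_cases htσ : |t| ≤ σ
    · have hg : 4 * (C₁ * Δ) ≤ ‖LSeries (chSeq (rchar (Z ^ b) χ)) (pt σ 0)‖ := by
        by_contra hc
        exact hχX ((hX2 χ).2 ⟨hχ1, h2, not_le.1 hc⟩)
      have hδσ : δ ≤ σ := by rw [hσ, le_div_iff₀ (by linarith)]; linarith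
      have hd : ‖LSeries (chSeq (rchar (Z ^ b) χ)) (pt σ 0) -
          LSeries (chSeq (rchar (Z ^ b) χ)) (pt δ t)‖ ≤ C₁ * Real.log Z * ‖pt σ 0 - pt δ t‖ := by
        refine norm_LSeries_sub_le (abscissa_chSeq _) (one_lt_pt_re hδ t) (one_lt_pt_re hσ0 0) ?_
        intro z hz
        obtain ⟨δ', t', rfl, h3, h4⟩ := segment_pt hz
        refine hder t' (h4.trans (max_le ht12 (by rw [abs_zero]; positivity))) δ' (lt_of_lt_of_le ?_ h3)
        exact lt_min hδ hσ0
      have hd2 : ‖pt σ 0 - pt δ t‖ ≤ 2 * σ := by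
        refine (norm_pt_sub_le _ _ _ _).trans ?_
        rw [zero_sub, abs_neg, abs_of_nonneg (by linarith)]
        linarith
      have hd3 : C₁ * Real.log Z * ‖pt σ 0 - pt δ t‖ ≤ 2 * (C₁ * Δ) := by
        calc _ ≤ C₁ * Real.log Z * (2 * σ) := by gcongr
          _ = _ := by rw [hσ]; field_simp
      have := norm_sub_norm_le (LSeries (chSeq (rchar (Z ^ b) χ)) (pt σ 0))
        (LSeries (chSeq (rchar (Z ^ b) χ)) (pt δ t))
      have : 0 < C₁ * Δ := by positivity
      linarith [hlow.1]
    · refine hlow.2.trans (lower_of_three_four_one hb hZ hq hqZ hC₃1 hΔ₃ χ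
        (fun δ hδ => (hder t ht12 δ hδ).trans (by gcongr)) ?_ hδ hδη)
      rw [h2]
      refine (hP Z hZ q hq hqZ (2 * t) ?_ h2t _ (by positivity) ?_).trans h23
      · rw [abs_mul, abs_of_pos (by norm_num : (0 : ℝ) < 2), mul_div_assoc, ← hσ]
        linarith [not_le.1 htσ]
      · rw [div_le_one (by linarith)]; linarith
  · refine hlow.1.trans (lower_of_three_four_one hb hZ hq hqZ hC₁ hΔ χ
        (fun δ hδ => hder t ht12 δ hδ) ?_ hδ (hδη.trans hΔ₃Δ))
    have := hU Z hZ q hq hqZ _ h2 (2 * t) h2t 0 (by norm_num) σ hσ0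
    rwa [logk_zero, pow_zero, mul_one] at this

end LowerBound

section Kernel

open MeasureTheory FourierTransform

/-- The triangle function. -/
noncomputable def tri (v : ℝ) : ℝ := max 0 (1 - |v|)

/-- Its Fourier transform, in the variable `2πw`. -/
noncomputable def fej (ξ : ℝ) : ℝ := 2 * (1 - Real.cos ξ) / ξ ^ 2

lemma tri_nonneg (v : ℝ) : 0 ≤ tri v := le_max_left _ _

lemma tri_le_one (v : ℝ) : tri v ≤ 1 := max_le zero_le_one (by linarith [abs_nonneg v])

lemma tri_eq_zero {v : ℝ} (hv : 1 ≤ |v|) : tri v = 0 := max_eq_left (by linarith)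

lemma abs_tri_sub_le (v w : ℝ) : |tri v - tri w| ≤ |v - w| := by
  have h := abs_max_sub_max_le_abs (1 - |v|) (1 - |w|) 0
  rw [max_comm _ (0 : ℝ), max_comm _ (0 : ℝ)] at h
  refine h.trans ?_
  rw [show 1 - |v| - (1 - |w|) = |w| - |v| by ring, abs_sub_comm v w]
  exact abs_abs_sub_abs_le _ _

lemma continuous_tri : Continuous tri := by unfold tri; fun_prop

lemma fej_nonneg (ξ : ℝ) : 0 ≤ fej ξ := by
  have := Real.cos_le_one ξ
  unfold fej
  apply div_nonneg <;> nlinarith [sq_nonneg ξ]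

lemma fej_le_one (ξ : ℝ) : fej ξ ≤ 1 := by
  have := Real.one_sub_sq_div_two_le_cos (x := ξ)
  unfold fej
  exact div_le_one_of_le₀ (by linarith) (sq_nonneg _)

lemma fej_le (ξ : ℝ) : fej ξ ≤ 4 / ξ ^ 2 := by
  have := Real.neg_one_le_cos ξ
  unfold fej
  gcongr
  linarith

lemma measurable_fej : Measurable fej := by unfold fej; fun_prop

lemma fej_le_inv (ξ : ℝ) : fej ξ ≤ 5 * (1 + ξ ^ 2)⁻¹ := by
  rw [← div_eq_mul_inv]
  by_cases h : ξ = 0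
  · have := fej_le_one ξ
    simp only [h] at this ⊢
    norm_num
    linarith
  have hx : 0 < ξ ^ 2 := by positivity
  by_cases h1 : ξ ^ 2 ≤ 4
  · exact (fej_le_one ξ).trans (by rw [le_div_iff₀ (by positivity)]; linarith)
  · refine (fej_le ξ).trans ?_
    rw [div_le_div_iff₀ hx (by positivity)]
    linarith [not_le.1 h1]

lemma integrable_fej : Integrable fej := by
  refine (integrable_inv_one_add_sq.const_mul 5).mono' measurable_fej.aestronglyMeasurable ?_
  filter_upwards with ξ
  rw [Real.norm_eq_abs, abs_of_nonneg (fej_nonneg ξ)]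
  exact fej_le_inv ξ

lemma integral_tri_mul_exp {c : ℂ} (hc : c ≠ 0) :
    ∫ v : ℝ, Complex.exp (-(c * v)) * (tri v : ℂ) = (Complex.exp c + Complex.exp (-c) - 2) / c ^ 2 := by
  have hsupp : Function.support (fun v : ℝ => Complex.exp (-(c * v)) * (tri v : ℂ))
      ⊆ Set.Ioc (-1) 1 := by
    intro v hv
    by_contra h
    apply hv
    have : 1 ≤ |v| := by
      by_contra h1
      exact h ⟨(abs_lt.1 (not_le.1 h1)).1, (abs_lt.1 (not_le.1 h1)).2.le⟩
    simp [tri_eq_zero this]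
  have hcont : Continuous (fun v : ℝ => Complex.exp (-(c * v)) * (tri v : ℂ)) := by
    have := continuous_tri
    fun_prop
  rw [← intervalIntegral.integral_eq_integral_of_support_subset hsupp,
    ← intervalIntegral.integral_add_adjacent_intervals (b := 0)
      (hcont.intervalIntegrable _ _) (hcont.intervalIntegrable _ _)]
  have hE : ∀ v : ℝ, HasDerivAt (fun v : ℝ => Complex.exp (-(c * v)))
      (Complex.exp (-(c * v)) * (-(c * 1))) v := by
    intro v
    exact (((Complex.ofRealCLM.hasDerivAt (x := v)).const_mul c).neg).cexp
  have hid : ∀ v : ℝ, HasDerivAt (fun v : ℝ => (v : ℂ)) 1 v := fun v =>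
    Complex.ofRealCLM.hasDerivAt (x := v)
  have h1 : ∫ v in (0 : ℝ)..1, Complex.exp (-(c * v)) * (tri v : ℂ)
      = Complex.exp (-c) / c ^ 2 + 1 / c - 1 / c ^ 2 := by
    have hd : ∀ v ∈ Set.uIcc (0 : ℝ) 1, HasDerivAt
        (fun v : ℝ => -(1 - (v : ℂ)) * Complex.exp (-(c * v)) / c + Complex.exp (-(c * v)) / c ^ 2)
        (Complex.exp (-(c * v)) * (tri v : ℂ)) v := by
      intro v hv
      rw [Set.uIcc_of_le zero_le_one] at hv
      have e : tri v = 1 - v := by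
        rw [tri, abs_of_nonneg hv.1, max_eq_right (by linarith [hv.2])]
      rw [e]
      refine (((((hid v).const_sub 1).neg.mul (hE v)).div_const c).add
        ((hE v).div_const (c ^ 2))).congr_deriv ?_
      simp only [Pi.neg_apply]
      push_cast
      field_simp
      ring
    rw [intervalIntegral.integral_eq_sub_of_hasDerivAt hd (hcont.intervalIntegrable _ _)]
    simp
    ring
  have h2 : ∫ v in (-1 : ℝ)..0, Complex.exp (-(c * v)) * (tri v : ℂ)
      = Complex.exp c / c ^ 2 - 1 / c - 1 / c ^ 2 := by
    have hd : ∀ v ∈ Set.uIcc (-1 : ℝ) 0, HasDerivAt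
        (fun v : ℝ => -(1 + (v : ℂ)) * Complex.exp (-(c * v)) / c - Complex.exp (-(c * v)) / c ^ 2)
        (Complex.exp (-(c * v)) * (tri v : ℂ)) v := by
      intro v hv
      rw [Set.uIcc_of_le (by norm_num)] at hv
      have e : tri v = 1 + v := by
        rw [tri, abs_of_nonpos hv.2, max_eq_right (by linarith [hv.1])]; ring
      rw [e]
      refine (((((hid v).const_add 1).neg.mul (hE v)).div_const c).sub
        ((hE v).div_const (c ^ 2))).congr_deriv ?_
      simp only [Pi.neg_apply]
      push_cast
      field_simp
      ring
    rw [intervalIntegral.integral_eq_sub_of_hasDerivAt hd (hcont.intervalIntegrable _ _)]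
    simp
    ring
  rw [h1, h2]
  field_simp
  ring

lemma fourier_tri {w : ℝ} (hw : w ≠ 0) :
    𝓕 (fun v => (tri v : ℂ)) w = fej (2 * Real.pi * w) := by
  have hπ := Real.pi_pos
  have hc : ((2 * Real.pi * w : ℝ) : ℂ) * Complex.I ≠ 0 := by
    simp [hw, hπ.ne']
  rw [Real.fourier_real_eq_integral_exp_smul]
  have h := integral_tri_mul_exp hc
  rw [Complex.exp_mul_I, ← neg_mul, Complex.exp_mul_I, Complex.cos_neg, Complex.sin_neg] at h
  refine Eq.trans ?_ (h.trans ?_)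
  · congr 1; funext v
    rw [smul_eq_mul]
    congr 2
    push_cast; ring
  · rw [fej, mul_pow, Complex.I_sq]
    push_cast
    ring

/-- Fourier inversion for the triangle. -/
lemma integral_fej (v : ℝ) :
    ∫ ξ : ℝ, (fej ξ : ℂ) * Complex.exp (ξ * v * Complex.I) = 2 * Real.pi * tri v := by
  have hπ := Real.pi_pos
  have hae : (𝓕 (fun v => (tri v : ℂ))) =ᵐ[volume] fun w => ((fej (2 * Real.pi * w) : ℝ) : ℂ) := by
    have : ∀ᵐ w : ℝ, w ≠ 0 := by simp [ae_iff]
    filter_upwards [this] with w hw using fourier_tri hw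
  have hInt : Integrable (fun w : ℝ => ((fej (2 * Real.pi * w) : ℝ) : ℂ)) :=
    ((integrable_fej.comp_mul_left' (by positivity : 2 * Real.pi ≠ 0))).ofReal
  have htri : Integrable (fun v => (tri v : ℂ)) := by
    have hc : Continuous (fun v => (tri v : ℂ)) := by
      have := continuous_tri
      fun_prop
    refine hc.integrable_of_hasCompactSupport ?_
    refine HasCompactSupport.of_support_subset_isCompact (isCompact_Icc (a := -1) (b := 1)) ?_
    intro v hv
    by_contra h
    apply hv
    have : 1 ≤ |v| := by
      by_contra h1
      exact h ⟨(abs_lt.1 (not_le.1 h1)).1.le, (abs_lt.1 (not_le.1 h1)).2.le⟩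
    simp [tri_eq_zero this]
  have h1 := htri.fourierInv_fourier_eq (hInt.congr hae.symm) (v := v) (by
    have := continuous_tri
    have : Continuous (fun v => (tri v : ℂ)) := by fun_prop
    exact this.continuousAt)
  rw [Real.fourierInv_eq'] at h1
  have h2 : ∫ w : ℝ, Complex.exp ((↑(2 * Real.pi * inner ℝ w v) * Complex.I)) •
      𝓕 (fun v => (tri v : ℂ)) w
      = ∫ w : ℝ, (fun ξ : ℝ => (fej ξ : ℂ) * Complex.exp (ξ * v * Complex.I)) (2 * Real.pi * w) := by
    refine integral_congr_ae ?_
    filter_upwards [hae] with w hw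
    rw [hw, smul_eq_mul, mul_comm]
    congr 2
    simp
    ring
  rw [h2, Measure.integral_comp_mul_left
    (fun ξ : ℝ => (fej ξ : ℂ) * Complex.exp (ξ * v * Complex.I)), abs_of_pos (by positivity), Complex.real_smul] at h1
  have h3 : (2 * Real.pi : ℂ) ≠ 0 := by
    have : (Real.pi : ℂ) ≠ 0 := by exact_mod_cast hπ.ne'
    simp [this]
  rw [← h1, Complex.ofReal_inv, Complex.ofReal_mul, Complex.ofReal_ofNat, ← mul_assoc,
    mul_inv_cancel₀ h3, one_mul]

/-- The smoothing kernel at scale `1/T`. -/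
noncomputable def kr (T v : ℝ) : ℝ := T * tri (T * v)

/-- The weight on the dual side. -/
noncomputable def wk (T t : ℝ) : ℝ := fej (T⁻¹ * t)

lemma wk_nonneg (T t : ℝ) : 0 ≤ wk T t := fej_nonneg _

lemma wk_le {T : ℝ} (hT : 0 < T) (t : ℝ) : wk T t ≤ 4 * T ^ 2 / t ^ 2 := by
  refine (fej_le _).trans (le_of_eq ?_)
  rw [mul_pow, inv_pow]
  by_cases ht : t = 0
  · simp [ht]
  · field_simp

lemma integrable_wk {T : ℝ} (hT : 0 < T) : Integrable (wk T) :=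
  integrable_fej.comp_mul_left' (inv_ne_zero hT.ne')

lemma integral_wk_mul {T : ℝ} (hT : 0 < T) (v : ℝ) :
    ∫ t : ℝ, (wk T t : ℂ) * Complex.exp (t * v * Complex.I) = 2 * Real.pi * kr T v := by
  have h : ∫ t : ℝ, (wk T t : ℂ) * Complex.exp (t * v * Complex.I)
      = ∫ t : ℝ, (fun ξ : ℝ => (fej ξ : ℂ) * Complex.exp (ξ * (T * v : ℝ) * Complex.I)) (T⁻¹ * t) := by
    congr 1; funext t
    simp only [wk]
    congr 2
    push_cast
    have : (T : ℂ) ≠ 0 := by exact_mod_cast hT.ne'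
    field_simp
  rw [h, Measure.integral_comp_mul_left
    (fun ξ : ℝ => (fej ξ : ℂ) * Complex.exp (ξ * (T * v : ℝ) * Complex.I)), integral_fej, inv_inv, abs_of_pos hT, kr, Complex.real_smul]
  push_cast; ring

lemma kr_nonneg {T : ℝ} (hT : 0 ≤ T) (v : ℝ) : 0 ≤ kr T v := mul_nonneg hT (tri_nonneg _)

lemma kr_le {T : ℝ} (hT : 0 ≤ T) (v : ℝ) : kr T v ≤ T := mul_le_of_le_one_right hT (tri_le_one _)

lemma kr_eq_zero {T v : ℝ} (hT : 0 < T) (hv : 1 / T ≤ |v|) : kr T v = 0 := by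
  rw [kr, tri_eq_zero, mul_zero]
  rw [abs_mul, abs_of_pos hT]
  rwa [div_le_iff₀' hT] at hv

lemma abs_kr_sub_le {T : ℝ} (hT : 0 ≤ T) (v w : ℝ) : |kr T v - kr T w| ≤ T ^ 2 * |v - w| := by
  rw [kr, kr, ← mul_sub, abs_mul, abs_of_nonneg hT, pow_two, mul_assoc]
  refine mul_le_mul_of_nonneg_left ((abs_tri_sub_le _ _).trans (le_of_eq ?_)) hT
  rw [← mul_sub, abs_mul, abs_of_nonneg hT]

lemma integral_wk_le {T : ℝ} (hT : 0 < T) : ∫ t, wk T t ≤ 2 * Real.pi * T := by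
  have h := integral_wk_mul hT 0
  have h2 : ∫ t : ℝ, (wk T t : ℂ) * Complex.exp (t * (0 : ℝ) * Complex.I) = ((∫ t, wk T t : ℝ) : ℂ) := by
    rw [← integral_complex_ofReal]
    simp
  rw [h2] at h
  have h3 : (∫ t, wk T t) = 2 * Real.pi * kr T 0 := by exact_mod_cast h
  rw [h3]
  have := kr_le hT.le 0
  have := Real.pi_pos
  gcongr

lemma integral_wk_tail_le {T A : ℝ} (hT : 0 < T) (hA : 0 < A) :
    ∫ t in {t : ℝ | A < |t|}, wk T t ≤ 8 * T ^ 2 / A := by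
  have hset : {t : ℝ | A < |t|} = Set.Iio (-A) ∪ Set.Ioi A := by
    ext t
    simp only [Set.mem_ofPred_eq, Set.mem_union, Set.mem_Iio, Set.mem_Ioi, lt_abs]
    constructor
    · rintro (h | h)
      · exact Or.inr h
      · exact Or.inl (by linarith)
    · rintro (h | h)
      · exact Or.inr (by linarith)
      · exact Or.inl h
  have hsq : ∀ t : ℝ, 0 < t → 4 * T ^ 2 / t ^ 2 = 4 * T ^ 2 * t ^ (-2 : ℝ) := by
    intro t ht
    rw [Real.rpow_neg ht.le, div_eq_mul_inv]
    norm_num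
  have hI : IntegrableOn (fun t : ℝ => 4 * T ^ 2 * t ^ (-2 : ℝ)) (Set.Ioi A) :=
    (integrableOn_Ioi_rpow_of_lt (by norm_num) hA).const_mul _
  have hpos : ∫ t in Set.Ioi A, wk T t ≤ 4 * T ^ 2 / A := by
    calc ∫ t in Set.Ioi A, wk T t ≤ ∫ t in Set.Ioi A, 4 * T ^ 2 * t ^ (-2 : ℝ) := by
          refine setIntegral_mono_on (integrable_wk hT).integrableOn hI measurableSet_Ioi ?_
          intro t ht
          rw [← hsq t (hA.trans ht)]
          exact wk_le hT t
      _ = 4 * T ^ 2 / A := by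
          rw [integral_const_mul, integral_Ioi_rpow_of_lt (by norm_num) hA]
          norm_num
          rw [Real.rpow_neg_one]; ring
  have hneg : ∫ t in Set.Iio (-A), wk T t ≤ 4 * T ^ 2 / A := by
    have : ∫ t in Set.Iio (-A), wk T t = ∫ t in Set.Ioi A, wk T t := by
      have h := integral_comp_neg_Ioi A (wk T)
      rw [← integral_Iic_eq_integral_Iio, ← h]
      refine integral_congr_ae (Filter.Eventually.of_forall fun t => ?_)
      simp [wk, fej]
    rw [this]; exact hpos
  rw [hset, setIntegral_union ?_ measurableSet_Ioi (integrable_wk hT).integrableOn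
    (integrable_wk hT).integrableOn]
  · have : 8 * T ^ 2 / A = 4 * T ^ 2 / A + 4 * T ^ 2 / A := by ring
    linarith
  · rw [Set.disjoint_left]
    intro t h1 h2
    simp only [Set.mem_Iio, Set.mem_Ioi] at h1 h2
    linarith

end Kernel

section DirichletIntegral

open MeasureTheory

lemma tw_eq_exp (t : ℝ) {n : ℕ} (hn : 0 < n) :
    tw t n = Complex.exp (-(t * Real.log n) * Complex.I) := by
  rw [tw, Complex.cpow_def_of_ne_zero (by exact_mod_cast hn.ne'), ← Complex.natCast_log]
  congr 1; push_cast; ring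

lemma continuous_tw {n : ℕ} (hn : 0 < n) : Continuous fun t => tw t n := by
  have : (fun t => tw t n) = fun t : ℝ => Complex.exp (-(t * Real.log n) * Complex.I) := by
    funext t; exact tw_eq_exp t hn
  rw [this]; fun_prop

lemma continuous_pt (δ : ℝ) : Continuous (pt δ) := by unfold pt; fun_prop

lemma continuous_LSeries_pt {f : ℕ → ℂ} (hf : LSeries.abscissaOfAbsConv f ≤ 1) {δ : ℝ} (hδ : 0 < δ) :
    Continuous fun t => LSeries f (pt δ t) := by
  refine continuous_iff_continuousAt.2 fun t => ?_
  have h := (hasDerivAt_LSeries_logk hf 0 (one_lt_pt_re hδ t)).continuousAt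
  rw [logk_zero] at h
  exact h.comp (continuous_pt δ).continuousAt

lemma norm_term_pt (f : ℕ → ℂ) (δ t : ℝ) (n : ℕ) :
    ‖LSeries.term f (pt δ t) n‖ = ‖LSeries.term f (pt δ 0) n‖ := by
  rw [LSeries.norm_term_eq, LSeries.norm_term_eq, pt_re, pt_re]

lemma norm_LSeries_pt_le {f : ℕ → ℂ} (hf : LSeries.abscissaOfAbsConv f ≤ 1) {δ : ℝ} (hδ : 0 < δ)
    (t : ℝ) : ‖LSeries f (pt δ t)‖ ≤ ∑' n, ‖LSeries.term f (pt δ 0) n‖ := by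
  have hs := summable_logk hf 0 (one_lt_pt_re hδ t)
  rw [logk_zero] at hs
  refine (norm_tsum_le_tsum_norm hs.norm).trans (le_of_eq ?_)
  exact tsum_congr fun n => norm_term_pt f δ t n

lemma term_pt (f : ℕ → ℂ) (δ t : ℝ) {n : ℕ} (hn : 0 < n) :
    LSeries.term f (pt δ t) n = f n * tw t n * ((n : ℝ) ^ (-1 - δ) : ℝ) := by
  have := term_logk f 0 δ t hn
  rw [logk_zero] at this
  rw [this, logWt, pow_zero, one_mul]

lemma integral_tw_wk {T : ℝ} (hT : 0 < T) (u : ℝ) {n : ℕ} (hn : 0 < n) :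
    ∫ t : ℝ, tw t n * (Complex.exp (t * u * Complex.I) * wk T t)
      = 2 * Real.pi * kr T (u - Real.log n) := by
  rw [← integral_wk_mul hT]
  congr 1; funext t
  rw [tw_eq_exp t hn, ← mul_assoc, ← Complex.exp_add, mul_comm]
  congr 2
  push_cast; ring

lemma integral_LSeries_wk {f : ℕ → ℂ} (hf : LSeries.abscissaOfAbsConv f ≤ 1) {δ : ℝ} (hδ : 0 < δ)
    {T : ℝ} (hT : 0 < T) {u : ℝ} {N : ℕ} (hN : u + 1 / T ≤ Real.log (N + 1)) :
    ∫ t : ℝ, LSeries f (pt δ t) * (Complex.exp (t * u * Complex.I) * wk T t)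
      = 2 * Real.pi * ∑ n ∈ Ioc 0 N, f n * (((n : ℝ) ^ (-1 - δ) * kr T (u - Real.log n) : ℝ) : ℂ) := by
  have hs := summable_logk hf 0 (one_lt_pt_re hδ 0)
  rw [logk_zero] at hs
  have hW := integrable_wk hT
  set F : ℕ → ℝ → ℂ := fun n t => LSeries.term f (pt δ t) n *
    (Complex.exp (t * u * Complex.I) * wk T t) with hF
  have hn : ∀ n t, ‖F n t‖ = ‖LSeries.term f (pt δ 0) n‖ * wk T t := by
    intro n t
    rw [hF]
    simp only
    rw [norm_mul, norm_mul, norm_term_pt, show (t : ℂ) * u * Complex.I = ((t * u : ℝ) : ℂ) * Complex.I by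
      push_cast; ring, Complex.norm_exp_ofReal_mul_I, one_mul, Complex.norm_real, Real.norm_eq_abs,
      abs_of_nonneg (wk_nonneg _ _)]
  have hmeas : ∀ n, AEStronglyMeasurable (F n) := by
    intro n
    rcases Nat.eq_zero_or_pos n with rfl | hn
    · have : F 0 = fun _ => 0 := by funext t; simp [hF]
      rw [this]; exact aestronglyMeasurable_const
    · have h1 : Continuous fun t => LSeries.term f (pt δ t) n := by
        have : (fun t => LSeries.term f (pt δ t) n)
            = fun t => f n * tw t n * ((n : ℝ) ^ (-1 - δ) : ℝ) := by
          funext t; exact term_pt f δ t hn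
        rw [this]
        have := continuous_tw hn
        fun_prop
      refine h1.aestronglyMeasurable.mul (Continuous.aestronglyMeasurable ?_ |>.mul
        hW.ofReal.aestronglyMeasurable)
      fun_prop
  have hInt : ∀ n, Integrable (F n) := fun n => by
    refine (hW.const_mul ‖LSeries.term f (pt δ 0) n‖).mono' (hmeas n) ?_
    filter_upwards with t
    rw [hn]
  have hsum : Summable fun n => ∫ t, ‖F n t‖ := by
    simp only [hn, integral_const_mul]
    exact hs.norm.mul_right _
  have h := hasSum_integral_of_summable_integral_norm hInt hsum
  have h1 : ∫ t : ℝ, LSeries f (pt δ t) * (Complex.exp (t * u * Complex.I) * wk T t)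
      = ∫ t, ∑' n, F n t := by
    congr 1; funext t
    rw [hF]; simp only
    rw [tsum_mul_right]; rfl
  have h2 : ∀ n, ∫ t, F n t = if n = 0 then 0 else
      2 * Real.pi * (f n * (((n : ℝ) ^ (-1 - δ) * kr T (u - Real.log n) : ℝ) : ℂ)) := by
    intro n
    rcases Nat.eq_zero_or_pos n with rfl | hn
    · simp [hF]
    · rw [if_neg hn.ne']
      have : F n = fun t => (f n * ((n : ℝ) ^ (-1 - δ) : ℝ)) *
          (tw t n * (Complex.exp (t * u * Complex.I) * wk T t)) := by
        funext t; rw [hF]; simp only; rw [term_pt f δ t hn]; ring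
      rw [this, integral_const_mul, integral_tw_wk hT u hn]
      push_cast; ring
  rw [h1, ← h.tsum_eq, tsum_eq_sum (s := Ioc 0 N), Finset.mul_sum]
  · refine Finset.sum_congr rfl fun n hn => ?_
    rw [h2, if_neg (by have := (mem_Ioc.1 hn).1; omega)]
  · intro n hn
    rw [h2]
    split_ifs with h0
    · rfl
    · have hnN : N + 1 ≤ n := by
        by_contra hc
        exact hn (mem_Ioc.2 ⟨by omega, by omega⟩)
      have : Real.log (N + 1) ≤ Real.log n :=
        Real.log_le_log (by positivity) (by exact_mod_cast hnN)
      rw [kr_eq_zero hT]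
      · simp
      · rw [abs_of_nonpos] <;> linarith [one_div_pos.2 hT]

lemma conj_tw (t : ℝ) {n : ℕ} (hn : 0 < n) :
    (starRingEnd ℂ) (tw t n) = Complex.exp (t * Real.log n * Complex.I) := by
  rw [tw_eq_exp t hn, ← Complex.exp_conj, map_mul, map_neg, map_mul, Complex.conj_ofReal,
    Complex.conj_ofReal, Complex.conj_I]
  congr 1; ring

lemma sum_char_mul_conj {q : ℕ} (hq : 0 < q) {m n : ℕ} (hm : IsUnit (m : ZMod q)) :
    ∑ χ : DirichletCharacter ℂ q, χ (n : ZMod q) * (starRingEnd ℂ) (χ (m : ZMod q))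
      = if (n : ZMod q) = m then (q.totient : ℂ) else 0 := by
  have : NeZero q := ⟨hq.ne'⟩
  have h := DirichletCharacter.sum_char_inv_mul_char_eq ℂ hm (n : ZMod q)
  have e : (if (n : ZMod q) = m then (q.totient : ℂ) else 0)
      = if (m : ZMod q) = n then (q.totient : ℂ) else 0 := by
    simp only [eq_comm]
  rw [e, ← h]
  refine Finset.sum_congr rfl fun χ _ => ?_
  rw [mul_comm]
  congr 1
  have h2 := MulChar.inv_apply_eq_inv' χ (m : ZMod q)
  have h3 : (m : ZMod q)⁻¹ = Ring.inverse (m : ZMod q) := by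
    obtain ⟨u, hu⟩ := hm
    rw [← hu, Ring.inverse_unit, ZMod.inv_coe_unit]
  rw [h3, ← MulChar.inv_apply, ← MulChar.star_apply']
  rfl

/-- Mean value theorem for nonnegative coefficients satisfying a Brun–Titchmarsh bound. -/
lemma sum_integral_sq_le {q : ℕ} (hq : 0 < q) {a : ℕ → ℝ} (ha : ∀ n, 0 ≤ a n)
    (hunit : ∀ n, a n ≠ 0 → IsUnit (n : ZMod q)) {T K δ : ℝ} (hT : 1 ≤ T) (hδ : 0 < δ) (hδ1 : δ ≤ 1)
    {N : ℕ}
    (hK : ∀ n, 0 < n → a n ≠ 0 → ∑ m ∈ (Ioc 0 N).filter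
      (fun m : ℕ => (m : ZMod q) = n ∧ |Real.log m - Real.log n| < 1 / T), a m
        ≤ K * (n / (T * q.totient))) :
    ∑ χ : DirichletCharacter ℂ q, ∫ t : ℝ,
      ‖∑ n ∈ Ioc 0 N, (χ (n : ZMod q) * a n) * tw t n * ((n : ℝ) ^ (-1 - δ) : ℝ)‖ ^ 2 * wk T t
      ≤ 2 * Real.pi * Real.exp 2 * K * ∑ n ∈ Ioc 0 N, a n * (n : ℝ) ^ (-1 - 2 * δ) := by
  have hT0 : 0 < T := by linarith
  have hφ : 0 < (q.totient : ℝ) := by exact_mod_cast Nat.totient_pos.2 hq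
  have hexpand : ∀ χ : DirichletCharacter ℂ q, ∀ t : ℝ,
      ((‖∑ n ∈ Ioc 0 N, (χ (n : ZMod q) * a n) * tw t n * ((n : ℝ) ^ (-1 - δ) : ℝ)‖ ^ 2 * wk T t : ℝ) : ℂ)
      = ∑ n ∈ Ioc 0 N, ∑ m ∈ Ioc 0 N, (χ (n : ZMod q) * (starRingEnd ℂ) (χ (m : ZMod q))) *
        ((a n * a m * ((n : ℝ) ^ (-1 - δ) * (m : ℝ) ^ (-1 - δ)) : ℝ) : ℂ) *
        (tw t n * (Complex.exp (t * Real.log m * Complex.I) * wk T t)) := by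
    intro χ t
    push_cast
    rw [← Complex.mul_conj', map_sum, Finset.sum_mul_sum, Finset.sum_mul]
    refine Finset.sum_congr rfl fun n _ => ?_
    rw [Finset.sum_mul]
    refine Finset.sum_congr rfl fun m hm => ?_
    rw [map_mul, map_mul, map_mul, conj_tw t (mem_Ioc.1 hm).1, Complex.conj_ofReal, Complex.conj_ofReal]
    push_cast
    ring
  have hInt : ∀ n ∈ Ioc 0 N, ∀ m ∈ Ioc 0 N, Integrable fun t : ℝ =>
      tw t n * (Complex.exp (t * Real.log m * Complex.I) * wk T t) := by
    intro n hn m _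
    refine (integrable_wk hT0).mono' ?_ ?_
    · refine (continuous_tw (mem_Ioc.1 hn).1).aestronglyMeasurable.mul
        (Continuous.aestronglyMeasurable ?_ |>.mul (integrable_wk hT0).ofReal.aestronglyMeasurable)
      fun_prop
    · filter_upwards with t
      rw [norm_mul, norm_mul, norm_tw (mem_Ioc.1 hn).1, one_mul,
        show (t : ℂ) * Real.log m * Complex.I = ((t * Real.log m : ℝ) : ℂ) * Complex.I by push_cast; ring,
        Complex.norm_exp_ofReal_mul_I, one_mul, Complex.norm_real, Real.norm_eq_abs,
        abs_of_nonneg (wk_nonneg _ _)]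
  have hI : ∀ χ : DirichletCharacter ℂ q, ((∫ t : ℝ,
      ‖∑ n ∈ Ioc 0 N, (χ (n : ZMod q) * a n) * tw t n * ((n : ℝ) ^ (-1 - δ) : ℝ)‖ ^ 2 * wk T t : ℝ) : ℂ)
      = ∑ n ∈ Ioc 0 N, ∑ m ∈ Ioc 0 N, (χ (n : ZMod q) * (starRingEnd ℂ) (χ (m : ZMod q))) *
        ((a n * a m * ((n : ℝ) ^ (-1 - δ) * (m : ℝ) ^ (-1 - δ)) * (2 * Real.pi *
          kr T (Real.log m - Real.log n)) : ℝ) : ℂ) := by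
    intro χ
    rw [← integral_complex_ofReal]
    simp only [hexpand]
    rw [integral_finsetSum _ fun n hn => integrable_finsetSum _ fun m hm =>
      (hInt n hn m hm).const_mul _]
    refine Finset.sum_congr rfl fun n hn => ?_
    rw [integral_finsetSum _ fun m hm => (hInt n hn m hm).const_mul _]
    refine Finset.sum_congr rfl fun m hm => ?_
    rw [integral_const_mul, integral_tw_wk hT0 _ (mem_Ioc.1 hn).1]
    push_cast; ring
  have hS : ∑ χ : DirichletCharacter ℂ q, ∫ t : ℝ,
      ‖∑ n ∈ Ioc 0 N, (χ (n : ZMod q) * a n) * tw t n * ((n : ℝ) ^ (-1 - δ) : ℝ)‖ ^ 2 * wk T t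
      = ∑ n ∈ Ioc 0 N, ∑ m ∈ Ioc 0 N, (if (n : ZMod q) = m then (q.totient : ℝ) else 0) *
        (a n * a m * ((n : ℝ) ^ (-1 - δ) * (m : ℝ) ^ (-1 - δ)) * (2 * Real.pi *
          kr T (Real.log m - Real.log n))) := by
    rw [← Complex.ofReal_inj, Complex.ofReal_sum, Finset.sum_congr rfl fun χ _ => hI χ,
      Finset.sum_comm, Complex.ofReal_sum]
    refine Finset.sum_congr rfl fun n _ => ?_
    rw [Finset.sum_comm, Complex.ofReal_sum]
    refine Finset.sum_congr rfl fun m _ => ?_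
    rw [← Finset.sum_mul]
    by_cases hm : a m = 0
    · simp [hm]
    · rw [sum_char_mul_conj hq (hunit m hm)]
      split_ifs <;> push_cast <;> ring
  rw [hS, Finset.mul_sum]
  refine Finset.sum_le_sum fun n hn => ?_
  have hn0 := (mem_Ioc.1 hn).1
  have hn1 : (0 : ℝ) < n := by exact_mod_cast hn0
  by_cases han : a n = 0
  · simp [han]
  have hterm : ∀ m ∈ Ioc 0 N, (if (n : ZMod q) = m then (q.totient : ℝ) else 0) *
        (a n * a m * ((n : ℝ) ^ (-1 - δ) * (m : ℝ) ^ (-1 - δ)) * (2 * Real.pi *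
          kr T (Real.log m - Real.log n)))
      ≤ if ((m : ZMod q) = n ∧ |Real.log m - Real.log n| < 1 / T) then
        (q.totient * (a n * ((n : ℝ) ^ (-1 - δ) * (Real.exp 2 * (n : ℝ) ^ (-1 - δ))) *
          (2 * Real.pi * T))) * a m else 0 := by
    intro m hm
    have hm0 : (0 : ℝ) < m := by exact_mod_cast (mem_Ioc.1 hm).1
    by_cases h1 : (m : ZMod q) = n
    · by_cases h2 : |Real.log m - Real.log n| < 1 / T
      · rw [if_pos h1.symm, if_pos ⟨h1, h2⟩]
        have h3 : (m : ℝ) ^ (-1 - δ) ≤ Real.exp 2 * (n : ℝ) ^ (-1 - δ) := by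
          rw [Real.rpow_def_of_pos hm0, Real.rpow_def_of_pos hn1, ← Real.exp_add]
          refine Real.exp_le_exp.2 ?_
          have h4 : 1 / T ≤ 1 := by rw [div_le_one hT0]; exact hT
          have h5 := (abs_lt.1 h2).1
          nlinarith
        have h4 := kr_le hT0.le (Real.log m - Real.log n)
        have h5 := kr_nonneg hT0.le (Real.log m - Real.log n)
        have := ha n
        have := ha m
        have := Real.pi_pos
        calc _ ≤ (q.totient : ℝ) * (a n * a m * ((n : ℝ) ^ (-1 - δ) * (Real.exp 2 * (n : ℝ) ^ (-1 - δ)))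
              * (2 * Real.pi * T)) := by gcongr
          _ = _ := by ring
      · simp only [kr_eq_zero hT0 (not_lt.1 h2), h2, and_false, if_false, mul_zero, le_refl]
    · simp only [h1, Ne.symm h1, false_and, if_false, zero_mul, le_refl]
  refine (Finset.sum_le_sum hterm).trans ?_
  rw [← Finset.sum_filter, ← Finset.mul_sum]
  have := ha n
  have := Real.pi_pos
  refine (mul_le_mul_of_nonneg_left (hK n hn0 han) (by positivity)).trans (le_of_eq ?_)
  have e : (n : ℝ) ^ (-1 - 2 * δ) = (n : ℝ) ^ (-1 - δ) * (n : ℝ) ^ (-1 - δ) * n := by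
    rw [← Real.rpow_add hn1]
    nth_rewrite 3 [← Real.rpow_one (n : ℝ)]
    rw [← Real.rpow_add hn1]
    congr 1; ring
  rw [e]
  field_simp

/-- The same bound for the full Dirichlet series. -/
lemma sum_integral_LSeries_sq_le {q : ℕ} (hq : 0 < q) {a : ℕ → ℝ} (ha : ∀ n, 0 ≤ a n)
    (hunit : ∀ n, a n ≠ 0 → IsUnit (n : ZMod q))
    (habs : ∀ χ : DirichletCharacter ℂ q,
      LSeries.abscissaOfAbsConv (fun n => χ (n : ZMod q) * a n) ≤ 1)
    {T K B δ : ℝ} (hT : 1 ≤ T) (hδ : 0 < δ) (hδ1 : δ ≤ 1) (hK0 : 0 ≤ K)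
    (hK : ∀ N n : ℕ, 0 < n → a n ≠ 0 → ∑ m ∈ (Ioc 0 N).filter
      (fun m : ℕ => (m : ZMod q) = n ∧ |Real.log m - Real.log n| < 1 / T), a m
        ≤ K * (n / (T * q.totient)))
    (hB : ∀ N, ∑ n ∈ Ioc 0 N, a n * (n : ℝ) ^ (-1 - 2 * δ) ≤ B) :
    ∑ χ : DirichletCharacter ℂ q, ∫ t : ℝ,
      ‖LSeries (fun n => χ (n : ZMod q) * a n) (pt δ t)‖ ^ 2 * wk T t
      ≤ 2 * Real.pi * Real.exp 2 * K * B := by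
  have hT0 : 0 < T := by linarith
  have hW := integrable_wk hT0
  have hsumm : ∀ χ : DirichletCharacter ℂ q, ∀ t, LSeriesSummable (fun n => χ (n : ZMod q) * a n) (pt δ t) := by
    intro χ t
    have := summable_logk (habs χ) 0 (one_lt_pt_re hδ t)
    rwa [logk_zero] at this
  have hlim : Filter.Tendsto (fun N : ℕ => ∑ χ : DirichletCharacter ℂ q, ∫ t : ℝ,
      ‖∑ n ∈ Ioc 0 N, (χ (n : ZMod q) * a n) * tw t n * ((n : ℝ) ^ (-1 - δ) : ℝ)‖ ^ 2 * wk T t)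
      Filter.atTop (nhds (∑ χ : DirichletCharacter ℂ q, ∫ t : ℝ,
      ‖LSeries (fun n => χ (n : ZMod q) * a n) (pt δ t)‖ ^ 2 * wk T t)) := by
    refine tendsto_finsetSum _ fun χ _ => ?_
    set f : ℕ → ℂ := fun n => χ (n : ZMod q) * a n with hf
    set S := ∑' n, ‖LSeries.term f (pt δ 0) n‖ with hS
    have hpart : ∀ (N : ℕ) (t : ℝ), ∑ n ∈ Ioc 0 N, (χ (n : ZMod q) * a n) * tw t n * ((n : ℝ) ^ (-1 - δ) : ℝ)
        = ∑ n ∈ Ioc 0 N, LSeries.term f (pt δ t) n := fun N t =>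
      Finset.sum_congr rfl fun n hn => (term_pt f δ t (mem_Ioc.1 hn).1).symm
    refine tendsto_integral_of_dominated_convergence (fun t => S ^ 2 * wk T t) ?_ (hW.const_mul _) ?_ ?_
    · intro N
      refine AEStronglyMeasurable.mul (Continuous.aestronglyMeasurable ?_) hW.aestronglyMeasurable
      refine Continuous.pow (Continuous.norm (continuous_finsetSum _ fun n hn => ?_)) 2
      have := continuous_tw (mem_Ioc.1 hn).1
      fun_prop
    · intro N
      filter_upwards with t
      rw [Real.norm_eq_abs, abs_of_nonneg (mul_nonneg (by positivity) (wk_nonneg _ _)), hpart]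
      refine mul_le_mul_of_nonneg_right (pow_le_pow_left₀ (norm_nonneg _) ?_ 2) (wk_nonneg _ _)
      refine (norm_sum_le _ _).trans ?_
      simp only [norm_term_pt f δ t]
      exact (hsumm χ 0).norm.sum_le_tsum _ fun _ _ => norm_nonneg _
    · filter_upwards with t
      simp only [hpart]
      exact ((tendsto_sum_term (hsumm χ t)).norm.pow 2).mul_const _
  refine le_of_tendsto hlim (Filter.Eventually.of_forall fun N => ?_)
  refine (sum_integral_sq_le hq ha hunit hT hδ hδ1 (hK N)).trans ?_
  have := Real.pi_pos
  gcongr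
  exact hB N

end DirichletIntegral

section MeanSquares

open ArithmeticFunction

/-- A multiplicative window around `n` is contained in an interval of comparable length. -/
lemma exists_window {T n : ℝ} (hT : 2 ≤ T) (hn : 2 * T ≤ n) : ∃ M N : ℕ, M ≤ N ∧ (N : ℝ) ≤ 2 * n ∧
    n / T ≤ (N : ℝ) - M ∧ (N : ℝ) - M ≤ 4 * (n / T) ∧ n / 4 ≤ M ∧
    ∀ m : ℕ, 0 < m → |Real.log m - Real.log n| < 1 / T → M < m ∧ m ≤ N := by
  have hT0 : 0 < T := by linarith
  have hn0 : 0 < n := by linarith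
  set w := n / T with hw
  have hw2 : 2 ≤ w := by rw [hw, le_div_iff₀ hT0]; linarith
  have hwn : 2 * w ≤ n := by rw [hw]; rw [mul_div_assoc', div_le_iff₀ hT0]; nlinarith
  have f1 := Nat.floor_le (show 0 ≤ n - w by linarith)
  have f2 := Nat.lt_floor_add_one (n - w)
  have f3 := Nat.floor_le (show 0 ≤ n + 2 * w by linarith)
  have f4 := Nat.lt_floor_add_one (n + 2 * w)
  refine ⟨⌊n - w⌋₊, ⌊n + 2 * w⌋₊, Nat.floor_le_floor (by linarith), by linarith, by linarith,
    by linarith, by linarith, fun m hm h => ?_⟩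
  have hm0 : (0 : ℝ) < m := by exact_mod_cast hm
  obtain ⟨h1, h2⟩ := abs_lt.1 h
  have hT1 : 0 < 1 / T := by positivity
  have hT2 : 1 / T ≤ 1 / 2 := one_div_le_one_div_of_le (by norm_num) hT
  constructor
  · rw [Nat.floor_lt (by linarith)]
    have h3 : n * Real.exp (-(1 / T)) < m := by
      rw [← Real.log_lt_log_iff (by positivity) hm0, Real.log_mul hn0.ne' (Real.exp_ne_zero _),
        Real.log_exp]
      linarith
    have h4 := Real.add_one_le_exp (-(1 / T))
    have h5 : n * (-(1 / T) + 1) = n - w := by rw [hw]; field_simp; ring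
    nlinarith [mul_le_mul_of_nonneg_left h4 hn0.le]
  · refine Nat.le_floor ?_
    have h3 : m < n * Real.exp (1 / T) := by
      rw [← Real.log_lt_log_iff hm0 (by positivity), Real.log_mul hn0.ne' (Real.exp_ne_zero _),
        Real.log_exp]
      linarith
    have h4 := abs_le.1 (Real.abs_exp_sub_one_sub_id_le (x := 1 / T) (by rw [abs_of_pos hT1]; linarith))
    have h6 : Real.exp (1 / T) ≤ 1 + 2 * (1 / T) := by nlinarith [h4.2]
    have h5 : n * (1 + 2 * (1 / T)) = n + 2 * w := by rw [hw]; field_simp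
    nlinarith [mul_le_mul_of_nonneg_left h6 hn0.le]

lemma isUnit_of_sift {y q n : ℕ} (hq : 0 < q) (hqy : q ≤ y) (h : sift 1 y n = 1) :
    IsUnit (n : ZMod q) := by
  rw [ZMod.isUnit_iff_coprime]
  refine Nat.coprime_of_dvd fun p hp hpn hpq => ?_
  have := sift_one_eq_one_iff.1 h p hp hpn
  have := Nat.le_of_dvd hq hpq
  omega

lemma lt_of_sift {y n : ℕ} (h : sift 1 y n = 1) (hn0 : 0 < n) (hn1 : n ≠ 1) : y < n := by
  by_contra hc
  exact hn1 (eq_one_of_sift h (not_lt.1 hc) hn0)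

lemma sum_integral_rough_sub_one_le (b : ℕ) (hb : 627 ≤ b) : ∃ C : ℝ, 1 ≤ C ∧ ∀ Z : ℕ, 2 ≤ Z →
    ∀ q : ℕ, 0 < q → q ≤ Z → ∀ δ : ℝ, 0 < δ → δ ≤ 1 → δ * Real.log Z ≤ 1 →
      ∑ χ : DirichletCharacter ℂ q, ∫ t : ℝ,
        ‖LSeries (chSeq (rchar (Z ^ b) χ)) (pt δ t) - 1‖ ^ 2 * wk Z t
      ≤ C * (1 / (Real.log Z ^ 2 * δ)) := by
  refine ⟨2 * Real.pi * Real.exp 2 * 12 * 10, ?_, fun Z hZ q hq hqZ δ hδ hδ1 hδZ => ?_⟩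
  · nlinarith [Real.pi_gt_three, Real.add_one_le_exp 2]
  have hZ' : (2 : ℝ) ≤ Z := by exact_mod_cast hZ
  have hl := half_le_log hZ
  set l := Real.log Z with hldef
  have hl0 : 0 < l := by linarith
  set a : ℕ → ℝ := fun n => if n = 1 then 0 else sift 1 (Z ^ b) n with ha
  have ha0 : ∀ n, 0 ≤ a n := fun n => by
    simp only [ha]; split_ifs; exacts [le_rfl, sift_nonneg _ _ _]
  have ha1 : ∀ n, a n ≤ sift 1 (Z ^ b) n := fun n => by
    simp only [ha]; split_ifs; exacts [sift_nonneg _ _ _, le_rfl]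
  have hane : ∀ n, a n ≠ 0 → n ≠ 1 ∧ sift 1 (Z ^ b) n = 1 := fun n hn => by
    simp only [ha] at hn
    split_ifs at hn with h
    · exact absurd rfl hn
    · exact ⟨h, (sift_eq_zero_or_one _ _ _).resolve_left hn⟩
  have hqb : q ≤ Z ^ b := hqZ.trans (Nat.le_self_pow (by omega) _)
  have hbd : ∀ χ : DirichletCharacter ℂ q, ∀ n : ℕ, ‖χ (n : ZMod q) * a n‖ ≤ 1 := fun χ n => by
    rw [norm_mul, Complex.norm_real, Real.norm_eq_abs, abs_of_nonneg (ha0 n)]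
    exact mul_le_one₀ (χ.norm_le_one n) (ha0 n) ((ha1 n).trans (sift_le_one _ _ _))
  have habs : ∀ χ : DirichletCharacter ℂ q,
      LSeries.abscissaOfAbsConv (fun n => χ (n : ZMod q) * a n) ≤ 1 := fun χ =>
    LSeries.abscissaOfAbsConv_le_of_le_const ⟨1, fun n _ => hbd χ n⟩
  have hmain := sum_integral_LSeries_sq_le hq ha0 (fun n hn => isUnit_of_sift hq hqb (hane n hn).2)
    habs (T := (Z : ℝ)) (K := 12 / l) (B := 5 / (l * δ) * 2) (by linarith) hδ hδ1 (by positivity)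
    (fun N n hn hann => ?_) (fun N => ?_)
  · refine le_trans (le_of_eq ?_) (hmain.trans (le_of_eq ?_))
    · refine Finset.sum_congr rfl fun χ _ => ?_
      congr 1; funext t
      have hs := one_lt_pt_re hδ t
      have hs1 : LSeriesSummable (chSeq (rchar (Z ^ b) χ)) (pt δ t) := by
        have := summable_logk (abscissa_chSeq (rchar (Z ^ b) χ)) 0 hs
        rwa [logk_zero] at this
      have hdel : LSeriesSummable LSeries.delta (pt δ t) := by
        refine LSeriesSummable_of_bounded_of_one_lt_re (m := 1) (fun n _ => ?_) hs
        rw [LSeries.delta]; split_ifs <;> simp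
      have e : LSeries (fun n => χ (n : ZMod q) * a n) (pt δ t)
          = LSeries (chSeq (rchar (Z ^ b) χ)) (pt δ t) - 1 := by
        rw [show (1 : ℂ) = LSeries LSeries.delta (pt δ t) by rw [LSeries_delta]; rfl,
          ← LSeries_sub hs1 hdel]
        refine LSeries_congr (fun {n} hn => ?_) _
        simp only [Pi.sub_apply, chSeq, rchar_apply, LSeries.delta, ha]
        split_ifs with h
        · subst h
          rw [(sift_one_eq_one_iff (y := Z ^ b) (n := 1)).2 (fun p hp h1 => absurd (Nat.dvd_one.1 h1) hp.ne_one)]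
          simp
        · ring
      rw [e]
    · field_simp; ring
  · obtain ⟨hn1, hs⟩ := hane n hann
    have hnb := lt_of_sift hs hn hn1
    have hnb' : (Z : ℝ) ^ 627 ≤ n := by
      have h3 : Z ^ 627 ≤ Z ^ b := Nat.pow_le_pow_right (by omega) hb
      have h4 : ((Z ^ 627 : ℕ) : ℝ) ≤ n := Nat.cast_le.2 (h3.trans hnb.le)
      rwa [Nat.cast_pow] at h4
    have hZ1 : (1 : ℝ) ≤ Z := by linarith
    have h1 : (Z : ℝ) * Z ^ 625 ≤ n / Z := by
      rw [le_div_iff₀ (by linarith)]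
      refine le_trans (le_of_eq ?_) hnb'
      rw [← pow_succ', ← pow_succ]
    have h2 : 2 * (Z : ℝ) ≤ n := by
      have : (Z : ℝ) ^ 2 ≤ Z ^ 627 := pow_le_pow_right₀ hZ1 (by norm_num)
      nlinarith
    obtain ⟨M', N', hMN, _, hlo, hhi, -, hwin⟩ := exists_window hZ' h2
    have hq' : (q : ℝ) ≤ Z := by exact_mod_cast hqZ
    have hφ : (0 : ℝ) < q.totient := by exact_mod_cast Nat.totient_pos.2 hq
    have hsieve := sum_sift_le hq (isUnit_of_sift hq hqb hs) hZ hMN (by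
      refine le_trans ?_ (h1.trans hlo); gcongr)
    calc _ ≤ ∑ m ∈ apIoc q n M' N', a m := by
          refine Finset.sum_le_sum_of_subset_of_nonneg (fun m hm => ?_) fun m _ _ => ha0 m
          simp only [mem_filter, mem_Ioc] at hm ⊢
          exact ⟨hwin m hm.1.1 hm.2.2, hm.2.1⟩
      _ ≤ ∑ m ∈ apIoc q n M' N', sift 1 Z m := Finset.sum_le_sum fun m _ =>
          (ha1 m).trans (sift_anti (Nat.le_self_pow (by omega) _) m)
      _ ≤ _ := hsieve
      _ ≤ 3 * ((4 * (n / Z)) / (q.totient * l)) := by gcongr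
      _ = _ := by field_simp; ring
  · calc _ ≤ ∑ n ∈ Ioc 0 N, sift 1 (Z ^ b) n * (n : ℝ) ^ (-1 - 2 * δ) := by
          refine Finset.sum_le_sum fun n _ => ?_
          gcongr
          exact ha1 n
      _ ≤ 1 + 3 / l * (1 + 1 / (2 * δ)) := by
          refine (sum_rough_mul_rpow_le (by omega) hZ (by positivity) N).trans ?_
          gcongr
          exact sum_rpow_neg_le (by positivity) N
      _ ≤ _ := by
          have e : 1 + 3 / l * (1 + 1 / (2 * δ)) = (l * δ + 3 * δ + 3 / 2) / (l * δ) := by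
            field_simp
            ring
          rw [e, div_mul_eq_mul_div]
          gcongr
          nlinarith

/-- The twisted von Mangoldt function. -/
noncomputable def vmSeq {q : ℕ} (χ : DirichletCharacter ℂ q) : ℕ → ℂ :=
  fun n => χ (n : ZMod q) * (Λ n : ℂ)

lemma abscissa_vmSeq {q : ℕ} (χ : DirichletCharacter ℂ q) :
    LSeries.abscissaOfAbsConv (vmSeq χ) ≤ 1 := by
  refine LSeries.abscissaOfAbsConv_le_of_forall_lt_LSeriesSummable fun y hy => ?_
  exact DirichletCharacter.LSeriesSummable_twist_vonMangoldt χ (by simpa using hy)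

lemma exists_sum_vonMangoldt_rpow_le : ∃ C : ℝ, 1 ≤ C ∧ ∀ η : ℝ, 0 < η → ∀ N : ℕ,
    ∑ n ∈ Ioc 0 N, Λ n * (n : ℝ) ^ (-1 - η) ≤ C * (1 + 1 / η) := by
  refine ⟨Real.log 4 + 4, ?_, fun η hη N => ?_⟩
  · have := Real.log_nonneg (show (1 : ℝ) ≤ 4 by norm_num)
    linarith
  have h := sum_mul_antitone_le (c := fun n => Λ n) (β := fun _ => Real.log 4 + 4)
    (φ := fun n : ℕ => (n : ℝ) ^ (-1 - η)) (β₀ := 0) (Nat.zero_le N) (fun n => vonMangoldt_nonneg)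
    (fun n hn _ => rpow_neg_succ_le hη.le hn) (fun n _ => by positivity) (fun m _ _ => by
      have := Chebyshev.psi_le_const_mul_self (x := m) (Nat.cast_nonneg m)
      rw [Chebyshev.psi, Nat.floor_natCast] at this
      simpa only [sum_const, Nat.card_Ioc, tsub_zero, nsmul_eq_mul, mul_comm, zero_add] using this)
    le_rfl
  rw [zero_mul, zero_add, ← Finset.mul_sum] at h
  refine h.trans ?_
  gcongr
  exact sum_rpow_neg_le hη N

lemma sum_integral_vmSeq_le (b : ℕ) (hb : 627 ≤ b) : ∃ C : ℝ, 1 ≤ C ∧ ∀ Z : ℕ, 2 ≤ Z →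
    ∀ q : ℕ, 0 < q → q ≤ Z → ∀ δ : ℝ, 0 < δ → δ ≤ 1 →
      ∑ χ : DirichletCharacter ℂ q, ∫ t : ℝ,
        ‖LSeries (vmSeq (rchar (Z ^ b) χ)) (pt δ t)‖ ^ 2 * wk Z t ≤ C * (1 / δ) := by
  obtain ⟨C₁, hC₁, hBT⟩ := exists_brun_titchmarsh
  obtain ⟨C₂, hC₂, hV⟩ := exists_sum_vonMangoldt_rpow_le
  refine ⟨2 * Real.pi * Real.exp 2 * (4 * C₁) * (2 * C₂) + 1, ?_, fun Z hZ q hq hqZ δ hδ hδ1 => ?_⟩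
  · have : 0 ≤ 2 * Real.pi * Real.exp 2 * (4 * C₁) * (2 * C₂) := by positivity
    linarith
  have hZ' : (2 : ℝ) ≤ Z := by exact_mod_cast hZ
  set a : ℕ → ℝ := fun n => sift 1 (Z ^ b) n * Λ n with ha
  have ha0 : ∀ n, 0 ≤ a n := fun n => mul_nonneg (sift_nonneg _ _ _) vonMangoldt_nonneg
  have ha1 : ∀ n, a n ≤ Λ n := fun n =>
    mul_le_of_le_one_left vonMangoldt_nonneg (sift_le_one _ _ _)
  have hane : ∀ n, a n ≠ 0 → n ≠ 1 ∧ sift 1 (Z ^ b) n = 1 := fun n hn => by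
    refine ⟨?_, (sift_eq_zero_or_one _ _ _).resolve_left (left_ne_zero_of_mul hn)⟩
    rintro rfl
    exact right_ne_zero_of_mul hn vonMangoldt_apply_one
  have hqb : q ≤ Z ^ b := hqZ.trans (Nat.le_self_pow (by omega) _)
  have hvm : ∀ χ : DirichletCharacter ℂ q, vmSeq (rchar (Z ^ b) χ) = fun n : ℕ => χ (n : ZMod q) * a n := by
    intro χ; funext n
    simp only [vmSeq, rchar_apply, ha]; push_cast; ring
  simp only [hvm]
  have hmain := sum_integral_LSeries_sq_le hq ha0 (fun n hn => isUnit_of_sift hq hqb (hane n hn).2)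
    (fun χ => by rw [← hvm]; exact abscissa_vmSeq _) (T := (Z : ℝ)) (K := 4 * C₁)
    (B := C₂ * (1 + 1 / (2 * δ))) (by linarith) hδ hδ1 (by positivity)
    (fun N n hn hann => ?_) (fun N => ?_)
  · refine hmain.trans ?_
    have h1 : C₂ * (1 + 1 / (2 * δ)) ≤ 2 * C₂ * (1 / δ) := by
      have : 1 ≤ 1 / δ := by rw [le_div_iff₀ hδ]; linarith
      have e : 1 / (2 * δ) = 1 / δ / 2 := by field_simp
      rw [e]; nlinarith
    have : 0 ≤ 1 / δ := by positivity
    have h2 : 0 ≤ 2 * Real.pi * Real.exp 2 * (4 * C₁) := by positivity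
    nlinarith [mul_le_mul_of_nonneg_left h1 h2]
  · obtain ⟨hn1, hs⟩ := hane n hann
    have hnb := lt_of_sift hs hn hn1
    have hZ1 : (1 : ℝ) ≤ Z := by linarith
    have hnb' : (Z : ℝ) ^ 5 ≤ n := by
      have h3 : Z ^ 5 ≤ Z ^ b := Nat.pow_le_pow_right (by omega) (by omega)
      exact_mod_cast h3.trans hnb.le
    have h2 : 2 * (Z : ℝ) ≤ n := by
      have : (Z : ℝ) ^ 2 ≤ Z ^ 5 := pow_le_pow_right₀ hZ1 (by norm_num)
      nlinarith
    have hn0 : (0 : ℝ) < n := by exact_mod_cast hn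
    obtain ⟨M', N', hMN, hN2, hlo, hhi, -, hwin⟩ := exists_window hZ' h2
    have hq' : (q : ℝ) ≤ Z := by exact_mod_cast hqZ
    have hφ : (0 : ℝ) < q.totient := by exact_mod_cast Nat.totient_pos.2 hq
    have hbt := hBT q hq n (isUnit_of_sift hq hqb hs) M' N' hMN (by
      calc (q : ℝ) ^ 2 * N' ≤ (Z : ℝ) ^ 2 * (2 * (n : ℝ)) := by gcongr
        _ ≤ ((n : ℝ) / Z) ^ 2 := by
          rw [div_pow, le_div_iff₀ (by positivity)]
          have : (Z : ℝ) ^ 2 * (2 * n) * Z ^ 2 ≤ Z ^ 5 * n := by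
            have : 0 ≤ (Z : ℝ) ^ 4 * n := by positivity
            nlinarith
          nlinarith
        _ ≤ _ := by gcongr)
    calc _ ≤ ∑ m ∈ apIoc q n M' N', a m := by
          refine Finset.sum_le_sum_of_subset_of_nonneg (fun m hm => ?_) fun m _ _ => ha0 m
          simp only [mem_filter, mem_Ioc] at hm ⊢
          exact ⟨hwin m hm.1.1 hm.2.2, hm.2.1⟩
      _ ≤ ∑ m ∈ apIoc q n M' N', Λ m := Finset.sum_le_sum fun m _ => ha1 m
      _ ≤ _ := hbt
      _ ≤ C₁ * ((4 * (n / Z)) / q.totient) := by gcongr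
      _ = _ := by field_simp
  · refine le_trans (Finset.sum_le_sum fun n _ => ?_) (hV (2 * δ) (by positivity) N)
    gcongr
    exact ha1 n

end MeanSquares

section CubicIdentity

open ArithmeticFunction

lemma hasDerivAt_unique_of_eq {F G : ℂ → ℂ} (h : ∀ s : ℂ, 1 < s.re → F s = G s) {F' G' s : ℂ}
    (hs : 1 < s.re) (hF : HasDerivAt F F' s) (hG : HasDerivAt G G' s) : F' = G' := by
  refine hF.unique (hG.congr_of_eventuallyEq ?_)
  filter_upwards [(isOpen_lt continuous_const Complex.continuous_re).mem_nhds hs] with z hz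
  exact h z hz

variable {q : ℕ} (χ : DirichletCharacter ℂ q)

lemma LSeries_chSeq_ne_zero {s : ℂ} (hs : 1 < s.re) : LSeries (logk 0 (chSeq χ)) s ≠ 0 := by
  rw [logk_zero]
  exact χ.LSeries_ne_zero_of_one_lt_re hs

lemma LSeries_log_one {s : ℂ} (hs : 1 < s.re) : LSeries (logk 1 (chSeq χ)) s
    = LSeries (logk 0 (chSeq χ)) s * LSeries (logk 0 (vmSeq χ)) s := by
  have h := DirichletCharacter.LSeries_twist_vonMangoldt_eq χ hs
  have hd := (hasDerivAt_LSeries_logk (abscissa_chSeq χ) 0 hs).deriv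
  have h0 := LSeries_chSeq_ne_zero χ hs
  rw [logk_zero] at hd h0
  rw [logk_zero, logk_zero]
  have e : LSeries (vmSeq χ) s = -deriv (LSeries (chSeq χ)) s / LSeries (chSeq χ) s := h
  rw [e, hd]
  field_simp

lemma LSeries_log_two {s : ℂ} (hs : 1 < s.re) : LSeries (logk 2 (chSeq χ)) s
    = LSeries (logk 1 (chSeq χ)) s * LSeries (logk 0 (vmSeq χ)) s
      + LSeries (logk 0 (chSeq χ)) s * LSeries (logk 1 (vmSeq χ)) s := by
  have h := hasDerivAt_unique_of_eq (fun s => LSeries_log_one χ (s := s)) hs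
    (hasDerivAt_LSeries_logk (abscissa_chSeq χ) 1 hs)
    ((hasDerivAt_LSeries_logk (abscissa_chSeq χ) 0 hs).mul
      (hasDerivAt_LSeries_logk (abscissa_vmSeq χ) 0 hs))
  simp only [Nat.reduceAdd] at h
  linear_combination -h

lemma LSeries_log_three {s : ℂ} (hs : 1 < s.re) : LSeries (logk 3 (chSeq χ)) s
    = LSeries (logk 2 (chSeq χ)) s * LSeries (logk 0 (vmSeq χ)) s
      + 2 * (LSeries (logk 1 (chSeq χ)) s * LSeries (logk 1 (vmSeq χ)) s)
      + LSeries (logk 0 (chSeq χ)) s * LSeries (logk 2 (vmSeq χ)) s := by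
  have h := hasDerivAt_unique_of_eq (fun s => LSeries_log_two χ (s := s)) hs
    (hasDerivAt_LSeries_logk (abscissa_chSeq χ) 2 hs)
    (((hasDerivAt_LSeries_logk (abscissa_chSeq χ) 1 hs).mul
      (hasDerivAt_LSeries_logk (abscissa_vmSeq χ) 0 hs)).add
      ((hasDerivAt_LSeries_logk (abscissa_chSeq χ) 0 hs).mul
      (hasDerivAt_LSeries_logk (abscissa_vmSeq χ) 1 hs)))
  simp only [Nat.reduceAdd] at h
  linear_combination -h

/-- The divisor function twisted by a character. -/
lemma convolution_chSeq (n : ℕ) :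
    (LSeries.convolution (chSeq χ) (chSeq χ)) n = chSeq χ n * (n.divisors.card : ℂ) := by
  rw [LSeries.convolution_def]
  have : ∀ p ∈ n.divisorsAntidiagonal, chSeq χ p.1 * chSeq χ p.2 = chSeq χ n := fun p hp => by
    rw [← (Nat.mem_divisorsAntidiagonal.1 hp).1]
    simp [chSeq]
  simp only
  rw [Finset.sum_congr rfl this, Finset.sum_const, nsmul_eq_mul, mul_comm]
  congr 2
  exact_mod_cast congrArg Finset.card (Nat.map_div_right_divisors (n := n)).symm |>.trans
    (Finset.card_map _)

/-- `Λ − 2 log + ½ τ log`. -/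
noncomputable def hW (n : ℕ) : ℝ :=
  Λ n - 2 * Real.log n + 1 / 2 * (n.divisors.card * Real.log n)

/-- `χ · (Λ − 2 log + ½ τ log) · log²`. -/
noncomputable def hSeq : ℕ → ℂ := fun n => χ (n : ZMod q) * ((hW n * Real.log n ^ 2 : ℝ) : ℂ)

lemma hSeq_eq (n : ℕ) : hSeq χ n = (logk 2 (vmSeq χ) - (2 : ℂ) • logk 3 (chSeq χ)
    + (1 / 2 : ℂ) • logk 3 (LSeries.convolution (chSeq χ) (chSeq χ))) n := by
  simp only [Pi.add_apply, Pi.sub_apply, Pi.smul_apply, smul_eq_mul, logk, convolution_chSeq]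
  simp only [hSeq, hW, vmSeq, chSeq]
  push_cast
  ring

lemma abscissa_smul (c : ℂ) {f : ℕ → ℂ} (hf : LSeries.abscissaOfAbsConv f ≤ 1) :
    LSeries.abscissaOfAbsConv (c • f) ≤ 1 := by
  refine LSeries.abscissaOfAbsConv_le_of_forall_lt_LSeriesSummable fun y hy => ?_
  have := summable_logk hf 0 (s := (y : ℂ)) (by simpa using hy)
  rw [logk_zero] at this
  exact this.smul c

lemma abscissa_conv : LSeries.abscissaOfAbsConv (LSeries.convolution (chSeq χ) (chSeq χ)) ≤ 1 :=
  (LSeries.abscissaOfAbsConv_convolution_le _ _).trans (max_le (abscissa_chSeq χ) (abscissa_chSeq χ))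

lemma abscissa_hSeq : LSeries.abscissaOfAbsConv (hSeq χ) ≤ 1 := by
  rw [funext (hSeq_eq χ)]
  have h1 : LSeries.abscissaOfAbsConv (logk 2 (vmSeq χ)) ≤ 1 := by
    rw [abscissa_logk]; exact abscissa_vmSeq χ
  have h2 : LSeries.abscissaOfAbsConv ((2 : ℂ) • logk 3 (chSeq χ)) ≤ 1 :=
    abscissa_smul _ (by rw [abscissa_logk]; exact abscissa_chSeq χ)
  have h3 := abscissa_smul (1 / 2 : ℂ) (le_of_eq_of_le (abscissa_logk 3 _) (abscissa_conv χ))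
  exact (LSeries.abscissaOfAbsConv_add_le _ _).trans
    (max_le ((LSeries.abscissaOfAbsConv_sub_le _ _).trans (max_le h1 h2)) h3)

lemma LSeries_conv_three {s : ℂ} (hs : 1 < s.re) : LSeries (logk 3 (LSeries.convolution (chSeq χ) (chSeq χ))) s
    = 6 * (LSeries (logk 1 (chSeq χ)) s * LSeries (logk 2 (chSeq χ)) s)
      + 2 * (LSeries (logk 0 (chSeq χ)) s * LSeries (logk 3 (chSeq χ)) s) := by
  have hf := abscissa_chSeq χ
  have hc := abscissa_conv χ
  have e0 : ∀ s : ℂ, 1 < s.re → LSeries (logk 0 (LSeries.convolution (chSeq χ) (chSeq χ))) s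
      = LSeries (logk 0 (chSeq χ)) s * LSeries (logk 0 (chSeq χ)) s := fun s hs => by
    have := summable_logk hf 0 hs
    rw [logk_zero] at this ⊢
    rw [logk_zero, LSeries_convolution' this this]
  have e1 : ∀ s : ℂ, 1 < s.re → LSeries (logk 1 (LSeries.convolution (chSeq χ) (chSeq χ))) s
      = 2 * (LSeries (logk 0 (chSeq χ)) s * LSeries (logk 1 (chSeq χ)) s) := fun s hs => by
    have h := hasDerivAt_unique_of_eq e0 hs (hasDerivAt_LSeries_logk hc 0 hs)
      ((hasDerivAt_LSeries_logk hf 0 hs).mul (hasDerivAt_LSeries_logk hf 0 hs))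
    simp only [Nat.reduceAdd] at h
    linear_combination -h
  have e2 : ∀ s : ℂ, 1 < s.re → LSeries (logk 2 (LSeries.convolution (chSeq χ) (chSeq χ))) s
      = 2 * (LSeries (logk 1 (chSeq χ)) s * LSeries (logk 1 (chSeq χ)) s
        + LSeries (logk 0 (chSeq χ)) s * LSeries (logk 2 (chSeq χ)) s) := fun s hs => by
    have h := hasDerivAt_unique_of_eq e1 hs (hasDerivAt_LSeries_logk hc 1 hs)
      (((hasDerivAt_LSeries_logk hf 0 hs).mul (hasDerivAt_LSeries_logk hf 1 hs)).const_mul 2)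
    simp only [Nat.reduceAdd] at h
    linear_combination -h
  have h := hasDerivAt_unique_of_eq e2 hs (hasDerivAt_LSeries_logk hc 2 hs)
    ((((hasDerivAt_LSeries_logk hf 1 hs).mul (hasDerivAt_LSeries_logk hf 1 hs)).add
      ((hasDerivAt_LSeries_logk hf 0 hs).mul (hasDerivAt_LSeries_logk hf 2 hs))).const_mul 2)
  simp only [Nat.reduceAdd] at h
  linear_combination -h

/-- First form of the series of `hSeq`. -/
lemma LSeries_hSeq {s : ℂ} (hs : 1 < s.re) : LSeries (hSeq χ) s
    = LSeries (logk 2 (vmSeq χ)) s - 2 * LSeries (logk 3 (chSeq χ)) s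
      + 3 * (LSeries (logk 1 (chSeq χ)) s * LSeries (logk 2 (chSeq χ)) s)
      + LSeries (logk 0 (chSeq χ)) s * LSeries (logk 3 (chSeq χ)) s := by
  have hf := abscissa_chSeq χ
  rw [funext (hSeq_eq χ), LSeries_add, LSeries_sub, LSeries_smul, LSeries_smul, LSeries_conv_three χ hs]
  · ring
  · exact summable_logk (abscissa_vmSeq χ) 2 hs
  · exact (summable_logk hf 3 hs).smul _
  · exact (summable_logk (abscissa_vmSeq χ) 2 hs).sub ((summable_logk hf 3 hs).smul _)
  · exact (summable_logk (abscissa_conv χ) 3 hs).smul _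

/-- Factored form of the series of `hSeq`. -/
lemma LSeries_hSeq' {s : ℂ} (hs : 1 < s.re) : LSeries (hSeq χ) s
    = LSeries (logk 2 (vmSeq χ)) s * (1 - LSeries (logk 0 (chSeq χ)) s) ^ 2
      - 4 * (LSeries (logk 1 (vmSeq χ)) s * (1 - LSeries (logk 0 (chSeq χ)) s)
          * LSeries (logk 1 (chSeq χ)) s)
      + LSeries (logk 0 (vmSeq χ)) s * (2 * LSeries (logk 1 (chSeq χ)) s ^ 2
          - 2 * ((1 - LSeries (logk 0 (chSeq χ)) s) * LSeries (logk 2 (chSeq χ)) s)) := by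
  rw [LSeries_hSeq χ hs]
  have h1 := LSeries_log_one χ hs
  have h2 := LSeries_log_two χ hs
  have h3 := LSeries_log_three χ hs
  set L0 := LSeries (logk 0 (chSeq χ)) s
  set L1 := LSeries (logk 1 (chSeq χ)) s
  set L2 := LSeries (logk 2 (chSeq χ)) s
  set L3 := LSeries (logk 3 (chSeq χ)) s
  set G0 := LSeries (logk 0 (vmSeq χ)) s
  set G1 := LSeries (logk 1 (vmSeq χ)) s
  set G2 := LSeries (logk 2 (vmSeq χ)) s
  linear_combination (L0 - 2) * h3 + L2 * h1 + 2 * L1 * h2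

end CubicIdentity

section CubicBound

open ArithmeticFunction MeasureTheory

lemma norm_LSeries_logk_le_of_le_log {f : ℕ → ℂ} (hf : LSeries.abscissaOfAbsConv f ≤ 1) (j : ℕ)
    (hfl : ∀ n, 0 < n → ‖f n‖ ≤ Real.log n ^ j) (k : ℕ) {δ : ℝ} (hδ : 0 < δ) (hδ1 : δ ≤ 1) (t : ℝ) :
    ‖LSeries (logk k f) (pt δ t)‖ ≤ 3 * 2 ^ (j + k) * (j + k).factorial / δ ^ (j + k + 1) := by
  refine norm_LSeries_logk_le (N₀ := 0) hf k hδ t fun N _ => ?_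
  refine (norm_sum_le _ _).trans ((Finset.sum_le_sum fun n hn => ?_).trans
    (sum_log_pow_rpow_le hδ hδ1 (j + k) N))
  have hn0 := (mem_Ioc.1 hn).1
  rw [norm_mul, norm_mul, norm_tw hn0, mul_one, Complex.norm_real, Real.norm_eq_abs,
    abs_of_nonneg (logWt_nonneg _ _ _), logWt, pow_add, mul_assoc]
  exact mul_le_mul_of_nonneg_right (hfl n hn0) (logWt_nonneg k δ n)

lemma norm_LSeries_hSeq_le {q : ℕ} (χ : DirichletCharacter ℂ q) {δ : ℝ} (hδ : 0 < δ) (hδ1 : δ ≤ 1)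
    (t : ℝ) : ‖LSeries (hSeq χ) (pt δ t)‖ ≤ 2000 / δ ^ 5 := by
  have hf := abscissa_chSeq χ
  have b1 : ∀ k, ‖LSeries (logk k (chSeq χ)) (pt δ t)‖ ≤ 3 * 2 ^ (0 + k) * (0 + k).factorial / δ ^ (0 + k + 1) :=
    fun k => norm_LSeries_logk_le_of_le_log hf 0 (fun n _ => by simpa [chSeq] using χ.norm_le_one n) k hδ hδ1 t
  have b2 := norm_LSeries_logk_le_of_le_log (abscissa_vmSeq χ) 1 (fun n _ => by
    rw [vmSeq, norm_mul, Complex.norm_real, Real.norm_eq_abs, abs_of_nonneg vonMangoldt_nonneg, pow_one]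
    exact (mul_le_of_le_one_left vonMangoldt_nonneg (χ.norm_le_one n)).trans vonMangoldt_le_log) 2 hδ hδ1 t
  have h0 := b1 0
  have h1 := b1 1
  have h2 := b1 2
  have h3 := b1 3
  norm_num [Nat.factorial] at h0 h1 h2 h3 b2
  rw [LSeries_hSeq χ (one_lt_pt_re hδ t)]
  set L0 := LSeries (logk 0 (chSeq χ)) (pt δ t)
  set L1 := LSeries (logk 1 (chSeq χ)) (pt δ t)
  set L2 := LSeries (logk 2 (chSeq χ)) (pt δ t)
  set L3 := LSeries (logk 3 (chSeq χ)) (pt δ t)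
  set G2 := LSeries (logk 2 (vmSeq χ)) (pt δ t)
  have hd : 144 / δ ^ 4 ≤ 144 / δ ^ 5 := by
    refine div_le_div_of_nonneg_left (by norm_num) (by positivity) ?_
    exact pow_le_pow_of_le_one hδ.le hδ1 (by norm_num)
  calc _ ≤ ‖G2‖ + ‖2 * L3‖ + ‖3 * (L1 * L2)‖ + ‖L0 * L3‖ := by
        refine (norm_add_le _ _).trans (add_le_add_left ((norm_add_le _ _).trans
          (add_le_add_left (norm_sub_le _ _) _)) _)
    _ = ‖G2‖ + 2 * ‖L3‖ + 3 * (‖L1‖ * ‖L2‖) + ‖L0‖ * ‖L3‖ := by simp only [norm_mul, RCLike.norm_ofNat]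
    _ ≤ 144 / δ ^ 4 + 2 * (144 / δ ^ 4) + 3 * ((6 / δ ^ 2) * (24 / δ ^ 3)) + 3 / δ * (144 / δ ^ 4) := by
        gcongr
    _ = 144 / δ ^ 4 + 2 * (144 / δ ^ 4) + 864 / δ ^ 5 := by field_simp; ring
    _ ≤ 144 / δ ^ 5 + 2 * (144 / δ ^ 5) + 864 / δ ^ 5 := by gcongr
    _ = 1296 / δ ^ 5 := by ring
    _ ≤ _ := by gcongr; norm_num

/-- The factored form is small when `L` is close to `1` and bounded below. -/
lemma exists_norm_LSeries_hSeq_le (C : ℝ) (hC : 1 ≤ C) : ∃ K : ℝ, 1 ≤ K ∧ ∀ {q : ℕ}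
    (χ : DirichletCharacter ℂ q) (s : ℂ) (l : ℝ), 1 < s.re → 1 / 2 ≤ l →
    1 ≤ C * ‖LSeries (chSeq χ) s‖ → (∀ k ≤ 3, ‖LSeries (logk k (chSeq χ)) s‖ ≤ C * l ^ k) →
    ‖LSeries (hSeq χ) s‖ ≤ K * (l ^ 3 * ‖LSeries (chSeq χ) s - 1‖ ^ 2 + l * ‖LSeries (vmSeq χ) s‖ ^ 2) := by
  set A := C ^ 2 with hA
  have hA1 : C ≤ A := by rw [hA]; nlinarith
  set B := C * (C + C * A) with hB
  set E := C * (C + C * A + 2 * (C * B)) with hE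
  set K := A + B + E + C with hK
  have hA0 : 1 ≤ A := by linarith
  have hB0 : 0 ≤ B := by positivity
  have hE0 : 0 ≤ E := by positivity
  have hK1 : 1 ≤ K := by linarith
  refine ⟨5 * K ^ 2, by nlinarith, fun {q} χ s l hs hl hlow hup => ?_⟩
  rw [LSeries_hSeq' χ hs]
  have h1 := LSeries_log_one χ hs
  have h2 := LSeries_log_two χ hs
  have h3 := LSeries_log_three χ hs
  have u0 := hup 0 (by norm_num)
  have u1 := hup 1 (by norm_num)
  have u2 := hup 2 (by norm_num)
  have u3 := hup 3 (by norm_num)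
  rw [show LSeries (chSeq χ) s = LSeries (logk 0 (chSeq χ)) s by rw [logk_zero]] at hlow ⊢
  rw [show LSeries (vmSeq χ) s = LSeries (logk 0 (vmSeq χ)) s by rw [logk_zero]]
  set L0 := LSeries (logk 0 (chSeq χ)) s
  set L1 := LSeries (logk 1 (chSeq χ)) s
  set L2 := LSeries (logk 2 (chSeq χ)) s
  set L3 := LSeries (logk 3 (chSeq χ)) s
  set G0 := LSeries (logk 0 (vmSeq χ)) s
  set G1 := LSeries (logk 1 (vmSeq χ)) s
  set G2 := LSeries (logk 2 (vmSeq χ)) s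
  have hl0 : 0 < l := by linarith
  have inv : ∀ X : ℂ, ‖X‖ ≤ C * ‖L0 * X‖ := fun X => by
    rw [norm_mul]; nlinarith [norm_nonneg X]
  rw [pow_one] at u1
  rw [pow_zero, mul_one] at u0
  have g0 : ‖G0‖ ≤ A * l := by
    have := inv G0
    rw [← h1] at this
    refine this.trans ?_
    rw [hA]; nlinarith
  have g1 : ‖G1‖ ≤ B * l ^ 2 := by
    refine (inv G1).trans ?_
    rw [show L0 * G1 = L2 - L1 * G0 by linear_combination -h2]
    calc C * ‖L2 - L1 * G0‖ ≤ C * (‖L2‖ + ‖L1‖ * ‖G0‖) := by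
          rw [← norm_mul]; gcongr; exact norm_sub_le _ _
      _ ≤ C * (C * l ^ 2 + C * l * (A * l)) := by gcongr
      _ = _ := by rw [hB]; ring
  have g2 : ‖G2‖ ≤ E * l ^ 3 := by
    refine (inv G2).trans ?_
    rw [show L0 * G2 = L3 - L2 * G0 - 2 * (L1 * G1) by linear_combination -h3]
    calc C * ‖L3 - L2 * G0 - 2 * (L1 * G1)‖ ≤ C * (‖L3‖ + ‖L2‖ * ‖G0‖ + 2 * (‖L1‖ * ‖G1‖)) := by
          gcongr
          refine (norm_sub_le _ _).trans ?_
          rw [norm_mul 2, norm_mul L1, RCLike.norm_ofNat, ← norm_mul L2]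
          gcongr
          exact norm_sub_le _ _
      _ ≤ C * (C * l ^ 3 + C * l ^ 2 * (A * l) + 2 * (C * l * (B * l ^ 2))) := by gcongr
      _ = _ := by rw [hE]; ring
  have v1 : ‖L1‖ ≤ K * ‖G0‖ := by
    rw [h1, norm_mul]
    gcongr
    linarith
  have w1 : ‖L1‖ ≤ K * l := u1.trans (by gcongr; linarith)
  have w2 : ‖L2‖ ≤ K * l ^ 2 := u2.trans (by gcongr; linarith)
  replace g1 : ‖G1‖ ≤ K * l ^ 2 := g1.trans (by gcongr; linarith)
  replace g2 : ‖G2‖ ≤ K * l ^ 3 := g2.trans (by gcongr; linarith)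
  rw [norm_sub_rev L0 1]
  set d := ‖1 - L0‖
  have hd : 0 ≤ d := norm_nonneg _
  have hg : 0 ≤ ‖G0‖ := norm_nonneg _
  calc _ ≤ ‖G2‖ * d ^ 2 + 4 * (‖G1‖ * d * ‖L1‖) + ‖G0‖ * (2 * (‖L1‖ * ‖L1‖) + 2 * (d * ‖L2‖)) := by
        refine (norm_add_le _ _).trans ?_
        refine add_le_add ((norm_sub_le _ _).trans (le_of_eq ?_)) ?_
        · simp only [norm_mul, norm_pow, RCLike.norm_ofNat, d]
        · rw [norm_mul]
          refine mul_le_mul_of_nonneg_left ((norm_sub_le _ _).trans (le_of_eq ?_)) hg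
          simp only [norm_mul, RCLike.norm_ofNat, d, pow_two]
    _ ≤ K * l ^ 3 * d ^ 2 + 4 * (K * l ^ 2 * d * (K * ‖G0‖))
        + ‖G0‖ * (2 * (K * l * (K * ‖G0‖)) + 2 * (d * (K * l ^ 2))) := by
        gcongr
    _ = K * (l ^ 3 * d ^ 2) + (4 * K ^ 2 + 2 * K) * (l ^ 2 * d * ‖G0‖) + 2 * K ^ 2 * (l * ‖G0‖ ^ 2) := by
        ring
    _ ≤ K ^ 2 * (l ^ 3 * d ^ 2) + 6 * K ^ 2 * ((l ^ 3 * d ^ 2 + l * ‖G0‖ ^ 2) / 2)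
        + 2 * K ^ 2 * (l * ‖G0‖ ^ 2) := by
        have hKK : K ≤ K ^ 2 := by nlinarith
        have : l ^ 2 * d * ‖G0‖ ≤ (l ^ 3 * d ^ 2 + l * ‖G0‖ ^ 2) / 2 := by
          nlinarith [mul_nonneg hl0.le (sq_nonneg (l * d - ‖G0‖))]
        gcongr
        linarith
    _ ≤ _ := by
        have : 0 ≤ K ^ 2 * (l ^ 3 * d ^ 2) := by positivity
        linarith

lemma integrable_norm_LSeries_pow_wk {f : ℕ → ℂ} (hf : LSeries.abscissaOfAbsConv f ≤ 1) {δ T : ℝ}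
    (hδ : 0 < δ) (hT : 0 < T) (c : ℂ) (k : ℕ) :
    Integrable fun t => ‖LSeries f (pt δ t) - c‖ ^ k * wk T t := by
  refine (integrable_wk hT).bdd_mul
    (c := (∑' n, ‖LSeries.term f (pt δ 0) n‖ + ‖c‖) ^ k) ?_ (Filter.Eventually.of_forall fun t => ?_)
  · exact (((continuous_LSeries_pt hf hδ).sub continuous_const).norm.pow k).aestronglyMeasurable
  · rw [norm_pow, norm_norm]
    gcongr
    exact (norm_sub_le _ _).trans (add_le_add_left (norm_LSeries_pt_le hf hδ t) _)

theorem exists_sum_integral_hSeq_le (b : ℕ) (hb : 627 ≤ b) : ∃ C η : ℝ, 1 ≤ C ∧ 0 < η ∧ η ≤ 1 / 4 ∧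
    ∀ Z : ℕ, 2 ≤ Z → ∀ q : ℕ, 0 < q → q ≤ Z → ∃ 𝒳 : Finset (DirichletCharacter ℂ q), 𝒳.card ≤ 1 ∧
      (∀ χ ∈ 𝒳, χ ≠ 1) ∧ ∀ δ : ℝ, 0 < δ → δ ≤ 1 → δ * Real.log Z ≤ η → 1 / δ ≤ Z →
      ∀ S : Finset (DirichletCharacter ℂ q), (∀ χ ∈ S, χ ≠ 1 ∧ χ ∉ 𝒳) →
        ∑ χ ∈ S, ∫ t : ℝ, ‖LSeries (hSeq (rchar (Z ^ b) χ)) (pt δ t)‖ * wk Z t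
          ≤ C * (Real.log Z / δ) := by
  obtain ⟨C₀, η, hC₀, hη0, hη1, hlow⟩ := exists_LSeries_lower_bound b (by omega)
  obtain ⟨C₁, hC₁, hup⟩ := exists_LSeries_bound b (by omega)
  obtain ⟨C₂, hC₂, hR⟩ := sum_integral_rough_sub_one_le b hb
  obtain ⟨C₃, hC₃, hV⟩ := sum_integral_vmSeq_le b hb
  obtain ⟨K, hK, hH⟩ := exists_norm_LSeries_hSeq_le (C₀ * C₁) (by nlinarith)
  refine ⟨K * (C₂ + C₃) + 32000, η, by nlinarith, hη0, hη1, fun Z hZ q hq hqZ => ?_⟩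
  obtain ⟨𝒳, hcard, hne, hX⟩ := hlow Z hZ q hq hqZ
  refine ⟨𝒳, hcard, hne, fun δ hδ hδ1 hδη hδZ S hS => ?_⟩
  have hZ' : (2 : ℝ) ≤ Z := by exact_mod_cast hZ
  have hZ0 : (0 : ℝ) < Z := by linarith
  have hl := half_le_log hZ
  set l := Real.log Z with hldef
  have hl0 : 0 < l := by linarith
  have hW := integrable_wk hZ0
  have hpt : ∀ χ ∈ S, ∀ t, ‖LSeries (hSeq (rchar (Z ^ b) χ)) (pt δ t)‖ * wk Z t
      ≤ K * (l ^ 3 * (‖LSeries (chSeq (rchar (Z ^ b) χ)) (pt δ t) - 1‖ ^ 2 * wk Z t)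
        + l * (‖LSeries (vmSeq (rchar (Z ^ b) χ)) (pt δ t)‖ ^ 2 * wk Z t))
        + 2000 / δ ^ 5 * ({t : ℝ | (Z : ℝ) ^ 10 < |t|}.indicator (wk Z) t) := by
    intro χ hχ t
    have hw := wk_nonneg (Z : ℝ) t
    by_cases ht : |t| ≤ (Z : ℝ) ^ 10
    · rw [Set.indicator_of_notMem (by simpa using ht), mul_zero, add_zero]
      have h1 := hX χ (hS χ hχ).1 (hS χ hχ).2 t ht δ hδ hδη
      have := hH (rchar (Z ^ b) χ) (pt δ t) l (one_lt_pt_re hδ t) hl (by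
          have := norm_nonneg (LSeries (chSeq (rchar (Z ^ b) χ)) (pt δ t))
          nlinarith) (fun k hk => by
          refine (hup Z hZ q hq hqZ χ (hS χ hχ).1 t (ht.trans
            (pow_le_pow_right₀ (by linarith) (by norm_num))) k hk δ hδ).trans ?_
          gcongr
          nlinarith)
      calc _ ≤ _ := mul_le_mul_of_nonneg_right this hw
        _ = _ := by ring
    · rw [Set.indicator_of_mem (by simpa using ht)]
      have h2 := mul_le_mul_of_nonneg_right (norm_LSeries_hSeq_le (rchar (Z ^ b) χ) hδ hδ1 t) hw
      have : 0 ≤ K * (l ^ 3 * (‖LSeries (chSeq (rchar (Z ^ b) χ)) (pt δ t) - 1‖ ^ 2 * wk Z t)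
        + l * (‖LSeries (vmSeq (rchar (Z ^ b) χ)) (pt δ t)‖ ^ 2 * wk Z t)) := by positivity
      linarith
  have hmeas : MeasurableSet {t : ℝ | (Z : ℝ) ^ 10 < |t|} :=
    measurableSet_lt measurable_const measurable_id.abs
  have hInt : ∀ χ ∈ S, ∫ t : ℝ, ‖LSeries (hSeq (rchar (Z ^ b) χ)) (pt δ t)‖ * wk Z t
      ≤ K * (l ^ 3 * (∫ t : ℝ, ‖LSeries (chSeq (rchar (Z ^ b) χ)) (pt δ t) - 1‖ ^ 2 * wk Z t)
        + l * (∫ t : ℝ, ‖LSeries (vmSeq (rchar (Z ^ b) χ)) (pt δ t)‖ ^ 2 * wk Z t))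
        + 2000 / δ ^ 5 * (8 * (Z : ℝ) ^ 2 / (Z : ℝ) ^ 10) := by
    intro χ hχ
    have i1 := integrable_norm_LSeries_pow_wk (abscissa_chSeq (rchar (Z ^ b) χ)) hδ hZ0 1 2
    have i2 := integrable_norm_LSeries_pow_wk (abscissa_vmSeq (rchar (Z ^ b) χ)) hδ hZ0 0 2
    have i3 := integrable_norm_LSeries_pow_wk (abscissa_hSeq (rchar (Z ^ b) χ)) hδ hZ0 0 1
    simp only [sub_zero, pow_one] at i2 i3
    have i4 := hW.indicator hmeas
    have i12 : Integrable fun t : ℝ => K * (l ^ 3 * (‖LSeries (chSeq (rchar (Z ^ b) χ)) (pt δ t) - 1‖ ^ 2 * wk Z t)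
        + l * (‖LSeries (vmSeq (rchar (Z ^ b) χ)) (pt δ t)‖ ^ 2 * wk Z t)) := ((i1.const_mul (l ^ 3)).add (i2.const_mul l)).const_mul K
    have h5 := integral_mono i3 (i12.add (i4.const_mul (2000 / δ ^ 5))) (hpt χ hχ)
    have e : ∫ t : ℝ, (K * (l ^ 3 * (‖LSeries (chSeq (rchar (Z ^ b) χ)) (pt δ t) - 1‖ ^ 2 * wk Z t)
        + l * (‖LSeries (vmSeq (rchar (Z ^ b) χ)) (pt δ t)‖ ^ 2 * wk Z t))
        + 2000 / δ ^ 5 * ({t : ℝ | (Z : ℝ) ^ 10 < |t|}.indicator (wk Z) t))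
        = K * (l ^ 3 * (∫ t : ℝ, ‖LSeries (chSeq (rchar (Z ^ b) χ)) (pt δ t) - 1‖ ^ 2 * wk Z t)
        + l * (∫ t : ℝ, ‖LSeries (vmSeq (rchar (Z ^ b) χ)) (pt δ t)‖ ^ 2 * wk Z t))
        + 2000 / δ ^ 5 * ∫ t in {t : ℝ | (Z : ℝ) ^ 10 < |t|}, wk Z t := by
      rw [integral_add i12 (i4.const_mul _), integral_const_mul, integral_const_mul,
        integral_add (i1.const_mul _) (i2.const_mul _), integral_const_mul, integral_const_mul,
        integral_indicator hmeas]
    refine h5.trans (e.le.trans ?_)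
    gcongr
    exact integral_wk_tail_le hZ0 (by positivity)
  have hcardS : (S.card : ℝ) ≤ Z := by
    have h1 : S.card ≤ Fintype.card (DirichletCharacter ℂ q) := Finset.card_le_univ S
    have : NeZero q := ⟨hq.ne'⟩
    have h2 : Fintype.card (DirichletCharacter ℂ q) = q.totient := by
      rw [← Nat.card_eq_fintype_card]
      exact DirichletCharacter.card_eq_totient_of_hasEnoughRootsOfUnity ℂ q
    exact_mod_cast h1.trans (h2.le.trans ((Nat.totient_le q).trans hqZ))
  have hsub1 : ∑ χ ∈ S, ∫ t : ℝ, ‖LSeries (chSeq (rchar (Z ^ b) χ)) (pt δ t) - 1‖ ^ 2 * wk Z t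
      ≤ C₂ * (1 / (l ^ 2 * δ)) := by
    refine le_trans (Finset.sum_le_univ_sum_of_nonneg fun χ => ?_) (hR Z hZ q hq hqZ δ hδ hδ1 (by linarith))
    exact integral_nonneg fun t => mul_nonneg (by positivity) (wk_nonneg _ _)
  have hsub2 : ∑ χ ∈ S, ∫ t : ℝ, ‖LSeries (vmSeq (rchar (Z ^ b) χ)) (pt δ t)‖ ^ 2 * wk Z t
      ≤ C₃ * (1 / δ) := by
    refine le_trans (Finset.sum_le_univ_sum_of_nonneg fun χ => ?_) (hV Z hZ q hq hqZ δ hδ hδ1)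
    exact integral_nonneg fun t => mul_nonneg (by positivity) (wk_nonneg _ _)
  refine (Finset.sum_le_sum hInt).trans ?_
  rw [Finset.sum_add_distrib, ← Finset.mul_sum, Finset.sum_add_distrib, ← Finset.mul_sum,
    ← Finset.mul_sum, Finset.sum_const, nsmul_eq_mul]
  have htail : (S.card : ℝ) * (2000 / δ ^ 5 * (8 * (Z : ℝ) ^ 2 / (Z : ℝ) ^ 10)) ≤ 16000 := by
    calc _ ≤ (Z : ℝ) * (2000 * (Z : ℝ) ^ 5 * (8 * (Z : ℝ) ^ 2 / (Z : ℝ) ^ 10)) := by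
          have : 2000 / δ ^ 5 ≤ 2000 * (Z : ℝ) ^ 5 := by
            rw [div_eq_mul_one_div, ← one_div_pow]; gcongr
          gcongr
      _ = 16000 / (Z : ℝ) ^ 2 := by field_simp; norm_num
      _ ≤ _ := div_le_self (by norm_num) (by nlinarith)
  have hlδ : 1 / 2 ≤ l / δ := by rw [le_div_iff₀ hδ]; nlinarith
  have hmain : K * (l ^ 3 * (C₂ * (1 / (l ^ 2 * δ))) + l * (C₃ * (1 / δ))) = K * (C₂ + C₃) * (l / δ) := by
    field_simp
  calc _ ≤ K * (l ^ 3 * (C₂ * (1 / (l ^ 2 * δ))) + l * (C₃ * (1 / δ))) + 16000 := by gcongr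
    _ = K * (C₂ + C₃) * (l / δ) + 16000 := by rw [hmain]
    _ ≤ _ := by nlinarith

end CubicBound

section TypeOne

open ArithmeticFunction

lemma norm_sum_Ioc_mul_le {c φ : ℕ → ℝ} {B : ℝ} {M N : ℕ} (hMN : M ≤ N)
    (hc : ∀ m, M ≤ m → m ≤ N → |∑ n ∈ Ioc M m, c n| ≤ B) :
    |∑ n ∈ Ioc M N, c n * φ n| ≤ B * (|φ (N + 1)| + ∑ n ∈ Ioc M N, |φ n - φ (n + 1)|) := by
  have key : ∑ n ∈ Ioc M N, c n * φ n = (∑ n ∈ Ioc M N, c n) * φ (N + 1)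
      + ∑ m ∈ Ioc M N, (∑ n ∈ Ioc M m, c n) * (φ m - φ (m + 1)) := by
    clear hc
    induction N, hMN using Nat.le_induction with
    | base => simp
    | succ N h ih =>
      rw [Finset.sum_Ioc_succ_top h, ih, Finset.sum_Ioc_succ_top h, Finset.sum_Ioc_succ_top h,
        Finset.sum_Ioc_succ_top h c]
      ring
  rw [key, mul_add, Finset.mul_sum]
  refine (abs_add_le _ _).trans (add_le_add ?_ ((Finset.abs_sum_le_sum_abs _ _).trans
    (Finset.sum_le_sum fun m hm => ?_)))
  · rw [abs_mul]
    exact mul_le_mul_of_nonneg_right (hc N hMN le_rfl) (abs_nonneg _)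
  · rw [abs_mul]
    rw [mem_Ioc] at hm
    exact mul_le_mul_of_nonneg_right (hc m hm.1.le hm.2) (abs_nonneg _)

lemma logWt_anti {k : ℕ} (hk : k ≤ 3) {δ : ℝ} (hδ : 0 ≤ δ) {m n : ℕ} (hm : 27 ≤ m) (hmn : m ≤ n) :
    logWt k δ n ≤ logWt k δ m := by
  induction n, hmn using Nat.le_induction with
  | base => exact le_rfl
  | succ n h ih => exact (logWt_succ_le hk hδ (hm.trans h)).trans ih

lemma abs_sum_rough_sub_le {q : ℕ} (hq : 0 < q) {β β' : ZMod q} (hβ : IsUnit β) (hβ' : IsUnit β')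
    {y : ℕ} (hy : 2 ≤ y) (s : ℕ) {M N : ℕ} (hMN : M ≤ N) :
    |∑ m ∈ Ioc M N, sift 1 y m * ((if (m : ZMod q) = β then 1 else 0) - if (m : ZMod q) = β' then 1 else 0)|
      ≤ 2 * (((N : ℝ) - M) * (1 / (q.totient * Real.log y)) / 2 ^ s + (y : ℝ) ^ (208 * (s + 3))) := by
  have h1 := abs_le.1 (abs_sum_sift_sub_le hq hβ (show 1 ≤ y by omega) s hMN)
  have h2 := abs_le.1 (abs_sum_sift_sub_le hq hβ' (show 1 ≤ y by omega) s hMN)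
  have e : ∑ m ∈ Ioc M N, sift 1 y m * ((if (m : ZMod q) = β then 1 else 0) - if (m : ZMod q) = β' then 1 else 0)
      = ∑ n ∈ apIoc q β M N, sift 1 y n - ∑ n ∈ apIoc q β' M N, sift 1 y n := by
    simp only [mul_sub, Finset.sum_sub_distrib, mul_ite, mul_one, mul_zero, Finset.sum_filter]
  have hMN' : (0 : ℝ) ≤ (N : ℝ) - M := sub_nonneg.2 (by exact_mod_cast hMN)
  have h3 : ((N : ℝ) - M) * (vdens q y / q) / 2 ^ s ≤ ((N : ℝ) - M) * (1 / (q.totient * Real.log y)) / 2 ^ s := by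
    exact div_le_div_of_nonneg_right (mul_le_mul_of_nonneg_left (vdens_div_le_log hq hy) hMN') (by positivity)
  rw [e, abs_le]
  constructor <;> linarith [h1.1, h1.2, h2.1, h2.2]

/-- Sums over rough integers in two residue classes, against a smooth multiplicative window. -/
lemma abs_sum_window_sub_le {q : ℕ} (hq : 0 < q) {β β' : ZMod q} (hβ : IsUnit β) (hβ' : IsUnit β')
    {y : ℕ} (hy : 2 ≤ y) (s : ℕ) {δ T u : ℝ} (hδ : 0 ≤ δ) (hT : 2 ≤ T) {d : ℕ} (hd : 0 < d)
    (hdT : d * (2 * T) ≤ Real.exp u) (hu : 108 ≤ Real.exp u) (M N : ℕ) :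
    |∑ m ∈ Ioc M N, sift 1 y m * ((if (m : ZMod q) = β then 1 else 0) - if (m : ZMod q) = β' then 1 else 0)
        * (logWt 3 δ (d * m) * kr T (u - Real.log (d * m : ℕ)))|
      ≤ 720 * (u + 1) ^ 3 * (1 / (d * (q.totient * Real.log y)) / 2 ^ s
        + Real.exp (-u) * T * (y : ℝ) ^ (208 * (s + 3))) := by
  have hT0 : 0 < T := by linarith
  have hd0 : (0 : ℝ) < d := by exact_mod_cast hd
  have hd1 : (1 : ℝ) ≤ d := by exact_mod_cast hd
  have hy' : (1 : ℝ) < y := by exact_mod_cast hy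
  have hlogy : 0 < Real.log y := Real.log_pos hy'
  have hφ : (0 : ℝ) < q.totient := by exact_mod_cast Nat.totient_pos.2 hq
  have hu0 : 0 < u := by
    rw [← Real.exp_lt_exp, Real.exp_zero]; linarith
  set X := Real.exp u / d with hX
  have hX2 : 2 * T ≤ X := by rw [hX, le_div_iff₀ hd0]; linarith
  have hX0 : 0 < X := by linarith
  have hlogX : Real.log X = u - Real.log d := by
    rw [hX, Real.log_div (Real.exp_ne_zero _) hd0.ne', Real.log_exp]
  obtain ⟨M', N', hMN', hN2, hlo, hhi, hM4, hwin⟩ := exists_window hT hX2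
  set φ : ℕ → ℝ := fun m => logWt 3 δ (d * m) * kr T (u - Real.log (d * m : ℕ)) with hφdef
  have hlogdm : ∀ m : ℕ, 0 < m → Real.log (d * m : ℕ) = Real.log d + Real.log m := fun m hm => by
    push_cast
    exact Real.log_mul hd0.ne' (by exact_mod_cast hm.ne')
  have hφz : ∀ m : ℕ, 0 < m → ¬ (M' < m ∧ m ≤ N') → φ m = 0 := fun m hm h => by
    simp only [hφdef]
    rw [kr_eq_zero hT0, mul_zero]
    by_contra hc
    refine h (hwin m hm ?_)
    rw [hlogdm m hm] at hc
    have hc' := not_le.1 hc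
    rwa [hlogX, abs_sub_comm, sub_sub]
  set M₁ := max M M' with hM1
  set N₁ := min N N' with hN1
  set c : ℕ → ℝ := fun m => sift 1 y m * ((if (m : ZMod q) = β then 1 else 0) - if (m : ZMod q) = β' then 1 else 0) with hc
  have hclip : ∑ m ∈ Ioc M N, c m * φ m = ∑ m ∈ Ioc M₁ N₁, c m * φ m := by
    symm
    refine Finset.sum_subset (fun m hm => ?_) fun m hm hm' => ?_
    · simp only [mem_Ioc, hM1, hN1, max_lt_iff, le_min_iff] at hm ⊢
      exact ⟨hm.1.1, hm.2.1⟩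
    · rw [hφz m (by have := (mem_Ioc.1 hm).1; omega), mul_zero]
      simp only [mem_Ioc, hM1, hN1, max_lt_iff, le_min_iff] at hm hm'
      tauto
  have hRHS : 0 ≤ 720 * (u + 1) ^ 3 * (1 / (d * (q.totient * Real.log y)) / 2 ^ s
        + Real.exp (-u) * T * (y : ℝ) ^ (208 * (s + 3))) := by positivity
  change |∑ m ∈ Ioc M N, c m * φ m| ≤ _
  rw [hclip]
  rcases lt_or_ge N₁ M₁ with hlt | hge
  · rw [Finset.Ioc_eq_empty (by omega)]
    simpa using hRHS
  set A := 4 * (u + 1) ^ 3 * Real.exp (-u) with hA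
  have hA0 : 0 ≤ A := by positivity
  have hMN'' : M' < N' := by
    have : 0 < X / T := by positivity
    have : (M' : ℝ) < N' := by linarith
    exact_mod_cast this
  have hdM : (27 : ℝ) ≤ (d * (M' + 1) : ℕ) := by
    push_cast
    have : d * (X / 4) = Real.exp u / 4 := by rw [hX]; field_simp
    nlinarith
  have hwt : ∀ m, M' < m → logWt 3 δ (d * m) ≤ A := fun m hm => by
    refine (logWt_anti le_rfl hδ (m := d * (M' + 1)) (by exact_mod_cast hdM)
      (Nat.mul_le_mul_left _ hm)).trans ?_
    refine (logWt_le hδ (by positivity)).trans ?_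
    have h1 : Real.log (d * (M' + 1) : ℕ) ≤ u + 1 := by
      have h2 : ((M' + 1 : ℕ) : ℝ) ≤ 2 * X := le_trans (by exact_mod_cast hMN'') hN2
      have h3 : ((d * (M' + 1) : ℕ) : ℝ) ≤ Real.exp (u + 1) := by
        rw [Nat.cast_mul, Real.exp_add]
        calc (d : ℝ) * ((M' + 1 : ℕ) : ℝ) ≤ d * (2 * X) := by gcongr
          _ = Real.exp u * 2 := by rw [hX]; field_simp
          _ ≤ _ := by gcongr; linarith [Real.add_one_le_exp 1]
      calc _ ≤ Real.log (Real.exp (u + 1)) := Real.log_le_log (by positivity) h3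
        _ = _ := Real.log_exp _
    have h4 : Real.exp u / 4 ≤ ((d * (M' + 1) : ℕ) : ℝ) := by
      push_cast
      have : d * (X / 4) = Real.exp u / 4 := by rw [hX]; field_simp
      nlinarith
    have h0 : 0 ≤ Real.log (d * (M' + 1) : ℕ) := Real.log_natCast_nonneg _
    calc _ ≤ (u + 1) ^ 3 / (Real.exp u / 4) := by gcongr
      _ = A := by rw [hA, Real.exp_neg]; field_simp
  have hMM : M' ≤ M₁ := le_max_right _ _
  have hB := norm_sum_Ioc_mul_le (c := c) (φ := φ)
    (B := 2 * ((4 * (X / T)) * (1 / (q.totient * Real.log y)) / 2 ^ s + (y : ℝ) ^ (208 * (s + 3)))) hge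
    (fun m h1 h2 => by
      refine (abs_sum_rough_sub_le hq hβ hβ' hy s h1).trans ?_
      have : (m : ℝ) - M₁ ≤ 4 * (X / T) := by
        have e1 : (m : ℝ) ≤ N' := by exact_mod_cast h2.trans (min_le_right _ _)
        have e2 : (M' : ℝ) ≤ M₁ := by exact_mod_cast hMM
        linarith
      gcongr)
  have hend : |φ (N₁ + 1)| ≤ T * A := by
    simp only [hφdef]
    rw [abs_mul, abs_of_nonneg (logWt_nonneg _ _ _), abs_of_nonneg (kr_nonneg hT0.le _), mul_comm]
    exact mul_le_mul (kr_le hT0.le _) (hwt _ (by omega)) (logWt_nonneg _ _ _) hT0.le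
  have hdiff : ∀ m ∈ Ioc M₁ N₁, |φ m - φ (m + 1)| ≤ A * (T ^ 2 * (4 / X))
      + T * (logWt 3 δ (d * m) - logWt 3 δ (d * (m + 1))) := by
    intro m hm
    rw [mem_Ioc] at hm
    have hm0 : 0 < m := by omega
    have hmM : M' < m := by omega
    have hmX : X / 4 ≤ m := hM4.trans (by exact_mod_cast hmM.le)
    have h1 : |kr T (u - Real.log (d * m : ℕ)) - kr T (u - Real.log (d * (m + 1) : ℕ))| ≤ T ^ 2 * (4 / X) := by
      refine (abs_kr_sub_le hT0.le _ _).trans ?_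
      gcongr
      rw [hlogdm m hm0, hlogdm (m + 1) (by omega)]
      rw [show u - (Real.log d + Real.log m) - (u - (Real.log d + Real.log (m + 1 : ℕ)))
        = Real.log (m + 1 : ℕ) - Real.log m by ring, abs_of_nonneg]
      · push_cast
        refine (log_succ_sub_log_le hm0).trans ?_
        rw [div_le_div_iff₀ (by exact_mod_cast hm0) hX0]; linarith
      · rw [sub_nonneg]
        exact Real.log_le_log (by exact_mod_cast hm0) (by push_cast; linarith)
    have h2 : 0 ≤ logWt 3 δ (d * m) - logWt 3 δ (d * (m + 1)) := by
      rw [sub_nonneg]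
      refine logWt_anti le_rfl hδ ?_ (Nat.mul_le_mul_left _ (Nat.le_succ m))
      have h5 : 27 ≤ d * (M' + 1) := by exact_mod_cast hdM
      exact h5.trans (Nat.mul_le_mul_left _ hmM)
    have e : φ m - φ (m + 1) = logWt 3 δ (d * (m + 1))
        * (kr T (u - Real.log (d * m : ℕ)) - kr T (u - Real.log (d * (m + 1) : ℕ)))
        + (logWt 3 δ (d * m) - logWt 3 δ (d * (m + 1))) * kr T (u - Real.log (d * m : ℕ)) := by
      simp only [hφdef]; ring
    rw [e]
    refine (abs_add_le _ _).trans (add_le_add ?_ ?_)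
    · rw [abs_mul, abs_of_nonneg (logWt_nonneg _ _ _)]
      exact mul_le_mul (hwt _ (by omega)) h1 (abs_nonneg _) hA0
    · rw [abs_mul, abs_of_nonneg h2, abs_of_nonneg (kr_nonneg hT0.le _), mul_comm T]
      exact mul_le_mul_of_nonneg_left (kr_le hT0.le _) h2
  have htel : ∑ m ∈ Ioc M₁ N₁, (logWt 3 δ (d * m) - logWt 3 δ (d * (m + 1)))
      = logWt 3 δ (d * (M₁ + 1)) - logWt 3 δ (d * (N₁ + 1)) := by
    have : ∀ N, M₁ ≤ N → ∑ m ∈ Ioc M₁ N, (logWt 3 δ (d * m) - logWt 3 δ (d * (m + 1)))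
      = logWt 3 δ (d * (M₁ + 1)) - logWt 3 δ (d * (N + 1)) := fun N h => by
      induction N, h using Nat.le_induction with
      | base => simp
      | succ N h ih => rw [Finset.sum_Ioc_succ_top h, ih]; ring
    exact this N₁ hge
  have hTV : ∑ m ∈ Ioc M₁ N₁, |φ m - φ (m + 1)| ≤ 17 * (T * A) := by
    refine (Finset.sum_le_sum hdiff).trans ?_
    rw [Finset.sum_add_distrib, Finset.sum_const, ← Finset.mul_sum, htel, Nat.card_Ioc, nsmul_eq_mul]
    have h1 : ((N₁ - M₁ : ℕ) : ℝ) ≤ 4 * (X / T) := by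
      rw [Nat.cast_sub hge]
      have e1 : (N₁ : ℝ) ≤ N' := by exact_mod_cast min_le_right _ _
      have e2 : (M' : ℝ) ≤ M₁ := by exact_mod_cast hMM
      linarith
    have h2 : logWt 3 δ (d * (M₁ + 1)) - logWt 3 δ (d * (N₁ + 1)) ≤ A := by
      linarith [hwt (M₁ + 1) (by omega), logWt_nonneg 3 δ (d * (N₁ + 1))]
    calc _ ≤ 4 * (X / T) * (A * (T ^ 2 * (4 / X))) + T * A := by gcongr
      _ = _ := by field_simp; ring
  refine hB.trans ?_
  calc _ ≤ 2 * ((4 * (X / T)) * (1 / (q.totient * Real.log y)) / 2 ^ s + (y : ℝ) ^ (208 * (s + 3)))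
        * (T * A + 17 * (T * A)) := by gcongr
    _ = 144 * (u + 1) ^ 3 * (4 * (1 / (d * (q.totient * Real.log y)) / 2 ^ s)
        * (Real.exp (-u) * Real.exp u) + Real.exp (-u) * T * (y : ℝ) ^ (208 * (s + 3))) := by
      rw [hA, hX]; field_simp; ring
    _ ≤ 144 * (u + 1) ^ 3 * (5 * (1 / (d * (q.totient * Real.log y)) / 2 ^ s)
        + 5 * (Real.exp (-u) * T * (y : ℝ) ^ (208 * (s + 3)))) := by
      rw [← Real.exp_add, neg_add_cancel, Real.exp_zero, mul_one]
      have h1 : 0 ≤ 1 / (d * (q.totient * Real.log y)) / 2 ^ s := by positivity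
      have h2 : 0 ≤ Real.exp (-u) * T * (y : ℝ) ^ (208 * (s + 3)) := by positivity
      exact mul_le_mul_of_nonneg_left (by linarith) (by positivity)
    _ = _ := by ring

end TypeOne

section TypeOneDivisor

open ArithmeticFunction

lemma sift_one_mul (y d m : ℕ) : sift 1 y (d * m) = sift 1 y d * sift 1 y m := by
  rcases sift_eq_zero_or_one 1 y d with h1 | h1 <;> rcases sift_eq_zero_or_one 1 y m with h2 | h2 <;>
    rcases sift_eq_zero_or_one 1 y (d * m) with h | h <;> rw [h1, h2, h] <;> simp only [mul_zero, mul_one]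
  · rw [sift_one_eq_one_iff] at h
    exact absurd (h1.symm.trans (sift_one_eq_one_iff.2 fun p hp hd => h p hp (hd.mul_right m))) zero_ne_one
  · rw [sift_one_eq_one_iff] at h
    exact absurd (h1.symm.trans (sift_one_eq_one_iff.2 fun p hp hd => h p hp (hd.mul_right m))) zero_ne_one
  · rw [sift_one_eq_one_iff] at h
    exact absurd (h2.symm.trans (sift_one_eq_one_iff.2 fun p hp hd => h p hp (hd.mul_left d))) zero_ne_one
  · rw [sift_one_eq_one_iff] at h1 h2
    exact absurd (h.symm.trans (sift_one_eq_one_iff.2 fun p hp hd =>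
      (hp.dvd_mul.1 hd).elim (h1 p hp) (h2 p hp))) zero_ne_one

/-- The difference of two residue class indicators, restricted to rough integers. -/
noncomputable def clDiff (y : ℕ) {q : ℕ} (β β' : ZMod q) (n : ℕ) : ℝ :=
  sift 1 y n * ((if (n : ZMod q) = β then 1 else 0) - if (n : ZMod q) = β' then 1 else 0)

lemma abs_sum_clDiff_mul_le {q : ℕ} (hq : 0 < q) {β β' : ZMod q} (hβ : IsUnit β) (hβ' : IsUnit β')
    {y : ℕ} (hy : 2 ≤ y) (hqy : q ≤ y) (s : ℕ) {δ T u : ℝ} (hδ : 0 ≤ δ) (hT : 2 ≤ T) {d : ℕ} (hd : 0 < d)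
    (hdT : d * (2 * T) ≤ Real.exp u) (hu : 108 ≤ Real.exp u) (M N : ℕ) :
    |∑ m ∈ Ioc M N, clDiff y β β' (d * m) * (logWt 3 δ (d * m) * kr T (u - Real.log (d * m : ℕ)))|
      ≤ 720 * (u + 1) ^ 3 * (sift 1 y d * (d : ℝ) ^ (-1 - 0 : ℝ) / (q.totient * Real.log y) / 2 ^ s
        + Real.exp (-u) * T * (y : ℝ) ^ (208 * (s + 3))) := by
  have hu0 : 0 < u := by
    rw [← Real.exp_lt_exp, Real.exp_zero]; linarith
  rcases sift_eq_zero_or_one 1 y d with h0 | h1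
  · have : ∀ m, clDiff y β β' (d * m) = 0 := fun m => by
      rw [clDiff, sift_one_mul, h0]; ring
    simp only [this, zero_mul, Finset.sum_const_zero, abs_zero, h0, zero_div, zero_add]
    positivity
  · obtain ⟨v, hv⟩ := isUnit_of_sift hq hqy h1
    have e : ∀ m : ℕ, clDiff y β β' (d * m) = clDiff y (↑v⁻¹ * β : ZMod q) (↑v⁻¹ * β' : ZMod q) m := fun m => by
      have h2 : ∀ γ : ZMod q, ((d * m : ℕ) : ZMod q) = γ ↔ (m : ZMod q) = ↑v⁻¹ * γ := fun γ => by
        rw [Nat.cast_mul, ← hv, Units.eq_inv_mul_iff_mul_eq]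
      rw [clDiff, clDiff, sift_one_mul, h1, one_mul]
      simp only [h2]
    have h3 := abs_sum_window_sub_le hq ((v⁻¹).isUnit.mul hβ) ((v⁻¹).isUnit.mul hβ') hy s hδ hT hd hdT hu M N
    simp only [e]
    refine h3.trans (le_of_eq ?_)
    rw [h1, sub_zero, Real.rpow_neg_one, one_mul]
    field_simp

lemma sum_card_divisors_mul {F : ℕ → ℝ} (z N : ℕ) (hz : z ≤ N) :
    ∑ n ∈ Ioc 0 N, (n.divisors.card : ℝ) * F n = ∑ d ∈ Ioc 0 z, ∑ m ∈ Ioc 0 (N / d), F (d * m)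
      + ∑ m ∈ Ioc 0 (N / (z + 1)), ∑ d ∈ Ioc z (N / m), F (m * d) := by
  have h1 : ∑ n ∈ Ioc 0 N, (n.divisors.card : ℝ) * F n
      = ∑ d ∈ Ioc 0 N, ∑ m ∈ Ioc 0 (N / d), F (d * m) := by
    have : ∀ d ∈ Ioc 0 N, ∑ m ∈ Ioc 0 (N / d), F (d * m) = ∑ n ∈ Ioc 0 N, if d ∣ n then F n else 0 :=
      fun d hd => by rw [← sum_filter_dvd F (mem_Ioc.1 hd).1, Finset.sum_filter]
    rw [Finset.sum_congr rfl this, Finset.sum_comm]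
    refine Finset.sum_congr rfl fun n hn => ?_
    rw [mem_Ioc] at hn
    rw [← Finset.sum_filter, Finset.sum_const, nsmul_eq_mul]
    congr 3
    ext d
    simp only [Nat.mem_divisors, mem_filter, mem_Ioc]
    exact ⟨fun h => ⟨⟨Nat.pos_of_dvd_of_pos h.1 hn.1, (Nat.le_of_dvd hn.1 h.1).trans hn.2⟩, h.1⟩,
      fun h => ⟨h.2, by omega⟩⟩
  rw [h1, ← Finset.sum_Ioc_consecutive _ (Nat.zero_le z) hz]
  congr 1
  refine (Finset.sum_comm' fun d m => ?_).trans (Finset.sum_congr rfl fun m _ =>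
    Finset.sum_congr rfl fun d _ => by rw [mul_comm])
  simp only [mem_Ioc]
  constructor
  · rintro ⟨⟨h2, h3⟩, h4, h5⟩
    have h6 : m * d ≤ N := (Nat.le_div_iff_mul_le (by omega)).1 h5
    refine ⟨⟨h2, (Nat.le_div_iff_mul_le h4).2 (by linarith)⟩, h4, (Nat.le_div_iff_mul_le (by omega)).2 ?_⟩
    exact (Nat.mul_le_mul_left m h2).trans h6
  · rintro ⟨⟨h2, h3⟩, h4, h5⟩
    have h6 : d * m ≤ N := (Nat.le_div_iff_mul_le (by omega)).1 h3
    exact ⟨⟨h2, (Nat.le_mul_of_pos_right d h4).trans h6⟩, h4, (Nat.le_div_iff_mul_le (by omega)).2 (by linarith)⟩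

/-- Type I estimate for `∑ τ(n)` and `∑ 1` over rough integers in residue classes. -/
lemma abs_sum_clDiff_divisors_le {q : ℕ} (hq : 0 < q) {β β' : ZMod q} (hβ : IsUnit β) (hβ' : IsUnit β')
    {b : ℕ} (hb : 625 ≤ b) {Z : ℕ} (hZ : 2 ≤ Z) (hqy : q ≤ Z) (s : ℕ) {δ u : ℝ} (hδ : 0 ≤ δ)
    (hZu : 8 * (Z : ℝ) ≤ Real.exp (u / 2)) :
    |∑ n ∈ Ioc 0 ⌊2 * Real.exp u⌋₊, clDiff (Z ^ b) β β' n * (2 - n.divisors.card / 2)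
        * (logWt 3 δ n * kr Z (u - Real.log n))|
      ≤ 720 * (u + 1) ^ 3 * ((2 + 2 * (1 + 3 / Real.log Z * (2 + u))) / (q.totient * Real.log Z) / 2 ^ s
        + 6 * Real.exp (-(u / 2)) * Z * ((Z ^ b : ℕ) : ℝ) ^ (208 * (s + 3))) := by
  have hy : 2 ≤ Z ^ b := hZ.trans (Nat.le_self_pow (by omega) _)
  have hqy' : q ≤ Z ^ b := hqy.trans (Nat.le_self_pow (by omega) _)
  have hZ' : (2 : ℝ) ≤ Z := by exact_mod_cast hZ
  have hφ : (0 : ℝ) < q.totient := by exact_mod_cast Nat.totient_pos.2 hq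
  have hℓ : 0 < Real.log Z := Real.log_pos (by linarith)
  have hℓy : Real.log Z ≤ Real.log (Z ^ b : ℕ) :=
    Real.log_le_log (by linarith) (by exact_mod_cast Nat.le_self_pow (by omega) _)
  set E := Real.exp (u / 2) with hE
  have hEu : Real.exp u = E * E := by rw [hE, ← Real.exp_add]; congr 1; ring
  have hE16 : 16 ≤ E := by linarith
  have hu : 108 ≤ Real.exp u := by rw [hEu]; nlinarith
  have hu0 : 0 < u := by rw [← Real.exp_lt_exp, Real.exp_zero]; linarith
  set Y := ((Z ^ b : ℕ) : ℝ) ^ (208 * (s + 3)) with hY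
  set G : ℕ → ℝ := fun n => clDiff (Z ^ b) β β' n * (logWt 3 δ n * kr Z (u - Real.log n)) with hG
  set P := Real.exp (-u) * Z * Y with hP
  have hY0 : 0 ≤ Y := by positivity
  have hP0 : 0 ≤ P := by positivity
  have hEn : Real.exp (-(u / 2)) = E⁻¹ := by rw [hE, Real.exp_neg]
  have hPE : P * E = Real.exp (-(u / 2)) * Z * Y := by
    rw [hP, hEn, Real.exp_neg, hEu]; field_simp
  set A := 1 + 3 / Real.log Z * (2 + u) with hA
  have claim : ∀ K : ℕ, (K : ℝ) ≤ 2 * E → ∀ f : ℕ → ℝ, (∀ d ∈ Ioc 0 K, |f d| ≤ 720 * (u + 1) ^ 3 *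
      (sift 1 (Z ^ b) d * (d : ℝ) ^ (-1 - 0 : ℝ) / (q.totient * Real.log (Z ^ b : ℕ)) / 2 ^ s + P)) →
      |∑ d ∈ Ioc 0 K, f d| ≤ 720 * (u + 1) ^ 3 * (A / (q.totient * Real.log Z) / 2 ^ s + 2 * E * P) := by
    intro K hK f hf
    refine (Finset.abs_sum_le_sum_abs _ _).trans ((Finset.sum_le_sum hf).trans ?_)
    rw [← Finset.mul_sum, Finset.sum_add_distrib, ← Finset.sum_div, ← Finset.sum_div, Finset.sum_const,
      Nat.card_Ioc, nsmul_eq_mul, Nat.sub_zero]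
    have h1 : ∑ n ∈ Ioc 0 K, (n : ℝ) ^ (-1 - 0 : ℝ) ≤ 2 + u := by
      refine (sum_rpow_le_log le_rfl K).trans ?_
      rcases Nat.eq_zero_or_pos K with rfl | hK0
      · simp; linarith
      have h2 : Real.log K ≤ Real.log (2 * E) := Real.log_le_log (by exact_mod_cast hK0) hK
      rw [Real.log_mul two_ne_zero (by positivity), hE, Real.log_exp] at h2
      linarith [Real.log_le_sub_one_of_pos (show (0 : ℝ) < 2 by norm_num)]
    have h3 : ∑ n ∈ Ioc 0 K, sift 1 (Z ^ b) n * (n : ℝ) ^ (-1 - 0 : ℝ) ≤ A :=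
      (sum_rough_mul_rpow_le hb hZ le_rfl K).trans (by rw [hA]; gcongr)
    have hA0 : 0 ≤ A := by positivity
    gcongr
  have hwin : ∀ d : ℕ, 0 < d → (d : ℝ) ≤ 2 * E → (d : ℝ) * (2 * Z) ≤ Real.exp u := fun d _ hd => by
    rw [hEu]
    calc (d : ℝ) * (2 * Z) ≤ 2 * E * (2 * Z) := by gcongr
      _ ≤ E * E := by nlinarith
  have hT1 : |∑ n ∈ Ioc 0 ⌊2 * Real.exp u⌋₊, G n| ≤ 720 * (u + 1) ^ 3 *
      (1 / (q.totient * Real.log Z) / 2 ^ s + E * P) := by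
    have h := abs_sum_clDiff_mul_le hq hβ hβ' hy hqy' s hδ hZ' (d := 1) one_pos
      (hwin 1 one_pos (by push_cast; linarith)) hu 0 ⌊2 * Real.exp u⌋₊
    simp only [one_mul, Nat.cast_one, Real.one_rpow, mul_one] at h
    refine h.trans ?_
    have h1 := sift_le_one 1 (Z ^ b) 1
    have h2 : P ≤ E * P := le_mul_of_one_le_left hP0 (by linarith)
    gcongr
  set z := ⌊E⌋₊ with hz
  set N := ⌊2 * Real.exp u⌋₊ with hN
  have hzE : (z : ℝ) ≤ 2 * E := (Nat.floor_le (by linarith)).trans (by linarith)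
  have hzN : z ≤ N := Nat.floor_le_floor (by rw [hEu]; nlinarith)
  have hKE : ((N / (z + 1) : ℕ) : ℝ) ≤ 2 * E := by
    refine Nat.cast_div_le.trans ?_
    rw [div_le_iff₀ (by positivity)]
    have h1 : (N : ℝ) ≤ 2 * Real.exp u := Nat.floor_le (by positivity)
    have h2 : E < z + 1 := Nat.lt_floor_add_one E
    push_cast
    rw [hEu] at h1
    nlinarith
  have hT2 := claim z hzE (fun d => ∑ m ∈ Ioc 0 (N / d), G (d * m)) fun d hd => by
    rw [mem_Ioc] at hd
    exact abs_sum_clDiff_mul_le hq hβ hβ' hy hqy' s hδ hZ' hd.1 (hwin d hd.1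
      (le_trans (by exact_mod_cast hd.2) hzE)) hu _ _
  have hT3 := claim (N / (z + 1)) hKE (fun m => ∑ d ∈ Ioc z (N / m), G (m * d)) fun d hd => by
    rw [mem_Ioc] at hd
    exact abs_sum_clDiff_mul_le hq hβ hβ' hy hqy' s hδ hZ' hd.1 (hwin d hd.1
      (le_trans (by exact_mod_cast hd.2) hKE)) hu _ _
  have hsplit : ∑ n ∈ Ioc 0 N, clDiff (Z ^ b) β β' n * (2 - n.divisors.card / 2)
        * (logWt 3 δ n * kr Z (u - Real.log n))
      = 2 * ∑ n ∈ Ioc 0 N, G n - 1 / 2 * (∑ d ∈ Ioc 0 z, ∑ m ∈ Ioc 0 (N / d), G (d * m)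
        + ∑ m ∈ Ioc 0 (N / (z + 1)), ∑ d ∈ Ioc z (N / m), G (m * d)) := by
    rw [← sum_card_divisors_mul z N hzN, Finset.mul_sum, Finset.mul_sum, ← Finset.sum_sub_distrib]
    exact Finset.sum_congr rfl fun n _ => by simp only [hG]; ring
  rw [hsplit]
  have e : 720 * (u + 1) ^ 3 * ((2 + 2 * A) / (q.totient * Real.log Z) / 2 ^ s
        + 6 * Real.exp (-(u / 2)) * Z * Y)
      = 2 * (720 * (u + 1) ^ 3 * (1 / (q.totient * Real.log Z) / 2 ^ s + E * P))
        + 2 * (720 * (u + 1) ^ 3 * (A / (q.totient * Real.log Z) / 2 ^ s + 2 * E * P)) := by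
    have : 6 * Real.exp (-(u / 2)) * Z * Y = 6 * (E * P) := by rw [mul_comm E, hPE]; ring
    rw [this]; ring
  rw [e, abs_le]
  have a1 := abs_le.1 hT1
  have a2 := abs_le.1 hT2
  have a3 := abs_le.1 hT3
  have a4 := (abs_nonneg _).trans hT2
  constructor <;> linarith [a1.1, a1.2, a2.1, a2.2, a3.1, a3.2]

end TypeOneDivisor

section TypeOneFinal

open ArithmeticFunction

lemma add_five_pow_three_le (s : ℕ) : (s + 5) ^ 3 ≤ 216 * 2 ^ s := by
  induction s with
  | zero => norm_num
  | succ s ih => rw [pow_succ 2]; nlinarith [sq_nonneg s, Nat.zero_le (s ^ 3)]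

theorem exists_abs_sum_clDiff_le (b : ℕ) (hb : 625 ≤ b) : ∃ C R₀ : ℝ, 1 ≤ C ∧ 2 ≤ R₀ ∧
    ∀ Z : ℕ, 2 ≤ Z → ∀ q : ℕ, 0 < q → q ≤ Z → ∀ β β' : ZMod q, IsUnit β → IsUnit β' →
    ∀ D : ℝ, R₀ * Real.log Z ≤ D → D ≤ Z → ∀ u : ℝ, D / 2 ≤ u → u ≤ D → ∀ δ : ℝ, 0 ≤ δ →
      |∑ n ∈ Ioc 0 ⌊2 * Real.exp u⌋₊, clDiff (Z ^ b) β β' n * (2 - n.divisors.card / 2)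
        * (logWt 3 δ n * kr Z (u - Real.log n))| ≤ C * (Real.log Z * D / q.totient) := by
  set κ : ℝ := 832 * b with hκ
  have hb' : (625 : ℝ) ≤ b := by exact_mod_cast hb
  have hκ1 : 1 ≤ κ := by linarith
  refine ⟨720 * 176 * 216 * κ ^ 3 + 720 * 48 * 4, 20 * κ, ?_, by linarith, ?_⟩
  · have : 0 ≤ κ ^ 3 := by positivity
    linarith
  intro Z hZ q hq hqZ β β' hβ hβ' D hRD hDZ u hu1 hu2 δ hδ
  have hZ' : (2 : ℝ) ≤ Z := by exact_mod_cast hZ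
  set ℓ := Real.log Z with hℓ
  have hℓ2 : 1 / 2 ≤ ℓ := half_le_log hZ
  have hℓ0 : 0 < ℓ := by linarith
  set R := D / ℓ with hR
  have hR20 : 20 * κ ≤ R := by rw [hR, le_div_iff₀ hℓ0]; exact hRD
  have hDR : D = R * ℓ := by rw [hR]; field_simp
  have hD1 : 1 ≤ D := by nlinarith
  have hR1 : 1 ≤ R := by linarith
  have hfl : 20 ≤ ⌊R / κ⌋₊ := Nat.le_floor (by rw [le_div_iff₀ (by linarith)]; exact_mod_cast hR20)
  obtain ⟨s, hs⟩ := Nat.exists_eq_add_of_le (show 4 ≤ ⌊R / κ⌋₊ by omega)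
  have hs1 : κ * (s + 4) ≤ R := by
    have h := Nat.floor_le (show 0 ≤ R / κ by positivity)
    rw [hs, le_div_iff₀ (by linarith)] at h
    push_cast at h; linarith
  have hs2 : R ≤ κ * (s + 5) := by
    have h := (Nat.lt_floor_add_one (R / κ)).le
    rw [hs, div_le_iff₀ (by linarith)] at h
    push_cast at h; linarith
  set Y := ((Z ^ b : ℕ) : ℝ) ^ (208 * (s + 3)) with hY
  have hY1 : 1 ≤ Y := one_le_pow₀ (by exact_mod_cast Nat.one_le_pow _ _ (by omega))
  have hYE : (Z : ℝ) ^ 5 * Y ≤ Real.exp (u / 2) := by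
    rw [← Real.log_le_iff_le_exp (by positivity), Real.log_mul (by positivity) (by positivity), hY,
      Nat.cast_pow, ← pow_mul, Real.log_pow, Real.log_pow]
    have h1 : ((5 : ℕ) : ℝ) * ℓ + ((b * (208 * (s + 3)) : ℕ) : ℝ) * ℓ ≤ D / 4 := by
      have h2 : κ * (s + 4) * ℓ ≤ D := by rw [hDR]; gcongr
      rw [hκ] at h2
      push_cast
      nlinarith
    linarith
  have hZ8 : 8 * (Z : ℝ) ≤ Real.exp (u / 2) := by
    refine le_trans ?_ hYE
    calc 8 * (Z : ℝ) ≤ Z ^ 4 * Z := by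
          gcongr
          calc (8 : ℝ) ≤ 2 ^ 4 := by norm_num
            _ ≤ _ := by gcongr
      _ = Z ^ 5 * 1 := by ring
      _ ≤ _ := by gcongr
  refine (abs_sum_clDiff_divisors_le hq hβ hβ' hb hZ hqZ s hδ hZ8).trans ?_
  have hφ : (0 : ℝ) < q.totient := by exact_mod_cast Nat.totient_pos.2 hq
  have hφZ : (q.totient : ℝ) ≤ Z := by exact_mod_cast (Nat.totient_le q).trans hqZ
  have hu0 : 0 ≤ u := by linarith
  have h1 : (u + 1) ^ 3 * ((2 + 2 * (1 + 3 / ℓ * (2 + u))) / (q.totient * ℓ) / 2 ^ s)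
      ≤ 176 * 216 * κ ^ 3 * (ℓ * D / q.totient) := by
    have e1 : 2 + 2 * (1 + 3 / ℓ * (2 + u)) ≤ 22 * R := by
      have : 3 / ℓ * (2 + u) ≤ 3 / ℓ * (3 * D) := by gcongr; linarith
      have e : 3 / ℓ * (3 * D) = 9 * R := by rw [hR]; ring
      linarith
    have e2 : R ^ 3 ≤ 216 * κ ^ 3 * 2 ^ s := by
      have : ((s : ℝ) + 5) ^ 3 ≤ 216 * 2 ^ s := by exact_mod_cast add_five_pow_three_le s
      calc R ^ 3 ≤ (κ * (s + 5)) ^ 3 := by gcongr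
        _ = κ ^ 3 * (s + 5) ^ 3 := by ring
        _ ≤ κ ^ 3 * (216 * 2 ^ s) := by gcongr
        _ = _ := by ring
    calc _ ≤ (2 * D) ^ 3 * (22 * R / (q.totient * ℓ) / 2 ^ s) := by gcongr; linarith
      _ = 176 * (ℓ * D / q.totient) * (R ^ 3 / 2 ^ s) := by rw [hDR]; field_simp; ring
      _ ≤ 176 * (ℓ * D / q.totient) * (216 * κ ^ 3) := by
        gcongr
        rw [div_le_iff₀ (by positivity)]; exact e2
      _ = _ := by ring
  have h2 : (u + 1) ^ 3 * (6 * Real.exp (-(u / 2)) * Z * Y) ≤ 48 * 4 * (ℓ * D / q.totient) := by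
    have e1 : Real.exp (-(u / 2)) ≤ ((Z : ℝ) ^ 5 * Y)⁻¹ := by
      rw [Real.exp_neg]; gcongr
    calc _ ≤ (2 * (Z : ℝ)) ^ 3 * (6 * ((Z : ℝ) ^ 5 * Y)⁻¹ * Z * Y) := by gcongr; linarith
      _ = 48 * (1 / Z) := by field_simp; norm_num
      _ ≤ 48 * (1 / q.totient) := by gcongr
      _ ≤ 48 * (4 * (ℓ * D) / q.totient) := by gcongr; nlinarith
      _ = _ := by ring
  calc _ = 720 * ((u + 1) ^ 3 * ((2 + 2 * (1 + 3 / ℓ * (2 + u))) / (q.totient * ℓ) / 2 ^ s))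
        + 720 * ((u + 1) ^ 3 * (6 * Real.exp (-(u / 2)) * Z * Y)) := by ring
    _ ≤ 720 * (176 * 216 * κ ^ 3 * (ℓ * D / q.totient)) + 720 * (48 * 4 * (ℓ * D / q.totient)) := by gcongr
    _ = _ := by ring

end TypeOneFinal

section Smoothed

open ArithmeticFunction

lemma norm_sum_kr_le {f : ℕ → ℂ} (hf : LSeries.abscissaOfAbsConv f ≤ 1) {δ : ℝ} (hδ : 0 < δ) {T : ℝ}
    (hT : 0 < T) {u : ℝ} {N : ℕ} (hN : u + 1 / T ≤ Real.log (N + 1)) :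
    ‖∑ n ∈ Ioc 0 N, f n * (((n : ℝ) ^ (-1 - δ) * kr T (u - Real.log n) : ℝ) : ℂ)‖
      ≤ ∫ t : ℝ, ‖LSeries f (pt δ t)‖ * wk T t := by
  have h := integral_LSeries_wk hf hδ hT hN
  have hπ : (1 : ℝ) ≤ 2 * Real.pi := by linarith [Real.pi_gt_three]
  have h2 : ‖∫ t : ℝ, LSeries f (pt δ t) * (Complex.exp (t * u * Complex.I) * wk T t)‖
      ≤ ∫ t : ℝ, ‖LSeries f (pt δ t)‖ * wk T t := by
    refine (MeasureTheory.norm_integral_le_integral_norm _).trans (le_of_eq ?_)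
    congr 1
    funext t
    rw [norm_mul, norm_mul, ← Complex.ofReal_mul, Complex.norm_exp_ofReal_mul_I, one_mul,
      Complex.norm_real, Real.norm_eq_abs, abs_of_nonneg (wk_nonneg _ _)]
  refine le_trans ?_ h2
  rw [h, norm_mul, ← Complex.ofReal_ofNat, ← Complex.ofReal_mul, Complex.norm_real, Real.norm_eq_abs,
    abs_of_pos (by linarith)]
  exact le_mul_of_one_le_left (norm_nonneg _) hπ

lemma norm_sum_hSeq_le {q y : ℕ} (χ : DirichletCharacter ℂ q) {δ : ℝ} (hδ : 0 < δ) {T : ℝ} (hT : 0 < T)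
    {u : ℝ} {N : ℕ} (hN : u + 1 / T ≤ Real.log (N + 1)) :
    ‖∑ n ∈ Ioc 0 N, (sift 1 y n : ℂ) * χ (n : ZMod q)
        * ((hW n * Real.log n ^ 2 * ((n : ℝ) ^ (-1 - δ) * kr T (u - Real.log n)) : ℝ) : ℂ)‖
      ≤ ∫ t : ℝ, ‖LSeries (hSeq (rchar y χ)) (pt δ t)‖ * wk T t := by
  refine le_trans (le_of_eq ?_) (norm_sum_kr_le (abscissa_hSeq (rchar y χ)) hδ hT hN)
  exact congrArg norm (Finset.sum_congr rfl fun n _ => by rw [hSeq, rchar_apply]; push_cast; ring)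

lemma norm_sum_class_fun_le {q y : ℕ} [NeZero q] {v : ZMod q → ℂ} (hv : ∀ β, ¬ IsUnit β → v β = 0)
    (hv0 : ∑ β, v β = 0) (F : ℕ → ℝ) {B : ℝ} (N : ℕ)
    (hB : ∀ β, IsUnit β → |∑ n ∈ Ioc 0 N, clDiff y β (1 : ZMod q) n * F n| ≤ B) :
    ‖∑ n ∈ Ioc 0 N, (sift 1 y n : ℂ) * v (n : ZMod q) * (F n : ℂ)‖ ≤ (∑ β, ‖v β‖) * B := by
  have e : ∑ n ∈ Ioc 0 N, (sift 1 y n : ℂ) * v (n : ZMod q) * (F n : ℂ)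
      = ∑ β : ZMod q, v β * ((∑ n ∈ Ioc 0 N, clDiff y β (1 : ZMod q) n * F n : ℝ) : ℂ) := by
    simp only [Complex.ofReal_sum, Finset.mul_sum]
    rw [Finset.sum_comm]
    refine Finset.sum_congr rfl fun n _ => ?_
    have h1 : ∀ β : ZMod q, v β * ((clDiff y β (1 : ZMod q) n * F n : ℝ) : ℂ)
        = (sift 1 y n : ℂ) * (F n : ℂ) * (if (n : ZMod q) = β then v β else 0)
          - v β * ((sift 1 y n : ℂ) * (F n : ℂ) * if (n : ZMod q) = 1 then 1 else 0) := fun β => by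
      rw [clDiff]
      push_cast
      split_ifs <;> simp only [Complex.ofReal_one, Complex.ofReal_zero] <;> ring
    simp only [h1]
    rw [Finset.sum_sub_distrib, ← Finset.sum_mul, hv0, zero_mul, sub_zero, ← Finset.mul_sum,
      Finset.sum_ite_eq]
    simp only [mem_univ, if_true]
    ring
  rw [e, Finset.sum_mul]
  refine (norm_sum_le _ _).trans (Finset.sum_le_sum fun β _ => ?_)
  rw [norm_mul, Complex.norm_real, Real.norm_eq_abs]
  by_cases hβ : IsUnit β
  · exact mul_le_mul_of_nonneg_left (hB β hβ) (norm_nonneg _)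
  · simp [hv β hβ]

/-- Smoothed prime sums against combinations of characters avoiding an exceptional one. -/
theorem exists_smoothed_char_le (b : ℕ) (hb : 627 ≤ b) : ∃ C R₀ : ℝ, 1 ≤ C ∧ 2 ≤ R₀ ∧
    ∀ Z : ℕ, 2 ≤ Z → ∀ q : ℕ, ∀ [NeZero q], q ≤ Z → ∃ 𝒳 : Finset (DirichletCharacter ℂ q), 𝒳.card ≤ 1 ∧
      (∀ χ ∈ 𝒳, χ ≠ 1) ∧ ∀ D : ℝ, R₀ * Real.log Z ≤ D → D ≤ Z → ∀ u : ℝ, D / 2 ≤ u → u ≤ D →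
      ∀ S : Finset (DirichletCharacter ℂ q), (∀ χ ∈ S, χ ≠ 1 ∧ χ ∉ 𝒳) →
      ∀ g : DirichletCharacter ℂ q → ℂ, (∀ χ, ‖g χ‖ ≤ 1) →
      (∑ β : ZMod q, ‖∑ χ ∈ S, g χ * χ β‖ ≤ 3 * q.totient) →
        ‖∑ n ∈ Ioc 0 ⌊2 * Real.exp u⌋₊, (sift 1 (Z ^ b) n : ℂ) * (∑ χ ∈ S, g χ * χ (n : ZMod q))
          * ((Λ n * (logWt 2 (1 / D) n * kr Z (u - Real.log n)) : ℝ) : ℂ)‖ ≤ C * (Real.log Z * D) := by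
  obtain ⟨C₁, η, hC₁, hη, hη4, hH⟩ := exists_sum_integral_hSeq_le b hb
  obtain ⟨C₂, R₀, hC₂, hR₀, hW'⟩ := exists_abs_sum_clDiff_le b (by omega)
  refine ⟨C₁ + 3 * C₂, max R₀ (1 / η), by linarith, hR₀.trans (le_max_left _ _), ?_⟩
  intro Z hZ q _ hqZ
  have hq : 0 < q := Nat.pos_of_neZero q
  obtain ⟨𝒳, h𝒳1, h𝒳2, hH⟩ := hH Z hZ q hq hqZ
  refine ⟨𝒳, h𝒳1, h𝒳2, fun D hRD hDZ u hu1 hu2 S hS g hg hgS => ?_⟩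
  have hZ' : (2 : ℝ) ≤ Z := by exact_mod_cast hZ
  have hℓ2 : 1 / 2 ≤ Real.log Z := half_le_log hZ
  have hℓ0 : 0 < Real.log Z := by linarith
  have hRD1 : R₀ * Real.log Z ≤ D := le_trans (by gcongr; exact le_max_left _ _) hRD
  have hRD2 : 1 / η * Real.log Z ≤ D := le_trans (by gcongr; exact le_max_right _ _) hRD
  have hD1 : 1 ≤ D := by nlinarith
  have hD0 : 0 < D := by linarith
  set N := ⌊2 * Real.exp u⌋₊ with hN
  have hNu : u + 1 / (Z : ℝ) ≤ Real.log (N + 1) := by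
    have h1 : 2 * Real.exp u < N + 1 := Nat.lt_floor_add_one _
    have h2 : Real.log (2 * Real.exp u) ≤ Real.log (N + 1) := Real.log_le_log (by positivity) h1.le
    rw [Real.log_mul two_ne_zero (Real.exp_ne_zero _), Real.log_exp] at h2
    have h3 : 1 / (Z : ℝ) ≤ 1 / 2 := by gcongr
    linarith [Real.log_two_gt_d9]
  set v : ZMod q → ℂ := fun β => ∑ χ ∈ S, g χ * χ β with hv
  have hpart1 : ‖∑ n ∈ Ioc 0 N, (sift 1 (Z ^ b) n : ℂ) * v (n : ZMod q)
      * ((hW n * Real.log n ^ 2 * ((n : ℝ) ^ (-1 - 1 / D) * kr Z (u - Real.log n)) : ℝ) : ℂ)‖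
      ≤ C₁ * (Real.log Z * D) := by
    have e : ∑ n ∈ Ioc 0 N, (sift 1 (Z ^ b) n : ℂ) * v (n : ZMod q)
        * ((hW n * Real.log n ^ 2 * ((n : ℝ) ^ (-1 - 1 / D) * kr Z (u - Real.log n)) : ℝ) : ℂ)
        = ∑ χ ∈ S, g χ * ∑ n ∈ Ioc 0 N, (sift 1 (Z ^ b) n : ℂ) * χ (n : ZMod q)
        * ((hW n * Real.log n ^ 2 * ((n : ℝ) ^ (-1 - 1 / D) * kr Z (u - Real.log n)) : ℝ) : ℂ) := by
      simp only [hv, Finset.mul_sum, Finset.sum_mul]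
      rw [Finset.sum_comm]
      exact Finset.sum_congr rfl fun χ _ => Finset.sum_congr rfl fun n _ => by ring
    have h1 := hH (1 / D) (by positivity) (by rw [div_le_one hD0]; exact hD1)
      (by
        rw [one_div, inv_mul_le_iff₀ hD0]
        rw [one_div, inv_mul_le_iff₀ hη] at hRD2
        linarith) (by rwa [one_div_one_div]) S hS
    rw [e]
    refine (norm_sum_le _ _).trans (le_trans (Finset.sum_le_sum fun χ _ => ?_)
      (h1.trans (le_of_eq (by rw [div_div_eq_mul_div, div_one]))))
    rw [norm_mul]
    refine (mul_le_of_le_one_left (norm_nonneg _) (hg χ)).trans ?_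
    exact norm_sum_hSeq_le χ (by positivity) (by linarith) hNu
  have hpart2 : ‖∑ n ∈ Ioc 0 N, (sift 1 (Z ^ b) n : ℂ) * v (n : ZMod q)
      * (((2 - n.divisors.card / 2) * (logWt 3 (1 / D) n * kr Z (u - Real.log n)) : ℝ) : ℂ)‖
      ≤ 3 * C₂ * (Real.log Z * D) := by
    have hφ : (0 : ℝ) < q.totient := by exact_mod_cast Nat.totient_pos.2 hq
    refine (norm_sum_class_fun_le (v := v) (fun β hβ => ?_) ?_ (fun n =>
      (2 - n.divisors.card / 2) * (logWt 3 (1 / D) n * kr Z (u - Real.log n))) N (fun β hβ => ?_)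
      (B := C₂ * (Real.log Z * D / q.totient))).trans ?_
    · exact Finset.sum_eq_zero fun χ _ => by rw [MulChar.map_nonunit _ hβ, mul_zero]
    · simp only [hv]
      rw [Finset.sum_comm]
      refine Finset.sum_eq_zero fun χ hχ => ?_
      rw [← Finset.mul_sum, MulChar.sum_eq_zero_of_ne_one (hS χ hχ).1, mul_zero]
    · have h := hW' Z hZ q hq hqZ β 1 hβ isUnit_one D hRD1 hDZ u hu1 hu2 (1 / D) (by positivity)
      simpa only [mul_assoc] using h
    · calc _ ≤ 3 * (q.totient : ℝ) * (C₂ * (Real.log Z * D / q.totient)) := by gcongr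
        _ = _ := by field_simp
  have e : ∑ n ∈ Ioc 0 N, (sift 1 (Z ^ b) n : ℂ) * v (n : ZMod q)
          * ((Λ n * (logWt 2 (1 / D) n * kr Z (u - Real.log n)) : ℝ) : ℂ)
      = ∑ n ∈ Ioc 0 N, (sift 1 (Z ^ b) n : ℂ) * v (n : ZMod q)
      * ((hW n * Real.log n ^ 2 * ((n : ℝ) ^ (-1 - 1 / D) * kr Z (u - Real.log n)) : ℝ) : ℂ)
      + ∑ n ∈ Ioc 0 N, (sift 1 (Z ^ b) n : ℂ) * v (n : ZMod q)
      * (((2 - n.divisors.card / 2) * (logWt 3 (1 / D) n * kr Z (u - Real.log n)) : ℝ) : ℂ) := by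
    rw [← Finset.sum_add_distrib]
    refine Finset.sum_congr rfl fun n _ => ?_
    rw [← mul_add, ← Complex.ofReal_add]
    congr 2
    simp only [hW, logWt]
    ring
  rw [e]
  refine (norm_add_le _ _).trans ?_
  linarith

end Smoothed

section Desmoothing

open ArithmeticFunction

lemma sum_tri_sub (s : Finset ℕ) {w : ℝ} (hw : 0 ≤ w) :
    ∑ k ∈ s, tri (k - w) = (if ⌊w⌋₊ ∈ s then 1 - (w - ⌊w⌋₊) else 0) + if ⌊w⌋₊ + 1 ∈ s then w - ⌊w⌋₊ else 0 := by
  have h1 := Nat.floor_le hw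
  have h2 := Nat.lt_floor_add_one w
  have e : ∀ k : ℕ, tri (k - w) = (if k = ⌊w⌋₊ then 1 - (w - ⌊w⌋₊) else 0)
      + if k = ⌊w⌋₊ + 1 then w - ⌊w⌋₊ else 0 := fun k => by
    rcases lt_trichotomy k ⌊w⌋₊ with h | h | h
    · rw [if_neg h.ne, if_neg (by omega), add_zero]
      refine tri_eq_zero (le_trans ?_ (neg_le_abs _))
      have : (k : ℝ) + 1 ≤ ⌊w⌋₊ := by exact_mod_cast h
      linarith
    · rw [if_pos h, if_neg (by omega), add_zero, h, tri, abs_of_nonpos (by linarith), max_eq_right (by linarith)]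
      ring
    · rw [if_neg (by omega), zero_add]
      split_ifs with h'
      · rw [h', tri]
        push_cast
        rw [abs_of_nonneg (by linarith), max_eq_right (by linarith)]
        ring
      · refine tri_eq_zero (le_trans ?_ (le_abs_self _))
        have : (⌊w⌋₊ : ℝ) + 2 ≤ k := by exact_mod_cast (show ⌊w⌋₊ + 2 ≤ k by omega)
        linarith
  simp only [e, Finset.sum_add_distrib, Finset.sum_ite_eq']

lemma sum_tri_sub_le_one (s : Finset ℕ) {w : ℝ} (hw : 0 ≤ w) : ∑ k ∈ s, tri (k - w) ≤ 1 := by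
  rw [sum_tri_sub s hw]
  have h1 := Nat.floor_le hw
  have h2 := Nat.lt_floor_add_one w
  split_ifs <;> linarith

lemma sum_tri_sub_eq_one {s : Finset ℕ} {w : ℝ} (hw : 0 ≤ w) (h1 : ⌊w⌋₊ ∈ s) (h2 : ⌊w⌋₊ + 1 ∈ s) :
    ∑ k ∈ s, tri (k - w) = 1 := by
  rw [sum_tri_sub s hw, if_pos h1, if_pos h2]; ring

lemma sum_exp_div_le {T : ℝ} (hT : 1 ≤ T) (s : Finset ℕ) {K : ℕ} (hs : s ⊆ range (K + 1)) :
    ∑ k ∈ s, 1 / T * Real.exp (k / T) ≤ 2 * Real.exp (K / T) := by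
  have hT0 : 0 < T := by linarith
  have h1 : ∀ k : ℕ, 1 / T * Real.exp (k / T)
      ≤ 2 * Real.exp (((k + 1 : ℕ) : ℝ) / T - 1 / T) - 2 * Real.exp ((k : ℝ) / T - 1 / T) := fun k => by
    have e1 : ((k + 1 : ℕ) : ℝ) / T - 1 / T = k / T := by push_cast; ring
    rw [e1, Real.exp_sub]
    have h2 : 1 + 1 / T ≤ Real.exp (1 / T) := by linarith [Real.add_one_le_exp (1 / T)]
    have h3 : Real.exp (k / T) / Real.exp (1 / T) ≤ Real.exp (k / T) / (1 + 1 / T) := by gcongr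
    have h4 : 1 / T * Real.exp (k / T) ≤ 2 * Real.exp (k / T) - 2 * (Real.exp (k / T) / (1 + 1 / T)) := by
      have h5 : 1 / T ≤ 2 - 2 / (1 + 1 / T) := by
        rw [le_sub_iff_add_le, ← le_sub_iff_add_le', div_le_iff₀ (by positivity)]
        have : 1 / T ≤ 1 := by rw [div_le_one hT0]; exact hT
        nlinarith [one_div_pos.2 hT0]
      calc _ ≤ (2 - 2 / (1 + 1 / T)) * Real.exp (k / T) := by gcongr
        _ = _ := by ring
    linarith
  calc ∑ k ∈ s, 1 / T * Real.exp (k / T) ≤ ∑ k ∈ range (K + 1), 1 / T * Real.exp (k / T) :=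
        Finset.sum_le_sum_of_subset_of_nonneg hs fun _ _ _ => by positivity
    _ ≤ ∑ k ∈ range (K + 1), (2 * Real.exp (((k + 1 : ℕ) : ℝ) / T - 1 / T)
          - 2 * Real.exp ((k : ℝ) / T - 1 / T)) := Finset.sum_le_sum fun k _ => h1 k
    _ = 2 * Real.exp (((K + 1 : ℕ) : ℝ) / T - 1 / T) - 2 * Real.exp (((0 : ℕ) : ℝ) / T - 1 / T) :=
        Finset.sum_range_sub (fun k : ℕ => 2 * Real.exp ((k : ℝ) / T - 1 / T)) _
    _ ≤ _ := by
        have e1 : ((K + 1 : ℕ) : ℝ) / T - 1 / T = K / T := by push_cast; ring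
        rw [e1]
        linarith [Real.exp_pos (((0 : ℕ) : ℝ) / T - 1 / T)]

/-- The weight undoing the smoothing is `1 + O(1/T)`. -/
lemma abs_weight_sub_one_le {T δ u v : ℝ} (hT : 4 ≤ T) (hδ0 : 0 ≤ δ) (hδ : δ ≤ 1) (hu : 1 ≤ u)
    (h : |u - v| ≤ 1 / T) :
    |Real.exp ((1 + δ) * u) / u ^ 2 * (v ^ 2 * Real.exp ((-1 - δ) * v)) - 1| ≤ 10 / T := by
  have hT0 : 0 < T := by linarith
  obtain ⟨h1, h2⟩ := abs_le.1 h
  set t := 1 / T with ht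
  have ht0 : 0 < t := by positivity
  have ht4 : t ≤ 1 / 4 := by rw [ht]; gcongr
  have e : Real.exp ((1 + δ) * u) / u ^ 2 * (v ^ 2 * Real.exp ((-1 - δ) * v))
      = Real.exp ((1 + δ) * (u - v)) * (v / u) ^ 2 := by
    rw [show (1 + δ) * (u - v) = (1 + δ) * u + (-1 - δ) * v by ring, Real.exp_add]
    field_simp
  have hvu1 : 1 - t ≤ v / u := by rw [le_div_iff₀ (by linarith)]; nlinarith
  have hvu2 : v / u ≤ 1 + t := by rw [div_le_iff₀ (by linarith)]; nlinarith
  have hvu0 : 0 ≤ v / u := by linarith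
  have ha1 : 1 - 2 * t ≤ Real.exp ((1 + δ) * (u - v)) := by
    have := Real.add_one_le_exp ((1 + δ) * (u - v))
    nlinarith
  have ha2 : Real.exp ((1 + δ) * (u - v)) ≤ 1 + 4 * t := by
    have h3 : Real.exp ((1 + δ) * (u - v)) ≤ Real.exp (2 * t) := Real.exp_le_exp.2 (by nlinarith)
    have h4 := Real.abs_exp_sub_one_le (x := 2 * t) (by rw [abs_of_nonneg (by linarith)]; linarith)
    rw [abs_of_nonneg (by linarith : (0 : ℝ) ≤ 2 * t)] at h4
    linarith [(abs_le.1 h4).2]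
  have e8 : 10 / T = 10 * t := by rw [ht]; ring
  rw [e, e8, abs_le]
  constructor
  · have h5 : (1 - 2 * t) * (1 - t) ^ 2 ≤ Real.exp ((1 + δ) * (u - v)) * (v / u) ^ 2 := by
      have : 0 ≤ 1 - t := by linarith
      have : 0 ≤ 1 - 2 * t := by linarith
      gcongr
    have h6 : 0 ≤ t ^ 2 * (5 - 2 * t) := by
      have : 0 ≤ 5 - 2 * t := by linarith
      positivity
    nlinarith
  · have h5 : Real.exp ((1 + δ) * (u - v)) * (v / u) ^ 2 ≤ (1 + 4 * t) * (1 + t) ^ 2 := by gcongr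
    have h6 : 0 ≤ t * (4 - 9 * t - 4 * t ^ 2) := mul_nonneg ht0.le (by nlinarith)
    nlinarith

end Desmoothing

section Transfer

open ArithmeticFunction

set_option maxHeartbeats 1000000 in
/-- From smoothed sums weighted by `log² n / n^(1+1/D)` to sharp sums. -/
theorem norm_sum_le_of_smoothed {c : ℕ → ℂ} {D T E K w : ℝ} (hD : 2 ≤ D) (hT : 4 ≤ T) (hw : 1 ≤ w)
    (hwT : 8 * w * T ^ 2 ≤ Real.exp D) (hwD : w ≤ Real.exp (D / 2)) (hK0 : 0 ≤ K)
    (hE : ∀ u, D / 2 ≤ u → u ≤ D → ‖∑ n ∈ Ioc 0 ⌊2 * Real.exp u⌋₊,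
      c n * ((logWt 2 (1 / D) n * kr T (u - Real.log n) : ℝ) : ℂ)‖ ≤ E)
    (hK : ∀ M N : ℕ, M ≤ N → w * N ≤ ((N : ℝ) - M) ^ 2 → ∑ n ∈ Ioc M N, ‖c n‖ ≤ K * ((N : ℝ) - M)) :
    ‖∑ n ∈ Ioc 0 ⌊Real.exp D⌋₊, c n‖ ≤ 24 * (E * Real.exp D / D ^ 2) + 30 * (K * Real.exp D / T) := by
  have hT0 : 0 < T := by linarith
  have hD0 : 0 < D := by linarith
  set x := Real.exp D with hx
  set X := Real.exp (D / 2) with hX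
  have hxX : x = X * X := by rw [hx, hX, ← Real.exp_add]; congr 1; ring
  have hX0 : 0 < X := Real.exp_pos _
  have hTX : 2 * T ≤ X := by
    by_contra! h
    nlinarith
  set k₀ := ⌈T * (D / 2)⌉₊ with hk0
  set k₁ := ⌊T * D⌋₊ with hk1
  have hk0l : T * (D / 2) ≤ k₀ := Nat.le_ceil _
  have hk0u : (k₀ : ℝ) < T * (D / 2) + 1 := Nat.ceil_lt_add_one (by positivity)
  have hk1l : T * D < k₁ + 1 := Nat.lt_floor_add_one _
  have hk1u : (k₁ : ℝ) ≤ T * D := Nat.floor_le (by positivity)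
  set s := Icc k₀ k₁ with hs
  have hsu : ∀ k ∈ s, D / 2 ≤ (k : ℝ) / T ∧ (k : ℝ) / T ≤ D := fun k hk => by
    rw [hs, mem_Icc] at hk
    have h1 : (k₀ : ℝ) ≤ k := by exact_mod_cast hk.1
    have h2 : (k : ℝ) ≤ k₁ := by exact_mod_cast hk.2
    rw [le_div_iff₀ hT0, div_le_iff₀ hT0]
    constructor <;> linarith
  set N' := ⌊2 * x⌋₊ with hN'
  set G : ℝ → ℝ := fun u => Real.exp ((1 + 1 / D) * u) / u ^ 2 with hG
  have hG0 : ∀ u, 0 ≤ G u := fun u => by positivity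
  set ω : ℕ → ℝ := fun n => ∑ k ∈ s, 1 / T * G (k / T) * (logWt 2 (1 / D) n * kr T (k / T - Real.log n)) with hω
  have hkx : Real.exp (k₁ / T) ≤ x := Real.exp_le_exp.2 (by rw [div_le_iff₀ hT0]; linarith)
  have hkx2 : x / 2 ≤ Real.exp (k₁ / T) := by
    have h1 : D - 1 / T ≤ k₁ / T := by
      rw [le_div_iff₀ hT0, sub_mul, div_mul_cancel₀ _ hT0.ne']; linarith
    have h2 : Real.exp (D - 1 / T) ≤ Real.exp (k₁ / T) := Real.exp_le_exp.2 h1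
    rw [Real.exp_sub] at h2
    have h3 : Real.exp (1 / T) ≤ 2 := by
      have h5 : 1 / T ≤ Real.log 2 := by
        have : 1 / T ≤ 1 / 4 := by gcongr
        linarith [Real.log_two_gt_d9]
      calc _ ≤ Real.exp (Real.log 2) := Real.exp_le_exp.2 h5
        _ = 2 := Real.exp_log two_pos
    refine le_trans ?_ h2
    have : 0 < x := Real.exp_pos _
    gcongr
  have hx0 : 0 < x := Real.exp_pos _
  have hE0 : 0 ≤ E := (norm_nonneg _).trans (hE D (by linarith) le_rfl)
  have hmain : ‖∑ n ∈ Ioc 0 N', c n * (ω n : ℂ)‖ ≤ 24 * (E * x / D ^ 2) := by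
    have e : ∑ n ∈ Ioc 0 N', c n * (ω n : ℂ) = ∑ k ∈ s, ((1 / T * G (k / T) : ℝ) : ℂ)
        * ∑ n ∈ Ioc 0 N', c n * ((logWt 2 (1 / D) n * kr T (k / T - Real.log n) : ℝ) : ℂ) := by
      simp only [hω, Complex.ofReal_sum, Finset.mul_sum]
      rw [Finset.sum_comm]
      refine Finset.sum_congr rfl fun k _ => Finset.sum_congr rfl fun n _ => ?_
      push_cast
      ring
    have h1 : ∀ k ∈ s, ‖((1 / T * G (k / T) : ℝ) : ℂ)
        * ∑ n ∈ Ioc 0 N', c n * ((logWt 2 (1 / D) n * kr T (k / T - Real.log n) : ℝ) : ℂ)‖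
        ≤ 1 / T * Real.exp (k / T) * (12 * E / D ^ 2) := fun k hk => by
      obtain ⟨hu1, hu2⟩ := hsu k hk
      have e1 : ∑ n ∈ Ioc 0 N', c n * ((logWt 2 (1 / D) n * kr T (k / T - Real.log n) : ℝ) : ℂ)
          = ∑ n ∈ Ioc 0 ⌊2 * Real.exp (k / T)⌋₊,
            c n * ((logWt 2 (1 / D) n * kr T (k / T - Real.log n) : ℝ) : ℂ) := by
        symm
        refine Finset.sum_subset (Finset.Ioc_subset_Ioc_right (Nat.floor_le_floor ?_)) fun n hn hn' => ?_
        · have := Real.exp_le_exp.2 hu2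
          linarith
        · rw [mem_Ioc] at hn hn'
          have h3 : 2 * Real.exp (k / T) < n := by
            by_contra! h
            exact hn' ⟨hn.1, Nat.le_floor h⟩
          have h4 : Real.log (2 * Real.exp (k / T)) ≤ Real.log n := Real.log_le_log (by positivity) h3.le
          rw [Real.log_mul two_ne_zero (Real.exp_ne_zero _), Real.log_exp] at h4
          have h5 : 1 / T ≤ 1 / 4 := by gcongr
          rw [kr_eq_zero hT0 (le_trans ?_ (neg_le_abs _))]
          · simp
          · linarith [Real.log_two_gt_d9]
      have hGk : G (k / T) ≤ Real.exp (k / T) * (12 / D ^ 2) := by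
        have h3 : Real.exp ((1 + 1 / D) * (k / T)) ≤ Real.exp (k / T) * 3 := by
          have h4 : 1 / D * (k / T) ≤ 1 := by rw [one_div, inv_mul_le_iff₀ hD0]; linarith
          rw [add_mul, one_mul, Real.exp_add]
          have : Real.exp (1 / D * (k / T)) ≤ Real.exp 1 := Real.exp_le_exp.2 h4
          have := Real.exp_one_lt_d9
          gcongr
          linarith
        calc G (k / T) ≤ Real.exp (k / T) * 3 / (D / 2) ^ 2 := by
              simp only [hG]; gcongr
          _ = _ := by field_simp; norm_num
      rw [e1, norm_mul, Complex.norm_real, Real.norm_eq_abs, abs_of_nonneg (mul_nonneg (by positivity) (hG0 _))]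
      calc _ ≤ 1 / T * (Real.exp (k / T) * (12 / D ^ 2)) * E := by
            gcongr
            exact hE _ hu1 hu2
        _ = _ := by ring
    rw [e]
    refine (norm_sum_le _ _).trans ((Finset.sum_le_sum h1).trans ?_)
    rw [← Finset.sum_mul]
    have h2 := sum_exp_div_le (T := T) (by linarith) s (K := k₁) (fun k hk => by
      rw [hs, mem_Icc] at hk; rw [mem_range]; omega)
    calc _ ≤ 2 * Real.exp (k₁ / T) * (12 * E / D ^ 2) := by gcongr
      _ ≤ 2 * x * (12 * E / D ^ 2) := by gcongr
      _ = _ := by ring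
  obtain ⟨M, N, hMN, hN2, hlo, hhi, -, hwin⟩ := exists_window (T := T) (n := Real.exp (k₁ / T)) (by linarith)
    (by nlinarith)
  set N₀ := ⌊2 * X⌋₊ with hN0
  have hdiff : ∀ n ∈ Ioc 0 N', |(if n ≤ ⌊x⌋₊ then (1 : ℝ) else 0) - ω n|
      ≤ 10 / T + (if n ≤ N₀ then 1 else 0) + if M < n ∧ n ≤ N then 1 else 0 := by
    intro n hn
    have hn0 : 0 < n := (mem_Ioc.1 hn).1
    have hn0' : (0 : ℝ) < n := by exact_mod_cast hn0
    set v := Real.log n with hv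
    have hv0 : 0 ≤ v := Real.log_natCast_nonneg _
    have hTv0 : 0 ≤ T * v := by positivity
    set τ := ∑ k ∈ s, tri (k - T * v) with hτ
    have hτ0 : 0 ≤ τ := Finset.sum_nonneg fun _ _ => tri_nonneg _
    have hτ1 : τ ≤ 1 := sum_tri_sub_le_one s hTv0
    have hωτ : |τ - ω n| ≤ 10 / T := by
      have e : τ - ω n = ∑ k ∈ s, (1 - G (k / T) * logWt 2 (1 / D) n) * tri (k - T * v) := by
        simp only [hτ, hω]
        rw [← Finset.sum_sub_distrib]
        refine Finset.sum_congr rfl fun k _ => ?_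
        have : T * ((k : ℝ) / T - v) = k - T * v := by field_simp
        rw [kr, ← hv, this]
        field_simp
      rw [e]
      refine (Finset.abs_sum_le_sum_abs _ _).trans ?_
      calc _ ≤ ∑ k ∈ s, 10 / T * tri (k - T * v) := by
            refine Finset.sum_le_sum fun k hk => ?_
            rw [abs_mul, abs_of_nonneg (tri_nonneg _)]
            rcases le_or_gt 1 |(k : ℝ) - T * v| with h | h
            · rw [tri_eq_zero h, mul_zero, mul_zero]
            · refine mul_le_mul_of_nonneg_right ?_ (tri_nonneg _)
              have h1 : |(k : ℝ) / T - v| ≤ 1 / T := by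
                rw [show (k : ℝ) / T - v = (k - T * v) / T by field_simp, abs_div, abs_of_pos hT0]
                gcongr
              have h2 := abs_weight_sub_one_le hT (show 0 ≤ 1 / D by positivity)
                (by rw [div_le_one hD0]; linarith) (by linarith [(hsu k hk).1]) h1
              rw [abs_sub_comm, logWt, Real.rpow_def_of_pos hn0', ← hv, mul_comm v]
              exact h2
        _ = 10 / T * τ := by rw [← Finset.mul_sum]
        _ ≤ 10 / T * 1 := by gcongr
        _ = _ := mul_one _
    have hind : |(if n ≤ ⌊x⌋₊ then (1 : ℝ) else 0) - τ|
        ≤ (if n ≤ N₀ then 1 else 0) + if M < n ∧ n ≤ N then 1 else 0 := by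
      have h01 : |(if n ≤ ⌊x⌋₊ then (1 : ℝ) else 0) - τ| ≤ 1 := by
        rw [abs_le]; split_ifs <;> constructor <;> linarith
      have hp1 : (0 : ℝ) ≤ if n ≤ N₀ then 1 else 0 := by split_ifs <;> norm_num
      have hp2 : (0 : ℝ) ≤ if M < n ∧ n ≤ N then 1 else 0 := by split_ifs <;> norm_num
      have hfl := Nat.floor_le hTv0
      have hfl' := Nat.lt_floor_add_one (T * v)
      rcases lt_or_ge ⌊T * v⌋₊ k₀ with h | h
      · have h1 : T * v < k₀ := by
          have : ((⌊T * v⌋₊ : ℝ) + 1) ≤ k₀ := by exact_mod_cast h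
          linarith
        have h2 : n ≤ N₀ := by
          refine Nat.le_floor ?_
          have h3 : v ≤ D / 2 + Real.log 2 := by
            have h5 : T * v ≤ T * (D / 2 + Real.log 2) := by nlinarith [Real.log_two_gt_d9]
            exact le_of_mul_le_mul_left h5 hT0
          calc (n : ℝ) = Real.exp v := (Real.exp_log hn0').symm
            _ ≤ Real.exp (D / 2 + Real.log 2) := Real.exp_le_exp.2 h3
            _ = 2 * X := by rw [Real.exp_add, Real.exp_log two_pos, mul_comm]
        rw [if_pos h2]
        linarith
      rcases lt_or_ge ⌊T * v⌋₊ k₁ with h' | h'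
      · have h1 : τ = 1 := sum_tri_sub_eq_one hTv0 (by rw [hs, mem_Icc]; omega) (by rw [hs, mem_Icc]; omega)
        have h2 : n ≤ ⌊x⌋₊ := by
          refine Nat.le_floor ?_
          have h3 : ((⌊T * v⌋₊ : ℝ) + 1) ≤ k₁ := by exact_mod_cast h'
          have h4 : v ≤ D := le_of_mul_le_mul_left (by linarith) hT0
          calc (n : ℝ) = Real.exp v := (Real.exp_log hn0').symm
            _ ≤ x := Real.exp_le_exp.2 h4
        rw [if_pos h2, h1, sub_self, abs_zero]
        positivity
      rcases h'.eq_or_lt with h'' | h''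
      · have h1 : M < n ∧ n ≤ N := by
          refine hwin n hn0 ?_
          rw [← hv, Real.log_exp, show v - (k₁ : ℝ) / T = (T * v - k₁) / T by field_simp, abs_div, abs_of_pos hT0]
          gcongr
          rw [← h''] at hfl hfl'
          rw [abs_lt]
          constructor <;> linarith
        rw [if_pos h1]
        linarith
      · have h1 : τ = 0 := by
          rw [hτ, sum_tri_sub s hTv0, if_neg (by rw [hs, mem_Icc]; omega),
            if_neg (by rw [hs, mem_Icc]; omega), add_zero]
        have h2 : ¬ n ≤ ⌊x⌋₊ := fun h => by
          have h3 : (n : ℝ) ≤ x := (Nat.le_floor_iff hx0.le).1 h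
          have h4 : v ≤ D := by
            rw [hv, ← Real.log_exp D]; exact Real.log_le_log hn0' h3
          have h5 : ((k₁ : ℝ) + 1) ≤ ⌊T * v⌋₊ := by exact_mod_cast h''
          have h6 : T * v ≤ T * D := by gcongr
          linarith
        rw [if_neg h2, h1, sub_self, abs_zero]
        positivity
    calc _ = |((if n ≤ ⌊x⌋₊ then (1 : ℝ) else 0) - τ) + (τ - ω n)| := by congr 1; ring
      _ ≤ _ := by
        refine (abs_add_le _ _).trans ?_
        linarith
  have hsum : ∑ n ∈ Ioc 0 ⌊x⌋₊, c n = ∑ n ∈ Ioc 0 N', c n * (ω n : ℂ)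
      + ∑ n ∈ Ioc 0 N', c n * (((if n ≤ ⌊x⌋₊ then (1 : ℝ) else 0) - ω n : ℝ) : ℂ) := by
    rw [← Finset.sum_add_distrib]
    have h1 : ∀ n, c n * (ω n : ℂ) + c n * (((if n ≤ ⌊x⌋₊ then (1 : ℝ) else 0) - ω n : ℝ) : ℂ)
        = if n ≤ ⌊x⌋₊ then c n else 0 := fun n => by
      split_ifs <;> push_cast <;> ring
    simp only [h1]
    rw [← Finset.sum_filter]
    congr 1
    ext n
    simp only [mem_Ioc, mem_filter]
    have : ⌊x⌋₊ ≤ N' := Nat.floor_le_floor (by linarith)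
    constructor
    · exact fun h => ⟨⟨h.1, h.2.trans this⟩, h.2⟩
    · exact fun h => ⟨h.1.1, h.2⟩
  have hX4 : 8 ≤ X := by linarith
  have hpart : ‖∑ n ∈ Ioc 0 N', c n * (((if n ≤ ⌊x⌋₊ then (1 : ℝ) else 0) - ω n : ℝ) : ℂ)‖
      ≤ 10 / T * (K * N') + K * N₀ + K * (N - M) := by
    have hb1 : ∑ n ∈ Ioc 0 N', ‖c n‖ ≤ K * N' := by
      have h := hK 0 N' (Nat.zero_le _) ?_
      · simpa using h
      · have : 2 * x < N' + 1 := Nat.lt_floor_add_one _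
        have hx1 : X * 1 ≤ x := by rw [hxX]; gcongr; linarith
        have : w ≤ N' := by linarith
        rw [Nat.cast_zero, sub_zero, sq]
        gcongr
    have hb2 : ∑ n ∈ Ioc 0 N₀, ‖c n‖ ≤ K * N₀ := by
      have h := hK 0 N₀ (Nat.zero_le _) ?_
      · simpa using h
      · have : 2 * X < N₀ + 1 := Nat.lt_floor_add_one _
        have : w ≤ N₀ := by linarith
        rw [Nat.cast_zero, sub_zero, sq]
        gcongr
    have hb3 : ∑ n ∈ Ioc M N, ‖c n‖ ≤ K * (N - M) := by
      refine hK M N hMN ?_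
      have h1 : x / (2 * T) ≤ (N : ℝ) - M := by
        refine le_trans ?_ hlo
        rw [div_mul_eq_div_div]
        gcongr
      calc w * N ≤ w * (2 * x) := by gcongr; linarith
        _ = (8 * w * T ^ 2) * x / (2 * T) ^ 2 := by field_simp; ring
        _ ≤ x * x / (2 * T) ^ 2 := by gcongr
        _ = (x / (2 * T)) ^ 2 := by ring
        _ ≤ _ := by gcongr
    refine (norm_sum_le _ _).trans ?_
    calc _ ≤ ∑ n ∈ Ioc 0 N', (10 / T * ‖c n‖ + (if n ≤ N₀ then ‖c n‖ else 0)
          + if M < n ∧ n ≤ N then ‖c n‖ else 0) := by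
          refine Finset.sum_le_sum fun n hn => ?_
          rw [norm_mul, Complex.norm_real, Real.norm_eq_abs]
          refine (mul_le_mul_of_nonneg_left (hdiff n hn) (norm_nonneg _)).trans (le_of_eq ?_)
          split_ifs <;> ring
      _ = 10 / T * ∑ n ∈ Ioc 0 N', ‖c n‖ + ∑ n ∈ (Ioc 0 N').filter (· ≤ N₀), ‖c n‖
          + ∑ n ∈ (Ioc 0 N').filter (fun n => M < n ∧ n ≤ N), ‖c n‖ := by
          rw [Finset.sum_add_distrib, Finset.sum_add_distrib, Finset.mul_sum, Finset.sum_filter, Finset.sum_filter]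
      _ ≤ _ := by
          refine add_le_add (add_le_add (by gcongr) (le_trans ?_ hb2)) (le_trans ?_ hb3)
          · refine Finset.sum_le_sum_of_subset_of_nonneg (fun n hn => ?_) fun _ _ _ => norm_nonneg _
            simp only [mem_Ioc, mem_filter] at hn ⊢
            exact ⟨hn.1.1, hn.2⟩
          · refine Finset.sum_le_sum_of_subset_of_nonneg (fun n hn => ?_) fun _ _ _ => norm_nonneg _
            simp only [mem_Ioc, mem_filter] at hn ⊢
            exact hn.2
  rw [hsum]
  refine (norm_add_le _ _).trans (add_le_add hmain (hpart.trans ?_))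
  have h1 : (N' : ℝ) ≤ 2 * x := Nat.floor_le (by positivity)
  have h2 : (N₀ : ℝ) ≤ x / T := by
    refine (Nat.floor_le (by positivity)).trans ?_
    rw [le_div_iff₀ hT0, hxX]
    calc 2 * X * T = X * (2 * T) := by ring
      _ ≤ X * X := by gcongr
  have h3 : (N : ℝ) - M ≤ 4 * (x / T) := hhi.trans (by gcongr)
  calc _ ≤ 10 / T * (K * (2 * x)) + K * (x / T) + K * (4 * (x / T)) := by gcongr
    _ = 25 * (K * x / T) := by ring
    _ ≤ _ := by gcongr; norm_num

end Transfer

section SharpSums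

open ArithmeticFunction

/-- Prime sums against combinations of characters avoiding an exceptional one. -/
theorem exists_sum_vonMangoldt_char_le : ∃ C R₀ : ℝ, 1 ≤ C ∧ 2 ≤ R₀ ∧
    ∀ Z : ℕ, 2 ≤ Z → ∀ q : ℕ, ∀ [NeZero q], q ≤ Z → ∃ 𝒳 : Finset (DirichletCharacter ℂ q), 𝒳.card ≤ 1 ∧
      (∀ χ ∈ 𝒳, χ ≠ 1) ∧ ∀ D : ℝ, R₀ * Real.log Z ≤ D → D ≤ Z →
      ∀ S : Finset (DirichletCharacter ℂ q), (∀ χ ∈ S, χ ≠ 1 ∧ χ ∉ 𝒳) →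
      ∀ g : DirichletCharacter ℂ q → ℂ, (∀ χ, ‖g χ‖ ≤ 1) → ∀ a : ZMod q, IsUnit a →
      (∀ β : ZMod q, ‖∑ χ ∈ S, g χ * χ β‖ ≤ (if β = a then (q.totient : ℝ) else 0) + 2) →
        ‖∑ n ∈ Ioc 0 ⌊Real.exp D⌋₊, (∑ χ ∈ S, g χ * χ (n : ZMod q)) * (Λ n : ℂ)‖
          ≤ C * (Real.exp D * Real.log Z / D) := by
  obtain ⟨b, hb⟩ : ∃ b : ℕ, 627 ≤ b := ⟨627, le_rfl⟩
  obtain ⟨C₁, R₀, hC₁, hR₀, hS⟩ := exists_smoothed_char_le b hb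
  obtain ⟨K, hK0, hBT⟩ := exists_brun_titchmarsh
  have hb' : (627 : ℝ) ≤ b := by exact_mod_cast hb
  refine ⟨24 * C₁ + 180 * K + 6, max R₀ (b + 3), by linarith, hR₀.trans (le_max_left _ _), ?_⟩
  intro Z hZ q _ hqZ
  have hq : 0 < q := Nat.pos_of_neZero q
  obtain ⟨𝒳, h𝒳1, h𝒳2, hS⟩ := hS Z hZ q hqZ
  refine ⟨𝒳, h𝒳1, h𝒳2, fun D hRD hDZ S hSX g hg a ha hgS => ?_⟩
  have hZ' : (2 : ℝ) ≤ Z := by exact_mod_cast hZ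
  have hZ1 : (1 : ℝ) ≤ Z := by linarith
  set ℓ := Real.log Z with hℓ
  have hℓ2 : 1 / 2 ≤ ℓ := half_le_log hZ
  have hRD1 : R₀ * ℓ ≤ D := le_trans (by gcongr; exact le_max_left _ _) hRD
  have hRD2 : (b + 3) * ℓ ≤ D := le_trans (by gcongr; exact le_max_right _ _) hRD
  have hD8 : 8 ≤ D := by nlinarith
  have hD0 : 0 < D := by linarith
  have hZ8 : (8 : ℝ) ≤ Z := by linarith
  have hφ : (0 : ℝ) < q.totient := by exact_mod_cast Nat.totient_pos.2 hq
  have hqZ' : (q : ℝ) ≤ Z := by exact_mod_cast hqZ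
  have hφZ : (q.totient : ℝ) ≤ Z := by exact_mod_cast (Nat.totient_le q).trans hqZ
  have hq1 : (1 : ℝ) ≤ q := by exact_mod_cast hq
  set x := Real.exp D with hx
  have hx0 : 0 < x := Real.exp_pos _
  have hZpow : (Z : ℝ) ^ (b + 3) ≤ x := by
    rw [hx, ← Real.log_le_iff_le_exp (by positivity), Real.log_pow]
    push_cast
    exact hRD2
  set v : ZMod q → ℂ := fun β => ∑ χ ∈ S, g χ * χ β with hv
  have hvu : ∀ β, ¬ IsUnit β → v β = 0 := fun β hβ =>
    Finset.sum_eq_zero fun χ _ => by rw [MulChar.map_nonunit _ hβ, mul_zero]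
  have hvsum : ∑ β, ‖v β‖ ≤ 3 * q.totient := by
    have h1 : ∀ β : ZMod q, ‖v β‖ ≤ (if β = a then (q.totient : ℝ) else 0) + if IsUnit β then 2 else 0 :=
      fun β => by
        by_cases hβ : IsUnit β
        · rw [if_pos hβ]; exact hgS β
        · rw [hvu β hβ, norm_zero, if_neg hβ]; positivity
    refine (Finset.sum_le_sum fun β _ => h1 β).trans (le_of_eq ?_)
    rw [Finset.sum_add_distrib, Finset.sum_ite_eq', if_pos (mem_univ a), ← Finset.sum_filter,
      Finset.sum_const, nsmul_eq_mul]
    have h2 : (univ.filter (fun β : ZMod q => IsUnit β)).card = q.totient := by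
      rw [← ZMod.card_units_eq_totient, ← Finset.card_univ,
        ← Finset.card_map ⟨Units.val, Units.val_injective⟩]
      refine congrArg Finset.card (Finset.ext fun β => ?_)
      rw [mem_filter, mem_map]
      exact ⟨fun ⟨_, u, hu⟩ => ⟨u, mem_univ _, hu⟩, fun ⟨u, _, hu⟩ => ⟨mem_univ _, u, hu⟩⟩
    rw [h2]; ring
  set c : ℕ → ℂ := fun n => (sift 1 (Z ^ b) n : ℂ) * v (n : ZMod q) * (Λ n : ℂ) with hc
  have hcK : ∀ M N : ℕ, M ≤ N → (q : ℝ) ^ 2 * N ≤ ((N : ℝ) - M) ^ 2 →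
      ∑ n ∈ Ioc M N, ‖c n‖ ≤ 3 * K * ((N : ℝ) - M) := by
    intro M N hMN hqN
    have h1 : ∀ n, ‖c n‖ ≤ q.totient * (if (n : ZMod q) = a then Λ n else 0) + 2 * Λ n := fun n => by
      simp only [hc]
      rw [norm_mul, norm_mul, Complex.norm_real, Complex.norm_real, Real.norm_eq_abs, Real.norm_eq_abs,
        abs_of_nonneg (sift_nonneg _ _ _), abs_of_nonneg vonMangoldt_nonneg]
      calc _ ≤ 1 * ((if (n : ZMod q) = a then (q.totient : ℝ) else 0) + 2) * Λ n := by
            have := hgS (n : ZMod q)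
            have := sift_le_one 1 (Z ^ b) n
            have := @vonMangoldt_nonneg n
            gcongr
        _ = _ := by split_ifs <;> ring
    have h2 := hBT q hq a ha M N hMN hqN
    have h3 := hBT 1 one_pos 1 isUnit_one M N hMN (by
      refine le_trans ?_ hqN
      gcongr
      exact_mod_cast hq1)
    rw [apIoc_one, Nat.totient_one, Nat.cast_one, div_one] at h3
    rw [apIoc, Finset.sum_filter] at h2
    refine (Finset.sum_le_sum fun n _ => h1 n).trans ?_
    rw [Finset.sum_add_distrib, ← Finset.mul_sum, ← Finset.mul_sum]
    calc _ ≤ q.totient * (K * (((N : ℝ) - M) / q.totient)) + 2 * (K * ((N : ℝ) - M)) := by gcongr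
      _ = _ := by field_simp; ring
  have hrough := norm_sum_le_of_smoothed (c := c) (D := D) (T := Z) (E := C₁ * (ℓ * D)) (K := 3 * K)
    (w := (q : ℝ) ^ 2) (by linarith) (by linarith) (one_le_pow₀ hq1)
    (by
      refine le_trans ?_ hZpow
      calc 8 * (q : ℝ) ^ 2 * (Z : ℝ) ^ 2 ≤ Z * (Z : ℝ) ^ 2 * (Z : ℝ) ^ 2 := by gcongr
        _ = (Z : ℝ) ^ 5 := by ring
        _ ≤ _ := pow_le_pow_right₀ hZ1 (by omega))
    (by
      have h1 : (Z : ℝ) ^ 2 ≤ Real.exp (D / 2) := by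
        rw [← Real.log_le_iff_le_exp (by positivity), Real.log_pow]
        push_cast
        nlinarith
      exact le_trans (by gcongr) h1)
    (by positivity)
    (fun u hu1 hu2 => by
      have h := hS D hRD1 hDZ u hu1 hu2 S hSX g hg hvsum
      refine le_trans (le_of_eq ?_) h
      congr 1
      refine Finset.sum_congr rfl fun n _ => ?_
      simp only [hc, hv]
      push_cast
      ring)
    hcK
  have hsmooth : ‖∑ n ∈ Ioc 0 ⌊x⌋₊, v (n : ZMod q) * (Λ n : ℂ) * ((1 - sift 1 (Z ^ b) n : ℝ) : ℂ)‖
      ≤ 3 * (x / D) := by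
    refine (norm_sum_le _ _).trans ?_
    have h1 : ∀ n : ℕ, ‖v (n : ZMod q) * (Λ n : ℂ) * ((1 - sift 1 (Z ^ b) n : ℝ) : ℂ)‖
        ≤ 3 * Z * (Λ n * (1 - sift 1 (Z ^ b) n)) := fun n => by
      have h0 : 0 ≤ 1 - sift 1 (Z ^ b) n := by linarith [sift_le_one 1 (Z ^ b) n]
      rw [norm_mul, norm_mul, Complex.norm_real, Complex.norm_real, Real.norm_eq_abs, Real.norm_eq_abs,
        abs_of_nonneg vonMangoldt_nonneg, abs_of_nonneg h0, mul_assoc]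
      have h2 := hgS (n : ZMod q)
      have h3 : (if (n : ZMod q) = a then (q.totient : ℝ) else 0) ≤ Z := by split_ifs <;> linarith
      have h4 : 0 ≤ Λ n * (1 - sift 1 (Z ^ b) n) := mul_nonneg vonMangoldt_nonneg h0
      exact mul_le_mul_of_nonneg_right (by linarith) h4
    refine (Finset.sum_le_sum fun n _ => h1 n).trans ?_
    rw [← Finset.mul_sum]
    have h5 := sum_vonMangoldt_mul_one_sub_sift_le (Z ^ b) ⌊x⌋₊
    have h6 : Real.log ⌊x⌋₊ ≤ Z := by
      rcases Nat.eq_zero_or_pos ⌊x⌋₊ with h | h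
      · rw [h]; simp
      · refine le_trans ?_ hDZ
        calc _ ≤ Real.log x := Real.log_le_log (by exact_mod_cast h) (Nat.floor_le hx0.le)
          _ = D := Real.log_exp D
    calc _ ≤ 3 * (Z : ℝ) * (((Z ^ b : ℕ) : ℝ) * Z) := by gcongr; exact h5.trans (by gcongr)
      _ = 3 * ((Z : ℝ) ^ (b + 3) / Z) := by push_cast; rw [pow_add]; field_simp
      _ ≤ 3 * (x / D) := by gcongr
  have e : ∑ n ∈ Ioc 0 ⌊x⌋₊, (∑ χ ∈ S, g χ * χ (n : ZMod q)) * (Λ n : ℂ)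
      = ∑ n ∈ Ioc 0 ⌊x⌋₊, c n
        + ∑ n ∈ Ioc 0 ⌊x⌋₊, v (n : ZMod q) * (Λ n : ℂ) * ((1 - sift 1 (Z ^ b) n : ℝ) : ℂ) := by
    rw [← Finset.sum_add_distrib]
    refine Finset.sum_congr rfl fun n _ => ?_
    simp only [hc, hv]
    push_cast
    ring
  rw [e]
  refine (norm_add_le _ _).trans ((add_le_add hrough hsmooth).trans ?_)
  have h1 : x / D ≤ 2 * (x * ℓ / D) := by
    have : x * 1 ≤ x * (2 * ℓ) := by gcongr; linarith
    rw [← mul_div_assoc]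
    gcongr
    linarith
  have h2 : 30 * (3 * K * x / Z) ≤ 90 * K * (x / D) := by
    have : x / Z ≤ x / D := by gcongr
    calc _ = 90 * K * (x / Z) := by ring
      _ ≤ _ := by gcongr
  have h3 : 90 * K * (x / D) ≤ 90 * K * (2 * (x * ℓ / D)) := by gcongr
  have h4 : 24 * (C₁ * (ℓ * D) * x / D ^ 2) = 24 * C₁ * (x * ℓ / D) := by field_simp
  linarith

end SharpSums

section NearOne

open ArithmeticFunction

/-- The second derivative of `-ζ'/ζ - ζ` stays bounded near the point `1`. -/
lemma exists_norm_LSeries_near_one_le : ∃ C : ℝ, 1 ≤ C ∧ ∀ δ : ℝ, 0 < δ → δ ≤ 1 → ∀ t : ℝ, |t| ≤ 1 →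
    ‖LSeries (logk 2 (vmSeq (1 : DirichletCharacter ℂ 1))) (pt δ t)
      - LSeries (logk 2 (chSeq (1 : DirichletCharacter ℂ 1))) (pt δ t)‖ ≤ C := by
  set χ : DirichletCharacter ℂ 1 := 1 with hχ
  set Y : ℂ → ℂ := DirichletCharacter.LFunctionTrivChar₁ 1 with hY
  have hYd : Differentiable ℂ Y := DirichletCharacter.differentiable_LFunctionTrivChar₁ 1
  have hY1 : Y 1 = 1 := by simp [hY]
  have hYs : ∀ s : ℂ, s ≠ 1 → Y s = (s - 1) * χ.LFunction s := fun s hs => by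
    rw [hY, DirichletCharacter.LFunctionTrivChar₁, Function.update_of_ne hs]
  have hYd' : ∀ s : ℂ, s ≠ 1 → deriv Y s = (s - 1) * deriv χ.LFunction s + χ.LFunction s :=
    fun s hs => DirichletCharacter.deriv_LFunctionTrivChar₁_apply_of_ne_one 1 hs
  have hY0 : ∀ s : ℂ, 1 ≤ s.re → Y s ≠ 0 := fun s hs => by
    by_cases h : s = 1
    · rw [h, hY1]; exact one_ne_zero
    · rw [hYs s h]
      exact mul_ne_zero (sub_ne_zero.2 h) (DirichletCharacter.LFunction_ne_zero_of_one_le_re χ (Or.inr h) hs)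
  set U : Set ℂ := {s | Y s ≠ 0} with hU
  have hUo : IsOpen U := isOpen_ne_fun hYd.continuous continuous_const
  set G : ℂ → ℂ := fun s => -deriv Y s / Y s - dslope Y 1 s with hG
  have hGd : DifferentiableOn ℂ G U := by
    have h1 : DifferentiableOn ℂ (dslope Y 1) Set.univ :=
      (Complex.differentiableOn_dslope Filter.univ_mem).2 hYd.differentiableOn
    have h2 : DifferentiableOn ℂ (deriv Y) Set.univ := hYd.differentiableOn.deriv isOpen_univ
    exact ((h2.mono (Set.subset_univ _)).neg.div hYd.differentiableOn fun s hs => hs).sub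
      (h1.mono (Set.subset_univ _))
  have hGd1 : DifferentiableOn ℂ (deriv G) U := hGd.deriv hUo
  have hGd2 : DifferentiableOn ℂ (deriv (deriv G)) U := hGd1.deriv hUo
  have hsub : ∀ s : ℂ, 1 < s.re → s ∈ U := fun s hs => hY0 s hs.le
  have hnhds : ∀ s : ℂ, 1 < s.re → U ∈ nhds s := fun s hs => hUo.mem_nhds (hsub s hs)
  have e0 : ∀ s : ℂ, 1 < s.re → LSeries (logk 0 (vmSeq χ)) s - LSeries (logk 0 (chSeq χ)) s = G s := by
    intro s hs
    have hs1 : s ≠ 1 := fun h => by rw [h] at hs; simp at hs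
    have hL : ∀ z : ℂ, 1 < z.re → LSeries (chSeq χ) z = χ.LFunction z := fun z hz =>
      (DirichletCharacter.LFunction_eq_LSeries χ hz).symm
    have hLd : deriv (LSeries (chSeq χ)) s = deriv χ.LFunction s := by
      refine Filter.EventuallyEq.deriv_eq ?_
      filter_upwards [(isOpen_lt continuous_const Complex.continuous_re).mem_nhds hs] with z hz
      exact hL z hz
    have h : LSeries (vmSeq χ) s = -deriv (LSeries (chSeq χ)) s / LSeries (chSeq χ) s :=
      DirichletCharacter.LSeries_twist_vonMangoldt_eq χ hs
    have hL0 : χ.LFunction s ≠ 0 :=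
      DirichletCharacter.LFunction_ne_zero_of_one_le_re χ (Or.inr hs1) hs.le
    have hs1' : s - 1 ≠ 0 := sub_ne_zero.2 hs1
    rw [logk_zero, logk_zero, h, hLd, hL s hs, hG]
    simp only
    rw [dslope_of_ne _ hs1, slope_def_field, hY1, hYs s hs1, hYd' s hs1]
    field_simp
    ring
  have e1 : ∀ s : ℂ, 1 < s.re → -LSeries (logk 1 (vmSeq χ)) s + LSeries (logk 1 (chSeq χ)) s = deriv G s := by
    intro s hs
    have h := hasDerivAt_unique_of_eq e0 hs ((hasDerivAt_LSeries_logk (abscissa_vmSeq χ) 0 hs).sub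
      (hasDerivAt_LSeries_logk (abscissa_chSeq χ) 0 hs))
      (hGd.differentiableAt (hnhds s hs)).hasDerivAt
    simp only [Nat.reduceAdd] at h
    linear_combination h
  have e2 : ∀ s : ℂ, 1 < s.re → LSeries (logk 2 (vmSeq χ)) s - LSeries (logk 2 (chSeq χ)) s
      = deriv (deriv G) s := by
    intro s hs
    have h := hasDerivAt_unique_of_eq e1 hs ((hasDerivAt_LSeries_logk (abscissa_vmSeq χ) 1 hs).neg.add
      (hasDerivAt_LSeries_logk (abscissa_chSeq χ) 1 hs))
      (hGd1.differentiableAt (hnhds s hs)).hasDerivAt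
    simp only [Nat.reduceAdd] at h
    linear_combination h
  set K : Set ℂ := Set.Icc (1 : ℝ) 2 ×ℂ Set.Icc (-1 : ℝ) 1 with hK
  have hKc : IsCompact K := isCompact_Icc.reProdIm isCompact_Icc
  have hKU : K ⊆ U := fun s hs => hY0 s (Complex.mem_reProdIm.1 hs).1.1
  obtain ⟨C, hC⟩ := hKc.exists_bound_of_continuousOn (hGd2.continuousOn.mono hKU)
  refine ⟨max C 1, le_max_right _ _, fun δ hδ hδ1 t ht => ?_⟩
  rw [e2 _ (one_lt_pt_re hδ t)]
  refine (hC _ (Complex.mem_reProdIm.2 ⟨?_, ?_⟩)).trans (le_max_left _ _)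
  · rw [pt_re]; constructor <;> linarith
  · have : (pt δ t).im = t := by simp [pt]
    rw [this]; exact abs_le.1 ht

end NearOne

section ZetaBounds

open ArithmeticFunction

lemma one_add_log_pow_mul_rpow_tendsto (k : ℕ) {δ : ℝ} (hδ : 0 < δ) :
    Filter.Tendsto (fun N : ℕ => (1 + Real.log N) ^ k * (N : ℝ) ^ (-δ)) Filter.atTop (nhds 0) := by
  have h1 : Filter.Tendsto (fun x : ℝ => (1 + Real.log x) ^ k * x ^ (-δ)) Filter.atTop (nhds 0) := by
    have h3 : Filter.Tendsto (fun y : ℝ => (1 + y) ^ k * Real.exp (-δ * y)) Filter.atTop (nhds 0) := by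
      have h4 := Real.tendsto_pow_mul_exp_neg_atTop_nhds_zero k
      have h5 : Filter.Tendsto (fun y : ℝ => δ * (1 + y)) Filter.atTop Filter.atTop :=
        (Filter.tendsto_atTop_add_const_left _ 1 Filter.tendsto_id).const_mul_atTop hδ
      have h6 := ((h4.comp h5).const_mul (Real.exp δ / δ ^ k))
      rw [mul_zero] at h6
      refine h6.congr fun y => ?_
      simp only [Function.comp]
      rw [mul_pow, show -(δ * (1 + y)) = -δ + -δ * y by ring, Real.exp_add, Real.exp_neg]
      field_simp
    refine (h3.comp Real.tendsto_log_atTop).congr' ?_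
    filter_upwards [Filter.eventually_gt_atTop 0] with x hx
    simp only [Function.comp]
    rw [Real.rpow_def_of_pos hx, mul_comm (Real.log x)]
  exact h1.comp tendsto_natCast_atTop_atTop

/-- Bounds for `ζ` and its derivatives to the right of the line `Re s = 1`. -/
lemma norm_LSeries_one_le {X : ℕ} (hX : 3 ≤ X) {t : ℝ} (ht1 : 1 ≤ |t|) (ht : |t| ≤ (X : ℝ) ^ 2) {k : ℕ}
    (hk : k ≤ 3) {δ : ℝ} (hδ : 0 < δ) (hδ1 : δ ≤ 1) :
    ‖LSeries (logk k (chSeq (1 : DirichletCharacter ℂ 1))) (pt δ t)‖ ≤ 10 ^ 5 * Real.log X ^ 4 := by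
  have hX' : (3 : ℝ) ≤ X := by exact_mod_cast hX
  set l := Real.log X with hl
  have hl1 : 1 ≤ l := by
    rw [hl, Real.le_log_iff_exp_le (by linarith)]
    linarith [Real.exp_one_lt_d9]
  obtain ⟨M, hM⟩ : ∃ M, M = X ^ 4 := ⟨_, rfl⟩
  have hM' : (M : ℝ) = (X : ℝ) ^ 4 := by rw [hM]; push_cast; rfl
  have hM2 : 2 ≤ M := by rw [hM]; exact le_trans (by omega) (Nat.le_self_pow (by norm_num) X)
  have hM1 : (1 : ℝ) ≤ M := by exact_mod_cast (by omega : 1 ≤ M)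
  have hlM : Real.log M = 4 * l := by rw [hM', Real.log_pow]; push_cast; rfl
  have ht0 : t ≠ 0 := fun h0 => by rw [h0, abs_zero] at ht1; linarith
  have hev := (one_add_log_pow_mul_rpow_tendsto k hδ).eventually (ge_mem_nhds (show (0 : ℝ) < 1 by norm_num))
  obtain ⟨N₁, hN₁⟩ := Filter.eventually_atTop.1 hev
  refine norm_LSeries_logk_le (N₀ := max M N₁) (abscissa_chSeq _) k hδ t fun N hN => ?_
  have hMN : M ≤ N := (le_max_left _ _).trans hN
  have hNN : N₁ ≤ N := (le_max_right _ _).trans hN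
  have e1 : ∀ n : ℕ, chSeq (1 : DirichletCharacter ℂ 1) n = 1 := fun n => by
    rw [chSeq, MulChar.one_apply (isUnit_of_subsingleton _)]
  simp only [e1, one_mul]
  rw [← Finset.sum_Ioc_consecutive _ (Nat.zero_le _) hMN]
  have hkl : ∀ c : ℝ, 1 ≤ c → (c * l) ^ k ≤ (c * l) ^ 3 := fun c hc =>
    pow_le_pow_right₀ (by nlinarith) hk
  have h1 : ‖∑ n ∈ Ioc 0 M, tw t n * logWt k δ n‖ ≤ (4 * l) ^ 3 * (5 * l) := by
    refine (norm_sum_le _ _).trans ?_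
    have h2 : ∀ n ∈ Ioc 0 M, ‖tw t n * logWt k δ n‖ ≤ (4 * l) ^ 3 * (n : ℝ) ^ (-1 - δ) := fun n hn => by
      have hn0 := (mem_Ioc.1 hn).1
      have hn1 : (1 : ℝ) ≤ n := by exact_mod_cast hn0
      rw [norm_mul, Complex.norm_real, Real.norm_eq_abs, abs_of_nonneg (logWt_nonneg k δ n)]
      refine (mul_le_of_le_one_left (logWt_nonneg _ _ _) (norm_tw_le t n)).trans ?_
      rw [logWt]
      refine mul_le_mul_of_nonneg_right ?_ (by positivity)
      refine le_trans ?_ (hkl 4 (by norm_num))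
      refine pow_le_pow_left₀ (Real.log_nonneg hn1) ?_ _
      rw [← hlM]
      exact Real.log_le_log (by linarith) (by exact_mod_cast (mem_Ioc.1 hn).2)
    refine (Finset.sum_le_sum h2).trans ?_
    rw [← Finset.mul_sum]
    refine mul_le_mul_of_nonneg_left ?_ (by positivity)
    refine (sum_rpow_le_log hδ.le M).trans ?_
    rw [hlM]; linarith
  have hz : ∀ v : ℝ, 1 ≤ v → ‖zInt (δ + t * Complex.I) k v‖
      ≤ 24 * ((1 + Real.log v) ^ k * v ^ (-δ)) := fun v hv => by
    have h3 := norm_zInt_le (w := δ + t * Complex.I) one_pos le_rfl (ht1.trans (by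
        simpa using Complex.abs_im_le_norm ((δ : ℂ) + t * Complex.I))) k hv
    refine h3.trans ?_
    have hre : ((δ : ℂ) + t * Complex.I).re = δ := by simp
    have hf : ((k + 1).factorial : ℝ) ≤ 24 := by
      have : (k + 1).factorial ≤ (3 + 1).factorial := Nat.factorial_le (by omega)
      exact_mod_cast this
    have := Real.log_nonneg hv
    rw [hre, one_pow, div_one, mul_assoc]
    gcongr
  have hzN : ‖zInt (δ + t * Complex.I) k N‖ ≤ 24 := by
    have := hN₁ N hNN
    have := hz N (hM1.trans (by exact_mod_cast hMN))
    linarith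
  have hzM : ‖zInt (δ + t * Complex.I) k M‖ ≤ 24 * (5 * l) ^ 3 := by
    refine (hz M hM1).trans ?_
    refine mul_le_mul_of_nonneg_left ?_ (by norm_num)
    refine (mul_le_of_le_one_right (by rw [hlM]; positivity)
      (Real.rpow_le_one_of_one_le_of_nonpos hM1 (by linarith))).trans ?_
    refine le_trans ?_ (hkl 5 (by norm_num))
    refine pow_le_pow_left₀ (by rw [hlM]; positivity) ?_ _
    rw [hlM]; linarith
  have h3 : ‖∑ n ∈ Ioc M N, tw t n * logWt k δ n‖ ≤ 24 + 24 * (5 * l) ^ 3 + 2048 * 6 := by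
    have h4 := norm_sum_logWt_tw_sub_le hk hδ.le ht0 hM2 hMN
    have h7 : 2048 * (4 + δ + |t|) * (M : ℝ) ^ (-(1 / 2) : ℝ) ≤ 2048 * 6 := by
      have h8 : (M : ℝ) ^ (-(1 / 2) : ℝ) = ((X : ℝ) ^ 2)⁻¹ := by
        rw [hM', ← Real.rpow_natCast, ← Real.rpow_mul (by linarith), ← Real.rpow_natCast,
          ← Real.rpow_neg (by linarith)]
        norm_num
      have h12 : (1 : ℝ) ≤ (X : ℝ) ^ 2 := one_le_pow₀ (by linarith)
      rw [h8]
      calc _ ≤ 2048 * (6 * (X : ℝ) ^ 2) * ((X : ℝ) ^ 2)⁻¹ := by gcongr; linarith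
        _ = _ := by field_simp
    have e : ∑ n ∈ Ioc M N, tw t n * (logWt k δ n : ℂ) = ∑ n ∈ Ioc M N, (logWt k δ n : ℂ) * tw t n :=
      Finset.sum_congr rfl fun n _ => mul_comm _ _
    rw [e]
    have h8 := norm_sub_norm_le (∑ n ∈ Ioc M N, (logWt k δ n : ℂ) * tw t n)
      (zInt (δ + t * Complex.I) k N - zInt (δ + t * Complex.I) k M)
    have h9 := norm_sub_le (zInt (δ + t * Complex.I) k N) (zInt (δ + t * Complex.I) k M)
    linarith
  refine (norm_add_le _ _).trans ?_
  have h5 : 1 ≤ l ^ 4 := one_le_pow₀ hl1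
  have h6 : l ^ 3 ≤ l ^ 4 := pow_le_pow_right₀ hl1 (by norm_num)
  nlinarith

lemma norm_LSeries_one_real_le {σ : ℝ} (hσ : 0 < σ) (hσ1 : σ ≤ 1) (t : ℝ) :
    ‖LSeries (chSeq (1 : DirichletCharacter ℂ 1)) (pt σ t)‖ ≤ 2 / σ := by
  rw [← logk_zero (chSeq _)]
  refine norm_LSeries_logk_le (N₀ := 0) (abscissa_chSeq _) 0 hσ t fun N _ => ?_
  refine (norm_sum_le _ _).trans ((Finset.sum_le_sum fun n _ => ?_).trans
    ((sum_rpow_neg_le hσ N).trans ?_))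
  · rw [norm_mul, norm_mul, Complex.norm_real, Real.norm_eq_abs, abs_of_nonneg (logWt_nonneg 0 σ n),
      logWt, pow_zero, one_mul]
    refine mul_le_of_le_one_left (by positivity) ?_
    exact mul_le_one₀ (DirichletCharacter.norm_le_one _ _) (norm_nonneg _) (norm_tw_le t n)
  · have : 1 ≤ 1 / σ := by rw [le_div_iff₀ hσ]; linarith
    have e : 2 / σ = 1 / σ + 1 / σ := by ring
    linarith

/-- Lower bound for `ζ` to the right of the line `Re s = 1`. -/
lemma norm_LSeries_one_ge {X : ℕ} (hX : 3 ≤ X) {t : ℝ} (ht1 : 1 ≤ |t|) (ht : |t| ≤ X) {A η : ℝ}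
    (hA : A = 10 ^ 5 * Real.log X ^ 4) (hη : η = 1 / (128 * A ^ 5)) {δ : ℝ} (hδ : 0 < δ) (hδ1 : δ ≤ 1) :
    A * η ≤ ‖LSeries (chSeq (1 : DirichletCharacter ℂ 1)) (pt δ t)‖ := by
  have hX' : (3 : ℝ) ≤ X := by exact_mod_cast hX
  have hl1 : 1 ≤ Real.log X := by
    rw [Real.le_log_iff_exp_le (by linarith)]
    linarith [Real.exp_one_lt_d9]
  have hA1 : 1 ≤ A := by
    have : 1 ≤ Real.log X ^ 4 := one_le_pow₀ hl1
    rw [hA]; linarith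
  have hη0 : 0 < η := by rw [hη]; positivity
  have hη1 : η ≤ 1 := by
    rw [hη, div_le_one (by positivity)]
    have : 1 ≤ A ^ 5 := one_le_pow₀ hA1
    linarith
  have htX : |t| ≤ (X : ℝ) ^ 2 := by nlinarith
  have h2tX : |2 * t| ≤ (X : ℝ) ^ 2 := by rw [abs_mul, abs_two]; nlinarith
  have h2t1 : 1 ≤ |2 * t| := by rw [abs_mul, abs_two]; linarith
  have key : ∀ σ : ℝ, η ≤ σ → σ ≤ 1 →
      2 * (A * η) ≤ ‖LSeries (chSeq (1 : DirichletCharacter ℂ 1)) (pt σ t)‖ := by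
    intro σ hησ hσ1
    have hσ0 : 0 < σ := by linarith
    have h341 := (1 : DirichletCharacter ℂ 1).norm_LSeries_product_ge_one hσ0 t
    have e0 : (1 + (σ : ℂ)) = pt σ 0 := by simp [pt]
    have e1 : (1 + (σ : ℂ) + Complex.I * t) = pt σ t := by simp [pt, mul_comm]
    have e2 : (1 + (σ : ℂ) + 2 * Complex.I * t) = pt σ (2 * t) := by simp [pt]; ring
    rw [e1, e2, e0, norm_mul, norm_mul, norm_pow, norm_pow, one_pow] at h341
    have hP := norm_LSeries_one_real_le hσ0 hσ1 0
    have h2 := norm_LSeries_one_le hX h2t1 h2tX (k := 0) (by norm_num) hσ0 hσ1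
    rw [← hA, logk_zero] at h2
    set P := ‖LSeries (chSeq (1 : DirichletCharacter ℂ 1)) (pt σ 0)‖ with hPdef
    set L := ‖LSeries (chSeq (1 : DirichletCharacter ℂ 1)) (pt σ t)‖ with hLdef
    by_contra hc
    push Not at hc
    have hP' : P ≤ 2 / η := hP.trans (by gcongr)
    have h3 : P ^ 3 * L ^ 4 * A < 1 := by
      calc P ^ 3 * L ^ 4 * A ≤ (2 / η) ^ 3 * L ^ 4 * A := by gcongr
        _ < (2 / η) ^ 3 * (2 * (A * η)) ^ 4 * A := by
            have := pow_lt_pow_left₀ hc (norm_nonneg _) (four_ne_zero)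
            gcongr
        _ = 1 := by
            have : η * (128 * A ^ 5) = 1 := by rw [hη]; field_simp
            field_simp
            linear_combination this
    have h4 : P ^ 3 * L ^ 4 * ‖LSeries (chSeq (1 : DirichletCharacter ℂ 1)) (pt σ (2 * t))‖
        ≤ P ^ 3 * L ^ 4 * A := by gcongr
    exact absurd (le_trans h341 h4) (not_le.2 h3)
  have hAη : 0 < A * η := by positivity
  rcases le_total η δ with h | h
  · linarith [key δ h hδ1]
  have hd : ‖LSeries (chSeq (1 : DirichletCharacter ℂ 1)) (pt η t)
      - LSeries (chSeq (1 : DirichletCharacter ℂ 1)) (pt δ t)‖ ≤ A * ‖pt η t - pt δ t‖ := by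
    refine norm_LSeries_sub_le (abscissa_chSeq _) (one_lt_pt_re hδ t) (one_lt_pt_re hη0 t) ?_
    rintro z ⟨a, b', ha, hb', hab, rfl⟩
    have e : a • pt δ t + b' • pt η t = pt (a * δ + b' * η) t := by
      have : (a : ℂ) + b' = 1 := by exact_mod_cast hab
      simp only [pt, Complex.real_smul]
      push_cast
      linear_combination (1 + t * Complex.I) * this
    rw [e, hA]
    have h3 : a * δ + b' * δ = δ := by rw [← add_mul, hab, one_mul]
    have h4 : a * η + b' * η = η := by rw [← add_mul, hab, one_mul]
    have h5 := mul_le_mul_of_nonneg_left h hb'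
    have h6 := mul_le_mul_of_nonneg_left h ha
    exact norm_LSeries_one_le hX ht1 htX (by norm_num) (by linarith) (by linarith)
  have hd2 : ‖pt η t - pt δ t‖ ≤ η := by
    refine (norm_pt_sub_le _ _ _ _).trans ?_
    rw [sub_self, abs_zero, add_zero, abs_of_nonneg (by linarith)]
    linarith
  have hd3 : A * ‖pt η t - pt δ t‖ ≤ A * η := by gcongr
  have := norm_sub_norm_le (LSeries (chSeq (1 : DirichletCharacter ℂ 1)) (pt η t))
    (LSeries (chSeq (1 : DirichletCharacter ℂ 1)) (pt δ t))
  linarith [key η le_rfl hη1]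

/-- Bound for the second derivative of `-ζ'/ζ - ζ` to the right of the line `Re s = 1`. -/
lemma norm_LSeries_log_two_sub_le {X : ℕ} (hX : 3 ≤ X) {t : ℝ} (ht1 : 1 ≤ |t|) (ht : |t| ≤ X) {A : ℝ}
    (hA : A = 10 ^ 5 * Real.log X ^ 4) {δ : ℝ} (hδ : 0 < δ) (hδ1 : δ ≤ 1) :
    ‖LSeries (logk 2 (vmSeq (1 : DirichletCharacter ℂ 1))) (pt δ t)
      - LSeries (logk 2 (chSeq (1 : DirichletCharacter ℂ 1))) (pt δ t)‖ ≤ 8 * (128 * A ^ 5) ^ 3 := by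
  have hX' : (3 : ℝ) ≤ X := by exact_mod_cast hX
  have hl1 : 1 ≤ Real.log X := by
    rw [Real.le_log_iff_exp_le (by linarith)]
    linarith [Real.exp_one_lt_d9]
  have hA1 : 1 ≤ A := by
    have : 1 ≤ Real.log X ^ 4 := one_le_pow₀ hl1
    rw [hA]; linarith
  have htX : |t| ≤ (X : ℝ) ^ 2 := by nlinarith
  have hs := one_lt_pt_re hδ t
  have hL : ∀ k ≤ 3, ‖LSeries (logk k (chSeq (1 : DirichletCharacter ℂ 1))) (pt δ t)‖ ≤ A :=
    fun k hk => hA ▸ norm_LSeries_one_le hX ht1 htX hk hδ hδ1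
  have h1 := LSeries_log_one (1 : DirichletCharacter ℂ 1) hs
  have h2 := LSeries_log_two (1 : DirichletCharacter ℂ 1) hs
  have h3 := LSeries_log_three (1 : DirichletCharacter ℂ 1) hs
  have hlow := norm_LSeries_one_ge hX ht1 ht hA rfl hδ hδ1
  rw [← logk_zero (chSeq _)] at hlow
  have hL1 := hL 1 (by norm_num)
  have hL2 := hL 2 (by norm_num)
  have hL3 := hL 3 (by norm_num)
  set L0 := LSeries (logk 0 (chSeq (1 : DirichletCharacter ℂ 1))) (pt δ t)
  set L1 := LSeries (logk 1 (chSeq (1 : DirichletCharacter ℂ 1))) (pt δ t)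
  set L2 := LSeries (logk 2 (chSeq (1 : DirichletCharacter ℂ 1))) (pt δ t)
  set L3 := LSeries (logk 3 (chSeq (1 : DirichletCharacter ℂ 1))) (pt δ t)
  set V0 := LSeries (logk 0 (vmSeq (1 : DirichletCharacter ℂ 1))) (pt δ t)
  set V1 := LSeries (logk 1 (vmSeq (1 : DirichletCharacter ℂ 1))) (pt δ t)
  set V2 := LSeries (logk 2 (vmSeq (1 : DirichletCharacter ℂ 1))) (pt δ t)
  obtain ⟨B, hB⟩ : ∃ B, B = 128 * A ^ 5 := ⟨_, rfl⟩
  rw [← hB] at hlow ⊢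
  have hA5 : 1 ≤ A ^ 4 := one_le_pow₀ hA1
  have hAB : A ≤ B := by
    rw [hB, pow_succ]
    nlinarith
  have hB1 : 1 ≤ B := hA1.trans hAB
  have hA0 : 0 < A := by linarith
  have hB0 : 0 < B := by linarith
  have hdiv : ∀ z : ℂ, ∀ c : ℝ, ‖L0 * z‖ ≤ A * c → ‖z‖ ≤ B * c := fun z c h => by
    rw [norm_mul] at h
    have h4 : A * (1 / B) * ‖z‖ ≤ A * c := le_trans (by gcongr) h
    have h5 : A * (1 / B * ‖z‖) ≤ A * c := by rwa [← mul_assoc]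
    have h6 := le_of_mul_le_mul_left h5 hA0
    rwa [one_div, inv_mul_le_iff₀ hB0] at h6
  have hV0 : ‖V0‖ ≤ B * 1 := hdiv _ _ (by rw [← h1]; linarith)
  rw [mul_one] at hV0
  have hV1 : ‖V1‖ ≤ B * (1 + B) := hdiv _ _ (by
    have e : L0 * V1 = L2 - L1 * V0 := by rw [h2]; ring
    rw [e]
    refine (norm_sub_le _ _).trans ?_
    rw [norm_mul]
    have : ‖L1‖ * ‖V0‖ ≤ A * B := by gcongr
    linarith)
  have hV2 : ‖V2‖ ≤ B * (1 + B + 2 * (B * (1 + B))) := hdiv _ _ (by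
    have e : L0 * V2 = L3 - L2 * V0 - 2 * (L1 * V1) := by rw [h3]; ring
    rw [e]
    refine (norm_sub_le _ _).trans ?_
    have h4 := norm_sub_le L3 (L2 * V0)
    rw [norm_mul] at h4
    rw [norm_mul, norm_mul, Complex.norm_ofNat]
    have h5 : ‖L2‖ * ‖V0‖ ≤ A * B := by gcongr
    have h6 : ‖L1‖ * ‖V1‖ ≤ A * (B * (1 + B)) := by gcongr
    linarith)
  refine (norm_sub_le _ _).trans ?_
  have h7 : B ≤ B ^ 3 := le_self_pow₀ hB1 (by norm_num)
  have h8 : B ^ 2 ≤ B ^ 3 := pow_le_pow_right₀ hB1 (by norm_num)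
  nlinarith

end ZetaBounds

section PrimeNumberTheorem

open ArithmeticFunction

/-- The coefficients `(Λ(n) - 1) log² n`. -/
noncomputable def pntSeq : ℕ → ℂ :=
  logk 2 (vmSeq (1 : DirichletCharacter ℂ 1)) - logk 2 (chSeq (1 : DirichletCharacter ℂ 1))

lemma pntSeq_apply (n : ℕ) : pntSeq n = ((Real.log n ^ 2 * (Λ n - 1) : ℝ) : ℂ) := by
  rw [pntSeq, Pi.sub_apply, logk, logk, vmSeq, chSeq, MulChar.one_apply (isUnit_of_subsingleton _)]
  push_cast
  ring

lemma abscissa_pntSeq : LSeries.abscissaOfAbsConv pntSeq ≤ 1 :=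
  (LSeries.abscissaOfAbsConv_sub_le _ _).trans
    (max_le (by rw [abscissa_logk]; exact abscissa_vmSeq _) (by rw [abscissa_logk]; exact abscissa_chSeq _))

lemma LSeries_pntSeq {s : ℂ} (hs : 1 < s.re) : LSeries pntSeq s
    = LSeries (logk 2 (vmSeq (1 : DirichletCharacter ℂ 1))) s
      - LSeries (logk 2 (chSeq (1 : DirichletCharacter ℂ 1))) s :=
  LSeries_sub (summable_logk (abscissa_vmSeq _) 2 hs) (summable_logk (abscissa_chSeq _) 2 hs)

lemma norm_LSeries_pntSeq_le {δ : ℝ} (hδ : 0 < δ) (hδ1 : δ ≤ 1) (t : ℝ) :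
    ‖LSeries pntSeq (pt δ t)‖ ≤ 168 / δ ^ 4 := by
  have h1 : ‖LSeries (logk 2 (vmSeq (1 : DirichletCharacter ℂ 1))) (pt δ t)‖ ≤ 144 / δ ^ 4 := by
    refine norm_LSeries_logk_le (N₀ := 0) (abscissa_vmSeq _) 2 hδ t fun N _ => ?_
    have h := sum_log_pow_rpow_le hδ hδ1 3 N
    refine (norm_sum_le _ _).trans ((Finset.sum_le_sum fun n _ => ?_).trans (h.trans (le_of_eq ?_)))
    · rw [norm_mul, norm_mul, Complex.norm_real, Real.norm_eq_abs, abs_of_nonneg (logWt_nonneg 2 δ n),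
        logWt, vmSeq, norm_mul, Complex.norm_real, Real.norm_eq_abs, abs_of_nonneg vonMangoldt_nonneg]
      have h2 : ‖(1 : DirichletCharacter ℂ 1) (n : ZMod 1)‖ * Λ n * ‖tw t n‖ ≤ 1 * Real.log n * 1 := by
        gcongr
        · exact DirichletCharacter.norm_le_one _ _
        · exact vonMangoldt_le_log
        · exact norm_tw_le t n
      calc _ ≤ 1 * Real.log n * 1 * (Real.log n ^ 2 * (n : ℝ) ^ (-1 - δ)) := by gcongr
        _ = _ := by ring
    · norm_num [Nat.factorial]
  have h2 : ‖LSeries (logk 2 (chSeq (1 : DirichletCharacter ℂ 1))) (pt δ t)‖ ≤ 24 / δ ^ 4 := by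
    refine norm_LSeries_logk_le (N₀ := 0) (abscissa_chSeq _) 2 hδ t fun N _ => ?_
    have h := sum_log_pow_rpow_le hδ hδ1 2 N
    refine (norm_sum_le _ _).trans ((Finset.sum_le_sum fun n _ => ?_).trans (h.trans ?_))
    · rw [norm_mul, norm_mul, Complex.norm_real, Real.norm_eq_abs, abs_of_nonneg (logWt_nonneg 2 δ n),
        logWt]
      refine mul_le_of_le_one_left (by positivity) ?_
      exact mul_le_one₀ (DirichletCharacter.norm_le_one _ _) (norm_nonneg _) (norm_tw_le t n)
    · have e : (3 * 2 ^ 2 * (Nat.factorial 2 : ℕ) : ℝ) = 24 := by norm_num [Nat.factorial]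
      rw [e]
      exact div_le_div_of_nonneg_left (by norm_num) (by positivity)
        (pow_le_pow_of_le_one hδ.le hδ1 (by norm_num))
  rw [LSeries_pntSeq (one_lt_pt_re hδ t)]
  refine (norm_sub_le _ _).trans ((add_le_add h1 h2).trans (le_of_eq ?_))
  ring

lemma exists_integral_pntSeq_le : ∃ C : ℝ, 1 ≤ C ∧ ∀ D : ℝ, 16 ≤ D →
    ∫ t : ℝ, ‖LSeries pntSeq (pt (1 / D) t)‖ * wk D t ≤ C * (Real.log D ^ 60 * D) := by
  obtain ⟨C₀, hC₀, hnear⟩ := exists_norm_LSeries_near_one_le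
  obtain ⟨a, ha⟩ : ∃ a : ℝ, a = 10 ^ 5 * 10 ^ 4 := ⟨_, rfl⟩
  have ha1 : 1 ≤ a := by rw [ha]; norm_num
  obtain ⟨c, hc⟩ : ∃ c : ℝ, c = C₀ + 8 * (128 * a ^ 5) ^ 3 := ⟨_, rfl⟩
  have hc1 : 1 ≤ c := by
    have : 0 ≤ 8 * (128 * a ^ 5) ^ 3 := by positivity
    linarith
  refine ⟨7 * c + 1344, by linarith, fun D hD => ?_⟩
  have hD0 : 0 < D := by linarith
  have hlD : 1 ≤ Real.log D := by
    rw [Real.le_log_iff_exp_le hD0]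
    linarith [Real.exp_one_lt_d9]
  set X : ℕ := ⌈D⌉₊ ^ 5 with hX
  have hcD : D ≤ (⌈D⌉₊ : ℝ) := Nat.le_ceil D
  have hcD2 : (⌈D⌉₊ : ℝ) ≤ D ^ 2 := by
    have := Nat.ceil_lt_add_one hD0.le
    nlinarith
  have hXD : D ^ 5 ≤ (X : ℝ) := by rw [hX]; push_cast; gcongr
  have hX3' : (3 : ℝ) ≤ X := by
    refine le_trans ?_ hXD
    calc (3 : ℝ) ≤ D := by linarith
      _ ≤ D ^ 5 := le_self_pow₀ (by linarith) (by norm_num)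
  have hX3 : 3 ≤ X := by exact_mod_cast hX3'
  have hlX : Real.log X ≤ 10 * Real.log D := by
    rw [hX]
    push_cast
    rw [Real.log_pow]
    have : Real.log (⌈D⌉₊ : ℝ) ≤ Real.log (D ^ 2) := Real.log_le_log (by linarith) hcD2
    rw [Real.log_pow] at this
    push_cast at this ⊢
    linarith
  have hlX0 : 0 ≤ Real.log X := Real.log_nonneg (by linarith)
  have hδ : 0 < 1 / D := by positivity
  have hδ1 : 1 / D ≤ 1 := by rw [div_le_one hD0]; linarith
  have hmid : ∀ t : ℝ, |t| ≤ X → ‖LSeries pntSeq (pt (1 / D) t)‖ ≤ c * Real.log D ^ 60 := fun t ht => by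
    have h60 : 1 ≤ Real.log D ^ 60 := one_le_pow₀ hlD
    rw [LSeries_pntSeq (one_lt_pt_re hδ t)]
    rcases le_total |t| 1 with h | h
    · refine (hnear _ hδ hδ1 t h).trans ?_
      have : 0 ≤ 8 * (128 * a ^ 5) ^ 3 := by positivity
      nlinarith
    · refine (norm_LSeries_log_two_sub_le hX3 h ht rfl hδ hδ1).trans ?_
      have hA : 10 ^ 5 * Real.log X ^ 4 ≤ a * Real.log D ^ 4 := by
        calc _ ≤ 10 ^ 5 * (10 * Real.log D) ^ 4 := by gcongr
          _ = _ := by rw [ha]; ring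
      calc _ ≤ 8 * (128 * (a * Real.log D ^ 4) ^ 5) ^ 3 := by gcongr
        _ = 8 * (128 * a ^ 5) ^ 3 * Real.log D ^ 60 := by ring
        _ ≤ _ := by gcongr; linarith
  have htail : ∀ t : ℝ, ‖LSeries pntSeq (pt (1 / D) t)‖ ≤ 168 * D ^ 4 := fun t => by
    refine (norm_LSeries_pntSeq_le hδ hδ1 t).trans (le_of_eq ?_)
    field_simp
  have hmeas : MeasurableSet {t : ℝ | (X : ℝ) < |t|} :=
    measurableSet_lt measurable_const continuous_abs.measurable
  have hInt := integrable_wk hD0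
  have hpt : ∀ t : ℝ, ‖LSeries pntSeq (pt (1 / D) t)‖ * wk D t
      ≤ c * Real.log D ^ 60 * wk D t
        + 168 * D ^ 4 * Set.indicator {t : ℝ | (X : ℝ) < |t|} (wk D) t := fun t => by
    have hw := wk_nonneg D t
    by_cases h : (X : ℝ) < |t|
    · rw [Set.indicator_of_mem (show t ∈ {t : ℝ | (X : ℝ) < |t|} from h)]
      have h1 := mul_le_mul_of_nonneg_right (htail t) hw
      have h2 : 0 ≤ c * Real.log D ^ 60 * wk D t := by positivity
      linarith
    · rw [Set.indicator_of_notMem (show t ∉ {t : ℝ | (X : ℝ) < |t|} from h), mul_zero, add_zero]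
      exact mul_le_mul_of_nonneg_right (hmid t (not_lt.1 h)) hw
  have hi1 : MeasureTheory.Integrable fun t => c * Real.log D ^ 60 * wk D t := hInt.const_mul _
  have hi2 : MeasureTheory.Integrable fun t =>
      168 * D ^ 4 * Set.indicator {t : ℝ | (X : ℝ) < |t|} (wk D) t := (hInt.indicator hmeas).const_mul _
  have h1 := MeasureTheory.integral_mono_of_nonneg
    (Filter.Eventually.of_forall fun t => mul_nonneg (norm_nonneg _) (wk_nonneg D t)) (hi1.add hi2)
    (Filter.Eventually.of_forall hpt)
  refine h1.trans ?_
  rw [MeasureTheory.integral_add' hi1 hi2, MeasureTheory.integral_const_mul,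
    MeasureTheory.integral_const_mul, MeasureTheory.integral_indicator hmeas]
  have h2 := integral_wk_le hD0
  have h3 := integral_wk_tail_le hD0 (show (0 : ℝ) < X by linarith)
  have hπ : 2 * Real.pi ≤ 7 := by linarith [Real.pi_lt_d2]
  have h4 : 8 * D ^ 2 / X ≤ 8 / D ^ 3 := by
    rw [div_le_div_iff₀ (by linarith) (by positivity)]
    nlinarith
  have h5 : 168 * D ^ 4 * (8 / D ^ 3) = 1344 * D := by field_simp; norm_num
  have h60 : 1 ≤ Real.log D ^ 60 := one_le_pow₀ hlD
  calc _ ≤ c * Real.log D ^ 60 * (7 * D) + 168 * D ^ 4 * (8 / D ^ 3) := by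
        gcongr
        · refine h2.trans (by gcongr)
        · exact h3.trans h4
    _ = 7 * c * (Real.log D ^ 60 * D) + 1344 * (1 * D) := by rw [h5]; ring
    _ ≤ 7 * c * (Real.log D ^ 60 * D) + 1344 * (Real.log D ^ 60 * D) := by gcongr
    _ = _ := by ring

/-- The prime number theorem with an error term saving almost one logarithm. -/
theorem exists_abs_psi_sub_le : ∃ C : ℝ, 1 ≤ C ∧ ∀ D : ℝ, 16 ≤ D →
    |∑ n ∈ Ioc 0 ⌊Real.exp D⌋₊, Λ n - Real.exp D| ≤ C * (Real.exp D * Real.log D ^ 60 / D) := by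
  obtain ⟨C₁, hC₁, hH⟩ := exists_integral_pntSeq_le
  obtain ⟨K, hK0, hBT⟩ := exists_brun_titchmarsh
  refine ⟨24 * C₁ + 30 * (K + 1) + 1, by linarith, fun D hD => ?_⟩
  have hD0 : 0 < D := by linarith
  have hlD : 1 ≤ Real.log D := by
    rw [Real.le_log_iff_exp_le hD0]
    linarith [Real.exp_one_lt_d9]
  have h60 : 1 ≤ Real.log D ^ 60 := one_le_pow₀ hlD
  have hexp : ∀ y : ℝ, 0 ≤ y → y ^ 4 / 24 ≤ Real.exp y := fun y hy => by
    have := Real.pow_div_factorial_le_exp y hy 4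
    norm_num [Nat.factorial] at this
    exact this
  have hx1 : D ≤ Real.exp D := (by linarith : D ≤ D + 1).trans (Real.add_one_le_exp D)
  have hS := norm_sum_le_of_smoothed (c := fun n => ((Λ n - 1 : ℝ) : ℂ)) (D := D) (T := D)
    (E := C₁ * (Real.log D ^ 60 * D)) (K := K + 1) (w := 1) (by linarith) (by linarith) le_rfl
    (by
      refine le_trans ?_ (hexp D hD0.le)
      nlinarith [mul_self_nonneg (D ^ 2), pow_pos hD0 2, mul_le_mul hD hD (by norm_num) hD0.le])
    (by
      have := Real.add_one_le_exp (D / 2)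
      linarith)
    (by linarith)
    (fun u hu1 hu2 => by
      refine le_trans ?_ (hH D hD)
      have hNu : u + 1 / D ≤ Real.log ((⌊2 * Real.exp u⌋₊ : ℝ) + 1) := by
        have h1 : 2 * Real.exp u < (⌊2 * Real.exp u⌋₊ : ℝ) + 1 := Nat.lt_floor_add_one _
        have h2 : Real.log (2 * Real.exp u) ≤ Real.log ((⌊2 * Real.exp u⌋₊ : ℝ) + 1) :=
          Real.log_le_log (by positivity) h1.le
        rw [Real.log_mul two_ne_zero (Real.exp_ne_zero _), Real.log_exp] at h2
        have h3 : 1 / D ≤ 1 / 2 := by gcongr; linarith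
        linarith [Real.log_two_gt_d9]
      refine le_trans (le_of_eq ?_) (norm_sum_kr_le abscissa_pntSeq (show 0 < 1 / D by positivity) hD0 hNu)
      refine congrArg norm (Finset.sum_congr rfl fun n _ => ?_)
      rw [pntSeq_apply, logWt]
      push_cast
      ring)
    (fun M N hMN h => by
      have h1 := hBT 1 one_pos 1 isUnit_one M N hMN (by simpa using h)
      rw [apIoc_one, Nat.totient_one, Nat.cast_one, div_one] at h1
      have h2 : ∀ n ∈ Ioc M N, ‖((Λ n - 1 : ℝ) : ℂ)‖ ≤ Λ n + 1 := fun n _ => by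
        rw [Complex.norm_real, Real.norm_eq_abs]
        have := @vonMangoldt_nonneg n
        rw [abs_le]; constructor <;> linarith
      refine (Finset.sum_le_sum h2).trans ?_
      rw [Finset.sum_add_distrib, Finset.sum_const, Nat.card_Ioc, nsmul_eq_mul, mul_one, Nat.cast_sub hMN]
      linarith)
  rw [← Complex.ofReal_sum, Complex.norm_real, Real.norm_eq_abs, Finset.sum_sub_distrib,
    Finset.sum_const, Nat.card_Ioc, nsmul_eq_mul, mul_one, Nat.sub_zero] at hS
  have hx0 := Real.exp_pos D
  have hf1 := Nat.floor_le hx0.le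
  have hf2 := Nat.lt_floor_add_one (Real.exp D)
  have e1 : 24 * (C₁ * (Real.log D ^ 60 * D) * Real.exp D / D ^ 2)
      = 24 * C₁ * (Real.exp D * Real.log D ^ 60 / D) := by field_simp
  have e2 : 30 * ((K + 1) * Real.exp D / D) ≤ 30 * (K + 1) * (Real.exp D * Real.log D ^ 60 / D) := by
    have : Real.exp D / D ≤ Real.exp D * Real.log D ^ 60 / D := by
      gcongr
      exact le_mul_of_one_le_right hx0.le h60
    calc _ = 30 * (K + 1) * (Real.exp D / D) := by ring
      _ ≤ _ := by gcongr
  have e3 : 1 ≤ Real.exp D * Real.log D ^ 60 / D := by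
    rw [le_div_iff₀ hD0, one_mul]
    exact hx1.trans (le_mul_of_one_le_right hx0.le h60)
  rw [abs_le] at hS ⊢
  constructor <;> linarith [hS.1, hS.2]

end PrimeNumberTheorem

section Assembly

open ArithmeticFunction

open scoped Classical in
lemma sum_vonMangoldt_not_isUnit_le {q : ℕ} (hq : 0 < q) (N : ℕ) :
    ∑ n ∈ (Ioc 0 N).filter (fun n : ℕ => ¬IsUnit (n : ZMod q)), Λ n ≤ Nat.log 2 N * Real.log q := by
  have hL : (q ^ Nat.log 2 N : ℕ) ≠ 0 := pow_ne_zero _ hq.ne'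
  have h := vonMangoldt_sum (n := q ^ Nat.log 2 N)
  rw [Nat.cast_pow, Real.log_pow] at h
  rw [← h, ← Finset.sum_filter_ne_zero]
  refine Finset.sum_le_sum_of_subset_of_nonneg (fun n hn => ?_) fun _ _ _ => vonMangoldt_nonneg
  simp only [Finset.mem_filter, Finset.mem_Ioc] at hn
  obtain ⟨⟨⟨hn0, hnN⟩, hu⟩, hΛ⟩ := hn
  rw [ne_eq, vonMangoldt_eq_zero_iff, not_not] at hΛ
  obtain ⟨p, k, hp, hk, rfl⟩ := (isPrimePow_nat_iff _).1 hΛ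
  refine Nat.mem_divisors.2 ⟨?_, hL⟩
  have hpq : p ∣ q := by
    by_contra hpq
    refine hu ?_
    rw [ZMod.isUnit_iff_coprime]
    exact Nat.Coprime.pow_left _ ((Nat.Prime.coprime_iff_not_dvd hp).2 hpq)
  refine (pow_dvd_pow_of_dvd hpq k).trans (pow_dvd_pow q ?_)
  refine Nat.le_log_of_pow_le one_lt_two (le_trans ?_ hnN)
  exact Nat.pow_le_pow_left hp.two_le k

lemma sum_char_compl {q : ℕ} [NeZero q] {𝒳 : Finset (DirichletCharacter ℂ q)} (h𝒳 : ∀ χ ∈ 𝒳, χ ≠ 1)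
    {a : ℕ} (ha : IsUnit (a : ZMod q)) {S : Finset (DirichletCharacter ℂ q)}
    (hS : ∀ χ, χ ∈ S ↔ χ ≠ 1 ∧ χ ∉ 𝒳) (n : ℕ) :
    ∑ χ ∈ S, (starRingEnd ℂ) (χ a) * χ (n : ZMod q)
      = (if (n : ZMod q) = a then (q.totient : ℂ) else 0) - (1 : DirichletCharacter ℂ q) (n : ZMod q)
        - ∑ χ ∈ 𝒳, (starRingEnd ℂ) (χ a) * χ (n : ZMod q) := by
  classical
  have h1 : (1 : DirichletCharacter ℂ q) ∉ 𝒳 := fun h => h𝒳 1 h rfl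
  have e : S = univ \ insert 1 𝒳 := by
    ext χ
    simp [hS]
  rw [e, Finset.sum_sdiff_eq_sub (Finset.subset_univ _), Finset.sum_insert h1, MulChar.one_apply ha, map_one,
    one_mul, ← sum_char_mul_conj (NeZero.pos q) ha, sub_add_eq_sub_sub]
  simp only [mul_comm]

open scoped Classical in
lemma norm_sum_one_mul_vonMangoldt_sub_le {q : ℕ} (hq : 0 < q) (N : ℕ) (x : ℝ) :
    ‖∑ n ∈ Ioc 0 N, (1 : DirichletCharacter ℂ q) (n : ZMod q) * (Λ n : ℂ) - x‖
      ≤ |∑ n ∈ Ioc 0 N, Λ n - x| + Nat.log 2 N * Real.log q := by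
  have h : ∑ n ∈ Ioc 0 N, (1 : DirichletCharacter ℂ q) (n : ZMod q) * (Λ n : ℂ) - x
      = ((∑ n ∈ Ioc 0 N, Λ n - x
        - ∑ n ∈ (Ioc 0 N).filter (fun n : ℕ => ¬IsUnit (n : ZMod q)), Λ n : ℝ) : ℂ) := by
    rw [← Finset.sum_filter_add_sum_filter_not (Ioc 0 N) (fun n : ℕ => IsUnit (n : ZMod q)) (fun n => Λ n),
      ← Finset.sum_filter_add_sum_filter_not (Ioc 0 N) (fun n : ℕ => IsUnit (n : ZMod q)),
      Finset.sum_congr rfl fun n hn => by rw [MulChar.one_apply (Finset.mem_filter.1 hn).2, one_mul],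
      Finset.sum_congr (s₁ := (Ioc 0 N).filter fun n : ℕ => ¬IsUnit (n : ZMod q)) rfl fun n hn => by
        rw [MulChar.map_nonunit _ (Finset.mem_filter.1 hn).2, zero_mul]]
    push_cast
    simp only [Finset.sum_const_zero]
    ring
  rw [h, Complex.norm_real, Real.norm_eq_abs]
  refine (abs_sub _ _).trans (add_le_add le_rfl ?_)
  rw [abs_of_nonneg (Finset.sum_nonneg fun _ _ => vonMangoldt_nonneg)]
  exact sum_vonMangoldt_not_isUnit_le hq N

/-- Primes in arithmetic progressions after removing at most one character, with a nearly optimal saving. -/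
theorem exists_sum_vonMangoldt_progression_sub_le : ∃ C R₀ : ℝ, 1 ≤ C ∧ 2 ≤ R₀ ∧
    ∀ Z : ℕ, 2 ≤ Z → ∀ q : ℕ, ∀ [NeZero q], q ≤ Z → ∃ 𝒳 : Finset (DirichletCharacter ℂ q), 𝒳.card ≤ 1 ∧
      (∀ χ ∈ 𝒳, χ ≠ 1) ∧ ∀ D : ℝ, 16 ≤ D → R₀ * Real.log Z ≤ D → D ≤ Z →
      (∀ ψ : DirichletCharacter ℂ q, ψ ≠ 1 → ψ ∉ 𝒳 →
        ‖∑ n ∈ Ioc 0 ⌊Real.exp D⌋₊, (Λ n : ℂ) * ψ (n : ZMod q)‖ ≤ C * (Real.exp D * Real.log Z / D)) ∧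
      ∀ a : ℕ, IsUnit (a : ZMod q) →
        ‖∑ n ∈ (Ioc 0 ⌊Real.exp D⌋₊).filter (fun n : ℕ => (n : ZMod q) = (a : ZMod q)), (Λ n : ℂ)
          - (1 / (q.totient : ℝ)) * ∑ χ ∈ 𝒳, (starRingEnd ℂ) (χ (a : ZMod q)) *
            ∑ n ∈ Ioc 0 ⌊Real.exp D⌋₊, (Λ n : ℂ) * χ (n : ZMod q)
          - (Real.exp D / (q.totient : ℝ) : ℝ)‖
        ≤ C * (Real.exp D / q.totient) * (Real.log Z / D + Real.log D ^ 60 / D) := by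
  obtain ⟨C₁, R₀, hC₁, hR₀, H⟩ := exists_sum_vonMangoldt_char_le
  obtain ⟨C₂, hC₂, hψ⟩ := exists_abs_psi_sub_le
  refine ⟨C₁ + C₂ + 48, R₀, by linarith, hR₀, fun Z hZ q _ hqZ => ?_⟩
  obtain ⟨𝒳, hcard, h1, h𝒳⟩ := H Z hZ q hqZ
  refine ⟨𝒳, hcard, h1, fun D hD hRD hDZ => ⟨fun ψ hψ1 hψ𝒳 => ?_, fun a ha => ?_⟩⟩
  · have hZ1 : (1 : ℝ) ≤ Z := by exact_mod_cast (one_le_two.trans hZ)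
    have h0 : 0 ≤ Real.exp D * Real.log Z / D :=
      div_nonneg (mul_nonneg (Real.exp_pos D).le (Real.log_nonneg hZ1)) (by linarith)
    have h := h𝒳 D hRD hDZ {ψ} (by simpa using ⟨hψ1, hψ𝒳⟩) (fun _ => 1) (by simp) 1 isUnit_one fun β => by
      rw [Finset.sum_singleton, one_mul]
      have := DirichletCharacter.norm_le_one ψ β
      have h2 : (0 : ℝ) ≤ if β = 1 then (q.totient : ℝ) else 0 := by split_ifs <;> positivity
      linarith
    simp only [Finset.sum_singleton, one_mul] at h
    simp only [mul_comm (ψ _)] at h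
    exact h.trans (by gcongr; linarith)
  · classical
    have hD0 : 0 < D := by linarith
    have hφ : (0 : ℝ) < q.totient := by exact_mod_cast Nat.totient_pos.2 (NeZero.pos q)
    have hφ' : (q.totient : ℂ) ≠ 0 := by exact_mod_cast hφ.ne'
    set N := ⌊Real.exp D⌋₊ with hN
    set S : Finset (DirichletCharacter ℂ q) := univ.filter fun χ => χ ≠ 1 ∧ χ ∉ 𝒳 with hS
    have hmem : ∀ χ, χ ∈ S ↔ χ ≠ 1 ∧ χ ∉ 𝒳 := fun χ => by rw [hS, Finset.mem_filter]; simp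
    have hv := sum_char_compl h1 ha hmem
    have hc1 : ∀ (χ : DirichletCharacter ℂ q), ‖(starRingEnd ℂ) (χ (a : ZMod q))‖ ≤ 1 := fun χ => by
      rw [RCLike.norm_conj]
      exact DirichletCharacter.norm_le_one _ _
    have h := h𝒳 D hRD hDZ S (fun χ hχ => (hmem χ).1 hχ) (fun χ => (starRingEnd ℂ) (χ a)) hc1 a ha fun β => by
      obtain ⟨n, rfl⟩ : ∃ n : ℕ, (n : ZMod q) = β := ⟨β.val, ZMod.natCast_zmod_val β⟩
      rw [hv n]
      have e1 : ‖(if (n : ZMod q) = a then (q.totient : ℂ) else 0)‖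
          ≤ if (n : ZMod q) = a then (q.totient : ℝ) else 0 := by split_ifs <;> simp
      have e2 : ‖∑ χ ∈ 𝒳, (starRingEnd ℂ) (χ a) * χ (n : ZMod q)‖ ≤ 1 := by
        have hb : ∀ χ ∈ 𝒳, ‖(starRingEnd ℂ) (χ a) * χ (n : ZMod q)‖ ≤ 1 := fun χ _ => by
          rw [norm_mul]
          exact mul_le_one₀ (hc1 χ) (norm_nonneg _) (DirichletCharacter.norm_le_one _ _)
        refine (norm_sum_le_of_le _ hb).trans ?_
        rw [Finset.sum_const, nsmul_eq_mul, mul_one]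
        exact_mod_cast hcard
      have e3 := DirichletCharacter.norm_le_one (1 : DirichletCharacter ℂ q) (n : ZMod q)
      refine (norm_sub_le _ _).trans ?_
      have := norm_sub_le (if (n : ZMod q) = a then (q.totient : ℂ) else 0)
        ((1 : DirichletCharacter ℂ q) (n : ZMod q))
      linarith
    have hone := norm_sum_one_mul_vonMangoldt_sub_le (NeZero.pos q) N (Real.exp D)
    have hsum : ∑ n ∈ Ioc 0 N, (∑ χ ∈ S, (starRingEnd ℂ) (χ a) * χ (n : ZMod q)) * (Λ n : ℂ)
        = q.totient * ∑ n ∈ (Ioc 0 N).filter (fun n : ℕ => (n : ZMod q) = (a : ZMod q)), (Λ n : ℂ)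
          - ∑ n ∈ Ioc 0 N, (1 : DirichletCharacter ℂ q) (n : ZMod q) * (Λ n : ℂ)
          - ∑ χ ∈ 𝒳, (starRingEnd ℂ) (χ (a : ZMod q)) * ∑ n ∈ Ioc 0 N, (Λ n : ℂ) * χ (n : ZMod q) := by
      simp only [hv, sub_mul, Finset.sum_sub_distrib]
      congr 1
      · congr 1
        rw [Finset.sum_filter, Finset.mul_sum]
        refine Finset.sum_congr rfl fun n _ => ?_
        split_ifs <;> simp
      · simp only [Finset.sum_mul, Finset.mul_sum]
        rw [Finset.sum_comm]
        refine Finset.sum_congr rfl fun χ _ => Finset.sum_congr rfl fun n _ => by ring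
    have hE : ∑ n ∈ (Ioc 0 N).filter (fun n : ℕ => (n : ZMod q) = (a : ZMod q)), (Λ n : ℂ)
          - (1 / (q.totient : ℝ)) * ∑ χ ∈ 𝒳, (starRingEnd ℂ) (χ (a : ZMod q)) *
            ∑ n ∈ Ioc 0 N, (Λ n : ℂ) * χ (n : ZMod q)
          - (Real.exp D / (q.totient : ℝ) : ℝ)
        = (∑ n ∈ Ioc 0 N, (∑ χ ∈ S, (starRingEnd ℂ) (χ a) * χ (n : ZMod q)) * (Λ n : ℂ)
          + (∑ n ∈ Ioc 0 N, (1 : DirichletCharacter ℂ q) (n : ZMod q) * (Λ n : ℂ) - (Real.exp D : ℝ)))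
            / (q.totient : ℂ) := by
      rw [hsum, Complex.ofReal_div, Complex.ofReal_natCast]
      field_simp
      ring
    have hlD : 1 ≤ Real.log D := by
      rw [Real.le_log_iff_exp_le hD0]
      linarith [Real.exp_one_lt_d9]
    have h60 : 1 ≤ Real.log D ^ 60 := one_le_pow₀ hlD
    have hq0 : (0 : ℝ) < q := by exact_mod_cast NeZero.pos q
    have hq1 : (1 : ℝ) ≤ q := by exact_mod_cast NeZero.pos q
    have hZ0 : (1 : ℝ) ≤ Z := by exact_mod_cast (one_le_two.trans hZ)
    have hlqD : Real.log q ≤ D := by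
      have e1 : Real.log q ≤ Real.log Z := Real.log_le_log hq0 (by exact_mod_cast hqZ)
      have e2 := Real.log_nonneg hZ0
      nlinarith
    have hlN : (Nat.log 2 N : ℝ) ≤ 2 * D := by
      have hN0 : N ≠ 0 := (Nat.floor_pos.2 (Real.one_le_exp hD0.le)).ne'
      have e1 : ((2 : ℝ) ^ Nat.log 2 N) ≤ Real.exp D := by
        refine le_trans ?_ (Nat.floor_le (Real.exp_pos D).le)
        exact_mod_cast Nat.pow_log_le_self 2 hN0
      have e2 := Real.log_le_log (by positivity) e1
      rw [Real.log_pow, Real.log_exp] at e2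
      have : (0 : ℝ) ≤ Nat.log 2 N := Nat.cast_nonneg _
      nlinarith [Real.log_two_gt_d9]
    have hsm : (Nat.log 2 N : ℝ) * Real.log q ≤ 48 * (Real.exp D * Real.log D ^ 60 / D) := by
      have e1 : D ^ 3 / 6 ≤ Real.exp D := by
        have := Real.pow_div_factorial_le_exp D hD0.le 3
        norm_num [Nat.factorial] at this
        exact this
      calc (Nat.log 2 N : ℝ) * Real.log q ≤ 2 * D * D := by gcongr
        _ = 12 * (D ^ 3 / 6 * 1 / D) := by field_simp; ring
        _ ≤ 12 * (Real.exp D * Real.log D ^ 60 / D) := by gcongr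
        _ ≤ _ := by gcongr; norm_num
    have hP := hψ D hD
    have hn1 : 0 ≤ Real.exp D * Real.log Z / D :=
      div_nonneg (mul_nonneg (Real.exp_pos D).le (Real.log_nonneg hZ0)) hD0.le
    have hn2 : 0 ≤ Real.exp D * Real.log D ^ 60 / D := by positivity
    rw [hE, norm_div, Complex.norm_natCast, div_le_iff₀ hφ]
    refine (norm_add_le _ _).trans ((add_le_add h (hone.trans (add_le_add hP hsm))).trans ?_)
    have e : (C₁ + C₂ + 48) * (Real.exp D / q.totient) * (Real.log Z / D + Real.log D ^ 60 / D) * q.totient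
        = (C₁ + C₂ + 48) * (Real.exp D * Real.log Z / D)
          + (C₁ + C₂ + 48) * (Real.exp D * Real.log D ^ 60 / D) := by
      field_simp
    rw [e]
    nlinarith

lemma log_pow_div_le_rpow {e : ℝ} (he : e < 1) : ∃ K : ℝ, 1 ≤ K ∧ ∀ D r : ℝ, 1 ≤ D → 1 / D ≤ r → r ≤ 1 →
    Real.log D ^ 60 / D ≤ K * r ^ e := by
  obtain ⟨f, hf⟩ : ∃ f : ℝ, f = max e 0 := ⟨_, rfl⟩
  have hf0 : 0 ≤ f := hf ▸ le_max_right _ _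
  have hfe : e ≤ f := hf ▸ le_max_left _ _
  have hf1 : f < 1 := hf ▸ max_lt he one_pos
  obtain ⟨s, hs⟩ : ∃ s : ℝ, s = (1 - f) / 60 := ⟨_, rfl⟩
  have hs0 : 0 < s := by rw [hs]; linarith
  have hs1 : s ≤ 1 := by rw [hs]; linarith
  refine ⟨1 / s ^ 60, by rw [le_div_iff₀ (by positivity), one_mul]; exact pow_le_one₀ hs0.le hs1,
    fun D r hD hr hr1 => ?_⟩
  have hD0 : 0 < D := by linarith
  have hr0 : 0 < r := lt_of_lt_of_le (by positivity) hr
  have h1 : D ^ (-f) ≤ r ^ e := by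
    calc D ^ (-f) = (1 / D) ^ f := by rw [one_div, Real.inv_rpow hD0.le, Real.rpow_neg hD0.le]
      _ ≤ r ^ f := by gcongr
      _ ≤ r ^ e := Real.rpow_le_rpow_of_exponent_ge hr0 hr1 hfe
  have h2 : Real.log D ^ 60 / D ≤ 1 / s ^ 60 * D ^ (-f) := by
    have h3 : Real.log D ^ 60 ≤ (D ^ s / s) ^ 60 := by
      gcongr
      · exact Real.log_nonneg hD
      · exact Real.log_le_rpow_div hD0.le hs0
    have h4 : (D ^ s) ^ 60 = D ^ (-f) * D := by
      rw [← Real.rpow_natCast, ← Real.rpow_mul hD0.le, ← Real.rpow_add_one hD0.ne', hs]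
      congr 1
      push_cast
      ring
    rw [div_le_iff₀ hD0]
    refine h3.trans (le_of_eq ?_)
    rw [div_pow, h4]
    ring
  exact h2.trans (by gcongr)

/-- The estimates hold trivially, with no character removed, up to a constant factor. -/
lemma exists_sum_vonMangoldt_progression_trivial : ∃ C : ℝ, 1 ≤ C ∧ ∀ q : ℕ, 0 < q → ∀ x : ℝ,
    (q : ℝ) ^ 10 ≤ x →
      (∀ ψ : DirichletCharacter ℂ q, ‖∑ n ∈ Ioc 0 ⌊x⌋₊, (Λ n : ℂ) * ψ (n : ZMod q)‖ ≤ C * x) ∧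
      ∀ a : ℕ, IsUnit (a : ZMod q) →
        ‖∑ n ∈ (Ioc 0 ⌊x⌋₊).filter (fun n : ℕ => (n : ZMod q) = (a : ZMod q)), (Λ n : ℂ)
          - (x / (q.totient : ℝ) : ℝ)‖ ≤ C * (x / q.totient) := by
  obtain ⟨C, hC, h⟩ := exists_brun_titchmarsh
  have hl4 : 0 ≤ Real.log 4 := Real.log_nonneg (by norm_num)
  refine ⟨C + 1 + (Real.log 4 + 4), by linarith, fun q hq x hx => ?_⟩
  have hq1 : (1 : ℝ) ≤ q := by exact_mod_cast hq
  have hx0 : 0 ≤ x := le_trans (by positivity) hx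
  refine ⟨fun ψ => ?_, fun a ha => ?_⟩
  · have h1 := Chebyshev.psi_le_const_mul_self hx0
    rw [Chebyshev.psi] at h1
    refine (norm_sum_le_of_le (f := fun n : ℕ => (Λ n : ℂ) * ψ (n : ZMod q)) (Ioc 0 ⌊x⌋₊) fun n _ => ?_).trans
      (h1.trans (mul_le_mul_of_nonneg_right (by linarith) hx0))
    rw [norm_mul, Complex.norm_real, Real.norm_eq_abs, abs_of_nonneg vonMangoldt_nonneg]
    exact mul_le_of_le_one_right vonMangoldt_nonneg (DirichletCharacter.norm_le_one _ _)
  · have hN : q ^ 2 ≤ ⌊x⌋₊ := by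
      refine (Nat.pow_le_pow_right hq (by norm_num : 2 ≤ 10)).trans (Nat.le_floor ?_)
      exact_mod_cast hx
    have hN' : (q : ℝ) ^ 2 ≤ (⌊x⌋₊ : ℝ) := by exact_mod_cast hN
    have h1 := h q hq a ha 0 ⌊x⌋₊ (Nat.zero_le _) (by
      rw [Nat.cast_zero, sub_zero, sq (⌊x⌋₊ : ℝ)]
      gcongr)
    rw [Nat.cast_zero, sub_zero] at h1
    have h2 : C * ((⌊x⌋₊ : ℝ) / q.totient) ≤ C * (x / q.totient) := by
      gcongr
      exact Nat.floor_le hx0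
    have h3 : 0 ≤ x / (q.totient : ℝ) := by positivity
    rw [← Complex.ofReal_sum, ← Complex.ofReal_sub, Complex.norm_real, Real.norm_eq_abs]
    refine (abs_sub _ _).trans ?_
    rw [abs_of_nonneg h3, abs_of_nonneg (Finset.sum_nonneg fun _ _ => vonMangoldt_nonneg)]
    nlinarith

end Assembly

end SieveAP

open Complex
open scoped Classical

noncomputable section

theorem primes_in_progressions_removing_characters (J : ℕ) (hJ : 1 ≤ J) (ε : ℝ) (hε : 0 < ε) :
    ∃ C : ℝ, 0 < C ∧ ∀ q : ℕ, 1 ≤ q → ∀ x : ℝ, (q : ℝ) ^ 10 ≤ x → C ≤ x →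
    ∃ 𝒳 : Finset (DirichletCharacter ℂ q), 𝒳.card ≤ J ∧
      (∀ χ ∈ 𝒳, χ ≠ (1 : DirichletCharacter ℂ q)) ∧
      (∀ ψ : DirichletCharacter ℂ q, ψ ≠ 1 → ψ ∉ 𝒳 →
        ‖∑ n ∈ Finset.Icc 1 ⌊x⌋₊,
            (ArithmeticFunction.vonMangoldt n : ℂ) * ψ (n : ZMod q)‖ ≤
          C * x * (Real.log ((q : ℝ) * Real.log x) / Real.log x)
              ^ (1 - 1 / Real.sqrt ((J : ℝ) + 1) - ε)) ∧
      (∀ a : ℕ, Nat.Coprime a q →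
        ‖(∑ n ∈ (Finset.Icc 1 ⌊x⌋₊).filter (fun n : ℕ => (n : ZMod q) = (a : ZMod q)),
              (ArithmeticFunction.vonMangoldt n : ℂ))
            - (1 / (q.totient : ℝ)) *
                ∑ χ ∈ 𝒳, (starRingEnd ℂ) (χ (a : ZMod q)) *
                  ∑ n ∈ Finset.Icc 1 ⌊x⌋₊,
                    (ArithmeticFunction.vonMangoldt n : ℂ) * χ (n : ZMod q)
            - (x / (q.totient : ℝ) : ℝ)‖ ≤
          C * (x / (q.totient : ℝ)) *
            (Real.log ((q : ℝ) * Real.log x) / Real.log x)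
              ^ (1 - 1 / Real.sqrt ((J : ℝ) + 1) - ε)) := by
  obtain ⟨e, he⟩ : ∃ e : ℝ, e = 1 - 1 / Real.sqrt ((J : ℝ) + 1) - ε := ⟨_, rfl⟩
  have he1 : e < 1 := by
    have : 0 ≤ 1 / Real.sqrt ((J : ℝ) + 1) := by positivity
    linarith
  obtain ⟨C₁, R₀, hC₁, hR₀, hmain⟩ := SieveAP.exists_sum_vonMangoldt_progression_sub_le
  obtain ⟨C₂, hC₂, htriv⟩ := SieveAP.exists_sum_vonMangoldt_progression_trivial
  obtain ⟨K, hK, hlog⟩ := SieveAP.log_pow_div_le_rpow he1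
  rw [← he]
  have hCR : 1 ≤ C₂ * (2 * R₀) := by nlinarith
  refine ⟨C₁ * (2 + K) + C₂ * (2 * R₀) + Real.exp 16, by positivity, fun q hq x hqx hCx => ?_⟩
  have : NeZero q := ⟨(Nat.one_le_iff_ne_zero).1 hq⟩
  have hCK : 0 ≤ C₁ * (2 + K) := by positivity
  have hx16 : Real.exp 16 ≤ x := by linarith
  have hx0 : 0 < x := (Real.exp_pos 16).trans_le hx16
  obtain ⟨D, rfl⟩ : ∃ D : ℝ, Real.exp D = x := ⟨Real.log x, Real.exp_log hx0⟩
  have hD : 16 ≤ D := Real.exp_le_exp.1 hx16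
  have hD0 : 0 < D := by linarith
  rw [Real.log_exp]
  have hq1 : (1 : ℝ) ≤ q := by exact_mod_cast hq
  have hlq : 10 * Real.log q ≤ D := by
    have := Real.log_le_log (by positivity) hqx
    rwa [Real.log_exp, Real.log_pow, Nat.cast_ofNat] at this
  have hlD2 : Real.log D ≤ D / 2 := by
    have h1 := Real.log_le_sub_one_of_pos (show 0 < D / 2 by linarith)
    rw [Real.log_div hD0.ne' two_ne_zero] at h1
    linarith [Real.log_two_lt_d9]
  have hlD1 : 1 ≤ Real.log D := by
    rw [Real.le_log_iff_exp_le hD0]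
    linarith [Real.exp_one_lt_d9]
  have hQlog : Real.log ((q : ℝ) * D) = Real.log q + Real.log D :=
    Real.log_mul (by positivity) hD0.ne'
  have hlq0 : 0 ≤ Real.log q := Real.log_nonneg hq1
  obtain ⟨r, hr⟩ : ∃ r : ℝ, r = Real.log ((q : ℝ) * D) / D := ⟨_, rfl⟩
  rw [← hr]
  have hrD : 1 / D ≤ r := by
    rw [hr, hQlog]
    gcongr
    linarith
  have hr1 : r ≤ 1 := by
    rw [hr, hQlog, div_le_one hD0]
    linarith
  have hr0 : 0 < r := lt_of_lt_of_le (by positivity) hrD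
  have hre : r ≤ r ^ e := by
    calc r = r ^ (1 : ℝ) := (Real.rpow_one r).symm
      _ ≤ r ^ e := Real.rpow_le_rpow_of_exponent_ge hr0 hr1 he1.le
  have hre0 : 0 < r ^ e := hr0.trans_le hre
  have hφ : (0 : ℝ) < q.totient := by exact_mod_cast Nat.totient_pos.2 (NeZero.pos q)
  have hQ16 : 16 ≤ (q : ℝ) * D := by nlinarith
  have hZle : (q : ℝ) * D ≤ (⌈(q : ℝ) * D⌉₊ : ℝ) := Nat.le_ceil _
  have hZlt : (⌈(q : ℝ) * D⌉₊ : ℝ) < (q : ℝ) * D + 1 := Nat.ceil_lt_add_one (by positivity)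
  set Z := ⌈(q : ℝ) * D⌉₊
  have hqZ : q ≤ Z := by
    have : (q : ℝ) ≤ Z := by nlinarith
    exact_mod_cast this
  have hDZ : D ≤ Z := by nlinarith
  have hZ2 : 2 ≤ Z := by
    have : (2 : ℝ) ≤ Z := by linarith
    exact_mod_cast this
  have hlZ : Real.log Z / D ≤ 2 * r := by
    have h1 : Real.log Z ≤ Real.log (((q : ℝ) * D) ^ 2) :=
      Real.log_le_log (by linarith) (by nlinarith)
    rw [Real.log_pow, Nat.cast_ofNat] at h1
    rw [hr, ← mul_div_assoc]
    gcongr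
  have hI : Finset.Icc 1 ⌊Real.exp D⌋₊ = Finset.Ioc 0 ⌊Real.exp D⌋₊ := rfl
  rw [hI]
  rcases le_or_gt (R₀ * Real.log Z) D with hR | hR
  · obtain ⟨𝒳, hcard, hne, h𝒳⟩ := hmain Z hZ2 q hqZ
    obtain ⟨h1, h2⟩ := h𝒳 D hD hR hDZ
    have hC' : C₁ * (2 + K) ≤ C₁ * (2 + K) + C₂ * (2 * R₀) + Real.exp 16 := by
      linarith [Real.exp_pos 16]
    have hle : Real.log Z / D + Real.log D ^ 60 / D ≤ (2 + K) * r ^ e := by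
      have := hlog D r (by linarith) hrD hr1
      linarith
    have hlog0 : 0 ≤ Real.log D ^ 60 / D := by positivity
    refine ⟨𝒳, hcard.trans hJ, hne, fun ψ hψ hψ𝒳 => (h1 ψ hψ hψ𝒳).trans ?_, fun a ha =>
      (h2 a ((ZMod.isUnit_iff_coprime a q).2 ha)).trans ?_⟩
    · calc C₁ * (Real.exp D * Real.log Z / D) = C₁ * Real.exp D * (Real.log Z / D) := by ring
        _ ≤ C₁ * Real.exp D * ((2 + K) * r ^ e) := by gcongr; linarith
        _ = C₁ * (2 + K) * Real.exp D * r ^ e := by ring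
        _ ≤ _ := by gcongr
    · calc _ ≤ C₁ * (Real.exp D / q.totient) * ((2 + K) * r ^ e) := by gcongr
        _ = C₁ * (2 + K) * (Real.exp D / q.totient) * r ^ e := by ring
        _ ≤ _ := by gcongr
  · obtain ⟨h1, h2⟩ := htriv q hq (Real.exp D) hqx
    have hR1 : 1 ≤ 2 * R₀ * r ^ e := by
      have h3 : 1 ≤ R₀ * (Real.log Z / D) := by
        rw [← mul_div_assoc, le_div_iff₀ hD0]
        linarith
      have h4 : R₀ * (Real.log Z / D) ≤ R₀ * (2 * r ^ e) := by gcongr; linarith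
      linarith
    have hC' : C₂ * (2 * R₀) ≤ C₁ * (2 + K) + C₂ * (2 * R₀) + Real.exp 16 := by
      linarith [Real.exp_pos 16]
    have key : ∀ y : ℝ, 0 ≤ y →
        C₂ * y ≤ (C₁ * (2 + K) + C₂ * (2 * R₀) + Real.exp 16) * y * r ^ e := fun y hy => by
      calc C₂ * y = C₂ * y * 1 := (mul_one _).symm
        _ ≤ C₂ * y * (2 * R₀ * r ^ e) := by gcongr
        _ = C₂ * (2 * R₀) * y * r ^ e := by ring
        _ ≤ _ := by gcongr
    refine ⟨∅, by simp, by simp, fun ψ _ _ => (h1 ψ).trans (key _ (Real.exp_pos D).le), fun a ha => ?_⟩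
    rw [Finset.sum_empty, mul_zero, sub_zero]
    exact (h2 a ((ZMod.isUnit_iff_coprime a q).2 ha)).trans (key _ (by positivity))
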